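/- For every integer m ≥ 2 there are infinitely many natural numbers r such that the run of consecutive prime gaps δ_j = p_{r+j+1} − p_{r+j} (1 ≤ j ≤ m) satisfies δ_{j−1} ∣ δ_j for every j with 2 ≤ j ≤ m. -/

import Mathlib

/-- `nthPrime n` is the `n`-th smallest prime, so `nthPrime 1 = 2`. -/
noncomputable def nthPrime (n : ℕ) : ℕ := Nat.nth Nat.Prime (n - 1)

/-- The `j`-th prime gap in the run starting at `r`:
`primeGap r j = p_{r+j+1} - p_{r+j}`. -/
noncomputable def primeGap (r j : ℕ) : ℕ := nthPrime (r + j + 1) - nthPrime (r + j)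

namespace GapRuns

open Real Filter Topology Finset

/-- The log-Gaussian weight on positive reals, centred at `exp u`. -/
noncomputable def gw (u t : ℝ) : ℝ := t⁻¹ * exp (-(log t - u) ^ 2 / 2)

/-- The log-Gaussian weight on natural numbers. -/
noncomputable def om (u : ℝ) (n : ℕ) : ℝ := gw u n

lemma om_zero (u : ℝ) : om u 0 = 0 := by simp [om, gw]

lemma om_nonneg (u : ℝ) (n : ℕ) : 0 ≤ om u n := by unfold om gw; positivity

lemma gw_eq (u : ℝ) {t : ℝ} (ht : 0 < t) : gw u t = exp (-log t - (log t - u) ^ 2 / 2) := by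
  unfold gw
  rw [show -log t - (log t - u) ^ 2 / 2 = -log t + -(log t - u) ^ 2 / 2 by ring, exp_add, exp_neg,
    exp_log ht]

lemma gw_le (c u : ℝ) {t : ℝ} (ht : 0 < t) :
    gw u t ≤ exp ((c - 1) ^ 2 / 2) * exp ((c - 1) * u) * t ^ (-c) := by
  rw [gw_eq u ht, rpow_def_of_pos ht, ← exp_add, ← exp_add]
  apply exp_le_exp.mpr
  nlinarith [sq_nonneg ((log t - u) - (c - 1))]

lemma om_le (c u : ℝ) {n : ℕ} (hn : 0 < n) :
    om u n ≤ exp ((c - 1) ^ 2 / 2) * exp ((c - 1) * u) * (n : ℝ) ^ (-c) :=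
  gw_le c u (by exact_mod_cast hn)

lemma om_le_exp_neg (u : ℝ) (n : ℕ) : om u n ≤ 2 * exp (-u) := by
  rcases Nat.eq_zero_or_pos n with rfl | hn
  · rw [om_zero]; positivity
  · have h := om_le 0 u hn
    have h2 : exp ((0 - 1 : ℝ) ^ 2 / 2) ≤ 2 := by
      have : exp ((0 - 1 : ℝ) ^ 2 / 2) ^ 2 ≤ 2 ^ 2 := by
        rw [← exp_nat_mul]; norm_num
        linarith [exp_one_lt_d9]
      exact (pow_le_pow_iff_left₀ (exp_pos _).le (by norm_num) two_ne_zero).mp this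
    simp only [neg_zero, rpow_zero, mul_one] at h
    refine h.trans ?_
    rw [show (0 - 1) * u = -u by ring]
    gcongr

lemma gw_mul_sq_le (u : ℝ) {t : ℝ} (ht : 0 < t) :
    gw u t * (1 + |log t - u|) ^ 2 ≤ 16 * exp (-u / 2) * t ^ (-(1 / 2) : ℝ) := by
  set v := log t - u with hv
  have h1 : (1 + |v|) ^ 2 ≤ 8 * exp (v ^ 2 / 4) := by
    have := add_one_le_exp (v ^ 2 / 4)
    nlinarith [sq_abs v, sq_nonneg (|v| - 1)]
  have h2 : exp (1 / 4 : ℝ) ≤ 2 := by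
    have : exp (1 / 4 : ℝ) ≤ exp 1 := exp_le_exp.mpr (by norm_num)
    have h4 : exp (1 / 4 : ℝ) ^ 4 ≤ 2 ^ 4 := by
      rw [← exp_nat_mul]; norm_num
      linarith [exp_one_lt_d9]
    exact (pow_le_pow_iff_left₀ (exp_pos _).le (by norm_num) (by norm_num)).mp h4
  rw [gw_eq u ht, rpow_def_of_pos ht]
  calc exp (-log t - (log t - u) ^ 2 / 2) * (1 + |v|) ^ 2
      ≤ exp (-log t - (log t - u) ^ 2 / 2) * (8 * exp (v ^ 2 / 4)) := by gcongr
    _ = 8 * exp (-log t - (log t - u) ^ 2 / 2 + v ^ 2 / 4) := by rw [exp_add]; ring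
    _ ≤ 8 * exp (1 / 4 + (-u / 2 + log t * (-(1 / 2)))) := by
        refine mul_le_mul_of_nonneg_left (exp_le_exp.mpr ?_) (by norm_num)
        rw [← hv]
        nlinarith [sq_nonneg (v / 2 + 1 / 2)]
    _ = 8 * exp (1 / 4) * (exp (-u / 2) * exp (log t * (-(1 / 2)))) := by
        rw [exp_add, exp_add]; ring
    _ ≤ 8 * 2 * (exp (-u / 2) * exp (log t * (-(1 / 2)))) := by gcongr
    _ = _ := by ring

lemma hasDerivAt_gw (u : ℝ) {t : ℝ} (ht : 0 < t) :
    HasDerivAt (gw u) (-(gw u t / t * (1 + (log t - u)))) t := by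
  have h1 : HasDerivAt (fun t => -(log t - u) ^ 2 / 2) (-(log t - u) / t) t := by
    refine ((((hasDerivAt_log ht.ne').sub_const u).pow 2).neg.div_const 2).congr_deriv ?_
    push_cast
    field_simp
  refine ((hasDerivAt_inv ht.ne').mul h1.exp).congr_deriv ?_
  unfold gw
  field_simp
  ring

lemma hasDerivAt_gw_mul (u : ℝ) {m t : ℝ} (hm : 0 < m) (ht : 0 < t) :
    HasDerivAt (fun t => gw u (m * t)) (-(gw u (m * t) / t * (1 + (log (m * t) - u)))) t := by
  refine ((hasDerivAt_gw u (mul_pos hm ht)).comp t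
    ((hasDerivAt_id t).const_mul m)).congr_deriv ?_
  field_simp

lemma norm_sub_le_of_deriv {f f' : ℝ → ℝ} {D : ℝ} (hD : 0 ≤ D)
    (hf : ∀ t, 1 ≤ t → HasDerivAt f (f' t) t)
    (hb : ∀ t, 1 ≤ t → |f' t| ≤ D * t ^ (-(3 / 2) : ℝ)) {l : ℕ} (hl : 1 ≤ l) :
    |f ((l + 1 : ℕ) : ℝ) - f l| ≤ 3 * D * ((l + 1 : ℕ) : ℝ) ^ (-(3 / 2) : ℝ) := by
  have hl' : (1 : ℝ) ≤ l := by exact_mod_cast hl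
  have h := Convex.norm_image_sub_le_of_norm_hasDerivWithin_le (f := f) (f' := f')
    (C := D * (l : ℝ) ^ (-(3 / 2) : ℝ)) (s := Set.Icc (l : ℝ) (l + 1)) (x := l) (y := l + 1)
    (fun x hx => (hf x (hl'.trans hx.1)).hasDerivWithinAt)
    (fun x hx => (hb x (hl'.trans hx.1)).trans 
      (mul_le_mul_of_nonneg_left (rpow_le_rpow_of_nonpos (by linarith) hx.1 (by norm_num)) hD))
    (convex_Icc _ _) (by simp) (by simp)
  have h3 : (l : ℝ) ^ (-(3 / 2) : ℝ) ≤ 3 * ((l + 1 : ℕ) : ℝ) ^ (-(3 / 2) : ℝ) := by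
    have hle : ((l + 1 : ℕ) : ℝ) ≤ 2 * l := by push_cast; linarith
    have h4 : (2 * (l : ℝ)) ^ (-(3 / 2) : ℝ) ≤ ((l + 1 : ℕ) : ℝ) ^ (-(3 / 2) : ℝ) :=
      rpow_le_rpow_of_nonpos (by positivity) hle (by norm_num)
    rw [mul_rpow (by norm_num) (by linarith)] at h4
    have h5 : (1 : ℝ) ≤ 3 * (2 : ℝ) ^ (-(3 / 2) : ℝ) := by
      have : (2 : ℝ) ^ (3 / 2 : ℝ) ≤ 3 := by
        have h6 : ((2 : ℝ) ^ (3 / 2 : ℝ)) ^ 2 ≤ 3 ^ 2 := by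
          rw [← rpow_natCast, ← rpow_mul (by norm_num)]; norm_num
        exact (pow_le_pow_iff_left₀ (by positivity) (by norm_num) two_ne_zero).mp h6
      rw [rpow_neg (by norm_num)]
      rw [← div_eq_mul_inv, le_div_iff₀ (by positivity)]; linarith
    have h7 : 0 ≤ (l : ℝ) ^ (-(3 / 2) : ℝ) := by positivity
    nlinarith
  rw [norm_eq_abs] at h
  push_cast at *
  calc _ ≤ _ := h
    _ = D * (l : ℝ) ^ (-(3 / 2) : ℝ) := by simp
    _ ≤ D * (3 * ((l : ℝ) + 1) ^ (-(3 / 2) : ℝ)) := by gcongr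
    _ = _ := by ring

lemma rpow_half_mul_le {m t : ℝ} (hm : 1 ≤ m) (ht : 0 < t) :
    (m * t) ^ (-(1 / 2) : ℝ) / t ≤ t ^ (-(3 / 2) : ℝ) := by
  rw [mul_rpow (by linarith) ht.le, show (-(3 / 2) : ℝ) = -(1 / 2) - 1 by norm_num,
    rpow_sub_one ht.ne']
  have h1 : m ^ (-(1 / 2) : ℝ) ≤ 1 := rpow_le_one_of_one_le_of_nonpos hm (by norm_num)
  have h2 : 0 ≤ t ^ (-(1 / 2) : ℝ) := by positivity
  rw [mul_div_assoc]
  exact mul_le_of_le_one_left (by positivity) h1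

lemma om_diff_le {u : ℝ} {m : ℕ} (hm : 0 < m) (l : ℕ) :
    |om u (m * (l + 1)) - om u (m * l)| ≤
      48 * exp (-u / 2) * ((l + 1 : ℕ) : ℝ) ^ (-(3 / 2) : ℝ) := by
  have hm' : (1 : ℝ) ≤ m := by exact_mod_cast hm
  rcases Nat.eq_zero_or_pos l with rfl | hl
  · have := gw_mul_sq_le u (t := m) (by linarith)
    have h1 : gw u m ≤ gw u m * (1 + |log m - u|) ^ 2 :=
      le_mul_of_one_le_right (om_nonneg u m) (one_le_pow₀ (by linarith [abs_nonneg (log m - u)]))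
    have h2 : (m : ℝ) ^ (-(1 / 2) : ℝ) ≤ 1 := rpow_le_one_of_one_le_of_nonpos hm' (by norm_num)
    have h3 := exp_pos (-u / 2)
    have h0 := om_nonneg u m
    simp only [mul_zero, om_zero, zero_add, mul_one, sub_zero, Nat.cast_one, one_rpow]
    rw [abs_of_nonneg h0]
    unfold om
    nlinarith
  · have := norm_sub_le_of_deriv (f := fun t => gw u (m * t)) (D := 16 * exp (-u / 2))
      (by positivity)
      (fun t ht => hasDerivAt_gw_mul u (by linarith) (by linarith)) (fun t ht => by
        have h0 : (0 : ℝ) < m * t := by nlinarith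
        have hg : 0 ≤ gw u (m * t) := by unfold gw; positivity
        have h1 := gw_mul_sq_le u h0
        have h2 := rpow_half_mul_le hm' (t := t) (by linarith)
        rw [abs_neg, abs_mul, abs_of_nonneg (by positivity)]
        set v := log (m * t) - u
        have h3 : |1 + v| ≤ (1 + |v|) ^ 2 := by
          have := abs_add_le 1 v
          rw [abs_one] at this
          nlinarith [abs_nonneg v]
        calc gw u (m * t) / t * |1 + v| ≤ gw u (m * t) / t * (1 + |v|) ^ 2 := by gcongr
          _ = gw u (m * t) * (1 + |v|) ^ 2 / t := by ring
          _ ≤ (16 * exp (-u / 2) * (m * t) ^ (-(1 / 2) : ℝ)) / t := by gcongr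
          _ = 16 * exp (-u / 2) * ((m * t) ^ (-(1 / 2) : ℝ) / t) := by ring
          _ ≤ _ := by gcongr) hl
    simp only [om]
    push_cast at this ⊢
    refine this.trans (le_of_eq ?_)
    ring

lemma log_om_diff_le {u : ℝ} (hu : 0 ≤ u) {m : ℕ} (hm : 0 < m) (l : ℕ) :
    |log ((l + 1 : ℕ) : ℝ) * om u (m * (l + 1)) - log l * om u (m * l)| ≤
      48 * (1 + u) * exp (-u / 2) * ((l + 1 : ℕ) : ℝ) ^ (-(3 / 2) : ℝ) := by
  have hm' : (1 : ℝ) ≤ m := by exact_mod_cast hm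
  rcases Nat.eq_zero_or_pos l with rfl | hl
  · simp
    positivity
  · have := norm_sub_le_of_deriv (f := fun t => log t * gw u (m * t))
      (D := 16 * (1 + u) * exp (-u / 2)) (by positivity)
      (fun t ht => (hasDerivAt_log (by linarith)).mul
        (hasDerivAt_gw_mul u (by linarith) (by linarith))) (fun t ht => by
        have h0 : (0 : ℝ) < m * t := by nlinarith
        have ht0 : 0 < t := by linarith
        have hg : 0 ≤ gw u (m * t) := by unfold gw; positivity
        have h1 := gw_mul_sq_le u h0
        have h2 := rpow_half_mul_le hm' (t := t) (by linarith)
        have hlog : log t = (log (m * t) - u) + u - log m := by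
          rw [log_mul (by linarith) (by linarith)]; ring
        have hlt := log_nonneg ht
        have hlm := log_nonneg hm'
        set v := log (m * t) - u
        have hv := abs_nonneg v
        have hv2 := le_abs_self v
        have h3 : |1 - log t * (1 + v)| ≤ (1 + u) * (1 + |v|) ^ 2 := by
          have e1 : |log t| ≤ |v| + u := by rw [abs_of_nonneg hlt]; linarith
          have e2 : |1 + v| ≤ 1 + |v| := by
            have := abs_add_le 1 v
            rwa [abs_one] at this
          calc |1 - log t * (1 + v)| ≤ |1| + |log t * (1 + v)| := abs_sub _ _
            _ ≤ 1 + (|v| + u) * (1 + |v|) := by rw [abs_one, abs_mul]; gcongr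
            _ ≤ _ := by nlinarith [mul_nonneg hu hv, mul_nonneg hu (sq_nonneg |v|)]
        rw [show t⁻¹ * gw u (m * t) + log t * -(gw u (m * t) / t * (1 + v)) =
          gw u (m * t) / t * (1 - log t * (1 + v)) by field_simp; ring]
        rw [abs_mul, abs_of_nonneg (by positivity)]
        calc gw u (m * t) / t * |1 - log t * (1 + v)|
            ≤ gw u (m * t) / t * ((1 + u) * (1 + |v|) ^ 2) := by gcongr
          _ = (1 + u) * (gw u (m * t) * (1 + |v|) ^ 2 / t) := by ring
          _ ≤ (1 + u) * ((16 * exp (-u / 2) * (m * t) ^ (-(1 / 2) : ℝ)) / t) := by gcongr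
          _ = 16 * (1 + u) * exp (-u / 2) * ((m * t) ^ (-(1 / 2) : ℝ) / t) := by ring
          _ ≤ _ := by gcongr) hl
    simp only [om]
    push_cast at this ⊢
    refine this.trans (le_of_eq ?_)
    ring

/-- Abel summation against a sequence with bounded partial sums. -/
lemma norm_tsum_mul_le_of_partial_sums {c : ℕ → ℂ} {F : ℕ → ℝ} {B D : ℝ}
    (hc : ∀ N, ‖∑ n ∈ range N, c n‖ ≤ B)
    (hF : Tendsto F atTop (𝓝 0)) (hs : Summable fun n => c n * F n)
    (hD : ∀ N, ∑ n ∈ range N, |F (n + 1) - F n| ≤ D) :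
    ‖∑' n, c n * F n‖ ≤ B * D := by
  have hB : 0 ≤ B := (norm_nonneg _).trans (hc 0)
  have ht := hs.hasSum.tendsto_sum_nat
  have key : ∀ N, ‖∑ n ∈ range N, c n * F n‖ ≤ B * |F (N - 1)| + B * D := by
    intro N
    have := Finset.sum_range_by_parts (fun n => (F n : ℂ)) c N
    simp only [smul_eq_mul] at this
    rw [show ∑ n ∈ range N, c n * (F n : ℂ) = ∑ n ∈ range N, (F n : ℂ) * c n from
      Finset.sum_congr rfl fun _ _ => mul_comm _ _, this]
    refine (norm_sub_le _ _).trans (add_le_add ?_ ?_)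
    · rw [norm_mul, Complex.norm_real, norm_eq_abs, mul_comm]
      gcongr
      exact hc N
    · refine (norm_sum_le _ _).trans ?_
      calc _ ≤ ∑ i ∈ range (N - 1), |F (i + 1) - F i| * B := by
            refine Finset.sum_le_sum fun i _ => ?_
            rw [norm_mul, ← Complex.ofReal_sub, Complex.norm_real, norm_eq_abs]
            gcongr
            exact hc _
        _ = B * ∑ i ∈ range (N - 1), |F (i + 1) - F i| := by
            rw [← Finset.sum_mul, mul_comm]
        _ ≤ B * D := by gcongr; exact hD _
  have h2 : Tendsto (fun N => B * |F (N - 1)| + B * D) atTop (𝓝 (B * |0| + B * D)) :=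
    (((hF.comp (tendsto_sub_atTop_nat 1)).abs).const_mul B).add_const _
  simp only [abs_zero, mul_zero, zero_add] at h2
  exact le_of_tendsto_of_tendsto' ht.norm h2 key

/-- The value of the zeta function at `3 / 2`. -/
noncomputable def zetaThreeHalves : ℝ := ∑' n : ℕ, ((n + 1 : ℕ) : ℝ) ^ (-(3 / 2) : ℝ)

lemma summable_three_halves : Summable fun n : ℕ => ((n + 1 : ℕ) : ℝ) ^ (-(3 / 2) : ℝ) := by
  have := (summable_nat_add_iff (f := fun n : ℕ => (n : ℝ) ^ (-(3 / 2) : ℝ)) 1).mpr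
    (Real.summable_nat_rpow.mpr (by norm_num))
  exact this

lemma zetaThreeHalves_nonneg : 0 ≤ zetaThreeHalves := tsum_nonneg fun _ => by positivity

lemma sum_range_le_zeta {f : ℕ → ℝ} {D : ℝ} (hD : 0 ≤ D)
    (h : ∀ l, f l ≤ D * ((l + 1 : ℕ) : ℝ) ^ (-(3 / 2) : ℝ)) (N : ℕ) :
    ∑ n ∈ range N, f n ≤ D * zetaThreeHalves := by
  refine (Finset.sum_le_sum fun l _ => h l).trans ?_
  rw [← Finset.mul_sum]
  gcongr
  exact summable_three_halves.sum_le_tsum _ (fun _ _ => by positivity)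

lemma summable_mul_om {a : ℕ → ℂ} {A p : ℝ} (ha : ∀ n, 0 < n → ‖a n‖ ≤ A * (n : ℝ) ^ p) (u : ℝ) :
    Summable fun n => a n * (om u n : ℂ) := by
  have hs : Summable fun n : ℕ =>
      A * (exp ((p + 2 - 1) ^ 2 / 2) * exp ((p + 2 - 1) * u)) * (n : ℝ) ^ (-2 : ℝ) :=
    (Real.summable_nat_rpow.mpr (by norm_num)).mul_left _
  refine Summable.of_norm_bounded hs fun n => ?_
  rcases Nat.eq_zero_or_pos n with rfl | hn
  · simp [om_zero]
  · have hn' : (0 : ℝ) < n := by exact_mod_cast hn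
    rw [norm_mul, Complex.norm_real, norm_eq_abs, abs_of_nonneg (om_nonneg _ _)]
    calc ‖a n‖ * om u n ≤ (A * (n : ℝ) ^ p) *
          (exp ((p + 2 - 1) ^ 2 / 2) * exp ((p + 2 - 1) * u) * (n : ℝ) ^ (-(p + 2))) :=
          mul_le_mul (ha n hn) (om_le _ u hn) (om_nonneg _ _) ((norm_nonneg _).trans (ha n hn))
      _ = A * (exp ((p + 2 - 1) ^ 2 / 2) * exp ((p + 2 - 1) * u)) *
          ((n : ℝ) ^ p * (n : ℝ) ^ (-(p + 2))) := by ring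
      _ = _ := by
        rw [← rpow_add hn']
        congr 2
        ring

lemma summable_om (u : ℝ) : Summable (om u) := by
  have := summable_mul_om (a := fun _ => 1) (A := 1) (p := 0) (by simp) u
  simpa using (Complex.summable_ofReal (f := om u)).mp (by simpa using this)

lemma tendsto_om_mul {m : ℕ} (hm : 0 < m) (u : ℝ) :
    Tendsto (fun l : ℕ => om u (m * l)) atTop (𝓝 0) :=
  (summable_om u).tendsto_atTop_zero.comp (Filter.tendsto_id.const_mul_atTop' hm)

lemma tendsto_log_mul_om_mul {m : ℕ} (hm : 0 < m) (u : ℝ) :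
    Tendsto (fun l : ℕ => log l * om u (m * l)) atTop (𝓝 0) := by
  have h : Tendsto (fun n : ℕ => log n * om u n) atTop (𝓝 0) := by
    have := (summable_mul_om (a := fun n => (log n : ℂ)) (A := 1) (p := 1) (fun n hn => by
      have h1 : (1 : ℝ) ≤ n := by exact_mod_cast hn
      rw [Complex.norm_real, norm_eq_abs,
        abs_of_nonneg (log_nonneg h1), rpow_one, one_mul]
      exact (log_le_sub_one_of_pos (by linarith)).trans (by linarith)) u).tendsto_atTop_zero
    have h2 := (Complex.continuous_re.tendsto 0).comp this
    refine h2.congr fun n => ?_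
    simp only [Function.comp, ← Complex.ofReal_mul, Complex.ofReal_re]
  refine squeeze_zero' (Eventually.of_forall fun l => ?_) ?_
    (h.comp (Filter.tendsto_id.const_mul_atTop' hm))
  · have : 0 ≤ log (l : ℝ) := log_natCast_nonneg l
    have := om_nonneg u (m * l)
    positivity
  · filter_upwards [eventually_gt_atTop 0] with l hl
    simp only [Function.comp, id]
    have h1 : (0 : ℝ) < l := by exact_mod_cast hl
    have h2 : (l : ℝ) ≤ ((m * l : ℕ) : ℝ) := by exact_mod_cast Nat.le_mul_of_pos_left l hm
    exact mul_le_mul_of_nonneg_right (log_le_log h1 h2) (om_nonneg _ _)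

lemma norm_tsum_mul_om_le {c : ℕ → ℂ} {B : ℝ} (hc : ∀ N, ‖∑ n ∈ range N, c n‖ ≤ B)
    {u : ℝ} {m : ℕ} (hm : 0 < m) (hs : Summable fun l => c l * (om u (m * l) : ℂ)) :
    ‖∑' l, c l * (om u (m * l) : ℂ)‖ ≤ B * (48 * exp (-u / 2) * zetaThreeHalves) := by
  exact norm_tsum_mul_le_of_partial_sums (F := fun l => om u (m * l)) hc (tendsto_om_mul hm u) hs
    (fun N => sum_range_le_zeta (by positivity) (fun l => om_diff_le hm l) N)

lemma norm_tsum_mul_log_om_le {c : ℕ → ℂ} {B : ℝ} (hc : ∀ N, ‖∑ n ∈ range N, c n‖ ≤ B)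
    {u : ℝ} (hu : 0 ≤ u) {m : ℕ} (hm : 0 < m)
    (hs : Summable fun l => c l * ((log l * om u (m * l) : ℝ) : ℂ)) :
    ‖∑' l, c l * ((log l * om u (m * l) : ℝ) : ℂ)‖ ≤
      B * (48 * (1 + u) * exp (-u / 2) * zetaThreeHalves) :=
  norm_tsum_mul_le_of_partial_sums (F := fun l => log l * om u (m * l)) hc
    (tendsto_log_mul_om_mul hm u) hs
    (fun N => sum_range_le_zeta (by positivity) (fun l => log_om_diff_le hu hm l) N)

lemma tsum_om_le {u : ℝ} (hu : 0 ≤ u) : ∑' n, om u n ≤ 10 := by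
  have h12 : exp ((2 - 1 : ℝ) ^ 2 / 2) ≤ 2 := by
    have : exp ((2 - 1 : ℝ) ^ 2 / 2) ^ 2 ≤ 2 ^ 2 := by
      rw [← exp_nat_mul]; norm_num
      linarith [exp_one_lt_d9]
    exact (pow_le_pow_iff_left₀ (exp_pos _).le (by norm_num) two_ne_zero).mp this
  refine (summable_om u).tsum_le_of_sum_range_le fun M => ?_
  set N := ⌈exp u⌉₊ with hN
  have he : 1 ≤ exp u := one_le_exp hu
  have hN1 : exp u ≤ N := Nat.le_ceil _
  have hN2 : (N : ℝ) ≤ exp u + 1 := (Nat.ceil_lt_add_one (by positivity)).le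
  have hsub : range M ⊆ range (N + 1) ∪ Ioo N M := by
    intro i hi
    simp only [mem_union, mem_range, mem_Ioo] at hi ⊢
    omega
  have hI : ∑ n ∈ Ioo N M, om u n ≤ 4 := by
    calc ∑ n ∈ Ioo N M, om u n ≤ ∑ n ∈ Ioo N M, (2 * exp u) * ((n : ℝ) ^ 2)⁻¹ := by
          refine Finset.sum_le_sum fun n hn => ?_
          have hn0 : 0 < n := by simp at hn; omega
          refine (om_le 2 u hn0).trans ?_
          rw [show ((2 : ℝ) - 1) * u = u by ring, rpow_neg (by positivity), rpow_two]
          gcongr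
      _ ≤ (2 * exp u) * (2 / (N + 1)) := by
          rw [← Finset.mul_sum]
          gcongr
          exact sum_Ioo_inv_sq_le N M
      _ ≤ 4 := by
          rw [mul_div_assoc', div_le_iff₀ (by positivity)]
          linarith
  calc ∑ n ∈ range M, om u n ≤ ∑ n ∈ range (N + 1) ∪ Ioo N M, om u n :=
        Finset.sum_le_sum_of_subset_of_nonneg hsub fun _ _ _ => om_nonneg _ _
    _ ≤ ∑ n ∈ range (N + 1), om u n + ∑ n ∈ Ioo N M, om u n := by
        rw [← Finset.sum_union_inter]
        exact le_add_of_nonneg_right (Finset.sum_nonneg fun _ _ => om_nonneg _ _)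
    _ ≤ ∑ n ∈ range (N + 1), om u n + 4 := by gcongr
    _ ≤ 6 + 4 := by
        gcongr
        rw [Finset.sum_range_succ', om_zero, add_zero]
        calc ∑ n ∈ range N, om u (n + 1) ≤ ∑ n ∈ range N, 2 * exp (-u) :=
              Finset.sum_le_sum fun n _ => om_le_exp_neg _ _
          _ = N * (2 * exp (-u)) := by simp
          _ ≤ (exp u + 1) * (2 * exp (-u)) := by gcongr
          _ = 2 + 2 * exp (-u) := by
              rw [add_mul, mul_left_comm, ← exp_add]; simp
          _ ≤ 6 := by
              have : exp (-u) ≤ 1 := exp_le_one_iff.mpr (by linarith)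
              linarith
    _ = 10 := by norm_num

end GapRuns

namespace GapRuns

open Real Filter Topology Finset MeasureTheory

lemma sum_range_zmod {q : ℕ} [NeZero q] (f : ZMod q → ℂ) :
    ∑ n ∈ range q, f (n : ZMod q) = ∑ a, f a := by
  refine Finset.sum_bij (fun n _ => (n : ZMod q)) (fun _ _ => mem_univ _) ?_ ?_ (fun _ _ => rfl)
  · intro a ha b hb h
    have := (ZMod.natCast_eq_natCast_iff' a b q).mp h
    rwa [Nat.mod_eq_of_lt (mem_range.mp ha), Nat.mod_eq_of_lt (mem_range.mp hb)] at this
  · intro b _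
    exact ⟨b.val, mem_range.mpr (ZMod.val_lt b), ZMod.natCast_zmod_val b⟩

lemma norm_sum_range_zmod_le {q : ℕ} [NeZero q] {f : ZMod q → ℂ} {K : ℝ}
    (h0 : ∑ a, f a = 0) (hK : ∀ a, ‖f a‖ ≤ K) (N : ℕ) :
    ‖∑ n ∈ range N, f (n : ZMod q)‖ ≤ K * q := by
  have hq : 0 < q := Nat.pos_of_ne_zero (NeZero.ne q)
  have hK0 : 0 ≤ K := (norm_nonneg _).trans (hK 0)
  induction N using Nat.strong_induction_on with
  | _ N ih =>
    rcases lt_or_ge N q with h | h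
    · calc ‖∑ n ∈ range N, f (n : ZMod q)‖ ≤ ∑ n ∈ range N, K :=
            (norm_sum_le _ _).trans (Finset.sum_le_sum fun _ _ => hK _)
        _ = K * N := by simp [mul_comm]
        _ ≤ K * q := by gcongr
    · obtain ⟨M, rfl⟩ := Nat.exists_eq_add_of_le h
      rw [Finset.sum_range_add, sum_range_zmod, h0, zero_add]
      simpa using ih M (by omega)

lemma norm_sum_Icc_zmod_le {q : ℕ} [NeZero q] {f : ZMod q → ℂ} {K : ℝ}
    (h0 : ∑ a, f a = 0) (hK : ∀ a, ‖f a‖ ≤ K) (N : ℕ) :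
    ‖∑ n ∈ Icc 1 N, f (n : ZMod q)‖ ≤ K * q := by
  have h := norm_sum_range_zmod_le (f := fun a => f (a + 1)) (K := K)
    (by rw [← h0]; exact Fintype.sum_equiv (Equiv.addRight 1) _ _ fun _ => rfl) (fun a => hK _) N
  rw [Finset.range_eq_Ico] at h
  have e := Finset.sum_Ico_add' (fun n : ℕ => f (n : ZMod q)) 0 N 1
  push_cast at e
  rw [e] at h
  exact h

/-- The truncated Mellin transform of a function of moderate growth. -/
lemma norm_integral_mul_cpow_le {E : ℝ → ℂ} {Q ℓ : ℝ} (hQ : 1 ≤ Q) (hℓ : 2 ≤ ℓ)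
    (hQℓ : log Q ≤ ℓ) (h1 : ∀ t, 1 < t → ‖E t‖ ≤ 2 * t) (h2 : ∀ t, 1 < t → ‖E t‖ ≤ 2 * Q)
    {s : ℂ} (hs : 1 - 1 / ℓ ≤ s.re) :
    ‖∫ t in Set.Ioi (1 : ℝ), E t * (t : ℂ) ^ (-(s + 1))‖ ≤ 15 * ℓ := by
  have hℓ0 : 0 < ℓ := by linarith
  have hlt : -1 - 1 / ℓ < -1 := by
    have : 0 < 1 / ℓ := by positivity
    linarith
  have hi := integrableOn_Ioi_rpow_of_lt hlt zero_lt_one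
  have hbound : ∀ t : ℝ, 1 < t → ‖E t * (t : ℂ) ^ (-(s + 1))‖ ≤ 15 * t ^ (-1 - 1 / ℓ) := by
    intro t ht
    have ht0 : 0 < t := by linarith
    have hE : ‖E t‖ ≤ 2 * (t ^ (1 - 2 / ℓ) * Q ^ (2 / ℓ)) := by
      have ha : 0 ≤ 2 / ℓ := by positivity
      have hb : 0 ≤ 1 - 2 / ℓ := by
        rw [sub_nonneg, div_le_one hℓ0]; exact hℓ
      rcases le_total t Q with h | h
      · calc ‖E t‖ ≤ 2 * (t ^ (1 - 2 / ℓ) * t ^ (2 / ℓ)) := by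
              rw [← rpow_add ht0]; simpa using h1 t ht
          _ ≤ _ := by gcongr
      · calc ‖E t‖ ≤ 2 * (Q ^ (1 - 2 / ℓ) * Q ^ (2 / ℓ)) := by
              rw [← rpow_add (by linarith)]; simpa using h2 t ht
          _ ≤ _ := by gcongr
    have hQe : Q ^ (2 / ℓ) ≤ 7.5 := by
      rw [rpow_def_of_pos (by linarith)]
      have : log Q * (2 / ℓ) ≤ 2 := by
        rw [mul_div_assoc', div_le_iff₀ hℓ0]; linarith
      calc exp (log Q * (2 / ℓ)) ≤ exp 2 := exp_le_exp.mpr this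
        _ = exp 1 ^ 2 := by rw [← exp_nat_mul]; norm_num
        _ ≤ 2.72 ^ 2 := by gcongr; linarith [exp_one_lt_d9]
        _ ≤ 7.5 := by norm_num
    rw [norm_mul, Complex.norm_cpow_eq_rpow_re_of_pos ht0]
    have hre : (-(s + 1)).re ≤ -2 + 1 / ℓ := by
      rw [Complex.neg_re, Complex.add_re, Complex.one_re]; linarith
    calc ‖E t‖ * t ^ (-(s + 1)).re
        ≤ (2 * (t ^ (1 - 2 / ℓ) * 7.5)) * t ^ (-2 + 1 / ℓ) := by
          gcongr
          · exact hE.trans (by gcongr)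
          · exact ht.le
      _ = 15 * (t ^ (1 - 2 / ℓ) * t ^ (-2 + 1 / ℓ)) := by ring
      _ = 15 * t ^ (-1 - 1 / ℓ) := by
          rw [← rpow_add ht0]; congr 2; ring
  calc _ ≤ ∫ t in Set.Ioi (1 : ℝ), 15 * t ^ (-1 - 1 / ℓ) :=
        norm_integral_le_of_norm_le (hi.const_mul 15)
          ((ae_restrict_iff' measurableSet_Ioi).mpr (Eventually.of_forall hbound))
    _ = 15 * ℓ := by
        rw [integral_const_mul, integral_Ioi_rpow_of_lt hlt zero_lt_one, one_rpow]
        rw [show -1 - 1 / ℓ + 1 = -(1 / ℓ) by ring]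
        field_simp

lemma norm_sum_floor_le_two_mul {f : ℕ → ℂ} (hf : ∀ n, ‖f n‖ ≤ 1) {t : ℝ} (ht : 0 ≤ t) :
    ‖∑ k ∈ Icc 1 ⌊t⌋₊, f k‖ ≤ t := by
  calc _ ≤ ∑ k ∈ Icc 1 ⌊t⌋₊, (1 : ℝ) := (norm_sum_le _ _).trans (Finset.sum_le_sum fun _ _ => hf _)
    _ = ⌊t⌋₊ := by simp
    _ ≤ t := Nat.floor_le ht

lemma isBigO_sum_Icc {f : ℕ → ℂ} (hf : ∀ n, ‖f n‖ ≤ 1) :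
    (fun n => ∑ k ∈ Icc 1 n, f k) =O[atTop] fun n : ℕ => (n : ℝ) ^ (1 : ℝ) := by
  refine Asymptotics.IsBigO.of_bound 1 (Eventually.of_forall fun n => ?_)
  have := norm_sum_floor_le_two_mul hf (t := (n : ℝ)) (by positivity)
  simpa using this

/-- The bound for an `L`-series right of the line `Re s = 1` when the coefficients have
a mean value. -/
lemma norm_LSeries_le_of_mean {f : ℕ → ℂ} {m : ℂ} {Q ℓ : ℝ} (hf : ∀ n, ‖f n‖ ≤ 1) (hm : ‖m‖ ≤ 1)
    (hQ : 1 ≤ Q) (hℓ : 2 ≤ ℓ) (hQℓ : log Q ≤ ℓ)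
    (hS : ∀ N : ℕ, ‖∑ k ∈ Icc 1 N, f k - m * N‖ ≤ Q) {s : ℂ} (hs : 1 < s.re) :
    ‖LSeries f s‖ ≤ ‖s‖ * (15 * ℓ + 1 / ‖s - 1‖) := by
  have hsum : LSeriesSummable f s :=
    LSeriesSummable_of_bounded_of_one_lt_re (fun n _ => hf n) hs
  rw [LSeries_eq_mul_integral f zero_le_one hs hsum (isBigO_sum_Icc hf), norm_mul]
  gcongr
  have hre : (-s).re < -1 := by simp; linarith
  set S : ℝ → ℂ := fun t => ∑ k ∈ Icc 1 ⌊t⌋₊, f k with hSdef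
  have hmeas : Measurable S := by
    have : Measurable fun n : ℕ => ∑ k ∈ Icc 1 n, f k := measurable_from_top
    exact this.comp Nat.measurable_floor
  have hEle : ∀ t : ℝ, 1 < t → ‖S t - m * t‖ ≤ 2 * t := by
    intro t ht
    calc _ ≤ ‖S t‖ + ‖m * t‖ := norm_sub_le _ _
      _ ≤ t + 1 * t := by
          gcongr
          · exact norm_sum_floor_le_two_mul hf (by linarith)
          · rw [norm_mul, Complex.norm_real, norm_eq_abs, abs_of_pos (by linarith)]
            gcongr
      _ = 2 * t := by ring
  have hEQ : ∀ t : ℝ, 1 < t → ‖S t - m * t‖ ≤ 2 * Q := by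
    intro t ht
    calc _ = ‖(S t - m * ⌊t⌋₊) + m * (⌊t⌋₊ - t)‖ := by congr 1; ring
      _ ≤ Q + 1 * 1 := by
          refine (norm_add_le _ _).trans (add_le_add (hS _) ?_)
          rw [norm_mul]
          gcongr
          rw [← Complex.ofReal_natCast, ← Complex.ofReal_sub, Complex.norm_real, norm_eq_abs,
            abs_le]
          constructor
          · linarith [(Nat.lt_floor_add_one t).le]
          · linarith [Nat.floor_le (show 0 ≤ t by linarith)]
      _ ≤ 2 * Q := by linarith
  have hsplit : ∀ t ∈ Set.Ioi (1 : ℝ), S t * (t : ℂ) ^ (-(s + 1)) =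
      (S t - m * t) * (t : ℂ) ^ (-(s + 1)) + m * (t : ℂ) ^ (-s) := by
    intro t ht
    have ht0 : (t : ℂ) ≠ 0 := by
      rw [Complex.ofReal_ne_zero]; exact (zero_lt_one.trans ht).ne'
    rw [show -s = 1 + -(s + 1) by ring, Complex.cpow_add _ _ ht0, Complex.cpow_one]
    ring
  have hint2 : IntegrableOn (fun t : ℝ => m * (t : ℂ) ^ (-s)) (Set.Ioi 1) :=
    (integrableOn_Ioi_cpow_of_lt hre zero_lt_one).const_mul m
  have hint1 : IntegrableOn (fun t : ℝ => (S t - m * t) * (t : ℂ) ^ (-(s + 1))) (Set.Ioi 1) := by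
    have hb : IntegrableOn (fun t : ℝ => 2 * t ^ (-s.re)) (Set.Ioi 1) :=
      (integrableOn_Ioi_rpow_of_lt (by linarith) zero_lt_one).const_mul 2
    refine Integrable.mono' hb ?_ ?_
    · refine AEStronglyMeasurable.mul ?_ ?_
      · exact ((hmeas.sub (measurable_const.mul Complex.measurable_ofReal))).aestronglyMeasurable
      · refine ContinuousOn.aestronglyMeasurable ?_ measurableSet_Ioi
        intro t ht
        exact (Complex.continuousAt_ofReal_cpow_const _ _
          (Or.inr (zero_lt_one.trans ht).ne')).continuousWithinAt
    · refine (ae_restrict_iff' measurableSet_Ioi).mpr (Eventually.of_forall fun t ht => ?_)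
      have ht1 : 1 < t := ht
      have ht0 : 0 < t := by linarith
      rw [norm_mul, Complex.norm_cpow_eq_rpow_re_of_pos ht0]
      calc _ ≤ 2 * t * t ^ (-(s + 1)).re := by gcongr; exact hEle t ht1
        _ = 2 * (t ^ (1 : ℝ) * t ^ (-(s + 1)).re) := by rw [rpow_one]; ring
        _ = _ := by
          rw [← rpow_add ht0]; congr 2; simp
  rw [setIntegral_congr_fun measurableSet_Ioi hsplit, integral_add hint1 hint2]
  refine (norm_add_le _ _).trans (add_le_add ?_ ?_)
  · refine norm_integral_mul_cpow_le hQ hℓ hQℓ hEle hEQ ?_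
    have : 0 < 1 / ℓ := by positivity
    linarith
  · rw [integral_const_mul, integral_Ioi_cpow_of_lt hre zero_lt_one, norm_mul]
    have e : ‖-((1 : ℝ) : ℂ) ^ (-s + 1) / (-s + 1)‖ = 1 / ‖s - 1‖ := by
      rw [norm_div, norm_neg, Complex.ofReal_one, Complex.one_cpow, norm_one,
        show -s + 1 = -(s - 1) by ring, norm_neg]
    rw [e]
    exact mul_le_of_le_one_left (by positivity) hm

/-- Continuation of the Mellin representation of a nontrivial Dirichlet `L`-function. -/
lemma LFunction_eq_mul_integral {q : ℕ} [NeZero q] {χ : DirichletCharacter ℂ q} (hχ : χ ≠ 1)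
    {s : ℂ} (hs : 0 < s.re) :
    χ.LFunction s = s * ∫ t in Set.Ioi (1 : ℝ),
      (∑ k ∈ Icc 1 ⌊t⌋₊, χ (k : ZMod q)) * (t : ℂ) ^ (-(s + 1)) := by
  set S : ℝ → ℂ := fun t => ∑ k ∈ Icc 1 ⌊t⌋₊, χ (k : ZMod q) with hSdef
  have hSb : ∀ t, ‖S t‖ ≤ q := fun t => by
    simpa using norm_sum_Icc_zmod_le (f := fun a => χ a) (K := 1)
      (MulChar.sum_eq_zero_of_ne_one hχ) (fun a => χ.norm_le_one a) ⌊t⌋₊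
  have hS0 : ∀ t, t < 1 → S t = 0 := fun t ht => by
    simp [hSdef, Nat.floor_eq_zero.mpr ht]
  have hmeas : Measurable S := by
    have : Measurable fun n : ℕ => ∑ k ∈ Icc 1 n, χ (k : ZMod q) := measurable_from_top
    exact this.comp Nat.measurable_floor
  have hI : ∀ z : ℂ, ∫ t in Set.Ioi (1 : ℝ), S t * (t : ℂ) ^ (-(z + 1)) = mellin S (-z) := by
    intro z
    unfold mellin
    have h01 : Set.Ioi (0 : ℝ) = Set.Ioc 0 1 ∪ Set.Ioi 1 :=
      (Set.Ioc_union_Ioi_eq_Ioi zero_le_one).symm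
    rw [← MeasureTheory.integral_indicator measurableSet_Ioi,
      ← MeasureTheory.integral_indicator measurableSet_Ioi]
    refine MeasureTheory.integral_congr_ae ?_
    have hae : ∀ᵐ t : ℝ, t ≠ 1 := by simp [ae_iff]
    filter_upwards [hae] with t ht1
    by_cases h1 : 1 < t
    · rw [Set.indicator_of_mem (show t ∈ Set.Ioi (1 : ℝ) from h1),
        Set.indicator_of_mem (show t ∈ Set.Ioi (0 : ℝ) from zero_lt_one.trans h1), smul_eq_mul,
        mul_comm, show -z - 1 = -(z + 1) by ring]
    · rw [Set.indicator_of_notMem (show t ∉ Set.Ioi (1 : ℝ) from h1)]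
      have : S t = 0 := hS0 t (lt_of_le_of_ne (not_lt.mp h1) ht1)
      by_cases h0 : t ∈ Set.Ioi (0 : ℝ)
      · rw [Set.indicator_of_mem h0, this, smul_zero]
      · rw [Set.indicator_of_notMem h0]
  have hdiff : ∀ z : ℂ, 0 < z.re → DifferentiableAt ℂ (fun z => z * mellin S (-z)) z := by
    intro z hz
    have hm : DifferentiableAt ℂ (mellin S) (-z) := by
      refine mellin_differentiableAt_of_isBigO_rpow (a := 0) (b := (-z).re - 1) ?_ ?_ ?_ ?_ ?_
      · refine LocallyIntegrable.locallyIntegrableOn ?_ _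
        refine (locallyIntegrable_const (q : ℝ)).mono hmeas.aestronglyMeasurable ?_
        exact Eventually.of_forall fun t => (hSb t).trans (by simp)
      · refine Asymptotics.IsBigO.of_bound q (Eventually.of_forall fun t => ?_)
        simpa using hSb t
      · simpa using hz
      · refine Asymptotics.IsBigO.of_bound 1 ?_
        have : Set.Iio (1 : ℝ) ∈ 𝓝[>] (0 : ℝ) :=
          mem_nhdsWithin_of_mem_nhds (Iio_mem_nhds zero_lt_one)
        filter_upwards [this] with t ht
        rw [hS0 t ht, norm_zero]
        positivity
      · linarith
    exact differentiableAt_id.mul (hm.comp z differentiableAt_id.neg)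
  have hopen : IsOpen {z : ℂ | 0 < z.re} := isOpen_lt continuous_const Complex.continuous_re
  have hEq : Set.EqOn χ.LFunction (fun z => z * mellin S (-z)) {z : ℂ | 0 < z.re} := by
    refine AnalyticOnNhd.eqOn_of_preconnected_of_eventuallyEq (𝕜 := ℂ) (z₀ := 2) ?_ ?_ ?_ ?_ ?_
    · exact DifferentiableOn.analyticOnNhd
        (DirichletCharacter.differentiable_LFunction hχ).differentiableOn hopen
    · exact DifferentiableOn.analyticOnNhd
        (fun z hz => (hdiff z hz).differentiableWithinAt) hopen
    · exact (convex_halfSpace_re_gt 0).isPreconnected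
    · simp
    · have : {z : ℂ | 1 < z.re} ∈ 𝓝 (2 : ℂ) :=
        (isOpen_lt continuous_const Complex.continuous_re).mem_nhds (by simp)
      filter_upwards [this] with z hz
      rw [DirichletCharacter.LFunction_eq_LSeries χ hz]
      have hf : ∀ n : ℕ, ‖χ (n : ZMod q)‖ ≤ 1 := fun n => χ.norm_le_one _
      rw [LSeries_eq_mul_integral _ zero_le_one hz
        (LSeriesSummable_of_bounded_of_one_lt_re (fun n _ => hf n) hz) (isBigO_sum_Icc hf), hI]
  rw [hEq hs, hI]

lemma norm_LFunction_le {q : ℕ} [NeZero q] {χ : DirichletCharacter ℂ q} (hχ : χ ≠ 1)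
    {ℓ : ℝ} (hℓ : 2 ≤ ℓ) (hq : log q ≤ ℓ) {s : ℂ} (hs : 1 - 1 / ℓ ≤ s.re) :
    ‖χ.LFunction s‖ ≤ 15 * ℓ * ‖s‖ := by
  have hq1 : (1 : ℝ) ≤ q := by exact_mod_cast NeZero.one_le
  have hs0 : 0 < s.re := by
    have : 1 / ℓ ≤ 1 / 2 := by gcongr
    linarith
  rw [LFunction_eq_mul_integral hχ hs0, norm_mul, mul_comm]
  gcongr
  refine norm_integral_mul_cpow_le hq1 hℓ hq (fun t ht => ?_) (fun t _ => ?_) hs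
  · refine (norm_sum_floor_le_two_mul (f := fun n : ℕ => χ (n : ZMod q))
      (fun n => χ.norm_le_one _) (by linarith)).trans (by linarith)
  · have := norm_sum_Icc_zmod_le (f := fun a => χ a) (K := 1)
      (MulChar.sum_eq_zero_of_ne_one hχ) (fun a => χ.norm_le_one a) ⌊t⌋₊
    linarith

/-- Derivative bound near the line `Re s = 1`. -/
lemma norm_deriv_LFunction_le {q : ℕ} [NeZero q] {χ : DirichletCharacter ℂ q} (hχ : χ ≠ 1)
    {ℓ : ℝ} (hℓ : 2 ≤ ℓ) (hq : log q ≤ ℓ) {s : ℂ} (hs : 1 - 1 / (2 * ℓ) ≤ s.re) :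
    ‖deriv χ.LFunction s‖ ≤ 30 * ℓ ^ 2 * (‖s‖ + 1) := by
  have hℓ0 : 0 < ℓ := by linarith
  have hd := DirichletCharacter.differentiable_LFunction hχ
  have h := Complex.norm_deriv_le_of_forall_mem_sphere_norm_le (f := χ.LFunction) (c := s)
    (R := 1 / (2 * ℓ)) (C := 15 * ℓ * (‖s‖ + 1)) (by positivity) hd.diffContOnCl (fun z hz => by
      have hz' : ‖z - s‖ = 1 / (2 * ℓ) := by simpa [dist_eq_norm] using hz
      have h1 : 1 / (2 * ℓ) ≤ 1 := by
        rw [div_le_one (by positivity)]; linarith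
      have h2 : ‖z‖ ≤ ‖s‖ + 1 := by
        calc ‖z‖ = ‖s + (z - s)‖ := by congr 1; ring
          _ ≤ ‖s‖ + ‖z - s‖ := norm_add_le _ _
          _ ≤ _ := by linarith
      have h3 := abs_le.mp ((Complex.abs_re_le_norm (z - s)).trans hz'.le)
      rw [Complex.sub_re] at h3
      refine (norm_LFunction_le hχ hℓ hq ?_).trans (by gcongr)
      have : 1 / ℓ = 1 / (2 * ℓ) + 1 / (2 * ℓ) := by field_simp; norm_num
      linarith [h3.1])
  refine h.trans (le_of_eq ?_)
  field_simp
  ring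

lemma one_char_apply {q : ℕ} (a : ZMod q) :
    (1 : DirichletCharacter ℂ q) a = 0 ∨ (1 : DirichletCharacter ℂ q) a = 1 := by
  by_cases h : IsUnit a
  · exact Or.inr (MulChar.one_apply h)
  · exact Or.inl (MulChar.map_nonunit _ h)

lemma norm_LSeries_one_le {q : ℕ} [NeZero q] {ℓ : ℝ} (hℓ : 2 ≤ ℓ) (hq : log q ≤ ℓ)
    {s : ℂ} (hs : 1 < s.re) :
    ‖LSeries (fun n => (1 : DirichletCharacter ℂ q) n) s‖ ≤ ‖s‖ * (15 * ℓ + 1 / ‖s - 1‖) := by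
  have hq1 : (1 : ℝ) ≤ q := by exact_mod_cast NeZero.one_le
  have hq0 : (q : ℂ) ≠ 0 := by exact_mod_cast NeZero.ne q
  have hcard : ‖∑ a, (1 : DirichletCharacter ℂ q) a‖ ≤ q := by
    calc _ ≤ ∑ a : ZMod q, (1 : ℝ) :=
          (norm_sum_le _ _).trans (Finset.sum_le_sum fun a _ =>
            (1 : DirichletCharacter ℂ q).norm_le_one a)
      _ = q := by simp [ZMod.card]
  set m : ℂ := (∑ a, (1 : DirichletCharacter ℂ q) a) / q with hm
  have hmr : ∃ r : ℝ, m = r ∧ 0 ≤ r ∧ r ≤ 1 := by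
    have h1 : ∑ a, (1 : DirichletCharacter ℂ q) a =
        ((∑ a, ((1 : DirichletCharacter ℂ q) a).re : ℝ) : ℂ) := by
      push_cast
      refine Finset.sum_congr rfl fun a _ => ?_
      rcases one_char_apply a with h | h <;> simp [h]
    refine ⟨(∑ a, ((1 : DirichletCharacter ℂ q) a).re) / q, ?_, ?_, ?_⟩
    · rw [hm, h1]; push_cast; rfl
    · refine div_nonneg (Finset.sum_nonneg fun a _ => ?_) (by linarith)
      rcases one_char_apply a with h | h <;> simp [h]
    · rw [div_le_one (by linarith)]
      calc _ ≤ ∑ a : ZMod q, (1 : ℝ) := Finset.sum_le_sum fun a _ => by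
            rcases one_char_apply a with h | h <;> simp [h]
        _ = q := by simp [ZMod.card]
  obtain ⟨r, hr, hr0, hr1⟩ := hmr
  refine norm_LSeries_le_of_mean (m := m) (Q := q)
    (fun n => (1 : DirichletCharacter ℂ q).norm_le_one _) ?_ hq1 hℓ hq (fun N => ?_) hs
  · rw [hr, Complex.norm_real, norm_eq_abs, abs_le]; constructor <;> linarith
  · have := norm_sum_Icc_zmod_le (f := fun a => (1 : DirichletCharacter ℂ q) a - m) (K := 1)
      (by
        rw [Finset.sum_sub_distrib, Finset.sum_const, card_univ, ZMod.card, nsmul_eq_mul, hm]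
        field_simp
        ring) (fun a => by
        rcases one_char_apply a with h | h <;> rw [hr, h]
        rotate_left
        · rw [← Complex.ofReal_one, ← Complex.ofReal_sub, Complex.norm_real, norm_eq_abs, abs_le]
          constructor <;> linarith
        · rw [zero_sub, norm_neg, Complex.norm_real, norm_eq_abs, abs_le]
          constructor <;> linarith) N
    rw [Finset.sum_sub_distrib] at this
    simpa [mul_comm] using this

end GapRuns

namespace GapRuns

open Real Filter Topology Finset MeasureTheory

lemma norm_LFunction_sub_le {q : ℕ} [NeZero q] {χ : DirichletCharacter ℂ q} (hχ : χ ≠ 1)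
    {ℓ : ℝ} (hℓ : 40 ≤ ℓ) (hq : log q ≤ ℓ) {s w : ℂ}
    (hs1 : 1 - 1 / (2 * ℓ) ≤ s.re) (hs2 : s.re ≤ 2) (hs3 : |s.im| ≤ ℓ)
    (hw1 : 1 - 1 / (2 * ℓ) ≤ w.re) (hw2 : w.re ≤ 2) (hw3 : |w.im| ≤ ℓ) :
    ‖χ.LFunction w - χ.LFunction s‖ ≤ ℓ ^ 4 * ‖w - s‖ := by
  have hd := DirichletCharacter.differentiable_LFunction hχ
  refine Convex.norm_image_sub_le_of_norm_deriv_le (𝕜 := ℂ)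
    (s := Set.Icc (1 - 1 / (2 * ℓ)) 2 ×ℂ Set.Icc (-ℓ) ℓ)
    (fun x _ => hd x) (fun x hx => ?_) ?_ ?_ ?_
  · rw [Complex.mem_reProdIm] at hx
    refine (norm_deriv_LFunction_le hχ (by linarith) hq hx.1.1).trans ?_
    have h1 : 1 / (2 * ℓ) ≤ 1 := by
      rw [div_le_one (by linarith)]; linarith
    have hx1 : |x.re| ≤ 2 := abs_le.mpr ⟨by linarith [hx.1.1], hx.1.2⟩
    have hx2 : |x.im| ≤ ℓ := abs_le.mpr hx.2
    have hn := Complex.norm_le_abs_re_add_abs_im x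
    calc 30 * ℓ ^ 2 * (‖x‖ + 1) ≤ 30 * ℓ ^ 2 * (ℓ + 2 + 1) := by gcongr; linarith
      _ = ℓ ^ 2 * (30 * (ℓ + 3)) := by ring
      _ ≤ ℓ ^ 2 * ℓ ^ 2 := by gcongr; nlinarith
      _ = ℓ ^ 4 := by ring
  · exact ((convex_Icc _ _).linear_preimage Complex.reLm).inter
      ((convex_Icc _ _).linear_preimage Complex.imLm)
  · exact Complex.mem_reProdIm.mpr ⟨⟨hs1, hs2⟩, abs_le.mp hs3⟩
  · exact Complex.mem_reProdIm.mpr ⟨⟨hw1, hw2⟩, abs_le.mp hw3⟩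

lemma norm_deriv_LFunction_le' {q : ℕ} [NeZero q] {χ : DirichletCharacter ℂ q} (hχ : χ ≠ 1)
    {ℓ : ℝ} (hℓ : 40 ≤ ℓ) (hq : log q ≤ ℓ) {s : ℂ}
    (hs1 : 1 - 1 / (2 * ℓ) ≤ s.re) (hs2 : s.re ≤ 2) (hs3 : |s.im| ≤ ℓ) :
    ‖deriv χ.LFunction s‖ ≤ ℓ ^ 4 := by
  refine (norm_deriv_LFunction_le hχ (by linarith) hq hs1).trans ?_
  have h1 : 1 / (2 * ℓ) ≤ 1 := by
    rw [div_le_one (by linarith)]; linarith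
  have hx1 : |s.re| ≤ 2 := abs_le.mpr ⟨by linarith, hs2⟩
  have hn := Complex.norm_le_abs_re_add_abs_im s
  calc 30 * ℓ ^ 2 * (‖s‖ + 1) ≤ 30 * ℓ ^ 2 * (ℓ + 2 + 1) := by gcongr; linarith
    _ = ℓ ^ 2 * (30 * (ℓ + 3)) := by ring
    _ ≤ ℓ ^ 2 * ℓ ^ 2 := by gcongr; nlinarith
    _ = ℓ ^ 4 := by ring

/-- Lower bound for `L` just right of the line, away from the real axis for quadratic
characters. -/
lemma one_le_norm_LFunction_right {q : ℕ} [NeZero q] {χ : DirichletCharacter ℂ q}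
    {ℓ : ℝ} (hℓ : 40 ≤ ℓ) (hq : log q ≤ ℓ) {t : ℝ} (ht : |t| ≤ ℓ)
    (h2 : χ ^ 2 = 1 → 1 ≤ |t| * ℓ ^ 25) :
    1 ≤ ‖χ.LFunction (1 + ((ℓ ^ 80)⁻¹ : ℝ) + Complex.I * t)‖ * ℓ ^ 68 := by
  have hℓ0 : 0 < ℓ := by linarith
  set δ : ℝ := (ℓ ^ 80)⁻¹ with hδ
  have hδ0 : 0 < δ := by positivity
  have hδ1 : δ ≤ 1 := inv_le_one_of_one_le₀ (one_le_pow₀ (by linarith))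
  have h341 := DirichletCharacter.norm_LSeries_product_ge_one χ hδ0 t
  have hre1 : 1 < (1 + (δ : ℂ)).re := by simpa using hδ0
  have hre2 : 1 < (1 + (δ : ℂ) + Complex.I * t).re := by simpa using hδ0
  have hre3 : 1 < (1 + (δ : ℂ) + 2 * Complex.I * t).re := by simpa using hδ0
  rw [norm_mul, norm_mul, norm_pow, norm_pow, ← DirichletCharacter.LFunction_eq_LSeries χ hre2]
    at h341
  have hn2 : ‖1 + (δ : ℂ) + 2 * Complex.I * t‖ ≤ 2 * ℓ + 2 := by
    calc _ ≤ ‖1 + (δ : ℂ)‖ + ‖2 * Complex.I * t‖ := norm_add_le _ _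
      _ ≤ (‖(1 : ℂ)‖ + ‖(δ : ℂ)‖) + 2 * |t| := by
          gcongr
          · exact norm_add_le _ _
          · simp
      _ ≤ _ := by
          rw [Complex.norm_real, norm_eq_abs, abs_of_pos hδ0, norm_one]
          linarith
  have hB : ‖LSeries (fun n => (χ ^ 2) n) (1 + δ + 2 * Complex.I * t)‖ ≤ ℓ ^ 28 := by
    by_cases hc : χ ^ 2 = 1
    · rw [hc]
      refine (norm_LSeries_one_le (by linarith) hq hre3).trans ?_
      have h3 : |t| ≤ ‖1 + (δ : ℂ) + 2 * Complex.I * t - 1‖ := by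
        refine le_trans ?_ (Complex.abs_im_le_norm _)
        simp only [Complex.sub_im, Complex.add_im, Complex.one_im, Complex.ofReal_im,
          Complex.mul_im, Complex.mul_re, Complex.re_ofNat, Complex.im_ofNat, Complex.I_re,
          Complex.I_im, Complex.ofReal_re]
        norm_num
        linarith [abs_nonneg t]
      have h4 := h2 hc
      have h5 : 0 < |t| := by
        by_contra h
        have : |t| = 0 := le_antisymm (not_lt.mp h) (abs_nonneg t)
        rw [this] at h4; linarith
      have h6 : 1 / ‖1 + (δ : ℂ) + 2 * Complex.I * t - 1‖ ≤ ℓ ^ 25 := by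
        rw [div_le_iff₀ (h5.trans_le h3)]
        calc 1 ≤ |t| * ℓ ^ 25 := h4
          _ ≤ _ := by rw [mul_comm]; gcongr
      calc _ ≤ (2 * ℓ + 2) * (15 * ℓ + ℓ ^ 25) := by gcongr
        _ ≤ (ℓ * ℓ) * (ℓ ^ 25 + ℓ ^ 25) := by
            gcongr
            · nlinarith
            · calc 15 * ℓ ≤ ℓ ^ 2 := by nlinarith
                _ ≤ ℓ ^ 25 := pow_le_pow_right₀ (by linarith) (by norm_num)
        _ = 2 * ℓ ^ 27 := by ring
        _ ≤ ℓ * ℓ ^ 27 := by gcongr; linarith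
        _ = ℓ ^ 28 := by ring
    · rw [← DirichletCharacter.LFunction_eq_LSeries _ hre3]
      refine (norm_LFunction_le hc (by linarith) hq ?_).trans ?_
      · have : 0 < 1 / ℓ := by positivity
        linarith
      · calc _ ≤ 15 * ℓ * (2 * ℓ + 2) := by gcongr
          _ = ℓ * (30 * ℓ + 30) := by ring
          _ ≤ ℓ * ℓ ^ 2 := by gcongr; nlinarith
          _ = ℓ ^ 3 := by ring
          _ ≤ ℓ ^ 28 := pow_le_pow_right₀ (by linarith) (by norm_num)
  have hA : ‖LSeries (fun n => (1 : DirichletCharacter ℂ q) n) (1 + δ)‖ ≤ ℓ ^ 81 := by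
    refine (norm_LSeries_one_le (by linarith) hq hre1).trans ?_
    have e1 : ‖1 + (δ : ℂ) - 1‖ = δ := by
      rw [add_sub_cancel_left, Complex.norm_real, norm_eq_abs, abs_of_pos hδ0]
    have e2 : ‖1 + (δ : ℂ)‖ ≤ 2 := by
      refine (norm_add_le _ _).trans ?_
      rw [Complex.norm_real, norm_eq_abs, abs_of_pos hδ0, norm_one]; linarith
    rw [e1, hδ, one_div, inv_inv]
    calc _ ≤ 2 * (ℓ ^ 80 + ℓ ^ 80) := by
          gcongr
          calc 15 * ℓ ≤ ℓ ^ 2 := by nlinarith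
            _ ≤ ℓ ^ 80 := pow_le_pow_right₀ (by linarith) (by norm_num)
      _ = 4 * ℓ ^ 80 := by ring
      _ ≤ ℓ * ℓ ^ 80 := by gcongr; linarith
      _ = ℓ ^ 81 := by ring
  set a := ‖χ.LFunction (1 + δ + Complex.I * t)‖
  have ha : 0 ≤ a := norm_nonneg _
  have h1 : 1 ≤ (a * ℓ ^ 68) ^ 4 := by
    calc 1 ≤ _ := h341
      _ ≤ (ℓ ^ 81) ^ 3 * a ^ 4 * ℓ ^ 28 := by gcongr
      _ = a ^ 4 * ℓ ^ 271 := by ring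
      _ ≤ a ^ 4 * ℓ ^ 272 := by gcongr <;> [linarith; norm_num]
      _ = _ := by ring
  by_contra hlt
  exact absurd h1 (not_le.mpr (pow_lt_one₀ (by positivity) (not_le.mp hlt) (by norm_num)))

/-- A zero-free strip with an explicit lower bound, given a lower bound at `1` in the
quadratic case. -/
lemma one_le_norm_LFunction_mul {q : ℕ} [NeZero q] {χ : DirichletCharacter ℂ q} (hχ : χ ≠ 1)
    {ℓ : ℝ} (hℓ : 40 ≤ ℓ) (hq : log q ≤ ℓ) (hL : χ ^ 2 = 1 → 1 ≤ ‖χ.LFunction 1‖ * ℓ ^ 20)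
    {s : ℂ} (hs1 : 1 - (ℓ ^ 80)⁻¹ ≤ s.re) (hs2 : s.re ≤ 1 + (ℓ ^ 80)⁻¹) (hs3 : |s.im| ≤ ℓ) :
    1 ≤ ‖χ.LFunction s‖ * ℓ ^ 69 := by
  have hℓ0 : 0 < ℓ := by linarith
  set δ : ℝ := (ℓ ^ 80)⁻¹ with hδ
  have hδ0 : 0 < δ := by positivity
  have hδℓ : δ ≤ 1 / (2 * ℓ) := by
    rw [hδ, ← one_div]
    refine one_div_le_one_div_of_le (by linarith) ?_
    calc 2 * ℓ ≤ ℓ ^ 2 := by nlinarith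
      _ ≤ ℓ ^ 80 := pow_le_pow_right₀ (by linarith) (by norm_num)
  have hδ1 : δ ≤ 1 := inv_le_one_of_one_le₀ (one_le_pow₀ (by linarith))
  by_cases hc : χ ^ 2 = 1 → 1 ≤ |s.im| * ℓ ^ 25
  · have h1 := one_le_norm_LFunction_right hℓ hq hs3 hc
    rw [← hδ] at h1
    set w : ℂ := 1 + δ + Complex.I * s.im with hw
    have hwre : w.re = 1 + δ := by simp [hw]
    have hwim : w.im = s.im := by simp [hw]
    have hp : 0 < 1 / (2 * ℓ) := by positivity
    have h2 := norm_LFunction_sub_le hχ hℓ hq (s := s) (w := w) (by linarith) (by linarith) hs3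
      (by rw [hwre]; linarith) (by rw [hwre]; linarith) (by rw [hwim]; exact hs3)
    have h3 : ‖w - s‖ ≤ 2 * δ := by
      refine (Complex.norm_le_abs_re_add_abs_im _).trans ?_
      rw [Complex.sub_re, Complex.sub_im, hwre, hwim, sub_self, abs_zero, add_zero, abs_le]
      constructor <;> linarith
    have h4 : ‖χ.LFunction w‖ ≤ ‖χ.LFunction s‖ + ℓ ^ 4 * (2 * δ) := by
      have : ‖χ.LFunction w‖ ≤ ‖χ.LFunction s‖ + ‖χ.LFunction w - χ.LFunction s‖ := by
        calc _ = ‖χ.LFunction s + (χ.LFunction w - χ.LFunction s)‖ := by congr 1; ring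
          _ ≤ _ := norm_add_le _ _
      refine this.trans (by gcongr; exact h2.trans (by gcongr))
    have h5 : δ * ℓ ^ 80 = 1 := inv_mul_cancel₀ (by positivity)
    have h6 : ℓ ^ 4 * (2 * δ) * ℓ ^ 69 ≤ 1 := by
      calc ℓ ^ 4 * (2 * δ) * ℓ ^ 69 = δ * (2 * ℓ ^ 73) := by ring
        _ ≤ δ * (ℓ * ℓ ^ 73) := by gcongr; linarith
        _ = δ * ℓ ^ 74 := by ring
        _ ≤ δ * ℓ ^ 80 := by gcongr <;> [linarith; norm_num]
        _ = 1 := h5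
    have h7 : ℓ ≤ ‖χ.LFunction w‖ * ℓ ^ 69 := by
      calc ℓ ≤ (‖χ.LFunction w‖ * ℓ ^ 68) * ℓ := le_mul_of_one_le_left hℓ0.le h1
        _ = _ := by ring
    have h8 : ‖χ.LFunction w‖ * ℓ ^ 69 ≤ (‖χ.LFunction s‖ + ℓ ^ 4 * (2 * δ)) * ℓ ^ 69 := by gcongr
    linarith
  · push Not at hc
    obtain ⟨hc1, hc2⟩ := hc
    have h1 := hL hc1
    have hp : 0 < 1 / (2 * ℓ) := by positivity
    have h2 := norm_LFunction_sub_le hχ hℓ hq (s := s) (w := 1) (by linarith) (by linarith) hs3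
      (by simp; linarith) (by simp) (by simp; linarith)
    have h3 : ‖1 - s‖ ≤ δ + |s.im| := by
      refine (Complex.norm_le_abs_re_add_abs_im _).trans ?_
      rw [Complex.sub_re, Complex.sub_im, Complex.one_re, Complex.one_im, zero_sub, abs_neg]
      gcongr
      rw [abs_le]
      constructor <;> linarith
    have h4 : ‖χ.LFunction 1‖ ≤ ‖χ.LFunction s‖ + ℓ ^ 4 * (δ + |s.im|) := by
      have : ‖χ.LFunction 1‖ ≤ ‖χ.LFunction s‖ + ‖χ.LFunction 1 - χ.LFunction s‖ := by
        calc _ = ‖χ.LFunction s + (χ.LFunction 1 - χ.LFunction s)‖ := by congr 1; ring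
          _ ≤ _ := norm_add_le _ _
      refine this.trans (by gcongr; exact h2.trans (by gcongr))
    have h5 : δ * ℓ ^ 80 = 1 := inv_mul_cancel₀ (by positivity)
    have h6 : ℓ ^ 4 * (δ + |s.im|) * ℓ ^ 21 ≤ 2 := by
      have : δ * ℓ ^ 25 ≤ δ * ℓ ^ 80 := by gcongr <;> [linarith; norm_num]
      calc ℓ ^ 4 * (δ + |s.im|) * ℓ ^ 21 = δ * ℓ ^ 25 + |s.im| * ℓ ^ 25 := by ring
        _ ≤ 2 := by linarith
    have h7 : ℓ ≤ ‖χ.LFunction 1‖ * ℓ ^ 21 := by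
      calc ℓ ≤ (‖χ.LFunction 1‖ * ℓ ^ 20) * ℓ := le_mul_of_one_le_left hℓ0.le h1
        _ = _ := by ring
    have h8 : ‖χ.LFunction 1‖ * ℓ ^ 21 ≤ (‖χ.LFunction s‖ + ℓ ^ 4 * (δ + |s.im|)) * ℓ ^ 21 := by
      gcongr
    have h9 : ‖χ.LFunction s‖ * ℓ ^ 21 ≤ ‖χ.LFunction s‖ * ℓ ^ 69 := by
      gcongr <;> [linarith; norm_num]
    linarith

end GapRuns

namespace GapRuns

open Real Filter Topology Finset MeasureTheory

/-- The product of two Dirichlet characters, as a character to the product modulus. -/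
noncomputable def prodChar {r₁ r₂ : ℕ} (χ₁ : DirichletCharacter ℂ r₁)
    (χ₂ : DirichletCharacter ℂ r₂) : DirichletCharacter ℂ (r₁ * r₂) :=
  DirichletCharacter.changeLevel (Nat.dvd_mul_right r₁ r₂) χ₁ *
    DirichletCharacter.changeLevel (Nat.dvd_mul_left r₂ r₁) χ₂

lemma char_natCast_eq_zero {r n : ℕ} (χ : DirichletCharacter ℂ r) (h : ¬ n.Coprime r) :
    χ (n : ZMod r) = 0 :=
  MulChar.map_nonunit _ fun hu => h ((ZMod.isUnit_iff_coprime n r).mp hu)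

lemma changeLevel_natCast {r N n : ℕ} (χ : DirichletCharacter ℂ r) (hd : r ∣ N)
    (h : n.Coprime N) : DirichletCharacter.changeLevel hd χ (n : ZMod N) = χ (n : ZMod r) := by
  have := DirichletCharacter.changeLevel_eq_cast_of_dvd' χ hd (a := n)
    (Nat.isCoprime_iff_coprime.mpr h)
  simpa using this

lemma prodChar_apply {r₁ r₂ : ℕ} (χ₁ : DirichletCharacter ℂ r₁)
    (χ₂ : DirichletCharacter ℂ r₂) (n : ℕ) :
    prodChar χ₁ χ₂ (n : ZMod (r₁ * r₂)) = χ₁ n * χ₂ n := by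
  by_cases h : n.Coprime (r₁ * r₂)
  · rw [prodChar, MulChar.mul_apply, changeLevel_natCast _ _ h, changeLevel_natCast _ _ h]
  · rw [char_natCast_eq_zero _ h]
    rw [Nat.coprime_mul_iff_right, not_and_or] at h
    rcases h with h | h
    · rw [char_natCast_eq_zero χ₁ h, zero_mul]
    · rw [char_natCast_eq_zero χ₂ h, mul_zero]

lemma sigma_eq_of_changeLevel_eq {r₁ r₂ N : ℕ} [NeZero N] {χ₁ : DirichletCharacter ℂ r₁}
    {χ₂ : DirichletCharacter ℂ r₂} (h₁ : χ₁.IsPrimitive) (h₂ : χ₂.IsPrimitive)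
    (d₁ : r₁ ∣ N) (d₂ : r₂ ∣ N)
    (h : DirichletCharacter.changeLevel d₁ χ₁ = DirichletCharacter.changeLevel d₂ χ₂) :
    (⟨r₁, χ₁⟩ : Σ r, DirichletCharacter ℂ r) = ⟨r₂, χ₂⟩ := by
  have e : r₁ = r₂ := by
    rw [← h₁, ← h₂, ← DirichletCharacter.conductor_changeLevel χ₁ d₁, h,
      DirichletCharacter.conductor_changeLevel χ₂ d₂]
  subst e
  rw [DirichletCharacter.changeLevel_injective d₁ h]

lemma sigma_eq_inv_of_prodChar_eq_one {r₁ r₂ : ℕ} [NeZero r₁] [NeZero r₂]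
    {χ₁ : DirichletCharacter ℂ r₁} {χ₂ : DirichletCharacter ℂ r₂} (h₁ : χ₁.IsPrimitive)
    (h₂ : χ₂.IsPrimitive) (h : prodChar χ₁ χ₂ = 1) :
    (⟨r₁, χ₁⟩ : Σ r, DirichletCharacter ℂ r) = ⟨r₂, χ₂⁻¹⟩ := by
  refine sigma_eq_of_changeLevel_eq (N := r₁ * r₂) h₁ ?_ (Nat.dvd_mul_right _ _)
    (Nat.dvd_mul_left _ _) ?_
  · rw [DirichletCharacter.isPrimitive_def, DirichletCharacter.conductor_inv]
    exact h₂
  · rw [map_inv]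
    exact eq_inv_of_mul_eq_one_left h

lemma quadratic_value {r : ℕ} {χ : DirichletCharacter ℂ r} (h : χ ^ 2 = 1) (a : ZMod r) :
    χ a = 0 ∨ χ a = 1 ∨ χ a = -1 := by
  by_cases ha : IsUnit a
  · right
    have : (χ ^ 2) a = 1 := by rw [h, MulChar.one_apply ha]
    rw [MulChar.pow_apply' _ two_ne_zero] at this
    exact mul_self_eq_one_iff.mp (by rwa [← sq])
  · exact Or.inl (MulChar.map_nonunit _ ha)

lemma euler_factor_le {a b : ℂ} {x : ℝ} (hx0 : 0 ≤ x) (hx1 : x ≤ 1)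
    (ha : a = 0 ∨ a = 1 ∨ a = -1) (hb : b = 0 ∨ b = 1 ∨ b = -1) :
    ‖(1 - (x : ℂ)) * (1 - a * x) * (1 - b * x) * (1 - a * b * x)‖ ≤ 1 := by
  have hx2 : x ^ 2 ≤ 1 := pow_le_one₀ hx0 hx1
  have key : ∀ y : ℝ, -1 ≤ y → y ≤ 1 → ‖(y : ℂ)‖ ≤ 1 := fun y h1 h2 => by
    rw [Complex.norm_real, norm_eq_abs, abs_le]; exact ⟨h1, h2⟩
  have h4 : (1 - x ^ 2) ^ 2 ≤ 1 := pow_le_one₀ (by linarith) (by nlinarith)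
  have h5 : (1 - x) ^ 2 ≤ 1 := pow_le_one₀ (by linarith) (by linarith)
  have h6 : (1 - x) ^ 4 ≤ 1 := pow_le_one₀ (by linarith) (by linarith)
  have e1 : ‖1 - (x : ℂ)‖ ≤ 1 := by
    have := key (1 - x) (by linarith) (by linarith); push_cast at this; exact this
  have e2 : ‖(1 - (x : ℂ)) ^ 2‖ ≤ 1 := by
    have := key ((1 - x) ^ 2) (by nlinarith) h5; push_cast at this; exact this
  have e3 : ‖1 - (x : ℂ) ^ 2‖ ≤ 1 := by
    have := key (1 - x ^ 2) (by linarith) (by nlinarith); push_cast at this; exact this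
  have e4 : ‖(1 - (x : ℂ) ^ 2) ^ 2‖ ≤ 1 := by
    have := key ((1 - x ^ 2) ^ 2) (by nlinarith) h4; push_cast at this; exact this
  have e5 : ‖(1 - (x : ℂ)) ^ 4‖ ≤ 1 := by
    have := key ((1 - x) ^ 4) (by nlinarith [sq_nonneg ((1 - x) ^ 2)]) h6
    push_cast at this; exact this
  rcases ha with rfl | rfl | rfl <;> rcases hb with rfl | rfl | rfl
  · convert e1 using 2; ring
  · convert e2 using 2; ring
  · convert e3 using 2; ring
  · convert e2 using 2; ring
  · convert e5 using 2; ring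
  · convert e4 using 2; ring
  · convert e3 using 2; ring
  · convert e4 using 2; ring
  · convert e4 using 2; ring

/-- The product of the zeta function and three quadratic `L`-functions is at least `1`. -/
lemma one_le_norm_LSeries_mul {r₁ r₂ : ℕ} {χ₁ : DirichletCharacter ℂ r₁}
    {χ₂ : DirichletCharacter ℂ r₂} (h₁ : χ₁ ^ 2 = 1) (h₂ : χ₂ ^ 2 = 1) {σ : ℝ} (hσ : 1 < σ) :
    1 ≤ ‖LSeries (fun n => (1 : DirichletCharacter ℂ 1) n) σ * LSeries (fun n => χ₁ n) σ *
      LSeries (fun n => χ₂ n) σ * LSeries (fun n => prodChar χ₁ χ₂ n) σ‖ := by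
  have hre : 1 < (σ : ℂ).re := by simpa using hσ
  have hP := (((DirichletCharacter.LSeries_eulerProduct_hasProd (1 : DirichletCharacter ℂ 1)
    hre).mul (DirichletCharacter.LSeries_eulerProduct_hasProd χ₁ hre)).mul
    (DirichletCharacter.LSeries_eulerProduct_hasProd χ₂ hre)).mul
    (DirichletCharacter.LSeries_eulerProduct_hasProd (prodChar χ₁ χ₂) hre)
  refine ge_of_tendsto hP.norm (Eventually.of_forall fun s => ?_)
  refine Finset.prod_induction _ (fun x : ℝ => 1 ≤ x) (fun _ _ ha hb => one_le_mul_of_one_le_of_one_le ha hb)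
    le_rfl fun p _ => ?_
  have hp1 : (1 : ℝ) < (p : ℕ) := by exact_mod_cast p.2.one_lt
  set x : ℝ := ((p : ℕ) : ℝ) ^ (-σ) with hx
  have hx0 : 0 ≤ x := by positivity
  have hx1 : x < 1 := rpow_lt_one_of_one_lt_of_neg hp1 (by linarith)
  have hcx : ((p : ℕ) : ℂ) ^ (-(σ : ℂ)) = (x : ℂ) := by
    rw [hx, Complex.ofReal_cpow (by positivity)]; push_cast; rfl
  have h1 : (1 : DirichletCharacter ℂ 1) (p : ℕ) = 1 := MulChar.one_apply (isUnit_of_subsingleton _)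
  have q₁ := quadratic_value h₁ ((p : ℕ) : ZMod r₁)
  have q₂ := quadratic_value h₂ ((p : ℕ) : ZMod r₂)
  have key := euler_factor_le hx0 hx1.le q₁ q₂
  have hne : ∀ a : ℂ, ‖a‖ ≤ 1 → 1 - a * x ≠ 0 := fun a ha h0 => by
    have : ‖a * x‖ = 1 := by rw [← sub_eq_zero.mp h0, norm_one]
    rw [norm_mul, Complex.norm_real, norm_eq_abs, abs_of_nonneg hx0] at this
    nlinarith
  have n₁ := hne _ (DirichletCharacter.norm_le_one χ₁ (p : ℕ))
  have n₂ := hne _ (DirichletCharacter.norm_le_one χ₂ (p : ℕ))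
  have n₁₂ := hne (χ₁ (p : ℕ) * χ₂ (p : ℕ)) (by
    rw [norm_mul]
    exact mul_le_one₀ (DirichletCharacter.norm_le_one χ₁ _) (norm_nonneg _)
      (DirichletCharacter.norm_le_one χ₂ _))
  have n₀ := hne 1 (by simp)
  rw [one_mul] at n₀
  simp only [hcx, h1, prodChar_apply, one_mul]
  rw [← mul_inv, ← mul_inv, ← mul_inv, norm_inv]
  refine (one_le_inv₀ ?_).mpr key
  rw [norm_pos_iff]
  exact mul_ne_zero (mul_ne_zero (mul_ne_zero n₀ n₁) n₂) n₁₂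

/-- Two distinct primitive quadratic characters of small conductor cannot both have a very small
`L`-value at `1`. -/
lemma sigma_eq_of_LFunction_small {r₁ r₂ : ℕ} [NeZero r₁] [NeZero r₂]
    {χ₁ : DirichletCharacter ℂ r₁} {χ₂ : DirichletCharacter ℂ r₂} (p₁ : χ₁.IsPrimitive)
    (p₂ : χ₂.IsPrimitive) (q₁ : χ₁ ^ 2 = 1) (q₂ : χ₂ ^ 2 = 1) (n₁ : χ₁ ≠ 1) (n₂ : χ₂ ≠ 1)
    {ℓ : ℝ} (hℓ : 40 ≤ ℓ) (l₁ : log r₁ ≤ ℓ) (l₂ : log r₂ ≤ ℓ)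
    (s₁ : ‖χ₁.LFunction 1‖ * ℓ ^ 20 ≤ 1) (s₂ : ‖χ₂.LFunction 1‖ * ℓ ^ 20 ≤ 1) :
    (⟨r₁, χ₁⟩ : Σ r, DirichletCharacter ℂ r) = ⟨r₂, χ₂⟩ := by
  by_contra hne
  have hℓ0 : 0 < ℓ := by linarith
  have hinv : χ₂⁻¹ = χ₂ := inv_eq_of_mul_eq_one_left (by rw [← sq, q₂])
  have n₁₂ : prodChar χ₁ χ₂ ≠ 1 := fun h => hne (by
    rw [sigma_eq_inv_of_prodChar_eq_one p₁ p₂ h, hinv])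
  set δ : ℝ := (ℓ ^ 24)⁻¹ with hδ
  have hδ0 : 0 < δ := by positivity
  have hδ1 : δ ≤ 1 := inv_le_one_of_one_le₀ (one_le_pow₀ (by linarith))
  have hσ : 1 < 1 + δ := by linarith
  have hre : 1 < ((1 + δ : ℝ) : ℂ).re := by simpa using hσ
  have hprod := one_le_norm_LSeries_mul q₁ q₂ hσ
  have hns : ‖((1 + δ : ℝ) : ℂ)‖ = 1 + δ := by
    rw [Complex.norm_real, norm_eq_abs, abs_of_pos (by linarith)]
  have hquad : ∀ (r : ℕ) [NeZero r] (χ : DirichletCharacter ℂ r), χ ≠ 1 → log r ≤ ℓ →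
      ‖χ.LFunction 1‖ * ℓ ^ 20 ≤ 1 →
      ‖LSeries (fun n => χ n) ((1 + δ : ℝ) : ℂ)‖ ≤ 2 * (ℓ ^ 20)⁻¹ := by
    intro r _ χ hχ hr hs
    rw [← DirichletCharacter.LFunction_eq_LSeries _ hre]
    have hd := norm_LFunction_sub_le hχ hℓ hr (s := 1) (w := ((1 + δ : ℝ) : ℂ))
      (by simp; positivity) (by simp) (by simp; positivity)
      (by simp only [Complex.ofReal_re]; have : 0 ≤ 1 / (2 * ℓ) := by positivity
          linarith) (by simp only [Complex.ofReal_re]; linarith) (by simp; positivity)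
    have h1 : ‖((1 + δ : ℝ) : ℂ) - 1‖ = δ := by
      push_cast
      rw [add_sub_cancel_left, Complex.norm_real, norm_eq_abs, abs_of_pos hδ0]
    rw [h1] at hd
    have h2 : ℓ ^ 4 * δ = (ℓ ^ 20)⁻¹ := by rw [hδ]; field_simp
    have h3 : ‖χ.LFunction 1‖ ≤ (ℓ ^ 20)⁻¹ := by
      rw [← one_div, le_div_iff₀ (by positivity)]; exact hs
    have h4 := norm_le_insert' (χ.LFunction ((1 + δ : ℝ) : ℂ)) (χ.LFunction 1)
    linarith
  have b₁ := hquad r₁ χ₁ n₁ l₁ s₁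
  have b₂ := hquad r₂ χ₂ n₂ l₂ s₂
  have b₀ := norm_LSeries_one_le (q := 1) (ℓ := 2) le_rfl (by simp) hre
  have h1 : ‖((1 + δ : ℝ) : ℂ) - 1‖ = δ := by
    push_cast
    rw [add_sub_cancel_left, Complex.norm_real, norm_eq_abs, abs_of_pos hδ0]
  rw [h1, hns, hδ, one_div, inv_inv, ← hδ] at b₀
  have b₁₂ := norm_LFunction_le n₁₂ (ℓ := 2 * ℓ) (by linarith) (by
    push_cast
    rw [log_mul (by exact_mod_cast NeZero.ne r₁) (by exact_mod_cast NeZero.ne r₂)]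
    linarith) (s := ((1 + δ : ℝ) : ℂ)) (by
      simp only [Complex.ofReal_re]
      have : 0 ≤ 1 / (2 * ℓ) := by positivity
      linarith)
  rw [DirichletCharacter.LFunction_eq_LSeries _ hre, hns] at b₁₂
  have h24 : 30 ≤ ℓ ^ 24 := by
    calc (30 : ℝ) ≤ ℓ ^ 1 := by linarith
      _ ≤ ℓ ^ 24 := pow_le_pow_right₀ (by linarith) (by norm_num)
  have b₀' : ‖LSeries (fun n => (1 : DirichletCharacter ℂ 1) n) ((1 + δ : ℝ) : ℂ)‖ ≤
      4 * ℓ ^ 24 := b₀.trans (by nlinarith)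
  have b₁₂' : ‖LSeries (fun n => prodChar χ₁ χ₂ n) ((1 + δ : ℝ) : ℂ)‖ ≤ 60 * ℓ :=
    b₁₂.trans (by nlinarith)
  rw [norm_mul, norm_mul, norm_mul] at hprod
  have hfin : 1 ≤ 4 * ℓ ^ 24 * (2 * (ℓ ^ 20)⁻¹) * (2 * (ℓ ^ 20)⁻¹) * (60 * ℓ) :=
    hprod.trans (by gcongr)
  have h5 : 4 * ℓ ^ 24 * (2 * (ℓ ^ 20)⁻¹) * (2 * (ℓ ^ 20)⁻¹) * (60 * ℓ) = 960 / ℓ ^ 15 := by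
    field_simp; norm_num
  rw [h5, le_div_iff₀ (by positivity), one_mul] at hfin
  have : ℓ ^ 2 ≤ ℓ ^ 15 := pow_le_pow_right₀ (by linarith) (by norm_num)
  nlinarith

/-- `Good ℓ` says that no primitive quadratic character of conductor at most `exp ℓ` has an
exceptionally small `L`-value at `1`. -/
def Good (ℓ : ℝ) : Prop :=
  ∀ (r : ℕ) [NeZero r] (χ : DirichletCharacter ℂ r), log r ≤ ℓ → χ.IsPrimitive → χ ≠ 1 →
    χ ^ 2 = 1 → 1 ≤ ‖χ.LFunction 1‖ * ℓ ^ 20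

lemma exists_good (ℓ₀ : ℝ) : ∃ ℓ, ℓ₀ ≤ ℓ ∧ Good ℓ := by
  by_contra! hbad
  set ℓ₁ := max ℓ₀ 40 with hℓ₁
  have hℓ₁0 : (0 : ℝ) < ℓ₁ := lt_of_lt_of_le (by norm_num) (le_max_right _ _)
  have h₁ := hbad ℓ₁ (le_max_left _ _)
  simp only [Good] at h₁
  push Not at h₁
  obtain ⟨r, hr, χ, hlog, hp, hne, hsq, hsmall⟩ := h₁
  set v := ‖χ.LFunction 1‖ with hv
  have hv0 : 0 < v := norm_pos_iff.mpr (DirichletCharacter.LFunction_apply_one_ne_zero hne)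
  set ℓ := v ^ (-(1 / 20) : ℝ) with hℓ
  have hℓ0 : 0 < ℓ := by positivity
  have hvℓ : v * ℓ ^ 20 = 1 := by
    rw [hℓ, ← rpow_natCast, ← rpow_mul hv0.le]
    norm_num
    rw [rpow_neg_one, mul_inv_cancel₀ hv0.ne']
  have hlt : ℓ₁ < ℓ := by
    refine lt_of_pow_lt_pow_left₀ 20 hℓ0.le ?_
    refine lt_of_mul_lt_mul_left ?_ hv0.le
    rw [hvℓ]; exact hsmall
  have h40 : 40 ≤ ℓ := (le_max_right _ _).trans hlt.le
  have h₂ := hbad ℓ ((le_max_left _ _).trans hlt.le)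
  simp only [Good] at h₂
  push Not at h₂
  obtain ⟨r', hr', χ', hlog', hp', hne', hsq', hsmall'⟩ := h₂
  have heq := sigma_eq_of_LFunction_small hp hp' hsq hsq' hne hne' h40 (hlog.trans hlt.le) hlog'
    hvℓ.le hsmall'.le
  obtain rfl : r = r' := congrArg Sigma.fst heq
  obtain rfl : χ = χ' := eq_of_heq (Sigma.mk.inj heq).2
  exact absurd hvℓ hsmall'.ne

end GapRuns

namespace GapRuns

open Real Filter Topology Finset MeasureTheory

/-- The Mellin kernel of the weight `om u`. -/
noncomputable def mk (u : ℝ) (w : ℂ) : ℂ := Complex.exp (w ^ 2 / 2 + u * w)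

lemma norm_mk (u δ t : ℝ) :
    ‖mk u (δ + Complex.I * t)‖ = exp (δ ^ 2 / 2 + u * δ) * exp (-(1 / 2) * t ^ 2) := by
  rw [mk, Complex.norm_exp, ← exp_add]
  congr 1
  simp [sq]
  ring

lemma continuous_mk (u δ : ℝ) : Continuous fun t : ℝ => mk u (δ + Complex.I * t) := by
  unfold mk; fun_prop

lemma integrable_gauss : Integrable fun t : ℝ => exp (-(1 / 2) * t ^ 2) :=
  integrable_exp_neg_mul_sq (by norm_num)

lemma integrable_mk (u δ : ℝ) : Integrable fun t : ℝ => mk u (δ + Complex.I * t) := by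
  refine (integrable_gauss.const_mul (exp (δ ^ 2 / 2 + u * δ))).mono'
    (continuous_mk u δ).aestronglyMeasurable (Eventually.of_forall fun t => ?_)
  rw [norm_mk]

lemma integral_mk_mul_cpow (u δ : ℝ) {n : ℕ} (hn : 0 < n) :
    ∫ t : ℝ, (n : ℂ) ^ (-(1 + δ + Complex.I * t)) * mk u (δ + Complex.I * t) =
      (√(2 * π) : ℝ) * (om u n : ℂ) := by
  have hn0 : (n : ℂ) ≠ 0 := by exact_mod_cast hn.ne'
  have hlog : Complex.log n = (log n : ℝ) := by rw [Complex.natCast_log]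
  set v : ℝ := log n - u with hv
  have h1 : ∀ t : ℝ, (n : ℂ) ^ (-(1 + δ + Complex.I * t)) * mk u (δ + Complex.I * t) =
      (n : ℂ)⁻¹ * Complex.exp ((-(1 / 2) : ℂ) * t ^ 2 + Complex.I * (δ - v) * t +
        (δ ^ 2 / 2 - v * δ)) := by
    intro t
    rw [show -(1 + (δ : ℂ) + Complex.I * t) = -1 + -(δ + Complex.I * t) by ring,
      Complex.cpow_add _ _ hn0, Complex.cpow_neg_one, mul_assoc, Complex.cpow_def_of_ne_zero hn0,
      hlog, mk, ← Complex.exp_add]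
    congr 2
    rw [hv]
    push_cast
    ring_nf
    rw [Complex.I_sq]
    ring
  simp_rw [h1]
  rw [integral_const_mul, integral_cexp_quadratic (by norm_num)]
  have h2 : ((π : ℂ) / -(-(1 / 2))) ^ (1 / 2 : ℂ) = (√(2 * π) : ℝ) := by
    rw [sqrt_eq_rpow, Complex.ofReal_cpow (by positivity)]
    push_cast
    congr 1
    ring
  rw [h2]
  have h3 : (δ : ℂ) ^ 2 / 2 - v * δ - (Complex.I * (δ - v)) ^ 2 / (4 * -(1 / 2)) =
      ((-v ^ 2 / 2 : ℝ) : ℂ) := by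
    rw [mul_pow, Complex.I_sq]
    push_cast
    ring
  rw [h3, ← Complex.ofReal_exp, om, gw, ← hv]
  push_cast
  ring

lemma hasSum_om_eq_integral {a : ℕ → ℂ} {u δ : ℝ}
    (ha : LSeriesSummable a (1 + δ : ℝ)) (h0 : a 0 = 0) :
    HasSum (fun n => a n * om u n) ((((√(2 * π) : ℝ)) : ℂ)⁻¹ *
      ∫ t : ℝ, LSeries a (1 + δ + Complex.I * t) * mk u (δ + Complex.I * t)) := by
  have hre : ∀ t : ℝ, (1 + δ + Complex.I * t : ℂ).re = ((1 + δ : ℝ) : ℂ).re := by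
    intro t; simp
  have hnt : ∀ (n : ℕ) (t : ℝ), ‖LSeries.term a (1 + δ + Complex.I * t) n‖ =
      ‖LSeries.term a (1 + δ : ℝ) n‖ := by
    intro n t
    rw [LSeries.norm_term_eq, LSeries.norm_term_eq, hre]
  have hterm : ∀ (n : ℕ) (t : ℝ), LSeries.term a (1 + δ + Complex.I * t) n *
      mk u (δ + Complex.I * t) =
      a n * ((n : ℂ) ^ (-(1 + δ + Complex.I * t)) * mk u (δ + Complex.I * t)) := by
    intro n t
    rcases Nat.eq_zero_or_pos n with rfl | hn
    · simp [h0]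
    · rw [LSeries.term_of_ne_zero hn.ne', Complex.cpow_neg]
      ring
  have hcont : ∀ n, Continuous fun t : ℝ => LSeries.term a (1 + δ + Complex.I * t) n *
      mk u (δ + Complex.I * t) := by
    intro n
    rcases Nat.eq_zero_or_pos n with rfl | hn
    · simp only [LSeries.term_zero, zero_mul]
      exact continuous_const
    · simp_rw [hterm]
      have hn0 : (n : ℂ) ≠ 0 := by exact_mod_cast hn.ne'
      refine continuous_const.mul (Continuous.mul ?_ (continuous_mk u δ))
      exact Continuous.const_cpow (by fun_prop) (Or.inl hn0)
  have hint : ∀ n, Integrable fun t : ℝ => LSeries.term a (1 + δ + Complex.I * t) n *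
      mk u (δ + Complex.I * t) := by
    intro n
    refine ((integrable_mk u δ).norm.const_mul ‖LSeries.term a (1 + δ : ℝ) n‖).mono'
      (hcont n).aestronglyMeasurable (Eventually.of_forall fun t => ?_)
    rw [norm_mul, hnt]
  have hs : Summable fun n => ∫ t : ℝ, ‖LSeries.term a (1 + δ + Complex.I * t) n *
      mk u (δ + Complex.I * t)‖ := by
    simp_rw [norm_mul, hnt, integral_const_mul]
    exact ha.norm.mul_right _
  have h := hasSum_integral_of_summable_integral_norm hint hs
  simp_rw [tsum_mul_right] at h
  have h2 := h.mul_left (((√(2 * π) : ℝ)) : ℂ)⁻¹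
  have hpos : ((√(2 * π) : ℝ) : ℂ) ≠ 0 := by
    rw [Ne, Complex.ofReal_eq_zero]; positivity
  suffices he : (fun n => a n * (om u n : ℂ)) = fun n => (((√(2 * π) : ℝ)) : ℂ)⁻¹ *
      ∫ t : ℝ, LSeries.term a (1 + δ + Complex.I * t) n * mk u (δ + Complex.I * t) by
    rw [he]; exact h2
  funext n
  rcases Nat.eq_zero_or_pos n with rfl | hn
  · simp [h0]
  · simp_rw [hterm, integral_const_mul, integral_mk_mul_cpow u δ hn]
    field_simp

lemma norm_tsum_om_le {a : ℕ → ℂ} {u : ℝ} (hu : 1 ≤ u)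
    (ha : LSeriesSummable a (1 + 1 / u : ℝ)) (h0 : a 0 = 0) {f : ℝ → ℝ}
    (hf : ∀ t : ℝ, ‖LSeries a (1 + (1 / u : ℝ) + Complex.I * t)‖ ≤ f t)
    (hi : Integrable fun t => f t * exp (-(1 / 2) * t ^ 2)) :
    ‖∑' n, a n * om u n‖ ≤ 2 * ∫ t, f t * exp (-(1 / 2) * t ^ 2) := by
  rw [(hasSum_om_eq_integral (u := u) ha h0).tsum_eq, norm_mul, norm_inv, Complex.norm_real,
    norm_eq_abs, abs_of_nonneg (sqrt_nonneg _)]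
  set δ : ℝ := 1 / u with hδ
  have hδ1 : δ ≤ 1 := by rw [hδ, div_le_one (by linarith)]; exact hu
  have hδ0 : 0 ≤ δ := by positivity
  have hI0 : 0 ≤ ∫ t, f t * exp (-(1 / 2) * t ^ 2) := integral_nonneg fun t =>
    mul_nonneg ((norm_nonneg _).trans (hf t)) (exp_pos _).le
  have hE : exp (δ ^ 2 / 2 + u * δ) ≤ 4.5 := by
    have h1 : δ ^ 2 / 2 + u * δ ≤ 3 / 2 := by
      have : u * δ = 1 := by rw [hδ]; field_simp
      nlinarith
    have h2 : exp (3 / 2) ^ 2 ≤ 4.5 ^ 2 := by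
      rw [← exp_nat_mul]
      have h3 : exp (((2 : ℕ) : ℝ) * (3 / 2)) = exp 1 ^ 3 := by
        rw [← exp_nat_mul]; norm_num
      rw [h3]
      have := exp_one_lt_d9
      have h4 : exp 1 ^ 3 ≤ 2.72 ^ 3 := pow_le_pow_left₀ (exp_pos _).le (by linarith) 3
      norm_num at h4 ⊢
      linarith
    have h3 : exp (3 / 2) ≤ 4.5 := (pow_le_pow_iff_left₀ (exp_pos _).le (by norm_num)
      two_ne_zero).mp h2
    exact (exp_le_exp.mpr h1).trans h3
  have hS : 2.25 ≤ √(2 * π) := by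
    apply le_sqrt_of_sq_le
    have := pi_gt_three
    norm_num
    linarith
  have hb : ‖∫ t : ℝ, LSeries a (1 + δ + Complex.I * t) * mk u (δ + Complex.I * t)‖ ≤
      4.5 * ∫ t, f t * exp (-(1 / 2) * t ^ 2) := by
    rw [← integral_const_mul]
    refine norm_integral_le_of_norm_le (hi.const_mul _) (Eventually.of_forall fun t => ?_)
    rw [norm_mul, norm_mk]
    calc _ ≤ f t * (4.5 * exp (-(1 / 2) * t ^ 2)) := by
          gcongr
          · exact (norm_nonneg _).trans (hf t)
          · exact hf t
      _ = _ := by ring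
  calc _ ≤ (2.25)⁻¹ * (4.5 * ∫ t, f t * exp (-(1 / 2) * t ^ 2)) := by gcongr
    _ = _ := by ring

lemma summable_rpow_one_add {δ : ℝ} (hδ : 0 < δ) : Summable fun n : ℕ => (n : ℝ) ^ (-(1 + δ)) :=
  Real.summable_nat_rpow.mpr (by linarith)

lemma tsum_rpow_one_add_le {δ : ℝ} (hδ : 0 < δ) (hδ1 : δ ≤ 1) :
    ∑' n : ℕ, (n : ℝ) ^ (-(1 + δ)) ≤ 62 / δ := by
  have hre : 1 < ((1 + δ : ℝ) : ℂ).re := by simpa using hδ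
  have h := norm_LSeries_one_le (q := 1) (ℓ := 2) le_rfl (by simp) hre
  have h1 : ‖((1 + δ : ℝ) : ℂ) - 1‖ = δ := by
    push_cast
    rw [add_sub_cancel_left, Complex.norm_real, norm_eq_abs, abs_of_pos hδ]
  rw [h1, Complex.norm_real, norm_eq_abs, abs_of_pos (by linarith)] at h
  have h2 : LSeries (fun n => (1 : DirichletCharacter ℂ 1) n) ((1 + δ : ℝ) : ℂ) =
      ((∑' n : ℕ, (n : ℝ) ^ (-(1 + δ)) : ℝ) : ℂ) := by
    rw [LSeries, Complex.ofReal_tsum]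
    refine tsum_congr fun n => ?_
    rcases Nat.eq_zero_or_pos n with rfl | hn
    · rw [LSeries.term_zero, Nat.cast_zero, zero_rpow (by linarith), Complex.ofReal_zero]
    · rw [LSeries.term_of_ne_zero hn.ne', MulChar.one_apply (isUnit_of_subsingleton _),
        Complex.ofReal_cpow (by positivity), one_div, Complex.ofReal_neg, Complex.cpow_neg]
      simp
  rw [h2, Complex.norm_real, norm_eq_abs] at h
  refine (le_abs_self _).trans (h.trans ?_)
  rw [le_div_iff₀ hδ]
  have : (1 + δ) * (15 * 2 + 1 / δ) * δ = (1 + δ) * (30 * δ + 1) := by field_simp; ring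
  rw [this]
  nlinarith

lemma log_pow_mul_rpow_le {δ : ℝ} (hδ : 0 < δ) (k : ℕ) {n : ℕ} (hn : 0 < n) :
    log n ^ (k + 1) * (n : ℝ) ^ (-(1 + δ)) ≤
      (2 * (k + 1) / δ) ^ (k + 1) * (n : ℝ) ^ (-(1 + δ / 2)) := by
  have hn1 : (1 : ℝ) ≤ n := by exact_mod_cast hn
  have hn0 : (0 : ℝ) < n := by linarith
  have h := log_le_rpow_div hn0.le (ε := δ / (2 * (k + 1))) (by positivity)
  calc _ ≤ ((n : ℝ) ^ (δ / (2 * (k + 1))) / (δ / (2 * (k + 1)))) ^ (k + 1) *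
        (n : ℝ) ^ (-(1 + δ)) := by
        gcongr
    _ = (2 * (k + 1) / δ) ^ (k + 1) * ((n : ℝ) ^ (δ / 2) * (n : ℝ) ^ (-(1 + δ))) := by
        have e : δ / (2 * (k + 1)) * ((k + 1 : ℕ) : ℝ) = δ / 2 := by
          push_cast; field_simp
        rw [div_eq_mul_inv, mul_pow, ← rpow_mul_natCast hn0.le, e, inv_div]
        ring
    _ = _ := by
        rw [← rpow_add hn0]
        congr 2
        ring

end GapRuns

namespace GapRuns

open Real Filter Topology Finset MeasureTheory
open ArithmeticFunction (vonMangoldt)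
open scoped ArithmeticFunction.vonMangoldt

lemma norm_LSeries_le_of_log {a : ℕ → ℂ} (k : ℕ) (ha : ∀ n, ‖a n‖ ≤ log n ^ (k + 1)) {δ : ℝ}
    (hδ : 0 < δ) (hδ1 : δ ≤ 1) {s : ℂ} (hs : s.re = 1 + δ) :
    LSeriesSummable a s ∧ ‖LSeries a s‖ ≤ (2 * (k + 1) / δ) ^ (k + 1) * (124 / δ) := by
  have hsum : Summable fun n : ℕ => (2 * (k + 1) / δ) ^ (k + 1) * (n : ℝ) ^ (-(1 + δ / 2)) :=
    (summable_rpow_one_add (half_pos hδ)).mul_left _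
  have hb : ∀ n, ‖LSeries.term a s n‖ ≤
      (2 * (k + 1) / δ) ^ (k + 1) * (n : ℝ) ^ (-(1 + δ / 2)) := by
    intro n
    rcases Nat.eq_zero_or_pos n with rfl | hn
    · rw [LSeries.term_zero, norm_zero]; positivity
    · rw [LSeries.norm_term_eq, if_neg hn.ne', hs, div_eq_mul_inv, ← rpow_neg (by positivity)]
      refine le_trans ?_ (log_pow_mul_rpow_le hδ k hn)
      gcongr
      exact ha n
  refine ⟨Summable.of_norm_bounded hsum hb, ?_⟩
  refine (tsum_of_norm_bounded hsum.hasSum hb).trans ?_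
  rw [tsum_mul_left]
  have := tsum_rpow_one_add_le (half_pos hδ) (by linarith)
  have h2 : 62 / (δ / 2) = 124 / δ := by field_simp; norm_num
  rw [h2] at this
  gcongr

/-- The twist of the von Mangoldt function by a Dirichlet character. -/
noncomputable def twL {r : ℕ} (χ : DirichletCharacter ℂ r) (n : ℕ) : ℂ := χ n * (Λ n : ℂ)

lemma norm_twL_le {r : ℕ} (χ : DirichletCharacter ℂ r) (n : ℕ) : ‖twL χ n‖ ≤ log n := by
  rw [twL, norm_mul, Complex.norm_real, norm_eq_abs,
    abs_of_nonneg ArithmeticFunction.vonMangoldt_nonneg]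
  exact (mul_le_of_le_one_left ArithmeticFunction.vonMangoldt_nonneg
    (DirichletCharacter.norm_le_one χ _)).trans ArithmeticFunction.vonMangoldt_le_log

lemma twL_zero {r : ℕ} (χ : DirichletCharacter ℂ r) : twL χ 0 = 0 := by simp [twL]

lemma LSeries_twL {r : ℕ} [NeZero r] (χ : DirichletCharacter ℂ r) {s : ℂ} (hs : 1 < s.re) :
    LSeries (twL χ) s = -(deriv χ.LFunction s / χ.LFunction s) := by
  have h := DirichletCharacter.LSeries_twist_vonMangoldt_eq χ hs
  rw [← DirichletCharacter.deriv_LFunction_eq_deriv_LSeries χ hs,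
    ← DirichletCharacter.LFunction_eq_LSeries χ hs, neg_div] at h
  exact h

lemma exp_three_halves_le : exp (3 / 2) ≤ 4.5 := by
  refine (pow_le_pow_iff_left₀ (exp_pos _).le (by norm_num) two_ne_zero).mp ?_
  rw [← exp_nat_mul]
  have h3 : exp (((2 : ℕ) : ℝ) * (3 / 2)) = exp 1 ^ 3 := by
    rw [← exp_nat_mul]; norm_num
  rw [h3]
  have := exp_one_lt_d9
  have h4 : exp 1 ^ 3 ≤ 2.72 ^ 3 := pow_le_pow_left₀ (exp_pos _).le (by linarith) 3
  norm_num at h4 ⊢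
  linarith

lemma integral_exp_quarter_le : ∫ t : ℝ, exp (-(1 / 4) * t ^ 2) ≤ 4 := by
  rw [integral_gaussian, sqrt_le_left (by norm_num)]
  have := pi_lt_d2
  norm_num
  linarith

lemma integral_box_le {f : ℂ → ℂ} {u ℓ η δ K : ℝ} (hℓ : 0 ≤ ℓ) (hδη : -η ≤ δ) (hK : 0 ≤ K)
    (hδη1 : δ + η ≤ 1)
    (hf : DifferentiableOn ℂ f (Set.Icc (-η) δ ×ℂ Set.Icc (-ℓ) ℓ))
    (hb : ∀ a t : ℝ, -η ≤ a → a ≤ δ → |t| = ℓ → ‖f (a + t * Complex.I)‖ ≤ K)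
    (hl : ∀ t : ℝ, |t| ≤ ℓ → ‖f (-η + t * Complex.I)‖ ≤ u) :
    ‖∫ t in (-ℓ)..ℓ, f (δ + t * Complex.I)‖ ≤ 2 * K + 2 * ℓ * u := by
  have h := Complex.integral_boundary_rect_eq_zero_of_differentiableOn f (⟨-η, -ℓ⟩) (⟨δ, ℓ⟩)
    (by simpa only [Set.uIcc_of_le hδη, Set.uIcc_of_le (neg_le_self hℓ)] using hf)
  simp only at h
  have b1 : ‖∫ x : ℝ in (-η)..δ, f (x + (-ℓ : ℝ) * Complex.I)‖ ≤ K := by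
    refine (intervalIntegral.norm_integral_le_of_norm_le_const (C := K) fun x hx => ?_).trans ?_
    · rw [Set.uIoc_of_le hδη] at hx
      exact hb x (-ℓ) hx.1.le hx.2 (by rw [abs_neg, abs_of_nonneg hℓ])
    · rw [abs_of_nonneg (by linarith)]
      nlinarith
  have b2 : ‖∫ x : ℝ in (-η)..δ, f (x + (ℓ : ℝ) * Complex.I)‖ ≤ K := by
    refine (intervalIntegral.norm_integral_le_of_norm_le_const (C := K) fun x hx => ?_).trans ?_
    · rw [Set.uIoc_of_le hδη] at hx
      exact hb x ℓ hx.1.le hx.2 (abs_of_nonneg hℓ)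
    · rw [abs_of_nonneg (by linarith)]
      nlinarith
  have b3 : ‖∫ y : ℝ in (-ℓ)..ℓ, f ((-η : ℝ) + y * Complex.I)‖ ≤ 2 * ℓ * u := by
    refine (intervalIntegral.norm_integral_le_of_norm_le_const (C := u) fun x hx => ?_).trans ?_
    · rw [Set.uIoc_of_le (neg_le_self hℓ)] at hx
      have := hl x (abs_le.mpr ⟨hx.1.le, hx.2⟩)
      push_cast
      exact this
    · rw [abs_of_nonneg (by linarith)]
      linarith
  have e : Complex.I • (∫ y : ℝ in (-ℓ)..ℓ, f (δ + y * Complex.I)) =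
      Complex.I • (∫ y : ℝ in (-ℓ)..ℓ, f ((-η : ℝ) + y * Complex.I)) -
      (∫ x : ℝ in (-η)..δ, f (x + (-ℓ : ℝ) * Complex.I)) +
      (∫ x : ℝ in (-η)..δ, f (x + (ℓ : ℝ) * Complex.I)) := by
    linear_combination h
  have e2 := congrArg norm e
  rw [norm_smul, Complex.norm_I, one_mul] at e2
  rw [e2]
  refine (norm_add_le _ _).trans ?_
  have h4 := norm_sub_le (Complex.I • (∫ y : ℝ in (-ℓ)..ℓ, f ((-η : ℝ) + y * Complex.I)))
    (∫ x : ℝ in (-η)..δ, f (x + (-ℓ : ℝ) * Complex.I))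
  rw [norm_smul, Complex.norm_I, one_mul] at h4
  linarith

theorem norm_psi_le_of_good {r : ℕ} [NeZero r] {χ : DirichletCharacter ℂ r}
    (hp : χ.IsPrimitive) (hne : χ ≠ 1) {ℓ : ℝ} (hℓ : 40 ≤ ℓ) (hG : Good ℓ) (hr : log r ≤ ℓ) :
    ‖∑' n, twL χ n * om (ℓ ^ 100) n‖ ≤ ℓ ^ 210 * exp (-(1 / 4) * ℓ ^ 2) := by
  have hℓ0 : 0 < ℓ := by linarith
  have hℓ1 : 1 ≤ ℓ := by linarith
  set u := ℓ ^ 100 with hu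
  set δ := u⁻¹ with hδ
  set η := (ℓ ^ 80)⁻¹ with hη
  have hu0 : 0 < u := by positivity
  have hη0 : 0 < η := by positivity
  have hδ0 : 0 < δ := by positivity
  have hδη : δ ≤ η := by
    rw [hδ, hη, hu]; gcongr <;> norm_num
  have hη2 : η ≤ 1 / 2 := by
    rw [hη, ← one_div]
    gcongr
    calc (2 : ℝ) ≤ ℓ ^ 1 := by linarith
      _ ≤ ℓ ^ 80 := pow_le_pow_right₀ hℓ1 (by norm_num)
  have huδ : u * δ = 1 := mul_inv_cancel₀ hu0.ne'
  have huη : u * η = ℓ ^ 20 := by rw [hu, hη]; field_simp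
  set f : ℂ → ℂ := fun w => -(deriv χ.LFunction (1 + w) / χ.LFunction (1 + w)) * mk u w with hf
  have hL : ∀ a t : ℝ, -η ≤ a → a ≤ δ → |t| ≤ ℓ →
      1 ≤ ‖χ.LFunction (1 + (a + t * Complex.I))‖ * ℓ ^ 69 := fun a t h1 h2 h3 =>
    one_le_norm_LFunction_mul hne hℓ hr (hG r χ hr hp hne) (by simp; linarith)
      (by simp; linarith) (by simpa using h3)
  have hinv : 1 / (2 * ℓ) ≥ η := by
    rw [hη, ← one_div]
    gcongr
    calc 2 * ℓ ≤ ℓ ^ 2 := by nlinarith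
      _ ≤ ℓ ^ 80 := pow_le_pow_right₀ hℓ1 (by norm_num)
  have hfb : ∀ a t : ℝ, -η ≤ a → a ≤ δ → |t| ≤ ℓ → ‖f (a + t * Complex.I)‖ ≤
      ℓ ^ 73 * (exp (a ^ 2 / 2 + u * a) * exp (-(1 / 2) * t ^ 2)) := by
    intro a t h1 h2 h3
    have hre : (1 + ((a : ℂ) + t * Complex.I)).re = 1 + a := by simp
    have hd := norm_deriv_LFunction_le' hne hℓ hr (s := 1 + (a + t * Complex.I))
      (by rw [hre]; linarith)
      (by simp; linarith) (by simpa using h3)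
    have hl := hL a t h1 h2 h3
    have hl0 : 0 < ‖χ.LFunction (1 + (a + t * Complex.I))‖ := by
      by_contra hc
      have : ‖χ.LFunction (1 + (a + t * Complex.I))‖ = 0 := le_antisymm (not_lt.mp hc) (norm_nonneg _)
      rw [this] at hl
      norm_num at hl
    have hm := norm_mk u a t
    rw [mul_comm Complex.I] at hm
    rw [hf]
    simp only
    rw [norm_mul, norm_neg, norm_div, hm]
    gcongr
    rw [div_le_iff₀ hl0]
    calc _ ≤ ℓ ^ 4 := hd
      _ ≤ ℓ ^ 4 * (‖χ.LFunction (1 + (a + t * Complex.I))‖ * ℓ ^ 69) :=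
          le_mul_of_one_le_right (by positivity) hl
      _ = _ := by ring
  have hdL := DirichletCharacter.differentiable_LFunction hne
  have hmk : Differentiable ℂ (mk u) := by unfold mk; fun_prop
  have hdd : Differentiable ℂ (deriv χ.LFunction) := hdL.deriv
  have hbox : ‖∫ t in (-ℓ)..ℓ, f (δ + t * Complex.I)‖ ≤
      2 * (ℓ ^ 73 * (4.5 * exp (-(1 / 4) * ℓ ^ 2))) +
        2 * ℓ * (ℓ ^ 73 * (4.5 * exp (-(1 / 4) * ℓ ^ 2))) := by
    refine integral_box_le (η := η) hℓ0.le (by linarith) (by positivity) (by linarith) ?_ ?_ ?_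
    · intro w hw
      obtain ⟨h1, h2⟩ := hw
      have hw' : 1 ≤ ‖χ.LFunction (1 + w)‖ * ℓ ^ 69 := by
        have := hL w.re w.im h1.1 h1.2 (abs_le.mpr ⟨h2.1, h2.2⟩)
        rwa [Complex.re_add_im] at this
      have hw0 : χ.LFunction (1 + w) ≠ 0 := by
        intro h0
        rw [h0, norm_zero, zero_mul] at hw'
        norm_num at hw'
      have e1 : DifferentiableAt ℂ (fun w => χ.LFunction (1 + w)) w :=
        (hdL (1 + w)).comp w ((differentiableAt_id).const_add 1)
      have e2 : DifferentiableAt ℂ (fun w => deriv χ.LFunction (1 + w)) w :=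
        (hdd (1 + w)).comp w ((differentiableAt_id).const_add 1)
      exact (((e2.div e1 hw0).neg).mul (hmk w)).differentiableWithinAt
    · intro a t h1 h2 h3
      refine (hfb a t h1 h2 h3.le).trans (mul_le_mul_of_nonneg_left ?_ (by positivity))
      refine mul_le_mul ?_ (exp_le_exp.mpr ?_) (exp_pos _).le (by norm_num)
      · refine le_trans (exp_le_exp.mpr ?_) exp_three_halves_le
        have : u * a ≤ 1 := by nlinarith
        nlinarith
      · rw [← sq_abs t, h3]
        nlinarith
    · intro t h3
      have h4 := hfb (-η) t le_rfl (by linarith) h3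
      push_cast at h4
      refine h4.trans (mul_le_mul_of_nonneg_left ?_ (by positivity))
      rw [← exp_add]
      refine le_trans (b := exp (3 / 2 + (-(1 / 4) * ℓ ^ 2))) (exp_le_exp.mpr ?_) ?_
      · have h5 : ℓ ^ 2 ≤ ℓ ^ 20 := pow_le_pow_right₀ hℓ1 (by norm_num)
        nlinarith [sq_nonneg t]
      · rw [exp_add]
        gcongr
        exact exp_three_halves_le
  have hre : ∀ t : ℝ, ((1 + δ + Complex.I * t : ℂ)).re = 1 + δ := by intro t; simp
  have hδ1 : δ ≤ 1 := by linarith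
  have hlog : ∀ n, ‖twL χ n‖ ≤ log n ^ (0 + 1) := fun n => by simpa using norm_twL_le χ n
  have hsum := (norm_LSeries_le_of_log 0 hlog hδ0 hδ1 (s := (1 + δ : ℝ)) (by simp)).1
  rw [(hasSum_om_eq_integral (u := u) hsum (twL_zero χ)).tsum_eq, norm_mul, norm_inv,
    Complex.norm_real, norm_eq_abs, abs_of_nonneg (sqrt_nonneg _)]
  have hS : (√(2 * π))⁻¹ ≤ 1 := by
    apply inv_le_one_of_one_le₀
    apply le_sqrt_of_sq_le
    linarith [pi_gt_three]
  have hfe : ∀ t : ℝ, LSeries (twL χ) (1 + δ + Complex.I * t) * mk u (δ + Complex.I * t) =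
      f (δ + t * Complex.I) := by
    intro t
    rw [LSeries_twL χ (by rw [hre]; linarith), mul_comm Complex.I, add_assoc]
  have htail : ∀ t : ℝ, ‖f (δ + t * Complex.I)‖ ≤
      1116 * u ^ 2 * exp (-(1 / 2) * t ^ 2) := by
    intro t
    rw [← hfe, norm_mul, norm_mk]
    have h1 := (norm_LSeries_le_of_log 0 hlog hδ0 hδ1 (hre t)).2
    have h2 : exp (δ ^ 2 / 2 + u * δ) ≤ 4.5 :=
      le_trans (exp_le_exp.mpr (by nlinarith)) exp_three_halves_le
    calc _ ≤ ((2 * ((0 : ℕ) + 1) / δ) ^ (0 + 1) * (124 / δ)) *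
          (4.5 * exp (-(1 / 2) * t ^ 2)) := by gcongr
      _ = 1116 * u ^ 2 * exp (-(1 / 2) * t ^ 2) := by
          rw [hδ]; push_cast; field_simp; ring
  have hcont : Continuous fun t : ℝ => f (δ + t * Complex.I) := by
    have e1 : Continuous fun t : ℝ => χ.LFunction (1 + (δ + t * Complex.I)) :=
      hdL.continuous.comp (by fun_prop)
    have e2 : Continuous fun t : ℝ => deriv χ.LFunction (1 + (δ + t * Complex.I)) :=
      hdd.continuous.comp (by fun_prop)
    have e3 : Continuous fun t : ℝ => mk u (δ + t * Complex.I) :=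
      hmk.continuous.comp (by fun_prop)
    refine ((e2.div e1 fun t => ?_).neg).mul e3
    exact DirichletCharacter.LFunction_ne_zero_of_one_le_re χ (Or.inl hne) (by simp; exact hδ0.le)
  have hint : Integrable fun t : ℝ => f (δ + t * Complex.I) :=
    (integrable_gauss.const_mul (1116 * u ^ 2)).mono' hcont.aestronglyMeasurable
      (Eventually.of_forall htail)
  simp_rw [hfe]
  rw [← integral_add_compl (measurableSet_Ioc (a := -ℓ) (b := ℓ)) hint,
    ← intervalIntegral.integral_of_le (neg_le_self hℓ0.le)]
  have hquart : Integrable fun t : ℝ => exp (-(1 / 4) * t ^ 2) :=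
    integrable_exp_neg_mul_sq (by norm_num)
  have htl : ‖∫ t in (Set.Ioc (-ℓ) ℓ)ᶜ, f (δ + t * Complex.I)‖ ≤
      1116 * u ^ 2 * exp (-(1 / 4) * ℓ ^ 2) * 4 := by
    refine (norm_integral_le_of_norm_le
      (g := fun t => 1116 * u ^ 2 * exp (-(1 / 4) * ℓ ^ 2) * exp (-(1 / 4) * t ^ 2))
      (hquart.const_mul _).integrableOn ?_).trans ?_
    · refine (ae_restrict_iff' measurableSet_Ioc.compl).mpr (Eventually.of_forall fun t ht => ?_)
      refine (htail t).trans ?_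
      rw [mul_assoc _ (exp _) (exp _), ← exp_add]
      gcongr
      have h1 : ℓ ^ 2 ≤ t ^ 2 := by
        rw [Set.mem_compl_iff, Set.mem_Ioc, not_and_or, not_lt, not_le] at ht
        rcases ht with ht | ht <;> nlinarith
      linarith
    · calc _ ≤ ∫ t, 1116 * u ^ 2 * exp (-(1 / 4) * ℓ ^ 2) * exp (-(1 / 4) * t ^ 2) :=
            setIntegral_le_integral (hquart.const_mul _)
              (Eventually.of_forall fun t => by positivity)
        _ ≤ _ := by
            rw [integral_const_mul]
            gcongr
            exact integral_exp_quarter_le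
  calc _ ≤ 1 * (2 * (ℓ ^ 73 * (4.5 * exp (-(1 / 4) * ℓ ^ 2))) +
        2 * ℓ * (ℓ ^ 73 * (4.5 * exp (-(1 / 4) * ℓ ^ 2))) +
          1116 * u ^ 2 * exp (-(1 / 4) * ℓ ^ 2) * 4) := by
        gcongr
        exact (norm_add_le _ _).trans (add_le_add hbox htl)
    _ = (9 * ℓ ^ 73 + 9 * ℓ ^ 74 + 4464 * ℓ ^ 200) * exp (-(1 / 4) * ℓ ^ 2) := by
        rw [hu]; ring
    _ ≤ _ := by
        gcongr
        have h1 : ℓ ^ 73 ≤ ℓ ^ 200 := pow_le_pow_right₀ hℓ1 (by norm_num)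
        have h2 : ℓ ^ 74 ≤ ℓ ^ 200 := pow_le_pow_right₀ hℓ1 (by norm_num)
        have h3 : (40 : ℝ) ^ 3 ≤ ℓ ^ 3 := pow_le_pow_left₀ (by norm_num) hℓ 3
        calc _ ≤ ℓ ^ 3 * ℓ ^ 200 := by
              have : 0 ≤ ℓ ^ 200 := by positivity
              nlinarith
          _ = ℓ ^ 203 := by ring
          _ ≤ _ := pow_le_pow_right₀ hℓ1 (by norm_num)

end GapRuns

namespace GapRuns

open Real Filter Topology Finset MeasureTheory
open scoped ComplexConjugate

lemma summable_mul_weight {w : ℕ → ℝ} (hw0 : ∀ n, 0 ≤ w n) {f : ℕ → ℂ} {g : ℕ → ℝ}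
    (hs : Summable fun n => w n * g n) (hf : ∀ n, ‖f n‖ ≤ g n) :
    Summable fun n => f n * (w n : ℂ) := by
  refine Summable.of_norm_bounded hs fun n => ?_
  rw [norm_mul, Complex.norm_real, norm_eq_abs, abs_of_nonneg (hw0 n), mul_comm]
  gcongr
  · exact hw0 n
  · exact hf n

/-- The large sieve inequality, deduced from a bound for the Gram matrix. -/
lemma sum_norm_tsum_sq_le {ι : Type*} (s : Finset ι) (φ : ι → ℕ → ℂ) (hφ : ∀ i n, ‖φ i n‖ ≤ 1)
    {w : ℕ → ℝ} (hw0 : ∀ n, 0 ≤ w n) (hw : Summable w) {D E K : ℝ} (hD : ∑' n, w n ≤ D)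
    (hE0 : 0 ≤ E) (hE : ∀ i ∈ s, ∀ j ∈ s, i ≠ j → ‖∑' n, φ i n * conj (φ j n) * w n‖ ≤ E)
    (hK : D + #s * E ≤ K) (hK0 : 0 < K) (b : ℕ → ℂ) (hb : Summable fun n => w n * ‖b n‖ ^ 2) :
    ∑ i ∈ s, ‖∑' n, b n * φ i n * w n‖ ^ 2 ≤ K * ∑' n, w n * ‖b n‖ ^ 2 := by
  classical
  set A : ι → ℂ := fun i => ∑' n, b n * φ i n * w n with hA
  set S : ℝ := ∑ i ∈ s, ‖A i‖ ^ 2 with hS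
  have hD0 : 0 ≤ D := (tsum_nonneg hw0).trans hD
  have hwb : Summable fun n => w n * (1 + ‖b n‖ ^ 2) := by
    simp_rw [mul_add, mul_one]; exact hw.add hb
  have hb1 : ∀ n, ‖b n‖ ≤ 1 + ‖b n‖ ^ 2 := fun n => by nlinarith [sq_nonneg (‖b n‖ - 1)]
  have hsA : ∀ i, Summable fun n => b n * φ i n * w n := fun i =>
    summable_mul_weight hw0 hwb fun n => by
      rw [norm_mul]
      exact (mul_le_of_le_one_right (norm_nonneg _) (hφ i n)).trans (hb1 n)
  have hw1 : Summable fun n => w n * (1 : ℝ) := by simpa using hw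
  have hsG : ∀ i j, Summable fun n => φ i n * conj (φ j n) * w n := fun i j =>
    summable_mul_weight hw0 hw1 fun n => by
      rw [norm_mul, Complex.norm_conj]
      exact mul_le_one₀ (hφ i n) (norm_nonneg _) (hφ j n)
  set g : ℕ → ℂ := fun n => ∑ i ∈ s, conj (A i) * φ i n with hg
  have h1 : HasSum (fun n => b n * g n * w n) (S : ℂ) := by
    have h := hasSum_sum (f := fun i n => conj (A i) * (b n * φ i n * w n)) (s := s)
      (a := fun i => conj (A i) * A i) fun i _ => (hsA i).hasSum.mul_left _
    have e1 : ∑ i ∈ s, conj (A i) * A i = (S : ℂ) := by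
      rw [hS]; push_cast
      exact Finset.sum_congr rfl fun i _ => by rw [Complex.conj_mul']
    rw [e1] at h
    refine h.congr_fun ?_
    intro n
    rw [hg]
    simp only [Finset.mul_sum, Finset.sum_mul]
    exact Finset.sum_congr rfl fun i _ => by ring
  have h2 : HasSum (fun n => (‖g n‖ ^ 2 * w n : ℂ))
      (∑ i ∈ s, ∑ j ∈ s, conj (A i) * A j * ∑' n, φ i n * conj (φ j n) * w n) := by
    have h := hasSum_sum (s := s)
      (f := fun i n => ∑ j ∈ s, conj (A i) * A j * (φ i n * conj (φ j n) * w n)) fun i _ =>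
      hasSum_sum (s := s) fun j _ => ((hsG i j).hasSum.mul_left (conj (A i) * A j))
    refine h.congr_fun ?_
    intro n
    rw [← Complex.mul_conj', hg]
    simp only [map_sum, map_mul, Complex.conj_conj, Finset.sum_mul]
    refine Finset.sum_congr rfl fun i _ => ?_
    rw [Finset.mul_sum, Finset.sum_mul]
    exact Finset.sum_congr rfl fun j _ => by ring
  have hGb : ∀ i ∈ s, ∀ j ∈ s, ‖∑' n, φ i n * conj (φ j n) * (w n : ℂ)‖ ≤
      (if i = j then D else 0) + E := by
    intro i hi j hj
    by_cases hij : i = j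
    · rw [if_pos hij]
      refine (tsum_of_norm_bounded hw.hasSum fun n => ?_).trans (by linarith)
      rw [norm_mul, norm_mul, Complex.norm_conj, Complex.norm_real, norm_eq_abs,
        abs_of_nonneg (hw0 n)]
      exact mul_le_of_le_one_left (hw0 n) (mul_le_one₀ (hφ i n) (norm_nonneg _) (hφ j n))
    · rw [if_neg hij, zero_add]
      exact hE i hi j hj hij
  have h3 : ‖∑ i ∈ s, ∑ j ∈ s, conj (A i) * A j * ∑' n, φ i n * conj (φ j n) * (w n : ℂ)‖ ≤
      K * S := by
    calc _ ≤ ∑ i ∈ s, ∑ j ∈ s, ‖A i‖ * ‖A j‖ * ((if i = j then D else 0) + E) := by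
          refine (norm_sum_le _ _).trans (Finset.sum_le_sum fun i hi => ?_)
          refine (norm_sum_le _ _).trans (Finset.sum_le_sum fun j hj => ?_)
          rw [norm_mul, norm_mul, Complex.norm_conj]
          gcongr
          exact hGb i hi j hj
      _ = D * S + E * (∑ i ∈ s, ‖A i‖) ^ 2 := by
          simp_rw [mul_add, Finset.sum_add_distrib, mul_ite, mul_zero]
          congr 1
          · rw [hS, Finset.mul_sum]
            refine Finset.sum_congr rfl fun i hi => ?_
            rw [Finset.sum_ite_eq, if_pos hi]; ring
          · rw [sq, Finset.sum_mul_sum, Finset.mul_sum]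
            refine Finset.sum_congr rfl fun i hi => ?_
            rw [Finset.mul_sum]
            exact Finset.sum_congr rfl fun j _ => by ring
      _ ≤ D * S + E * (#s * S) := by
          gcongr
          exact sq_sum_le_card_mul_sum_sq
      _ = (D + #s * E) * S := by ring
      _ ≤ K * S := by gcongr
  have h1' : HasSum (fun n => w n * (b n * g n).re) S := by
    have := Complex.hasSum_re h1
    simpa [mul_comm] using this
  have h2' : HasSum (fun n => w n * ‖g n‖ ^ 2) (∑ i ∈ s, ∑ j ∈ s, conj (A i) * A j *
      ∑' n, φ i n * conj (φ j n) * (w n : ℂ)).re := by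
    refine (Complex.hasSum_re h2).congr_fun ?_
    intro n
    have : (‖g n‖ ^ 2 * w n : ℂ) = ((w n * ‖g n‖ ^ 2 : ℝ) : ℂ) := by push_cast; ring
    rw [this, Complex.ofReal_re]
  have h4 := hasSum_le (fun n => ?_) (h1'.mul_left (2 * K)) ((hb.hasSum.mul_left (K ^ 2)).add h2')
  · have h5 := (Complex.re_le_norm _).trans h3
    have h6 : K * S ≤ K * (K * ∑' n, w n * ‖b n‖ ^ 2) := by nlinarith
    exact le_of_mul_le_mul_left h6 hK0
  · have h7 : (b n * g n).re ≤ ‖b n‖ * ‖g n‖ := by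
      rw [← norm_mul]; exact Complex.re_le_norm _
    have h8 : 2 * K * (b n * g n).re ≤ K ^ 2 * ‖b n‖ ^ 2 + ‖g n‖ ^ 2 := by
      nlinarith [sq_nonneg (K * ‖b n‖ - ‖g n‖)]
    nlinarith [hw0 n, mul_le_mul_of_nonneg_left h8 (hw0 n)]

/-- The weight `n ^ (-σ)` restricted to `n > U`. -/
noncomputable def tailWeight (U : ℕ) (σ : ℝ) (n : ℕ) : ℝ := if n ≤ U then 0 else (n : ℝ) ^ (-σ)

lemma tailWeight_nonneg (U : ℕ) (σ : ℝ) (n : ℕ) : 0 ≤ tailWeight U σ n := by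
  unfold tailWeight; split_ifs <;> positivity

lemma tailWeight_le (U : ℕ) (σ : ℝ) (n : ℕ) : tailWeight U σ n ≤ (n : ℝ) ^ (-σ) := by
  unfold tailWeight; split_ifs
  · positivity
  · rfl

lemma summable_tailWeight {U : ℕ} {δ : ℝ} (hδ : 0 < δ) : Summable (tailWeight U (1 + δ)) :=
  (summable_rpow_one_add hδ).of_nonneg_of_le (tailWeight_nonneg _ _) (tailWeight_le _ _)

lemma sum_abs_tailWeight_sub_le {U : ℕ} {σ : ℝ} (hσ : 1 ≤ σ) (hU : 0 < U) (N : ℕ) :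
    ∑ n ∈ range N, |tailWeight U σ (n + 1) - tailWeight U σ n| ≤ 2 * (U : ℝ)⁻¹ := by
  have hU' : (0 : ℝ) < U := by exact_mod_cast hU
  have hanti : ∀ n, U < n → tailWeight U σ (n + 1) ≤ tailWeight U σ n := by
    intro n hn
    rw [tailWeight, tailWeight, if_neg (by omega), if_neg (by omega)]
    have : (0 : ℝ) < n := by exact_mod_cast hU.trans hn
    exact rpow_le_rpow_of_nonpos this (by push_cast; linarith) (by linarith)
  have key : ∀ N, (N ≤ U → ∑ n ∈ range N, |tailWeight U σ (n + 1) - tailWeight U σ n| = 0) ∧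
      (U < N → ∑ n ∈ range N, |tailWeight U σ (n + 1) - tailWeight U σ n| + tailWeight U σ N ≤
        2 * (U : ℝ)⁻¹) := by
    intro N
    induction N with
    | zero => simp
    | succ N ih =>
      rw [Finset.sum_range_succ]
      refine ⟨fun h => ?_, fun h => ?_⟩
      · rw [ih.1 (by omega), tailWeight, tailWeight, if_pos h, if_pos (by omega)]
        simp
      · rcases Nat.lt_succ_iff_lt_or_eq.mp h with h' | h'
        · have h1 := ih.2 h'
          rw [abs_of_nonpos (sub_nonpos.mpr (hanti N h'))]
          linarith
        · subst h'
          rw [ih.1 le_rfl, zero_add]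
          have h0 : tailWeight U σ U = 0 := if_pos le_rfl
          rw [h0, sub_zero, abs_of_nonneg (tailWeight_nonneg _ _ _)]
          have h1 : tailWeight U σ (U + 1) ≤ (U : ℝ)⁻¹ := by
            rw [tailWeight, if_neg (by omega), ← rpow_neg_one]
            calc _ ≤ (U : ℝ) ^ (-σ) :=
                  rpow_le_rpow_of_nonpos hU' (by push_cast; linarith) (by linarith)
              _ ≤ _ := rpow_le_rpow_of_exponent_le (by exact_mod_cast hU) (by linarith)
          linarith
  rcases le_or_gt N U with h | h
  · rw [(key N).1 h]; positivity
  · have := (key N).2 h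
    linarith [tailWeight_nonneg U σ N]

lemma norm_tsum_char_mul_conj_le {r₁ r₂ : ℕ} [NeZero r₁] [NeZero r₂]
    {χ₁ : DirichletCharacter ℂ r₁} {χ₂ : DirichletCharacter ℂ r₂} (h₁ : χ₁.IsPrimitive)
    (h₂ : χ₂.IsPrimitive) (hne : (⟨r₁, χ₁⟩ : Σ r, DirichletCharacter ℂ r) ≠ ⟨r₂, χ₂⟩) {U : ℕ}
    (hU : 0 < U) {δ : ℝ} (hδ : 0 < δ) :
    ‖∑' n : ℕ, χ₁ n * conj (χ₂ n) * (tailWeight U (1 + δ) n : ℂ)‖ ≤ r₁ * r₂ * (2 * (U : ℝ)⁻¹) := by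
  have hc : ∀ n : ℕ, χ₁ n * conj (χ₂ n) = prodChar χ₁ χ₂⁻¹ n := by
    intro n
    rw [prodChar_apply, ← MulChar.star_apply' χ₂]
    rfl
  have h₂' : (χ₂⁻¹).IsPrimitive := by
    rw [DirichletCharacter.isPrimitive_def, DirichletCharacter.conductor_inv]
    exact h₂
  have hχ : prodChar χ₁ χ₂⁻¹ ≠ 1 := fun h => hne (by
    rw [sigma_eq_inv_of_prodChar_eq_one h₁ h₂' h, inv_inv])
  simp_rw [hc]
  refine norm_tsum_mul_le_of_partial_sums (fun N => ?_)
    (summable_tailWeight hδ).tendsto_atTop_zero ?_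
    (sum_abs_tailWeight_sub_le (by linarith) hU)
  · have := norm_sum_range_zmod_le (f := fun a => prodChar χ₁ χ₂⁻¹ a) (K := 1)
      (MulChar.sum_eq_zero_of_ne_one hχ) (fun a => DirichletCharacter.norm_le_one _ a) N
    simpa using this
  · refine summable_mul_weight (g := fun _ => 1) (tailWeight_nonneg _ _)
      (by simpa using summable_tailWeight hδ) fun n => DirichletCharacter.norm_le_one _ _

/-- The primitive Dirichlet characters of conductor between `2` and `R`. -/
noncomputable def primChars (R : ℕ) : Finset (Σ r, DirichletCharacter ℂ r) := by
  classical exact (Icc 2 R).sigma fun r => univ.filter fun χ => χ.IsPrimitive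

lemma mem_primChars {R : ℕ} {c : Σ r, DirichletCharacter ℂ r} :
    c ∈ primChars R ↔ (2 ≤ c.1 ∧ c.1 ≤ R) ∧ c.2.IsPrimitive := by
  simp [primChars]

lemma ne_one_of_isPrimitive {r : ℕ} (hr : 2 ≤ r) {χ : DirichletCharacter ℂ r}
    (h : χ.IsPrimitive) : χ ≠ 1 := by
  rintro rfl
  have : NeZero r := ⟨by omega⟩
  have : (1 : DirichletCharacter ℂ r).conductor = r := h
  rw [DirichletCharacter.conductor_one] at this
  omega

lemma card_primChars_le (R : ℕ) : #(primChars R) ≤ R ^ 2 := by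
  classical
  rw [primChars, Finset.card_sigma, sq]
  calc _ ≤ ∑ r ∈ Icc 2 R, R := by
        refine Finset.sum_le_sum fun r hr => ?_
        rw [Finset.mem_Icc] at hr
        have : NeZero r := ⟨by omega⟩
        calc _ ≤ Fintype.card (DirichletCharacter ℂ r) := Finset.card_le_univ _
          _ = r.totient := by
            rw [← Nat.card_eq_fintype_card,
              DirichletCharacter.card_eq_totient_of_hasEnoughRootsOfUnity]
          _ ≤ R := (Nat.totient_le r).trans hr.2
    _ ≤ R * R := by
        rw [Finset.sum_const, smul_eq_mul, Nat.card_Icc]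
        gcongr
        omega

/-- The large sieve for primitive characters, with coefficients supported on `n > U`. -/
lemma large_sieve {R U : ℕ} (hU : 0 < U) {δ : ℝ} (hδ : 0 < δ) (hδ1 : δ ≤ 1) (b : ℕ → ℂ)
    (hb : Summable fun n : ℕ => (n : ℝ) ^ (-(1 + δ)) * ‖b n‖ ^ 2) :
    ∑ c ∈ primChars R, ‖∑' n : ℕ, b n * c.2 n * (tailWeight U (1 + δ) n : ℂ)‖ ^ 2 ≤
      (62 / δ + 2 * (R : ℝ) ^ 4 / U) * ∑' n : ℕ, (n : ℝ) ^ (-(1 + δ)) * ‖b n‖ ^ 2 := by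
  have hw0 := tailWeight_nonneg U (1 + δ)
  have hws := summable_tailWeight (U := U) hδ
  have hb' : Summable fun n => tailWeight U (1 + δ) n * ‖b n‖ ^ 2 :=
    hb.of_nonneg_of_le (fun n => mul_nonneg (hw0 n) (by positivity))
      fun n => by gcongr; exact tailWeight_le _ _ _
  have hcard : (#(primChars R) : ℝ) ≤ (R : ℝ) ^ 2 := by exact_mod_cast card_primChars_le R
  refine (sum_norm_tsum_sq_le (primChars R) (fun c n => c.2 n)
    (fun c n => DirichletCharacter.norm_le_one _ _) hw0 hws (D := 62 / δ) (K := 62 / δ + 2 * (R : ℝ) ^ 4 / U)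
    (E := R * R * (2 * (U : ℝ)⁻¹)) ?_ (by positivity) ?_ ?_ (by positivity) b hb').trans ?_
  · exact (hws.tsum_le_tsum (tailWeight_le _ _) (summable_rpow_one_add hδ)).trans
      (tsum_rpow_one_add_le hδ hδ1)
  · rintro ⟨r₁, χ₁⟩ h₁ ⟨r₂, χ₂⟩ h₂ hne
    rw [mem_primChars] at h₁ h₂
    simp only at h₁ h₂
    have : NeZero r₁ := ⟨by omega⟩
    have : NeZero r₂ := ⟨by omega⟩
    refine (norm_tsum_char_mul_conj_le h₁.2 h₂.2 hne hU hδ).trans ?_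
    have e1 : (r₁ : ℝ) ≤ R := by exact_mod_cast h₁.1.2
    have e2 : (r₂ : ℝ) ≤ R := by exact_mod_cast h₂.1.2
    gcongr
  · calc _ ≤ 62 / δ + (R : ℝ) ^ 2 * (R * R * (2 * (U : ℝ)⁻¹)) := by gcongr
      _ = _ := by ring
  · exact mul_le_mul_of_nonneg_left
      (hb'.tsum_le_tsum (fun n => by gcongr; exact tailWeight_le _ _ _) hb) (by positivity)

end GapRuns

namespace GapRuns
open Real Filter Topology Finset MeasureTheory
open ArithmeticFunction (zeta vonMangoldt moebius)
open scoped ArithmeticFunction.vonMangoldt ArithmeticFunction.Moebius ArithmeticFunction.zeta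

/-- The part of an arithmetic function supported on `n ≤ U`. -/
def lowPart (U : ℕ) (f : ArithmeticFunction ℝ) : ArithmeticFunction ℝ :=
  ⟨fun n => if n ≤ U then f n else 0, by simp⟩

lemma lowPart_apply (U : ℕ) (f : ArithmeticFunction ℝ) (n : ℕ) :
    lowPart U f n = if n ≤ U then f n else 0 := rfl

lemma abs_lowPart_le (U : ℕ) (f : ArithmeticFunction ℝ) (n : ℕ) : |lowPart U f n| ≤ |f n| := by
  rw [lowPart_apply]; split_ifs <;> simp

/-- The part of an arithmetic function supported on `n > U`. -/
def highPart (U : ℕ) (f : ArithmeticFunction ℝ) : ArithmeticFunction ℝ :=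
  ⟨fun n => if n ≤ U then 0 else f n, by simp⟩

lemma highPart_apply (U : ℕ) (f : ArithmeticFunction ℝ) (n : ℕ) :
    highPart U f n = if n ≤ U then 0 else f n := rfl

lemma abs_highPart_le (U : ℕ) (f : ArithmeticFunction ℝ) (n : ℕ) : |highPart U f n| ≤ |f n| := by
  rw [highPart_apply]; split_ifs <;> simp

lemma lowPart_add_highPart (U : ℕ) (f : ArithmeticFunction ℝ) :
    lowPart U f + highPart U f = f := by
  ext n
  rw [ArithmeticFunction.add_apply, lowPart_apply, highPart_apply]
  split_ifs <;> simp

/-- Vaughan's identity. -/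
lemma vaughan_identity (U : ℕ) :
    Λ = lowPart U Λ + lowPart U (μ : ArithmeticFunction ℝ) * ArithmeticFunction.log
      - (lowPart U Λ * lowPart U (μ : ArithmeticFunction ℝ)) * (ζ : ArithmeticFunction ℝ)
      + highPart U Λ * highPart U (μ : ArithmeticFunction ℝ) *
        (ζ : ArithmeticFunction ℝ) := by
  have h1 : (Λ : ArithmeticFunction ℝ) * (ζ : ArithmeticFunction ℝ) = ArithmeticFunction.log :=
    ArithmeticFunction.vonMangoldt_mul_zeta
  have h2 : (μ : ArithmeticFunction ℝ) * (ζ : ArithmeticFunction ℝ) = 1 :=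
    ArithmeticFunction.coe_moebius_mul_coe_zeta
  have h3 := lowPart_add_highPart U Λ
  have h4 := lowPart_add_highPart U (μ : ArithmeticFunction ℝ)
  set a := lowPart U Λ
  set b := highPart U Λ
  set c := lowPart U (μ : ArithmeticFunction ℝ)
  set d := highPart U (μ : ArithmeticFunction ℝ)
  rw [← h1]
  linear_combination (-b) * h2 + (c * ζ - 1) * h3 - b * ζ * h4

lemma abs_mul_apply_le {f g : ArithmeticFunction ℝ} {p : ℕ} (hf : ∀ n : ℕ, |f n| ≤ (n : ℝ) ^ p)
    (hg : ∀ n : ℕ, |g n| ≤ (n : ℝ) ^ p) (n : ℕ) : |(f * g) n| ≤ (n : ℝ) ^ (p + 1) := by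
  rw [ArithmeticFunction.mul_apply]
  calc _ ≤ ∑ x ∈ n.divisorsAntidiagonal, |f x.1 * g x.2| := Finset.abs_sum_le_sum_abs _ _
    _ ≤ ∑ x ∈ n.divisorsAntidiagonal, (n : ℝ) ^ p := by
        refine Finset.sum_le_sum fun x hx => ?_
        rw [abs_mul]
        have := (Nat.mem_divisorsAntidiagonal.mp hx).1
        rw [← this, Nat.cast_mul, mul_pow]
        gcongr
        · exact hf _
        · exact hg _
    _ = #n.divisors * (n : ℝ) ^ p := by
        rw [Finset.sum_const, nsmul_eq_mul, ← Nat.map_div_right_divisors, Finset.card_map]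
    _ ≤ _ := by
        rw [pow_succ']
        gcongr
        exact Nat.card_divisors_le_self n

lemma abs_vonMangoldt_le (n : ℕ) : |Λ n| ≤ log n := by
  rw [abs_of_nonneg ArithmeticFunction.vonMangoldt_nonneg]
  exact ArithmeticFunction.vonMangoldt_le_log

lemma log_natCast_le (n : ℕ) : log n ≤ n := (log_le_self (by positivity))

lemma abs_moebius_le (n : ℕ) : |(μ : ArithmeticFunction ℝ) n| ≤ 1 := by
  rw [ArithmeticFunction.intCoe_apply]
  exact_mod_cast ArithmeticFunction.abs_moebius_le_one

lemma abs_le_of_le_one {f : ArithmeticFunction ℝ} (hf : ∀ n, |f n| ≤ 1) (n : ℕ) :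
    |f n| ≤ (n : ℝ) ^ 1 := by
  rcases Nat.eq_zero_or_pos n with rfl | hn
  · simp
  · refine (hf n).trans ?_
    rw [pow_one]; exact_mod_cast hn

lemma abs_zeta_le (n : ℕ) : |(ζ : ArithmeticFunction ℝ) n| ≤ 1 := by
  rw [ArithmeticFunction.natCoe_apply, ArithmeticFunction.zeta_apply]
  split_ifs <;> simp

lemma pow_le_pow_nat {x : ℝ} {n p q : ℕ} (hpq : p ≤ q) (hp : p ≠ 0) (h : x ≤ (n : ℝ) ^ p) :
    x ≤ (n : ℝ) ^ q := by
  rcases Nat.eq_zero_or_pos n with rfl | hn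
  · simpa [hp, show q ≠ 0 by omega] using h
  · exact h.trans (pow_le_pow_right₀ (by exact_mod_cast hn) hpq)

/-- The weighted sum of an arithmetic function twisted by a character. -/
noncomputable def tws (u : ℝ) {r : ℕ} (χ : DirichletCharacter ℂ r) (f : ArithmeticFunction ℝ) : ℂ :=
  ∑' n : ℕ, χ n * (f n : ℂ) * (om u n : ℂ)

lemma summable_tws (u : ℝ) {r : ℕ} (χ : DirichletCharacter ℂ r) {f : ArithmeticFunction ℝ} {p : ℕ}
    (hf : ∀ n : ℕ, |f n| ≤ (n : ℝ) ^ p) :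
    Summable fun n : ℕ => χ n * (f n : ℂ) * (om u n : ℂ) := by
  refine summable_mul_om (A := 1) (p := p) (fun n _ => ?_) u
  rw [norm_mul, Complex.norm_real, norm_eq_abs, one_mul, rpow_natCast]
  exact (mul_le_of_le_one_left (abs_nonneg _) (DirichletCharacter.norm_le_one χ _)).trans (hf n)

lemma norm_tws_low_le {u : ℝ} {r : ℕ} (χ : DirichletCharacter ℂ r) (U : ℕ) :
    ‖tws u χ (lowPart U Λ)‖ ≤ 2 * ((U : ℝ) + 1) ^ 2 * exp (-u) := by
  rw [tws, tsum_eq_sum (s := range (U + 1)) (by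
    intro n hn
    rw [Finset.mem_range, not_lt] at hn
    rw [lowPart_apply, if_neg (by omega)]; simp)]
  calc _ ≤ ∑ n ∈ range (U + 1), ((U : ℝ) + 1) * (2 * exp (-u)) := by
        refine norm_sum_le_of_le _ fun n hn => ?_
        have hn' : (n : ℝ) ≤ U := by exact_mod_cast Nat.lt_succ_iff.mp (Finset.mem_range.mp hn)
        rw [norm_mul, norm_mul, Complex.norm_real, Complex.norm_real, norm_eq_abs, norm_eq_abs,
          abs_of_nonneg (om_nonneg u n)]
        have h1 : |lowPart U Λ n| ≤ (U : ℝ) + 1 :=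
          ((abs_lowPart_le U Λ n).trans (abs_vonMangoldt_le n)).trans
            ((log_natCast_le n).trans (by linarith))
        have h2 := om_le_exp_neg u n
        have h3 := om_nonneg u n
        have h4 := DirichletCharacter.norm_le_one χ n
        have h5 := mul_le_of_le_one_left (abs_nonneg (lowPart U Λ n)) h4
        exact mul_le_mul (h5.trans h1) h2 h3 (by positivity)
    _ = _ := by rw [Finset.sum_const, Finset.card_range, nsmul_eq_mul]; push_cast; ring

lemma norm_sum_char_le {r : ℕ} [NeZero r] {χ : DirichletCharacter ℂ r} (hχ : χ ≠ 1) (N : ℕ) :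
    ‖∑ n ∈ range N, χ n‖ ≤ r := by
  have := norm_sum_range_zmod_le (f := fun a => χ a) (K := 1)
    (MulChar.sum_eq_zero_of_ne_one hχ) (fun a => DirichletCharacter.norm_le_one _ a) N
  simpa using this

lemma tws_mul {u : ℝ} {r : ℕ} (χ : DirichletCharacter ℂ r) {c g : ArithmeticFunction ℝ} {D p : ℕ}
    (hc : ∀ n, D < n → c n = 0) (hg : ∀ n : ℕ, |g n| ≤ (n : ℝ) ^ p) :
    (∀ d, 0 < d → Summable fun l : ℕ => χ l * ((g l * om u (d * l) : ℝ) : ℂ)) ∧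
    tws u χ (c * g) = ∑ d ∈ Icc 1 D, (c d : ℂ) * χ d *
      ∑' l : ℕ, χ l * ((g l * om u (d * l) : ℝ) : ℂ) := by
  have hs : ∀ d, 0 < d → Summable fun l : ℕ => χ l * ((g l * om u (d * l) : ℝ) : ℂ) := by
    intro d hd
    have := summable_mul_om (a := fun n => if d ∣ n then χ (n / d : ℕ) * (g (n / d) : ℂ) else 0)
      (A := 1) (p := p) (fun n hn => ?_) u
    · have h2 := this.comp_injective (i := fun l : ℕ => d * l)
        (fun a b h => Nat.eq_of_mul_eq_mul_left hd h)
      refine h2.congr fun l => ?_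
      simp only [Function.comp_apply, dvd_mul_right, if_true, Nat.mul_div_cancel_left l hd]
      push_cast; ring
    · rw [one_mul, rpow_natCast]
      split_ifs
      · rw [norm_mul, Complex.norm_real, norm_eq_abs]
        refine (mul_le_of_le_one_left (abs_nonneg _) (DirichletCharacter.norm_le_one χ _)).trans
          ((hg _).trans ?_)
        gcongr
        exact Nat.div_le_self n d
      · simp
  refine ⟨hs, ?_⟩
  have hterm : ∀ n : ℕ, χ n * ((c * g) n : ℂ) * (om u n : ℂ) = ∑ d ∈ Icc 1 D,
      if d ∣ n then (c d : ℂ) * χ d * (χ (n / d : ℕ) * ((g (n / d) * om u n : ℝ) : ℂ)) else 0 := by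
    intro n
    rcases Nat.eq_zero_or_pos n with rfl | hn
    · simp [om_zero]
    · rw [ArithmeticFunction.mul_apply,
        Nat.sum_divisorsAntidiagonal (f := fun a b => c a * g b)]
      rw [← Finset.sum_filter, Complex.ofReal_sum, Finset.mul_sum, Finset.sum_mul]
      symm
      refine Finset.sum_subset_zero_on_sdiff (fun d hd => ?_) (fun d hd => ?_) (fun d hd => ?_)
      · exact Nat.mem_divisors.mpr ⟨(Finset.mem_filter.mp hd).2, hn.ne'⟩
      · rw [Finset.mem_sdiff, Finset.mem_filter, Nat.mem_divisors, Finset.mem_Icc] at hd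
        have : 0 < d := Nat.pos_of_dvd_of_pos hd.1.1 hn
        rw [hc d (by by_contra h; exact hd.2 ⟨⟨this, by omega⟩, hd.1.1⟩)]
        simp
      · obtain ⟨l, rfl⟩ := (Finset.mem_filter.mp hd).2
        have : 0 < d := Nat.pos_of_mul_pos_right hn
        rw [Nat.mul_div_cancel_left l this]
        push_cast
        rw [map_mul]
        ring
  rw [tws, tsum_congr hterm]
  have hinj : ∀ d, 0 < d → Function.Injective (fun l : ℕ => d * l) :=
    fun d hd a b h => Nat.eq_of_mul_eq_mul_left hd h
  have hsum : ∀ d ∈ Icc 1 D, HasSum (fun n : ℕ => if d ∣ n then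
      (c d : ℂ) * χ d * (χ (n / d : ℕ) * ((g (n / d) * om u n : ℝ) : ℂ)) else 0)
      ((c d : ℂ) * χ d * ∑' l : ℕ, χ l * ((g l * om u (d * l) : ℝ) : ℂ)) := by
    intro d hd
    have hd0 : 0 < d := (Finset.mem_Icc.mp hd).1
    rw [← (hinj d hd0).hasSum_iff]
    · refine ((hs d hd0).hasSum.mul_left _).congr_fun ?_
      intro l
      simp only [Function.comp_apply, dvd_mul_right, if_true, Nat.mul_div_cancel_left l hd0]
    · intro n hn
      rw [if_neg]
      rintro ⟨l, rfl⟩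
      exact hn ⟨l, rfl⟩
  exact (hasSum_sum hsum).tsum_eq

lemma norm_tws_mul_le {u B : ℝ} {r : ℕ} {χ : DirichletCharacter ℂ r} {c g : ArithmeticFunction ℝ}
    {D p : ℕ} (hc : ∀ n, D < n → c n = 0) (hg : ∀ n : ℕ, |g n| ≤ (n : ℝ) ^ p)
    (hB : ∀ d, 0 < d → (Summable fun l : ℕ => χ l * ((g l * om u (d * l) : ℝ) : ℂ)) →
      ‖∑' l : ℕ, χ l * ((g l * om u (d * l) : ℝ) : ℂ)‖ ≤ B) :
    ‖tws u χ (c * g)‖ ≤ (∑ d ∈ Icc 1 D, |c d|) * B := by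
  obtain ⟨hs, h⟩ := tws_mul (u := u) χ hc hg
  rw [h, Finset.sum_mul]
  refine norm_sum_le_of_le _ fun d hd => ?_
  have hd0 : 0 < d := (Finset.mem_Icc.mp hd).1
  have := hB d hd0 (hs d hd0)
  have h4 := DirichletCharacter.norm_le_one χ d
  rw [norm_mul, norm_mul, Complex.norm_real, norm_eq_abs]
  exact mul_le_mul (mul_le_of_le_one_right (abs_nonneg _) h4) this (norm_nonneg _) (abs_nonneg _)

end GapRuns

namespace GapRuns
open Real Filter Topology Finset MeasureTheory
open ArithmeticFunction (zeta vonMangoldt moebius)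
open scoped ArithmeticFunction.vonMangoldt ArithmeticFunction.Moebius ArithmeticFunction.zeta

/-- An arithmetic function twisted by a character. -/
noncomputable def tw {r : ℕ} (χ : DirichletCharacter ℂ r) (f : ArithmeticFunction ℝ) (n : ℕ) : ℂ :=
  χ n * (f n : ℂ)

lemma norm_tw_le {r : ℕ} (χ : DirichletCharacter ℂ r) (f : ArithmeticFunction ℝ) (n : ℕ) :
    ‖tw χ f n‖ ≤ |f n| := by
  rw [tw, norm_mul, Complex.norm_real, norm_eq_abs]
  exact mul_le_of_le_one_left (abs_nonneg _) (DirichletCharacter.norm_le_one χ _)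

lemma LSeries_tw_mul {r : ℕ} (χ : DirichletCharacter ℂ r) {f g : ArithmeticFunction ℝ} {s : ℂ}
    (hf : LSeriesSummable (tw χ f) s) (hg : LSeriesSummable (tw χ g) s) :
    LSeriesSummable (tw χ (f * g)) s ∧
      LSeries (tw χ (f * g)) s = LSeries (tw χ f) s * LSeries (tw χ g) s := by
  have h : tw χ (f * g) = LSeries.convolution (tw χ f) (tw χ g) := by
    ext n
    rw [LSeries.convolution_def, tw, ArithmeticFunction.mul_apply, Complex.ofReal_sum,
      Finset.mul_sum]
    refine Finset.sum_congr rfl fun x hx => ?_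
    rw [← (Nat.mem_divisorsAntidiagonal.mp hx).1, tw, tw]
    push_cast
    rw [map_mul]; ring
  rw [h]
  exact ⟨hf.convolution hg, LSeries_convolution' hf hg⟩

lemma LSeriesSummable_tw_of_le_one {r : ℕ} (χ : DirichletCharacter ℂ r) {f : ArithmeticFunction ℝ}
    (hf : ∀ n, |f n| ≤ 1) {s : ℂ} (hs : 1 < s.re) : LSeriesSummable (tw χ f) s :=
  LSeriesSummable_of_bounded_of_one_lt_re (m := 1) (fun n _ => (norm_tw_le χ f n).trans (hf n)) hs

lemma sum_norm_LSeries_sq_le {R U : ℕ} (hU : 0 < U) {δ : ℝ} (hδ : 0 < δ) (hδ1 : δ ≤ 1)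
    (f : ArithmeticFunction ℝ) {K : ℝ}
    (hf : Summable fun n : ℕ => (n : ℝ) ^ (-(1 + δ)) * |f n| ^ 2)
    (hK : ∑' n : ℕ, (n : ℝ) ^ (-(1 + δ)) * |f n| ^ 2 ≤ K) (t : ℝ) :
    ∑ c ∈ primChars R, ‖LSeries (tw c.2 (highPart U f)) (1 + δ + Complex.I * t)‖ ^ 2 ≤
      (62 / δ + 2 * (R : ℝ) ^ 4 / U) * K := by
  set b : ℕ → ℂ := fun n => (f n : ℂ) * (n : ℂ) ^ (-(Complex.I * t)) with hb
  have hbn : ∀ n, ‖b n‖ = |f n| := by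
    intro n
    rcases Nat.eq_zero_or_pos n with rfl | hn
    · simp [hb]
    · rw [hb]
      simp only
      rw [norm_mul, Complex.norm_real, norm_eq_abs, Complex.norm_natCast_cpow_of_pos hn]
      simp
  have h := large_sieve (R := R) hU hδ hδ1 b (by simpa only [hbn] using hf)
  simp only [hbn] at h
  refine le_trans (le_of_eq ?_) (h.trans (by gcongr))
  refine Finset.sum_congr rfl fun c _ => ?_
  congr 2
  rw [LSeries]
  refine tsum_congr fun n => ?_
  rcases Nat.eq_zero_or_pos n with rfl | hn
  · simp [hb]
  · have hn0 : (n : ℂ) ≠ 0 := by exact_mod_cast hn.ne'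
    rw [LSeries.term_of_ne_zero hn.ne', tw, highPart_apply, tailWeight]
    split_ifs
    · simp
    · rw [hb, Complex.ofReal_cpow (by positivity), div_eq_mul_inv, ← Complex.cpow_neg, neg_add,
        Complex.cpow_add _ _ hn0]
      push_cast
      rw [neg_add]
      ring

lemma norm_LSeries_zeta_le {r : ℕ} (hr : 2 ≤ r) {χ : DirichletCharacter ℂ r} (hχ : χ.IsPrimitive)
    {u : ℝ} (hu : 30 ≤ u) (hru : log r ≤ u / 15) (t : ℝ) :
    ‖LSeries (tw χ (ζ : ArithmeticFunction ℝ)) (1 + (1 / u : ℝ) + Complex.I * t)‖ ≤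
      u * (2 + |t|) := by
  have : NeZero r := ⟨by omega⟩
  have hu0 : 0 < 1 / u := by positivity
  have hu1 : 1 / u ≤ 1 := by rw [div_le_one₀ (by linarith)]; linarith
  have hre : (1 + (1 / u : ℝ) + Complex.I * t : ℂ).re = 1 + 1 / u := by simp
  have he : LSeries (tw χ (ζ : ArithmeticFunction ℝ)) (1 + (1 / u : ℝ) + Complex.I * t) =
      χ.LFunction (1 + (1 / u : ℝ) + Complex.I * t) := by
    rw [DirichletCharacter.LFunction_eq_LSeries χ (by rw [hre]; linarith)]
    refine LSeries_congr (fun {n} hn => ?_) _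
    rw [tw, ArithmeticFunction.natCoe_apply, ArithmeticFunction.zeta_apply, if_neg hn]
    simp
  rw [he]
  refine (norm_LFunction_le (ne_one_of_isPrimitive hr hχ) (ℓ := u / 15) (by linarith) hru
    (by rw [hre]; have : 0 ≤ 1 / (u / 15) := by positivity
        linarith)).trans ?_
  rw [show 15 * (u / 15) = u by ring]
  gcongr
  calc _ ≤ ‖(1 : ℂ) + (1 / u : ℝ)‖ + ‖Complex.I * (t : ℂ)‖ := norm_add_le _ _
    _ ≤ (‖(1 : ℂ)‖ + ‖((1 / u : ℝ) : ℂ)‖) + ‖Complex.I * (t : ℂ)‖ := by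
        gcongr; exact norm_add_le _ _
    _ ≤ _ := by
        rw [norm_one, Complex.norm_real, norm_mul, Complex.norm_I, one_mul, Complex.norm_real,
          norm_eq_abs, norm_eq_abs, abs_of_pos hu0]
        linarith

/-- A constant coming from the Gaussian integral of `2 + |t|`. -/
noncomputable def gaussConst : ℝ := ∫ t : ℝ, (2 + |t|) * exp (-(1 / 2) * t ^ 2)

lemma integrable_gaussConst : Integrable fun t : ℝ => (2 + |t|) * exp (-(1 / 2) * t ^ 2) := by
  have h1 := integrable_gauss
  have h2 : Integrable fun t : ℝ => t * exp (-(1 / 2) * t ^ 2) :=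
    integrable_mul_exp_neg_mul_sq (by norm_num)
  have h3 := (h1.const_mul 2).add h2.norm
  refine h3.congr (Eventually.of_forall fun t => ?_)
  simp only [Pi.add_apply, norm_mul, norm_eq_abs, abs_exp]
  ring

lemma gaussConst_nonneg : 0 ≤ gaussConst :=
  integral_nonneg fun t => by positivity

lemma exists_phase (z : ℂ) : ∃ ε : ℂ, ‖ε‖ ≤ 1 ∧ ε * z = ‖z‖ := by
  rcases eq_or_ne z 0 with rfl | hz
  · exact ⟨0, by simp⟩
  · have : (‖z‖ : ℂ) ≠ 0 := by exact_mod_cast norm_ne_zero_iff.mpr hz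
    refine ⟨‖z‖ / z, ?_, div_mul_cancel₀ _ hz⟩
    rw [norm_div, Complex.norm_real, norm_norm, div_self (norm_ne_zero_iff.mpr hz)]

lemma summable_vonMangoldt_sq {u : ℝ} (hu : 1 ≤ u) : Summable (fun n : ℕ => (n : ℝ) ^ (-(1 + 1 / u)) * |Λ n| ^ 2) ∧
      ∑' n : ℕ, (n : ℝ) ^ (-(1 + 1 / u)) * |Λ n| ^ 2 ≤ (4 * u) ^ 2 * (124 * u) := by
  set δ : ℝ := 1 / u with hδ
  have hu0 : 0 < u := by linarith
  have hδ0 : 0 < δ := by positivity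
  have hδ1 : δ ≤ 1 := by rw [hδ, div_le_one₀ (by linarith)]; linarith
  have hb : ∀ n : ℕ, (n : ℝ) ^ (-(1 + δ)) * |Λ n| ^ 2 ≤
      (4 * u) ^ 2 * (n : ℝ) ^ (-(1 + δ / 2)) := by
    intro n
    rcases Nat.eq_zero_or_pos n with rfl | hn
    · simp; positivity
    · have h1 := log_pow_mul_rpow_le hδ0 1 hn
      have h2 : (2 * ((1 : ℕ) + 1) / δ : ℝ) = 4 * u := by
        rw [hδ]; push_cast; field_simp; norm_num
      rw [h2] at h1
      refine le_trans ?_ h1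
      rw [mul_comm]
      have := abs_vonMangoldt_le n
      gcongr
  have hs := (summable_rpow_one_add (half_pos hδ0)).mul_left ((4 * u) ^ 2)
  refine ⟨hs.of_nonneg_of_le (fun n => by positivity) hb, ?_⟩
  refine (Summable.tsum_le_tsum hb (hs.of_nonneg_of_le (fun n => by positivity) hb) hs).trans ?_
  rw [tsum_mul_left]
  have h3 := tsum_rpow_one_add_le (half_pos hδ0) (by linarith)
  have h4 : 62 / (δ / 2) = 124 * u := by rw [hδ]; field_simp; norm_num
  rw [h4] at h3
  gcongr

lemma summable_moebius_sq {u : ℝ} (hu : 1 ≤ u) : Summable (fun n : ℕ => (n : ℝ) ^ (-(1 + 1 / u)) * |(μ : ArithmeticFunction ℝ) n| ^ 2) ∧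
      ∑' n : ℕ, (n : ℝ) ^ (-(1 + 1 / u)) * |(μ : ArithmeticFunction ℝ) n| ^ 2 ≤ 62 * u := by
  set δ : ℝ := 1 / u with hδ
  have hu0 : 0 < u := by linarith
  have hδ0 : 0 < δ := by positivity
  have hδ1 : δ ≤ 1 := by rw [hδ, div_le_one₀ (by linarith)]; linarith
  have hb : ∀ n : ℕ, (n : ℝ) ^ (-(1 + δ)) * |(μ : ArithmeticFunction ℝ) n| ^ 2 ≤
      (n : ℝ) ^ (-(1 + δ)) := fun n =>
    mul_le_of_le_one_right (by positivity) (pow_le_one₀ (abs_nonneg _) (abs_moebius_le n))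
  have hs := summable_rpow_one_add hδ0
  refine ⟨hs.of_nonneg_of_le (fun n => by positivity) hb, ?_⟩
  refine (Summable.tsum_le_tsum hb (hs.of_nonneg_of_le (fun n => by positivity) hb) hs).trans ?_
  refine (tsum_rpow_one_add_le hδ0 hδ1).trans (le_of_eq ?_)
  rw [hδ]; field_simp

lemma LSeries_sum_smul {ι : Type*} (S : Finset ι) (ε : ι → ℂ) {f : ι → ℕ → ℂ} {z : ℂ}
    (hf : ∀ i ∈ S, LSeriesSummable (f i) z) :
    LSeriesSummable (∑ i ∈ S, ε i • f i) z ∧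
      LSeries (∑ i ∈ S, ε i • f i) z = ∑ i ∈ S, ε i * LSeries (f i) z := by
  have h : ∀ i ∈ S, LSeriesSummable (ε i • f i) z := fun i hi => (hf i hi).smul (ε i)
  refine ⟨LSeriesSummable.sum h, ?_⟩
  rw [LSeries_sum h]
  refine Finset.sum_congr rfl fun i _ => ?_
  rw [LSeries_smul]

/-- The bilinear part of Vaughan's identity. -/
lemma sum_norm_tws_bilinear_le {R U : ℕ} (hU : 0 < U) {u : ℝ} (hu : 30 ≤ u)
    (hR : log R ≤ u / 15) (hRU : (R : ℝ) ^ 4 ≤ 2 * U) :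
    ∑ c ∈ primChars R, ‖tws u c.2 (highPart U Λ * highPart U (μ : ArithmeticFunction ℝ) *
      (ζ : ArithmeticFunction ℝ))‖ ≤ (10 ^ 6 * gaussConst) * u ^ 5 := by
  set δ : ℝ := 1 / u with hδ
  have hu0 : 0 < u := by linarith
  have hδ0 : 0 < δ := by positivity
  have hδ1 : δ ≤ 1 := by rw [hδ, div_le_one₀ (by linarith)]; linarith
  set F := highPart U Λ * highPart U (μ : ArithmeticFunction ℝ) * (ζ : ArithmeticFunction ℝ) with hF
  have hAμ : ∀ n, |highPart U (μ : ArithmeticFunction ℝ) n| ≤ 1 :=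
    fun n => (abs_highPart_le U _ n).trans (abs_moebius_le n)
  have hAΛ : ∀ n, |highPart U Λ n| ≤ log n :=
    fun n => (abs_highPart_le U _ n).trans (abs_vonMangoldt_le n)
  have hFn : ∀ n : ℕ, |F n| ≤ (n : ℝ) ^ 3 := by
    refine abs_mul_apply_le (abs_mul_apply_le (p := 1) ?_ (abs_le_of_le_one hAμ)) fun n =>
      pow_le_pow_nat (p := 1) (by norm_num) (by norm_num) (abs_le_of_le_one abs_zeta_le n)
    intro n
    rw [pow_one]; exact (hAΛ n).trans (log_natCast_le n)
  have hfac : ∀ (r : ℕ) (χ : DirichletCharacter ℂ r) (s : ℂ), s.re = 1 + δ →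
      LSeriesSummable (tw χ F) s ∧ LSeries (tw χ F) s = LSeries (tw χ (highPart U Λ)) s *
        LSeries (tw χ (highPart U (μ : ArithmeticFunction ℝ))) s *
        LSeries (tw χ (ζ : ArithmeticFunction ℝ)) s := by
    intro r χ s hs
    have hs1 : 1 < s.re := by linarith
    have h1 := (norm_LSeries_le_of_log 0 (a := tw χ (highPart U Λ)) (fun n => by
      simpa using (norm_tw_le χ _ n).trans (hAΛ n)) hδ0 hδ1 hs).1
    have h2 := LSeriesSummable_tw_of_le_one χ hAμ hs1
    have h3 := LSeriesSummable_tw_of_le_one χ abs_zeta_le hs1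
    have h12 := LSeries_tw_mul χ h1 h2
    have h123 := LSeries_tw_mul χ h12.1 h3
    exact ⟨h123.1, by rw [h123.2, h12.2]⟩
  choose ε hε1 hε using fun c : Σ r, DirichletCharacter ℂ r => exists_phase (tws u c.2 F)
  set a : ℕ → ℂ := ∑ c ∈ primChars R, ε c • tw c.2 F with ha
  have hsm : ∀ s : ℂ, s.re = 1 + δ → LSeriesSummable a s ∧ LSeries a s =
      ∑ c ∈ primChars R, ε c * LSeries (tw c.2 F) s := fun s hs =>
    LSeries_sum_smul (primChars R) ε fun c _ => (hfac c.1 c.2 s hs).1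
  have ha0 : a 0 = 0 := by
    simp [ha, tw, Finset.sum_apply]
  have hsum : ∑' n, a n * (om u n : ℂ) = ∑ c ∈ primChars R, ((‖tws u c.2 F‖ : ℝ) : ℂ) := by
    have : ∀ n, a n * (om u n : ℂ) =
        ∑ c ∈ primChars R, ε c * (c.2 n * (F n : ℂ) * (om u n : ℂ)) := by
      intro n
      rw [ha, Finset.sum_apply, Finset.sum_mul]
      refine Finset.sum_congr rfl fun c _ => ?_
      rw [Pi.smul_apply, smul_eq_mul, tw]; ring
    rw [tsum_congr this]
    rw [(hasSum_sum fun c _ => ((summable_tws u c.2 hFn).hasSum.mul_left (ε c))).tsum_eq]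
    exact Finset.sum_congr rfl fun c _ => hε c
  set G : ℝ := 10 ^ 6 / 2 * u ^ 5 with hG
  have hre : ∀ t : ℝ, (1 + δ + Complex.I * t : ℂ).re = 1 + δ := by intro t; simp
  have hKc : 62 / δ + 2 * (R : ℝ) ^ 4 / U ≤ 66 * u := by
    have h1 : 2 * (R : ℝ) ^ 4 / U ≤ 4 := by
      rw [div_le_iff₀ (by exact_mod_cast hU)]; linarith
    have h2 : 62 / δ = 62 * u := by rw [hδ]; field_simp
    rw [h2]; linarith
  have hsΛ := summable_vonMangoldt_sq (u := u) (by linarith)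
  have hsμ := summable_moebius_sq (u := u) (by linarith)
  rw [← hδ] at hsΛ hsμ
  have hbound : ∀ t : ℝ, ‖LSeries a (1 + (1 / u : ℝ) + Complex.I * t)‖ ≤ G * (2 + |t|) := by
    intro t
    set s : ℂ := 1 + (1 / u : ℝ) + Complex.I * t with hs
    have hsre : s.re = 1 + δ := hre t
    rw [(hsm s hsre).2]
    have hA := sum_norm_LSeries_sq_le (R := R) hU hδ0 hδ1 Λ hsΛ.1 hsΛ.2 t
    have hM := sum_norm_LSeries_sq_le (R := R) hU hδ0 hδ1 (μ : ArithmeticFunction ℝ) hsμ.1 hsμ.2 t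
    calc _ ≤ ∑ c ∈ primChars R, (u * (2 + |t|)) / 2 *
          (‖LSeries (tw c.2 (highPart U Λ)) s‖ ^ 2 +
            ‖LSeries (tw c.2 (highPart U (μ : ArithmeticFunction ℝ))) s‖ ^ 2) := by
          refine norm_sum_le_of_le _ fun c hc => ?_
          rw [mem_primChars] at hc
          have hlr : log c.1 ≤ u / 15 := by
            refine le_trans (log_le_log (by exact_mod_cast (by omega : 0 < c.1)) ?_) hR
            exact_mod_cast hc.1.2
          have h3 := norm_LSeries_zeta_le hc.1.1 hc.2 hu hlr t
          rw [norm_mul, (hfac c.1 c.2 s hsre).2, norm_mul, norm_mul]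
          refine (mul_le_of_le_one_left (by positivity) (hε1 c)).trans ?_
          calc _ ≤ ‖LSeries (tw c.2 (highPart U Λ)) s‖ *
                ‖LSeries (tw c.2 (highPart U (μ : ArithmeticFunction ℝ))) s‖ * (u * (2 + |t|)) :=
                mul_le_mul_of_nonneg_left h3 (by positivity)
            _ ≤ _ := by
                have := two_mul_le_add_sq (‖LSeries (tw c.2 (highPart U Λ)) s‖)
                  (‖LSeries (tw c.2 (highPart U (μ : ArithmeticFunction ℝ))) s‖)
                have h5 : 0 ≤ u * (2 + |t|) := by positivity
                nlinarith [mul_le_mul_of_nonneg_right this h5]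
      _ ≤ (u * (2 + |t|)) / 2 * (66 * u * ((4 * u) ^ 2 * (124 * u)) + 66 * u * (62 * u)) := by
          rw [← Finset.mul_sum, Finset.sum_add_distrib]
          refine mul_le_mul_of_nonneg_left (add_le_add (hA.trans ?_) (hM.trans ?_)) (by positivity)
          · exact mul_le_mul_of_nonneg_right hKc (by positivity)
          · exact mul_le_mul_of_nonneg_right hKc (by positivity)
      _ = (u * (2 + |t|)) / 2 * (130944 * u ^ 4 + 4092 * u ^ 2) := by ring
      _ ≤ (u * (2 + |t|)) / 2 * (10 ^ 6 * u ^ 4) := by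
          refine mul_le_mul_of_nonneg_left ?_ (by positivity)
          have : u ^ 2 ≤ u ^ 4 := pow_le_pow_right₀ (by linarith) (by norm_num)
          have h0 : 0 ≤ u ^ 4 := by positivity
          linarith
      _ = _ := by rw [hG]; ring
  have hfin := norm_tsum_om_le (u := u) (by linarith) (hsm _ (by simp [hδ])).1 ha0 hbound (by
    simpa only [mul_assoc] using integrable_gaussConst.const_mul G)
  rw [hsum, ← Complex.ofReal_sum, Complex.norm_real, norm_eq_abs,
    abs_of_nonneg (Finset.sum_nonneg fun c _ => norm_nonneg _)] at hfin
  refine hfin.trans (le_of_eq ?_)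
  simp_rw [mul_assoc]
  rw [integral_const_mul, ← gaussConst, hG]
  ring

end GapRuns

namespace GapRuns
open Real Filter Topology Finset MeasureTheory
open ArithmeticFunction (zeta vonMangoldt moebius)
open scoped ArithmeticFunction.vonMangoldt ArithmeticFunction.Moebius ArithmeticFunction.zeta

lemma tws_vonMangoldt_decomp (u : ℝ) {r : ℕ} (χ : DirichletCharacter ℂ r) (U : ℕ) :
    tws u χ Λ = tws u χ (lowPart U Λ) +
      tws u χ (lowPart U (μ : ArithmeticFunction ℝ) * ArithmeticFunction.log) -
      tws u χ (lowPart U Λ * lowPart U (μ : ArithmeticFunction ℝ) * (ζ : ArithmeticFunction ℝ)) +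
      tws u χ (highPart U Λ * highPart U (μ : ArithmeticFunction ℝ) *
        (ζ : ArithmeticFunction ℝ)) := by
  have hΛ : ∀ n : ℕ, |lowPart U Λ n| ≤ (n : ℝ) ^ 1 := fun n => by
    rw [pow_one]
    exact ((abs_lowPart_le U _ n).trans (abs_vonMangoldt_le n)).trans (log_natCast_le n)
  have hΛ' : ∀ n : ℕ, |highPart U Λ n| ≤ (n : ℝ) ^ 1 := fun n => by
    rw [pow_one]
    exact ((abs_highPart_le U _ n).trans (abs_vonMangoldt_le n)).trans (log_natCast_le n)
  have hμ : ∀ n : ℕ, |lowPart U (μ : ArithmeticFunction ℝ) n| ≤ (n : ℝ) ^ 1 :=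
    abs_le_of_le_one fun n => (abs_lowPart_le U _ n).trans (abs_moebius_le n)
  have hμ' : ∀ n : ℕ, |highPart U (μ : ArithmeticFunction ℝ) n| ≤ (n : ℝ) ^ 1 :=
    abs_le_of_le_one fun n => (abs_highPart_le U _ n).trans (abs_moebius_le n)
  have hlog : ∀ n : ℕ, |ArithmeticFunction.log n| ≤ (n : ℝ) ^ 1 := fun n => by
    rw [pow_one, ArithmeticFunction.log_apply, abs_of_nonneg (log_natCast_nonneg n)]
    exact log_natCast_le n
  have hζ : ∀ n : ℕ, |(ζ : ArithmeticFunction ℝ) n| ≤ (n : ℝ) ^ 2 := fun n =>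
    pow_le_pow_nat (p := 1) (by norm_num) (by norm_num) (abs_le_of_le_one abs_zeta_le n)
  have s1 := (summable_tws u χ hΛ).hasSum
  have s2 := (summable_tws u χ (abs_mul_apply_le hμ hlog)).hasSum
  have s3 := (summable_tws u χ (abs_mul_apply_le (abs_mul_apply_le hΛ hμ) hζ)).hasSum
  have s4 := (summable_tws u χ (abs_mul_apply_le (abs_mul_apply_le hΛ' hμ') hζ)).hasSum
  refine HasSum.tsum_eq (HasSum.congr_fun (((s1.add s2).sub s3).add s4) ?_)
  intro n
  have h := congrArg (fun f : ArithmeticFunction ℝ => (f n : ℂ)) (vaughan_identity U)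
  rw [h, sub_eq_add_neg, ArithmeticFunction.add_apply, ArithmeticFunction.add_apply,
    ArithmeticFunction.add_apply, ArithmeticFunction.neg_apply]
  push_cast
  ring

lemma norm_tws_log_le {u : ℝ} (hu : 0 ≤ u) {r : ℕ} [NeZero r] {χ : DirichletCharacter ℂ r}
    (hχ : χ ≠ 1) (U : ℕ) :
    ‖tws u χ (lowPart U (μ : ArithmeticFunction ℝ) * ArithmeticFunction.log)‖ ≤
      U * (r * (48 * (1 + u) * exp (-u / 2) * zetaThreeHalves)) := by
  refine (norm_tws_mul_le (D := U) (p := 1) (B := r * (48 * (1 + u) * exp (-u / 2) *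
    zetaThreeHalves)) (fun n hn => by rw [lowPart_apply, if_neg (by omega)]) (fun n => ?_)
    (fun d hd hs => ?_)).trans ?_
  · rw [pow_one, ArithmeticFunction.log_apply, abs_of_nonneg (log_natCast_nonneg n)]
    exact log_natCast_le n
  · exact norm_tsum_mul_log_om_le (c := fun l => χ l) (norm_sum_char_le hχ) hu hd hs
  · have hz := zetaThreeHalves_nonneg
    refine mul_le_mul_of_nonneg_right ?_ (by positivity)
    calc _ ≤ ∑ d ∈ Icc 1 U, (1 : ℝ) := Finset.sum_le_sum fun d _ =>
          (abs_lowPart_le U _ d).trans (abs_moebius_le d)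
      _ = U := by simp

lemma norm_tws_zeta_le {u : ℝ} {r : ℕ} [NeZero r] {χ : DirichletCharacter ℂ r}
    (hχ : χ ≠ 1) (U : ℕ) :
    ‖tws u χ (lowPart U Λ * lowPart U (μ : ArithmeticFunction ℝ) * (ζ : ArithmeticFunction ℝ))‖ ≤
      (U : ℝ) ^ 6 * (r * (48 * exp (-u / 2) * zetaThreeHalves)) := by
  have hΛ : ∀ n : ℕ, |lowPart U Λ n| ≤ (n : ℝ) ^ 1 := fun n => by
    rw [pow_one]
    exact ((abs_lowPart_le U _ n).trans (abs_vonMangoldt_le n)).trans (log_natCast_le n)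
  have hμ : ∀ n : ℕ, |lowPart U (μ : ArithmeticFunction ℝ) n| ≤ (n : ℝ) ^ 1 :=
    abs_le_of_le_one fun n => (abs_lowPart_le U _ n).trans (abs_moebius_le n)
  refine (norm_tws_mul_le (D := U * U) (p := 1) (B := r * (48 * exp (-u / 2) *
    zetaThreeHalves)) (fun n hn => ?_) (abs_le_of_le_one abs_zeta_le)
    (fun d hd hs => ?_)).trans ?_
  · rw [ArithmeticFunction.mul_apply]
    refine Finset.sum_eq_zero fun x hx => ?_
    have hx' := (Nat.mem_divisorsAntidiagonal.mp hx).1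
    rw [lowPart_apply, lowPart_apply]
    by_cases h1 : x.1 ≤ U
    · by_cases h2 : x.2 ≤ U
      · have := Nat.mul_le_mul h1 h2
        omega
      · rw [if_neg h2, mul_zero]
    · rw [if_neg h1, zero_mul]
  · have hone : ∀ l : ℕ, χ l * (((ζ : ArithmeticFunction ℝ) l * om u (d * l) : ℝ) : ℂ) =
        χ l * (om u (d * l) : ℂ) := by
      intro l
      rcases Nat.eq_zero_or_pos l with rfl | hl
      · simp [om_zero]
      · rw [ArithmeticFunction.natCoe_apply, ArithmeticFunction.zeta_apply, if_neg hl.ne']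
        simp
    simp_rw [hone] at hs ⊢
    exact norm_tsum_mul_om_le (c := fun l => χ l) (norm_sum_char_le hχ) hd hs
  · have hz := zetaThreeHalves_nonneg
    refine mul_le_mul_of_nonneg_right ?_ (by positivity)
    calc _ ≤ ∑ d ∈ Icc 1 (U * U), ((U * U : ℕ) : ℝ) ^ 2 := by
          refine Finset.sum_le_sum fun d hd => (abs_mul_apply_le hΛ hμ d).trans ?_
          have : (d : ℝ) ≤ (U * U : ℕ) := by exact_mod_cast (Finset.mem_Icc.mp hd).2
          gcongr
      _ = (U : ℝ) ^ 6 := by simp; ring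

/-- Mean value of twisted prime sums over primitive characters of moderate conductor. -/
lemma exists_sum_norm_psi_le : ∃ C : ℝ, 0 < C ∧ ∀ u : ℝ, 100 ≤ u →
    ∑ c ∈ primChars ⌊exp (u / 100)⌋₊, ‖∑' n, twL c.2 n * om u n‖ ≤ C * u ^ 5 := by
  have hz := zetaThreeHalves_nonneg
  have hg := gaussConst_nonneg
  refine ⟨10 ^ 6 * gaussConst + (80 + 960 * zetaThreeHalves), by positivity, fun u hu => ?_⟩
  set R := ⌊exp (u / 100)⌋₊ with hR
  set U := ⌊exp (u / 20)⌋₊ with hU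
  have hu0 : 0 ≤ u := by linarith
  have hR1 : 1 ≤ R := Nat.le_floor (by simpa using one_le_exp (by positivity))
  have hU1 : 1 ≤ U := Nat.le_floor (by simpa using one_le_exp (by positivity))
  have hRle : (R : ℝ) ≤ exp (u / 100) := Nat.floor_le (exp_pos _).le
  have hUle : (U : ℝ) ≤ exp (u / 20) := Nat.floor_le (exp_pos _).le
  have hUge : exp (u / 20) ≤ 2 * U := by
    have h1 := Nat.lt_floor_add_one (exp (u / 20))
    have h2 : (1 : ℝ) ≤ U := by exact_mod_cast hU1
    rw [← hU] at h1
    linarith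
  have hlogR : log R ≤ u / 15 := by
    have h : log R ≤ u / 100 := by
      rw [log_le_iff_le_exp (by exact_mod_cast hR1)]; exact hRle
    linarith
  have hRU : (R : ℝ) ^ 4 ≤ 2 * U := by
    refine le_trans ?_ hUge
    calc (R : ℝ) ^ 4 ≤ exp (u / 100) ^ 4 := by gcongr
      _ = exp (u / 25) := by rw [← exp_nat_mul]; congr 1; push_cast; ring
      _ ≤ _ := exp_le_exp.mpr (by linarith)
  have hbil := sum_norm_tws_bilinear_le (R := R) (U := U) hU1 (by linarith) hlogR hRU
  have hE : ∀ x : ℝ, exp (x * u) * exp (-u / 2) = exp ((x - 1 / 2) * u) := fun x => by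
    rw [← exp_add]; congr 1; ring
  set E := exp (-(12 / 100) * u) with hEdef
  have hexpl : ∀ x : ℝ, x ≤ -(12 / 100) → exp (x * u) ≤ E := fun x hx =>
    exp_le_exp.mpr (by nlinarith)
  have hper : ∀ c ∈ primChars R, ‖∑' n, twL c.2 n * om u n‖ ≤ (8 + 96 * zetaThreeHalves) *
      ((1 + u) * E) + ‖tws u c.2 (highPart U Λ *
        highPart U (μ : ArithmeticFunction ℝ) * (ζ : ArithmeticFunction ℝ))‖ := by
    intro c hc
    rw [mem_primChars] at hc
    have : NeZero c.1 := ⟨by omega⟩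
    have hχ := ne_one_of_isPrimitive hc.1.1 hc.2
    have hcR : (c.1 : ℝ) ≤ exp (u / 100) := le_trans (by exact_mod_cast hc.1.2) hRle
    have h1 : ‖tws u c.2 (lowPart U Λ)‖ ≤ 8 * ((1 + u) * E) := by
      refine (norm_tws_low_le c.2 U).trans ?_
      calc _ ≤ 2 * (2 * exp (u / 20)) ^ 2 * exp (-u) := by
            have : (1 : ℝ) ≤ exp (u / 20) := one_le_exp (by positivity)
            gcongr; linarith
        _ = 8 * exp ((-9 / 10) * u) := by
            rw [mul_pow, ← exp_nat_mul, ← mul_assoc, mul_assoc, ← exp_add]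
            norm_num
            ring
        _ ≤ 8 * (1 * E) := by
            rw [one_mul]; exact mul_le_mul_of_nonneg_left (hexpl _ (by norm_num)) (by norm_num)
        _ ≤ _ := by gcongr; linarith
    have h2 : ‖tws u c.2 (lowPart U (μ : ArithmeticFunction ℝ) * ArithmeticFunction.log)‖ ≤
        48 * zetaThreeHalves * ((1 + u) * E) := by
      refine (norm_tws_log_le hu0 hχ U).trans ?_
      calc _ ≤ exp (u / 20) * (exp (u / 100) * (48 * (1 + u) * exp (-u / 2) *
            zetaThreeHalves)) := by gcongr
        _ = 48 * zetaThreeHalves * ((1 + u) * exp ((-44 / 100) * u)) := by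
            rw [show exp ((-44 / 100) * u) = exp (u / 20) * exp (u / 100) * exp (-u / 2) by
              rw [← exp_add, ← exp_add]; congr 1; ring]
            ring
        _ ≤ _ := by
            have := hexpl (-44 / 100) (by norm_num)
            gcongr
    have h3 : ‖tws u c.2 (lowPart U Λ * lowPart U (μ : ArithmeticFunction ℝ) *
        (ζ : ArithmeticFunction ℝ))‖ ≤ 48 * zetaThreeHalves * ((1 + u) * E) := by
      refine (norm_tws_zeta_le hχ U).trans ?_
      calc _ ≤ exp (u / 20) ^ 6 * (exp (u / 100) * (48 * exp (-u / 2) *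
            zetaThreeHalves)) := by gcongr
        _ = 48 * zetaThreeHalves * (1 * exp ((-19 / 100) * u)) := by
            rw [show exp ((-19 / 100) * u) = exp (u / 20) ^ 6 * exp (u / 100) * exp (-u / 2) by
              rw [← exp_nat_mul, ← exp_add, ← exp_add]; congr 1; push_cast; ring]
            ring
        _ ≤ _ := by
            have := hexpl (-19 / 100) (by norm_num)
            gcongr
            linarith
    have heq : ∑' n, twL c.2 n * om u n = tws u c.2 Λ := rfl
    rw [heq, tws_vonMangoldt_decomp u c.2 U]
    refine (norm_add_le _ _).trans (add_le_add ?_ le_rfl)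
    refine (norm_sub_le _ _).trans ?_
    refine (add_le_add (norm_add_le _ _) le_rfl).trans ?_
    linarith
  refine (Finset.sum_le_sum hper).trans ?_
  rw [Finset.sum_add_distrib, Finset.sum_const, nsmul_eq_mul]
  have hcard : (#(primChars R) : ℝ) ≤ exp (2 / 100 * u) := by
    calc _ ≤ (R : ℝ) ^ 2 := by exact_mod_cast card_primChars_le R
      _ ≤ exp (u / 100) ^ 2 := by gcongr
      _ = _ := by rw [← exp_nat_mul]; congr 1; push_cast; ring
  have hsmall : (#(primChars R) : ℝ) * ((8 + 96 * zetaThreeHalves) * ((1 + u) * E)) ≤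
      80 + 960 * zetaThreeHalves := by
    have hE10 : exp (2 / 100 * u) * E * (1 + u) ≤ 10 := by
      rw [hEdef, ← exp_add, show 2 / 100 * u + -(12 / 100) * u = -(u / 10) by ring, exp_neg,
        inv_mul_le_iff₀ (exp_pos _)]
      linarith [add_one_le_exp (u / 10)]
    calc _ ≤ exp (2 / 100 * u) * ((8 + 96 * zetaThreeHalves) * ((1 + u) * E)) := by gcongr
      _ = (8 + 96 * zetaThreeHalves) * (exp (2 / 100 * u) * E * (1 + u)) := by ring
      _ ≤ (8 + 96 * zetaThreeHalves) * 10 := by gcongr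
      _ = _ := by ring
  have hu5 : 1 ≤ u ^ 5 := one_le_pow₀ (by linarith)
  have h8 : (80 + 960 * zetaThreeHalves) * 1 ≤ (80 + 960 * zetaThreeHalves) * u ^ 5 := by gcongr
  linarith

end GapRuns

namespace GapRuns
open Real Filter Topology Finset MeasureTheory

/-- The mean value over primitive characters that controls primes in progressions. -/
noncomputable def charMean (u : ℝ) (R : ℕ) : ℝ :=
  ∑ c ∈ primChars R, ‖∑' n, twL c.2 n * om u n‖ / √c.1

lemma charMean_nonneg (u : ℝ) (R : ℕ) : 0 ≤ charMean u R :=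
  Finset.sum_nonneg fun c _ => by positivity

/-- Primes are equidistributed on average, along arbitrarily large scales. -/
lemma exists_charMean_le (A : ℕ) (u₀ : ℝ) :
    ∃ u, u₀ ≤ u ∧ charMean u ⌊exp (u / 100)⌋₊ * u ^ A ≤ 1 := by
  obtain ⟨C, hC0, hC⟩ := exists_sum_norm_psi_le
  have t1 : ∀ᶠ ℓ : ℝ in atTop, ℓ ^ (210 + 100 * A) * exp (-ℓ) ≤ 1 / 2 :=
    (tendsto_pow_mul_exp_neg_atTop_nhds_zero _).eventually_le_const (by norm_num)
  have t2 : ∀ᶠ ℓ : ℝ in atTop, (ℓ / 2) ^ (500 + 100 * A) * exp (-(ℓ / 2)) ≤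
      1 / (2 * C * 2 ^ (500 + 100 * A)) :=
    ((tendsto_pow_mul_exp_neg_atTop_nhds_zero _).comp
      (tendsto_id.atTop_div_const (by norm_num : (0 : ℝ) < 2))).eventually_le_const (by positivity)
  obtain ⟨ℓ₁, hℓ₁⟩ := eventually_atTop.mp (t1.and t2)
  obtain ⟨ℓ, hℓ, hgood⟩ := exists_good (max ℓ₁ (max 40 u₀))
  have hℓ40 : 40 ≤ ℓ := (le_max_left _ _).trans ((le_max_right _ _).trans hℓ)
  have hℓu : u₀ ≤ ℓ := (le_max_right _ _).trans ((le_max_right _ _).trans hℓ)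
  obtain ⟨b1, b2⟩ := hℓ₁ ℓ ((le_max_left _ _).trans hℓ)
  have hℓ0 : 0 < ℓ := by linarith
  have hself : ℓ ≤ ℓ ^ 100 := le_self_pow₀ (by linarith) (by norm_num)
  set u := ℓ ^ 100 with hu
  have hu100 : 100 ≤ u := by
    have : ℓ ^ 2 ≤ u := pow_le_pow_right₀ (by linarith) (by norm_num)
    nlinarith
  refine ⟨u, hℓu.trans hself, ?_⟩
  set R := ⌊exp (u / 100)⌋₊ with hR
  have hper : ∀ c ∈ primChars R, ‖∑' n, twL c.2 n * om u n‖ / √c.1 ≤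
      (if (c.1 : ℝ) ≤ exp ℓ then ℓ ^ 210 * exp (-(1 / 4) * ℓ ^ 2) else 0) +
        exp (-(ℓ / 2)) * ‖∑' n, twL c.2 n * om u n‖ := by
    intro c hc
    rw [mem_primChars] at hc
    have : NeZero c.1 := ⟨by omega⟩
    have hc0 : (1 : ℝ) ≤ c.1 := by exact_mod_cast (by omega : 1 ≤ c.1)
    split_ifs with h
    · have h1 := norm_psi_le_of_good hc.2 (ne_one_of_isPrimitive hc.1.1 hc.2) hℓ40 hgood
        (by rw [log_le_iff_le_exp (by linarith)]; exact h)
      have h2 : ‖∑' n, twL c.2 n * om u n‖ / √c.1 ≤ ‖∑' n, twL c.2 n * om u n‖ :=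
        div_le_self (norm_nonneg _) (by rw [one_le_sqrt]; exact hc0)
      have h3 : 0 ≤ exp (-(ℓ / 2)) * ‖∑' n, twL c.2 n * om u n‖ := by positivity
      linarith
    · rw [zero_add, div_eq_mul_inv, mul_comm, exp_neg]
      refine mul_le_mul_of_nonneg_right ?_ (norm_nonneg _)
      apply inv_anti₀ (exp_pos _)
      apply le_sqrt_of_sq_le
      rw [← exp_nat_mul]
      push Not at h
      refine le_trans (le_of_eq ?_) h.le
      congr 1; push_cast; ring
  have hsum : charMean u R ≤ ℓ ^ 210 * exp (-ℓ) + exp (-(ℓ / 2)) * (C * u ^ 5) := by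
    refine (Finset.sum_le_sum hper).trans ?_
    rw [Finset.sum_add_distrib, ← Finset.mul_sum]
    refine add_le_add ?_ (mul_le_mul_of_nonneg_left (hC u hu100) (exp_pos _).le)
    rw [← Finset.sum_filter, Finset.sum_const, nsmul_eq_mul]
    have hsub : (primChars R).filter (fun c => (c.1 : ℝ) ≤ exp ℓ) ⊆ primChars ⌊exp ℓ⌋₊ := by
      intro c hc
      rw [Finset.mem_filter, mem_primChars] at hc
      rw [mem_primChars]
      exact ⟨⟨hc.1.1.1, Nat.le_floor hc.2⟩, hc.1.2⟩
    have hcard : (#((primChars R).filter (fun c => (c.1 : ℝ) ≤ exp ℓ)) : ℝ) ≤ exp (2 * ℓ) := by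
      calc _ ≤ (#(primChars ⌊exp ℓ⌋₊) : ℝ) := by exact_mod_cast Finset.card_le_card hsub
        _ ≤ ((⌊exp ℓ⌋₊ : ℕ) : ℝ) ^ 2 := by exact_mod_cast card_primChars_le _
        _ ≤ exp ℓ ^ 2 := by
            have := Nat.floor_le (exp_pos ℓ).le
            gcongr
        _ = _ := by rw [← exp_nat_mul]; norm_cast
    calc _ ≤ exp (2 * ℓ) * (ℓ ^ 210 * exp (-(1 / 4) * ℓ ^ 2)) :=
          mul_le_mul_of_nonneg_right hcard (by positivity)
      _ = ℓ ^ 210 * exp (2 * ℓ + -(1 / 4) * ℓ ^ 2) := by rw [exp_add]; ring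
      _ ≤ _ := by
          refine mul_le_mul_of_nonneg_left (exp_le_exp.mpr ?_) (by positivity)
          nlinarith
  have hb2 : exp (-(ℓ / 2)) * (C * u ^ 5) * u ^ A ≤ 1 / 2 := by
    have he : exp (-(ℓ / 2)) * (C * u ^ 5) * u ^ A =
        (C * 2 ^ (500 + 100 * A)) * ((ℓ / 2) ^ (500 + 100 * A) * exp (-(ℓ / 2))) := by
      rw [hu, div_pow, ← pow_mul, ← pow_mul, pow_add ℓ]
      field_simp
    rw [he]
    calc _ ≤ (C * 2 ^ (500 + 100 * A)) * (1 / (2 * C * 2 ^ (500 + 100 * A))) :=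
          mul_le_mul_of_nonneg_left b2 (by positivity)
      _ = 1 / 2 := by field_simp
  have hb1 : ℓ ^ 210 * exp (-ℓ) * u ^ A ≤ 1 / 2 := by
    refine le_trans (le_of_eq ?_) b1
    rw [hu, ← pow_mul, pow_add]; ring
  calc _ ≤ (ℓ ^ 210 * exp (-ℓ) + exp (-(ℓ / 2)) * (C * u ^ 5)) * u ^ A := by gcongr
    _ ≤ 1 := by rw [add_mul]; linarith

end GapRuns

namespace GapRuns
open Real Filter Topology Finset MeasureTheory
open scoped ArithmeticFunction.vonMangoldt

lemma vonMangoldt_le_log (n : ℕ) : Λ n ≤ log n := ArithmeticFunction.vonMangoldt_le_log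

lemma norm_vonMangoldt_le {n : ℕ} (hn : 0 < n) : ‖((Λ n : ℝ) : ℂ)‖ ≤ 1 * (n : ℝ) ^ (1 : ℝ) := by
  rw [Complex.norm_real, norm_of_nonneg ArithmeticFunction.vonMangoldt_nonneg, rpow_one, one_mul]
  refine (vonMangoldt_le_log n).trans ((log_le_sub_one_of_pos (by exact_mod_cast hn)).trans ?_)
  linarith

lemma summable_bdd_mul_vonMangoldt_mul_om {b : ℕ → ℝ} (hb : ∀ n, |b n| ≤ 1) (u : ℝ) :
    Summable fun n => b n * (Λ n * om u n) := by
  have h := summable_mul_om (a := fun n => ((b n * Λ n : ℝ) : ℂ)) (A := 1) (p := 1)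
    (fun n hn => by
      rw [Complex.ofReal_mul, norm_mul, Complex.norm_real, norm_eq_abs]
      exact (mul_le_of_le_one_left (norm_nonneg _) (hb n)).trans (norm_vonMangoldt_le hn)) u
  have h2 : Summable fun n => ((b n * (Λ n * om u n) : ℝ) : ℂ) := by
    refine h.congr fun n => ?_
    push_cast; ring
  exact_mod_cast h2

lemma summable_vonMangoldt_mul_om (u : ℝ) : Summable fun n => Λ n * om u n := by
  simpa using summable_bdd_mul_vonMangoldt_mul_om (b := fun _ => 1) (by simp) u

lemma summable_twL_mul_om {r : ℕ} (χ : DirichletCharacter ℂ r) (u : ℝ) :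
    Summable fun n => twL χ n * (om u n : ℂ) :=
  summable_mul_om (A := 1) (p := 1) (fun n hn => by
    rw [twL, norm_mul]
    exact (mul_le_of_le_one_left (norm_nonneg _) (DirichletCharacter.norm_le_one χ _)).trans
      (norm_vonMangoldt_le hn)) u

/-- The contribution to `∑ Λ om` of the integers that are not coprime to `q`. -/
noncomputable def ncp (u : ℝ) (q : ℕ) : ℝ := ∑' n : ℕ, (if n.Coprime q then 0 else 1) * (Λ n * om u n)

lemma summable_ncp (u : ℝ) (q : ℕ) :
    Summable fun n : ℕ => (if n.Coprime q then (0 : ℝ) else 1) * (Λ n * om u n) :=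
  summable_bdd_mul_vonMangoldt_mul_om (fun n => by split_ifs <;> simp) u

lemma log_mul_om_pow_le (u : ℝ) {p : ℕ} (hp : 2 ≤ p) (a : ℕ) :
    log p * om u (p ^ (a + 1)) ≤ 3 * exp (-u / 2) * (√2)⁻¹ ^ a := by
  have hp0 : (0 : ℝ) < p := by positivity
  have h1 : om u (p ^ (a + 1)) ≤ exp (1 / 8) * exp (-u / 2) * (√p)⁻¹ ^ (a + 1) := by
    refine (om_le (1 / 2) u (by positivity)).trans (le_of_eq ?_)
    congr 1
    · congr 1 <;> congr 1 <;> ring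
    · rw [Nat.cast_pow, ← rpow_natCast, ← rpow_mul hp0.le, sqrt_eq_rpow, ← rpow_neg hp0.le,
        ← rpow_natCast, ← rpow_mul hp0.le]
      congr 1; ring
  have h2 : log p ≤ 2 * √p := by
    have := log_le_rpow_div hp0.le (by norm_num : (0 : ℝ) < 1 / 2)
    rw [← sqrt_eq_rpow] at this
    linarith
  have h3 : exp (1 / 8) ≤ 3 / 2 := by
    have := exp_bound_div_one_sub_of_interval (x := 1 / 8) (by norm_num) (by norm_num)
    linarith [this]
  have h4 : (√p)⁻¹ ^ a ≤ (√2)⁻¹ ^ a := by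
    have : √2 ≤ √p := sqrt_le_sqrt (by exact_mod_cast hp)
    gcongr
  have hsp : 0 < √(p : ℝ) := sqrt_pos.mpr hp0
  calc log p * om u (p ^ (a + 1)) ≤ (2 * √p) * (exp (1 / 8) * exp (-u / 2) * (√p)⁻¹ ^ (a + 1)) :=
        mul_le_mul h2 h1 (om_nonneg _ _) (by positivity)
    _ = 2 * exp (1 / 8) * exp (-u / 2) * (√p)⁻¹ ^ a := by
        rw [pow_succ]; field_simp
    _ ≤ 2 * (3 / 2) * exp (-u / 2) * (√2)⁻¹ ^ a := by gcongr
    _ = _ := by ring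

lemma sum_inv_sqrt_two_pow_le (X : ℕ) : ∑ a ∈ range X, (√2)⁻¹ ^ a ≤ 4 := by
  have h2 : (√2)⁻¹ ≤ 3 / 4 := by
    rw [inv_le_comm₀ (by positivity) (by norm_num)]
    exact le_sqrt_of_sq_le (by norm_num)
  calc ∑ a ∈ range X, (√2)⁻¹ ^ a ≤ ∑ a ∈ range X, (3 / 4 : ℝ) ^ a := by gcongr
    _ ≤ 4 := by
      rw [geom_sum_eq (by norm_num)]
      have : (0 : ℝ) ≤ (3 / 4) ^ X := by positivity
      rw [div_le_iff_of_neg (by norm_num)]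
      linarith

lemma ncp_nonneg (u : ℝ) (q : ℕ) : 0 ≤ ncp u q := tsum_nonneg fun n => by
  have := om_nonneg u n
  have := @ArithmeticFunction.vonMangoldt_nonneg n
  split_ifs <;> positivity

lemma ncp_le (u : ℝ) {q : ℕ} (hq : q ≠ 0) : ncp u q ≤ 12 * q * exp (-u / 2) := by
  refine Real.tsum_le_of_sum_range_le (fun n => ?_) fun X => ?_
  · have := om_nonneg u n
    have := @ArithmeticFunction.vonMangoldt_nonneg n
    split_ifs <;> positivity
  set f : ℕ → ℝ := fun n => (if n.Coprime q then 0 else 1) * (Λ n * om u n) with hf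
  have hf0 : ∀ n, 0 ≤ f n := fun n => by
    have := om_nonneg u n
    have := @ArithmeticFunction.vonMangoldt_nonneg n
    simp only [hf]; split_ifs <;> positivity
  let S := (q.primeFactors ×ˢ range X).image fun c => c.1 ^ (c.2 + 1)
  have h1 : ∑ n ∈ range X, f n ≤ ∑ n ∈ S, f n := by
    rw [← Finset.sum_filter_ne_zero]
    refine Finset.sum_le_sum_of_subset_of_nonneg (fun n hn => ?_) fun n _ _ => hf0 n
    rw [mem_filter, Finset.mem_range] at hn
    obtain ⟨hnX, hn0⟩ := hn
    have hc : ¬ n.Coprime q := fun h => hn0 (by simp [hf, h])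
    have hL : Λ n ≠ 0 := fun h => hn0 (by simp [hf, h])
    rw [ArithmeticFunction.vonMangoldt_ne_zero_iff, isPrimePow_nat_iff] at hL
    obtain ⟨p, a, hp, ha, rfl⟩ := hL
    rw [Nat.coprime_pow_left_iff ha, hp.coprime_iff_not_dvd, not_not] at hc
    refine Finset.mem_image.mpr ⟨(p, a - 1), ?_, ?_⟩
    · refine mem_product.mpr ⟨Nat.mem_primeFactors.mpr ⟨hp, hc, hq⟩, Finset.mem_range.mpr ?_⟩
      have := Nat.lt_pow_self hp.one_lt (n := a)
      show a - 1 < X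
      omega
    · show p ^ (a - 1 + 1) = p ^ a
      congr 1; omega
  have h2 : ∑ n ∈ S, f n ≤ ∑ c ∈ q.primeFactors ×ˢ range X, f (c.1 ^ (c.2 + 1)) :=
    Finset.sum_image_le_of_nonneg fun c _ => hf0 _
  have h3 : ∑ c ∈ q.primeFactors ×ˢ range X, f (c.1 ^ (c.2 + 1)) ≤
      ∑ p ∈ q.primeFactors, 12 * exp (-u / 2) := by
    rw [sum_product]
    refine Finset.sum_le_sum fun p hp => ?_
    have hpp := Nat.prime_of_mem_primeFactors hp
    calc ∑ a ∈ range X, f (p ^ (a + 1)) ≤ ∑ a ∈ range X, 3 * exp (-u / 2) * (√2)⁻¹ ^ a := by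
          refine Finset.sum_le_sum fun a _ => (?_ : _ ≤ log p * om u (p ^ (a + 1))).trans
            (log_mul_om_pow_le u hpp.two_le a)
          have h0 := om_nonneg u (p ^ (a + 1))
          have hlog : 0 ≤ log p := log_natCast_nonneg p
          simp only [hf, ArithmeticFunction.vonMangoldt_apply_pow (Nat.succ_ne_zero a),
            ArithmeticFunction.vonMangoldt_apply_prime hpp]
          split_ifs
          · rw [zero_mul]; positivity
          · rw [one_mul]
      _ ≤ _ := by
          rw [← mul_sum]
          nlinarith [sum_inv_sqrt_two_pow_le X, exp_pos (-u / 2)]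
  refine h1.trans (h2.trans (h3.trans ?_))
  rw [sum_const, nsmul_eq_mul]
  have : (#q.primeFactors : ℝ) ≤ q := by
    have h : #q.primeFactors ≤ q := by
      calc #q.primeFactors ≤ #(Finset.Icc 1 q) := card_le_card fun p hp => by
            have := Nat.prime_of_mem_primeFactors hp
            exact Finset.mem_Icc.mpr ⟨this.one_le, Nat.le_of_dvd (by omega) (Nat.dvd_of_mem_primeFactors hp)⟩
        _ = q := by simp
    exact_mod_cast h
  nlinarith [exp_pos (-u / 2), mul_le_mul_of_nonneg_right this (exp_pos (-u / 2)).le]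

/-- Removing the primes dividing the level costs at most `ncp`. -/
lemma norm_tsum_twL_sub_le (u : ℝ) {q r : ℕ} (χ : DirichletCharacter ℂ q)
    (ψ : DirichletCharacter ℂ r) (h : ∀ n : ℕ, n.Coprime q → χ n = ψ n) :
    ‖∑' n, twL χ n * (om u n : ℂ) - ∑' n, twL ψ n * (om u n : ℂ)‖ ≤ ncp u q := by
  rw [← (summable_twL_mul_om χ u).tsum_sub (summable_twL_mul_om ψ u)]
  refine tsum_of_norm_bounded (summable_ncp u q).hasSum fun n => ?_
  have h0 := om_nonneg u n
  have h1 := @ArithmeticFunction.vonMangoldt_nonneg n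
  by_cases hn : n.Coprime q
  · rw [twL, twL, h n hn, sub_self, norm_zero, if_pos hn, zero_mul]
  · have hz : χ n = 0 := χ.map_nonunit fun hu => hn ((ZMod.isUnit_iff_coprime n q).mp hu)
    rw [if_neg hn, one_mul, twL, hz, zero_mul, zero_mul, zero_sub, norm_neg, norm_mul, twL, norm_mul,
      Complex.norm_real, Complex.norm_real, norm_of_nonneg h0, norm_of_nonneg h1]
    gcongr
    exact mul_le_of_le_one_left h1 (DirichletCharacter.norm_le_one ψ _)

/-- The smoothed Chebyshev function. -/
noncomputable def Psi (u : ℝ) : ℝ := ∑' n, Λ n * om u n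

lemma norm_tsum_twL_one_sub_le (u : ℝ) (q : ℕ) :
    ‖∑' n, twL (1 : DirichletCharacter ℂ q) n * (om u n : ℂ) - (Psi u : ℂ)‖ ≤ ncp u q := by
  have h := norm_tsum_twL_sub_le u (1 : DirichletCharacter ℂ q) (1 : DirichletCharacter ℂ 1)
    (fun n hn => by
      rw [MulChar.one_apply ((ZMod.isUnit_iff_coprime n q).mpr hn), MulChar.one_apply
        ((ZMod.isUnit_iff_coprime n 1).mpr (by simp))])
  convert h using 3
  rw [Psi, Complex.ofReal_tsum]
  refine tsum_congr fun n => ?_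
  rw [twL, MulChar.one_apply ((ZMod.isUnit_iff_coprime n 1).mpr (by simp))]
  push_cast; ring

/-- The nonprincipal characters modulo `q`, through their primitive inducing characters. -/
lemma sum_norm_tsum_twL_le (u : ℝ) {q R : ℕ} [NeZero q] (hqR : q ≤ R) :
    ∑ χ ∈ (univ : Finset (DirichletCharacter ℂ q)).erase 1, ‖∑' n, twL χ n * (om u n : ℂ)‖ ≤
      ∑ c ∈ primChars R with c.1 ∣ q, ‖∑' n, twL c.2 n * (om u n : ℂ)‖ + q.totient * ncp u q := by
  classical
  let j : DirichletCharacter ℂ q → Σ r, DirichletCharacter ℂ r :=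
    fun χ => ⟨χ.conductor, χ.primitiveCharacter⟩
  have hj : Function.Injective j := by
    have key : ∀ (c c' : Σ r, DirichletCharacter ℂ r) (h : c.1 ∣ q) (h' : c'.1 ∣ q), c = c' →
        DirichletCharacter.changeLevel h c.2 = DirichletCharacter.changeLevel h' c'.2 := by
      rintro c c' h h' rfl; rfl
    intro χ χ' h
    have := key _ _ χ.conductor_dvd_level χ'.conductor_dvd_level h
    rwa [DirichletCharacter.changeLevel_primitiveCharacter,
      DirichletCharacter.changeLevel_primitiveCharacter] at this
  have h1 : ∀ χ : DirichletCharacter ℂ q, ‖∑' n, twL χ n * (om u n : ℂ)‖ ≤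
      ‖∑' n, twL (j χ).2 n * (om u n : ℂ)‖ + ncp u q := fun χ => by
    have h := norm_tsum_twL_sub_le u χ χ.primitiveCharacter fun n hn => by
      have := χ.primitiveCharacter_apply_of_isCoprime (a := n) (Nat.isCoprime_iff_coprime.mpr hn)
      simpa using this.symm
    have := norm_le_norm_add_norm_sub' (∑' n, twL χ n * (om u n : ℂ))
      (∑' n, twL χ.primitiveCharacter n * (om u n : ℂ))
    show _ ≤ ‖∑' n, twL χ.primitiveCharacter n * (om u n : ℂ)‖ + _
    linarith
  calc _ ≤ ∑ χ ∈ (univ : Finset (DirichletCharacter ℂ q)).erase 1,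
        (‖∑' n, twL (j χ).2 n * (om u n : ℂ)‖ + ncp u q) := Finset.sum_le_sum fun χ _ => h1 χ
    _ = ∑ c ∈ ((univ : Finset (DirichletCharacter ℂ q)).erase 1).image j,
          ‖∑' n, twL c.2 n * (om u n : ℂ)‖ +
        #((univ : Finset (DirichletCharacter ℂ q)).erase 1) * ncp u q := by
        rw [sum_add_distrib, sum_const, nsmul_eq_mul, sum_image fun _ _ _ _ h => hj h]
    _ ≤ _ := by
        refine add_le_add (Finset.sum_le_sum_of_subset_of_nonneg ?_ fun _ _ _ => norm_nonneg _)
          (mul_le_mul_of_nonneg_right ?_ (ncp_nonneg u q))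
        · intro c hc
          obtain ⟨χ, hχ, rfl⟩ := Finset.mem_image.mp hc
          have hχ1 := Finset.ne_of_mem_erase hχ
          have hd : χ.conductor ∣ q := χ.conductor_dvd_level
          refine mem_filter.mpr ⟨mem_primChars.mpr ⟨⟨?_, ?_⟩, χ.primitiveCharacter_isPrimitive⟩, hd⟩
          · have h0 : χ.conductor ≠ 0 := χ.conductor_ne_zero
            have h1 : χ.conductor ≠ 1 := fun h => hχ1 (χ.eq_one_iff_conductor_eq_one.mpr h)
            show 2 ≤ χ.conductor
            omega
          · exact (Nat.le_of_dvd (NeZero.pos q) hd).trans hqR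
        · have h := DirichletCharacter.card_eq_totient_of_hasEnoughRootsOfUnity ℂ q
          rw [Nat.card_eq_fintype_card] at h
          have : #((univ : Finset (DirichletCharacter ℂ q)).erase 1) ≤ q.totient :=
            (card_le_card (erase_subset _ _)).trans_eq (by rw [card_univ, h])
          exact_mod_cast this

/-- Primes in arithmetic progressions, in terms of primitive characters. -/
lemma abs_progression_sub_le (u : ℝ) {q R : ℕ} [NeZero q] (hqR : q ≤ R) (a : ZMod q) :
    |∑' n : ℕ, (if (n : ZMod q) = a then 1 else 0) * (Λ n * om u n) -
        if IsUnit a then Psi u / q.totient else 0| ≤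
      (∑ c ∈ primChars R with c.1 ∣ q, ‖∑' n, twL c.2 n * (om u n : ℂ)‖) / q.totient +
        24 * q * exp (-u / 2) := by
  classical
  have hφ : (0 : ℝ) < q.totient := by exact_mod_cast Nat.totient_pos.mpr (NeZero.pos q)
  have hncp := ncp_le u (NeZero.ne q)
  have hS0 : 0 ≤ ∑ c ∈ primChars R with c.1 ∣ q, ‖∑' n, twL c.2 n * (om u n : ℂ)‖ :=
    Finset.sum_nonneg fun _ _ => norm_nonneg _
  split_ifs with ha
  · have hsum : ∑ χ : DirichletCharacter ℂ q, χ a⁻¹ * ∑' n, twL χ n * (om u n : ℂ) =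
        q.totient * ((∑' n : ℕ, (if (n : ZMod q) = a then (1 : ℝ) else 0) * (Λ n * om u n) : ℝ) : ℂ) := by
      rw [Complex.ofReal_tsum, ← tsum_mul_left]
      have : ∀ χ : DirichletCharacter ℂ q, HasSum (fun n => χ a⁻¹ * (twL χ n * (om u n : ℂ)))
          (χ a⁻¹ * ∑' n, twL χ n * (om u n : ℂ)) := fun χ =>
        (summable_twL_mul_om χ u).hasSum.mul_left _
      rw [← (hasSum_sum fun χ (_ : χ ∈ univ) => this χ).tsum_eq]
      refine tsum_congr fun n => ?_
      have h := DirichletCharacter.sum_char_inv_mul_char_eq ℂ ha (n : ZMod q)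
      simp only [twL]
      calc ∑ χ : DirichletCharacter ℂ q, χ a⁻¹ * (χ n * (Λ n : ℂ) * (om u n : ℂ)) =
          (∑ χ : DirichletCharacter ℂ q, χ a⁻¹ * χ n) * ((Λ n : ℂ) * (om u n : ℂ)) := by
            rw [sum_mul]; exact Finset.sum_congr rfl fun χ _ => by ring
        _ = _ := by
            rw [h]
            by_cases hn : (n : ZMod q) = a
            · rw [if_pos hn, if_pos hn.symm]; push_cast; ring
            · rw [if_neg hn, if_neg fun h => hn h.symm]; push_cast; ring
    set T := ∑' n : ℕ, (if (n : ZMod q) = a then (1 : ℝ) else 0) * (Λ n * om u n)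
    have h1 : ‖(q.totient : ℂ) * (T : ℂ) - (Psi u : ℂ)‖ ≤
        ∑ c ∈ primChars R with c.1 ∣ q, ‖∑' n, twL c.2 n * (om u n : ℂ)‖ + q.totient * ncp u q +
          ncp u q := by
      rw [← hsum, ← add_sum_erase _ _ (mem_univ (1 : DirichletCharacter ℂ q))]
      have ha' : IsUnit a⁻¹ := by
        obtain ⟨v, rfl⟩ := ha
        rw [ZMod.inv_coe_unit]; exact v⁻¹.isUnit
      rw [MulChar.one_apply ha', one_mul, add_sub_right_comm, add_comm]
      refine (norm_add_le _ _).trans (add_le_add ?_ (norm_tsum_twL_one_sub_le u q))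
      refine (norm_sum_le _ _).trans (le_trans (Finset.sum_le_sum fun χ _ => ?_)
        (sum_norm_tsum_twL_le u hqR))
      rw [norm_mul]
      exact mul_le_of_le_one_left (norm_nonneg _) (DirichletCharacter.norm_le_one χ _)
    have h2 : |q.totient * T - Psi u| ≤ ∑ c ∈ primChars R with c.1 ∣ q,
        ‖∑' n, twL c.2 n * (om u n : ℂ)‖ + q.totient * ncp u q + ncp u q := by
      rw [← norm_eq_abs, ← Complex.norm_real]; push_cast; exact h1
    have h3 : T - Psi u / q.totient = (q.totient * T - Psi u) / q.totient := by field_simp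
    rw [h3, abs_div, abs_of_pos hφ, div_le_iff₀ hφ, add_mul, div_mul_cancel₀ _ hφ.ne']
    have hφ1 : (1 : ℝ) ≤ q.totient := by exact_mod_cast Nat.totient_pos.mpr (NeZero.pos q)
    have := ncp_nonneg u q
    nlinarith
  · rw [sub_zero]
    have hle : |∑' n : ℕ, (if (n : ZMod q) = a then (1 : ℝ) else 0) * (Λ n * om u n)| ≤ ncp u q := by
      rw [← norm_eq_abs]
      refine tsum_of_norm_bounded (summable_ncp u q).hasSum fun n => ?_
      have h0 := om_nonneg u n
      have h1 := @ArithmeticFunction.vonMangoldt_nonneg n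
      by_cases hn : n.Coprime q
      · rw [if_neg fun h : (n : ZMod q) = a => ha (h ▸ (ZMod.isUnit_iff_coprime n q).mpr hn)]
        rw [if_pos hn]; simp
      · rw [if_neg hn, norm_mul, norm_of_nonneg (mul_nonneg h1 h0)]
        refine mul_le_mul_of_nonneg_right ?_ (mul_nonneg h1 h0)
        split_ifs <;> simp
    have : 0 ≤ (∑ c ∈ primChars R with c.1 ∣ q, ‖∑' n, twL c.2 n * (om u n : ℂ)‖) / q.totient := by
      positivity
    have := ncp_nonneg u q
    linarith

end GapRuns

namespace GapRuns
open Real Filter Topology Finset MeasureTheory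
open scoped ArithmeticFunction.vonMangoldt

lemma le_psi_sub_psi {y : ℝ} (hy : 10000 ≤ y) :
    y ≤ Chebyshev.psi (exp 2 * y) - Chebyshev.psi y := by
  have hy0 : 0 < y := by linarith
  have he : 7.3 ≤ exp 2 := by
    have := exp_one_gt_d9
    have h2 : exp 2 = exp 1 * exp 1 := by rw [← exp_add]; norm_num
    rw [h2]; nlinarith
  have he' : exp 2 ≤ 7.5 := by
    have := exp_one_lt_d9
    have h2 : exp 2 = exp 1 * exp 1 := by rw [← exp_add]; norm_num
    have := exp_pos 1
    rw [h2]; nlinarith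
  have h1 := Chebyshev.psi_ge' (x := exp 2 * y) (by positivity)
  have h2 := Chebyshev.psi_le (x := y) (by linarith)
  have hl2 := log_two_gt_d9
  have hl2' := log_two_lt_d9
  have hl4 : log 4 = 2 * log 2 := by
    rw [show (4 : ℝ) = 2 ^ 2 by norm_num, log_pow]; norm_num
  set z := y ^ (1 / 4 : ℝ) with hz
  have hz4 : z ^ 4 = y := by
    rw [hz, ← rpow_natCast, ← rpow_mul hy0.le]; norm_num
  have hz0 : 0 < z := by positivity
  have hz10 : 10 ≤ z := by
    by_contra! h
    have : z ^ 4 < 10 ^ 4 := pow_lt_pow_left₀ h hz0.le (by norm_num)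
    rw [hz4] at this; linarith
  have hsq : √y = z ^ 2 := by
    rw [← hz4, show z ^ 4 = (z ^ 2) ^ 2 by ring, sqrt_sq (by positivity)]
  have hlog : log y ≤ 4 * z := by
    have := log_le_rpow_div hy0.le (by norm_num : (0 : ℝ) < 1 / 4)
    linarith
  have hlog2 : log (exp 2 * y + 2) ≤ 3 + 4 * z := by
    have : exp 2 * y + 2 ≤ exp 3 * y := by
      have : exp 3 = exp 2 * exp 1 := by rw [← exp_add]; norm_num
      have := exp_one_gt_d9
      have h7 : 0 ≤ exp 2 * y * (exp 1 - 2) := by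
        have : 0 ≤ exp 1 - 2 := by linarith
        positivity
      have h8 : 7.3 * y ≤ exp 2 * y := mul_le_mul_of_nonneg_right he hy0.le
      nlinarith
    calc _ ≤ log (exp 3 * y) := log_le_log (by positivity) this
      _ = 3 + log y := by rw [log_mul (by positivity) hy0.ne', log_exp]
      _ ≤ _ := by linarith
  have h3 : 2 * √y * log y ≤ 8 * z ^ 3 := by
    rw [hsq]
    calc 2 * z ^ 2 * log y ≤ 2 * z ^ 2 * (4 * z) := by gcongr
      _ = _ := by ring
  have h4 : 8 * z ^ 3 ≤ 0.8 * y := by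
    rw [← hz4]; nlinarith [pow_pos hz0 3]
  have h5 : 4 * z ≤ 0.1 * y := by
    rw [← hz4]; nlinarith [pow_le_pow_left₀ (by norm_num) hz10 3]
  rw [hl4] at h2
  have h6 : (7.3 * y - 1) * 0.693 ≤ (exp 2 * y - 1) * log 2 :=
    mul_le_mul (by nlinarith) (by linarith) (by norm_num) (by nlinarith)
  have h7 : 2 * log 2 * y ≤ 1.4 * y := by gcongr; linarith
  linarith

lemma Psi_ge {u : ℝ} (hu : 11 ≤ u) : 1 / 20 ≤ Psi u := by
  have hy : 10000 ≤ exp (u - 1) := by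
    have h1 : exp 10 ≤ exp (u - 1) := exp_le_exp.mpr (by linarith)
    have h2 : exp 10 = exp 1 ^ 10 := by rw [← exp_nat_mul]; norm_num
    have h3 : (2.7 : ℝ) ^ 10 ≤ exp 1 ^ 10 :=
      pow_le_pow_left₀ (by norm_num) (by linarith [exp_one_gt_d9]) 10
    norm_num at h3
    linarith
  have h := le_psi_sub_psi hy
  have hx : exp 2 * exp (u - 1) = exp (u + 1) := by rw [← exp_add]; congr 1; ring
  rw [hx] at h
  set a := ⌊exp (u - 1)⌋₊
  set b := ⌊exp (u + 1)⌋₊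
  have hab : a ≤ b := Nat.floor_le_floor (exp_le_exp.mpr (by linarith))
  have hdiff : Chebyshev.psi (exp (u + 1)) - Chebyshev.psi (exp (u - 1)) = ∑ n ∈ Ioc a b, Λ n := by
    rw [Chebyshev.psi, Chebyshev.psi, sub_eq_iff_eq_add, add_comm (∑ n ∈ Ioc a b, Λ n)]
    exact (Finset.sum_Ioc_consecutive (fun n => Λ n) (Nat.zero_le a) hab).symm
  have hle : ∑ n ∈ Ioc a b, Λ n * exp (-u - 3 / 2) ≤ Psi u := by
    refine le_trans (b := ∑ n ∈ Ioc a b, Λ n * om u n) (Finset.sum_le_sum fun n hn => ?_)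
      ((summable_vonMangoldt_mul_om u).sum_le_tsum (Ioc a b) fun n _ =>
        mul_nonneg ArithmeticFunction.vonMangoldt_nonneg (om_nonneg u n))
    refine mul_le_mul_of_nonneg_left ?_ ArithmeticFunction.vonMangoldt_nonneg
    rw [Finset.mem_Ioc] at hn
    have hn0 : (0 : ℝ) < n := by exact_mod_cast (by omega : 0 < n)
    have h1 : u - 1 ≤ log n := by
      rw [le_log_iff_exp_le hn0]; exact ((Nat.floor_lt (exp_pos _).le).mp hn.1).le
    have h2 : log n ≤ u + 1 := by
      rw [log_le_iff_le_exp hn0]; exact (Nat.le_floor_iff (exp_pos _).le).mp hn.2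
    rw [om, gw_eq u hn0]
    refine exp_le_exp.mpr ?_
    have : (log n - u) ^ 2 ≤ 1 := by nlinarith
    linarith
  rw [← sum_mul, ← hdiff] at hle
  have h5 : exp (u - 1) * exp (-u - 3 / 2) = exp (-(5 / 2)) := by rw [← exp_add]; congr 1; ring
  have h6 : 1 / 20 ≤ exp (-(5 / 2)) := by
    rw [exp_neg, ← one_div]
    refine one_div_le_one_div_of_le (exp_pos _) ?_
    have h2 : exp (5 / 2) ^ 2 = exp 1 ^ 5 := by rw [← exp_nat_mul, ← exp_nat_mul]; norm_num
    have h3 : exp 1 ^ 5 ≤ 2.72 ^ 5 :=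
      pow_le_pow_left₀ (exp_pos _).le (by linarith [exp_one_lt_d9]) 5
    have h4 : (2.72 : ℝ) ^ 5 ≤ 400 := by norm_num
    refine (pow_le_pow_iff_left₀ (exp_pos _).le (by norm_num) two_ne_zero).mp ?_
    rw [h2]; linarith
  have := mul_le_mul_of_nonneg_right h (exp_pos (-u - 3 / 2)).le
  linarith

lemma summable_ind_mul_om {q : ℕ} (a : ZMod q) (u : ℝ) :
    Summable fun n : ℕ => (if (n : ZMod q) = a then (1 : ℝ) else 0) * om u n :=
  Summable.of_nonneg_of_le (fun n => mul_nonneg (by split_ifs <;> simp) (om_nonneg u n))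
    (fun n => mul_le_of_le_one_left (om_nonneg u n) (by split_ifs <;> simp)) (summable_om u)

/-- Integers in arithmetic progressions. -/
lemma abs_integers_progression_sub_le (u : ℝ) {q : ℕ} [NeZero q] (a : ZMod q) :
    |∑' n : ℕ, (if (n : ZMod q) = a then 1 else 0) * om u n - (∑' n, om u n) / q| ≤
      q * (48 * exp (-u / 2) * zetaThreeHalves) := by
  have hq : (0 : ℝ) < q := by exact_mod_cast NeZero.pos q
  have hq1 : (1 : ℝ) ≤ q := by exact_mod_cast NeZero.pos q
  let f : ZMod q → ℂ := fun b => (if b = a then 1 else 0) - (q : ℂ)⁻¹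
  have hf0 : ∑ b, f b = 0 := by
    simp only [f, sum_sub_distrib, sum_ite_eq', Finset.mem_univ, if_true, sum_const, card_univ,
      ZMod.card, nsmul_eq_mul]
    rw [mul_inv_cancel₀ (by exact_mod_cast NeZero.ne q), sub_self]
  have hf1 : ∀ b, ‖f b‖ ≤ 1 := fun b => by
    have : f b = (((if b = a then 1 else 0) - (q : ℝ)⁻¹ : ℝ) : ℂ) := by
      simp only [f]; split_ifs <;> push_cast <;> rfl
    rw [this, Complex.norm_real, norm_eq_abs]
    have h1 : 0 ≤ (q : ℝ)⁻¹ := by positivity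
    have h2 : (q : ℝ)⁻¹ ≤ 1 := inv_le_one_of_one_le₀ hq1
    split_ifs <;> rw [abs_le] <;> constructor <;> linarith
  have hs : Summable fun n : ℕ => ((if (n : ZMod q) = a then (1 : ℝ) else 0) * om u n -
      (q : ℝ)⁻¹ * om u n) := (summable_ind_mul_om a u).sub ((summable_om u).mul_left _)
  have he : ∀ n : ℕ, f n * (om u (1 * n) : ℂ) = (((if (n : ZMod q) = a then (1 : ℝ) else 0) * om u n -
      (q : ℝ)⁻¹ * om u n : ℝ) : ℂ) := fun n => by
    simp only [f, one_mul]; split_ifs <;> push_cast <;> ring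
  have h := norm_tsum_mul_om_le (c := fun n => f n) (B := 1 * q)
    (norm_sum_range_zmod_le hf0 hf1) (u := u) one_pos
    ((Complex.summable_ofReal.mpr hs).congr fun n => (he n).symm)
  simp only [he] at h
  rw [← Complex.ofReal_tsum, Complex.norm_real, norm_eq_abs, one_mul,
    (summable_ind_mul_om a u).tsum_sub ((summable_om u).mul_left _), tsum_mul_left] at h
  rwa [div_eq_inv_mul]

end GapRuns

namespace GapRuns
open Real Filter Topology Finset MeasureTheory

/-- A tensor product of quadratic forms, each given as a weighted sum of squares. -/
noncomputable def tensorForm {ι α κ : Type*} [Fintype ι] [DecidableEq ι] [Fintype α] [Fintype κ]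
    (w : ι → α → ℝ) (e : ι → α → κ → ℝ) (z : (ι → κ) → ℝ) : ℝ :=
  ∑ a : ι → α, (∏ i, w i (a i)) * (∑ b : ι → κ, (∏ i, e i (a i) (b i)) * z b) ^ 2

lemma tensorForm_equiv {ι ι' α κ : Type*} [Fintype ι] [DecidableEq ι] [Fintype ι'] [DecidableEq ι']
    [Fintype α] [Fintype κ] (f : ι' ≃ ι) (w : ι → α → ℝ) (e : ι → α → κ → ℝ) (z : (ι → κ) → ℝ) :
    tensorForm w e z = tensorForm (fun i => w (f i)) (fun i => e (f i))
      (fun b => z fun i => b (f.symm i)) := by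
  unfold tensorForm
  refine Fintype.sum_equiv (f.symm.arrowCongr (Equiv.refl α)) _ _ fun a => ?_
  congr 1
  · exact (f.prod_comp fun i => w i (a i)).symm
  · congr 1
    refine Fintype.sum_equiv (f.symm.arrowCongr (Equiv.refl κ)) _ _ fun b => ?_
    congr 1
    · exact (f.prod_comp fun i => e i (a i) (b i)).symm
    · congr 1; funext i; simp

lemma tensorForm_succ {n : ℕ} {α κ : Type*} [Fintype α] [Fintype κ]
    (w : Fin (n + 1) → α → ℝ) (e : Fin (n + 1) → α → κ → ℝ) (z : (Fin (n + 1) → κ) → ℝ) :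
    tensorForm w e z = ∑ a₀, w 0 a₀ * tensorForm (fun i => w i.succ) (fun i => e i.succ)
      (fun b => ∑ b₀, e 0 a₀ b₀ * z (Fin.cons b₀ b)) := by
  unfold tensorForm
  rw [← (Fin.consEquiv fun _ => α).sum_comp, Fintype.sum_prod_type]
  refine Finset.sum_congr rfl fun a₀ _ => ?_
  rw [mul_sum]
  refine Finset.sum_congr rfl fun a _ => ?_
  rw [← (Fin.consEquiv fun _ => κ).sum_comp, Fintype.sum_prod_type, Finset.sum_comm]
  simp only [Fin.consEquiv_apply, Fin.prod_univ_succ, Fin.cons_zero, Fin.cons_succ, mul_sum]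
  rw [mul_assoc]
  congr 3
  exact Finset.sum_congr rfl fun b _ => Finset.sum_congr rfl fun b₀ _ => by
    rw [mul_assoc, mul_left_comm]; rfl

lemma tensorForm_succ' {n : ℕ} {α κ : Type*} [Fintype α] [Fintype κ]
    (w : Fin (n + 1) → α → ℝ) (e : Fin (n + 1) → α → κ → ℝ) (z : (Fin (n + 1) → κ) → ℝ) :
    tensorForm w e z = ∑ a : Fin n → α, (∏ i, w i.succ (a i)) * ∑ a₀, w 0 a₀ *
      (∑ b₀, e 0 a₀ b₀ * ∑ b : Fin n → κ, (∏ i, e i.succ (a i) (b i)) * z (Fin.cons b₀ b)) ^ 2 := by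
  rw [tensorForm_succ]
  unfold tensorForm
  simp only [mul_sum (s := (univ : Finset (Fin n → α))), mul_sum (s := (univ : Finset α))]
  rw [Finset.sum_comm]
  refine Finset.sum_congr rfl fun a _ => Finset.sum_congr rfl fun a₀ _ => ?_
  rw [mul_left_comm]
  congr 3
  simp only [mul_sum]
  rw [Finset.sum_comm]
  exact Finset.sum_congr rfl fun b _ => Finset.sum_congr rfl fun b₀ _ => by ring

lemma tensorForm_mono_fin {α α' κ : Type*} [Fintype α] [Fintype α'] [Fintype κ] :
    ∀ {n : ℕ} {w : Fin n → α → ℝ} {e : Fin n → α → κ → ℝ} {w' : Fin n → α' → ℝ}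
    {e' : Fin n → α' → κ → ℝ}, (∀ i a, 0 ≤ w i a) → (∀ i a, 0 ≤ w' i a) →
    (∀ i (x : κ → ℝ), ∑ a, w i a * (∑ b, e i a b * x b) ^ 2 ≤
      ∑ a, w' i a * (∑ b, e' i a b * x b) ^ 2) →
    ∀ z : (Fin n → κ) → ℝ, tensorForm w e z ≤ tensorForm w' e' z
  | 0, w, e, w', e', _, _, _, z => by simp [tensorForm]
  | n + 1, w, e, w', e', hw, hw', h, z => by
    calc tensorForm w e z ≤ ∑ a : Fin n → α, (∏ i, w i.succ (a i)) * ∑ a₀, w' 0 a₀ *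
          (∑ b₀, e' 0 a₀ b₀ * ∑ b : Fin n → κ,
            (∏ i, e i.succ (a i) (b i)) * z (Fin.cons b₀ b)) ^ 2 := by
          rw [tensorForm_succ']
          exact Finset.sum_le_sum fun a _ => mul_le_mul_of_nonneg_left (h 0 _)
            (Finset.prod_nonneg fun i _ => hw _ _)
      _ = ∑ a₀, w' 0 a₀ * tensorForm (fun i => w i.succ) (fun i => e i.succ)
            (fun b => ∑ b₀, e' 0 a₀ b₀ * z (Fin.cons b₀ b)) := by
          unfold tensorForm
          simp only [mul_sum (s := (univ : Finset (Fin n → α))), mul_sum (s := (univ : Finset α'))]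
          rw [Finset.sum_comm]
          refine Finset.sum_congr rfl fun a₀ _ => Finset.sum_congr rfl fun a _ => ?_
          rw [mul_left_comm]
          congr 3
          simp only [mul_sum]
          rw [Finset.sum_comm]
          exact Finset.sum_congr rfl fun b _ => Finset.sum_congr rfl fun b₀ _ => by ring
      _ ≤ tensorForm w' e' z := by
          rw [tensorForm_succ w']
          exact Finset.sum_le_sum fun a₀ _ => mul_le_mul_of_nonneg_left
            (tensorForm_mono_fin (fun i => hw _) (fun i => hw' _) (fun i => h _) _) (hw' _ _)

/-- An inequality between quadratic forms passes to tensor products. -/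
lemma tensorForm_mono {ι α α' κ : Type*} [Fintype ι] [DecidableEq ι] [Fintype α] [Fintype α']
    [Fintype κ] {w : ι → α → ℝ} {e : ι → α → κ → ℝ} {w' : ι → α' → ℝ} {e' : ι → α' → κ → ℝ}
    (hw : ∀ i a, 0 ≤ w i a) (hw' : ∀ i a, 0 ≤ w' i a)
    (h : ∀ i (x : κ → ℝ), ∑ a, w i a * (∑ b, e i a b * x b) ^ 2 ≤
      ∑ a, w' i a * (∑ b, e' i a b * x b) ^ 2) (z : (ι → κ) → ℝ) :
    tensorForm w e z ≤ tensorForm w' e' z := by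
  rw [tensorForm_equiv (Fintype.equivFin ι).symm w, tensorForm_equiv (Fintype.equivFin ι).symm w']
  exact tensorForm_mono_fin (fun i => hw _) (fun i => hw' _) (fun i => h _) _

end GapRuns

namespace GapRuns
open Real Filter Topology Finset MeasureTheory

section OneDim

variable {k : ℕ}

/-- Values of the building blocks of the sieve weight at a single prime `q`. -/
noncomputable def evalAt (q : ℝ) (a b : Option (Fin k)) : ℝ :=
  match b with
  | none => 1
  | some i => 1 / (q - 1) - if a = some i then 1 else 0

/-- The law of a random integer at the prime `q`. -/
noncomputable def intLaw (q : ℝ) (a : Option (Fin k)) : ℝ :=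
  match a with
  | none => 1 - k / q
  | some _ => 1 / q

/-- The law of a random prime at the prime `q`, seen from the shift `m`. -/
noncomputable def primeLaw (m : Fin k) (q : ℝ) (a : Option (Fin k)) : ℝ :=
  match a with
  | none => 1 - (k - 1) / (q - 1)
  | some i => if i = m then 0 else 1 / (q - 1)

noncomputable def intDiag (q : ℝ) (a : Option (Fin k)) : ℝ :=
  match a with
  | none => 1 + 1 / (q * (q - 2))
  | some _ => 1 / q

noncomputable def primeDiag (m : Fin k) (q : ℝ) (a : Option (Fin k)) : ℝ :=
  match a with
  | none => 1
  | some i => if i = m then 0 else 1 / q * (1 - k / q)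

noncomputable def primeEval (m : Fin k) (q : ℝ) (a b : Option (Fin k)) : ℝ :=
  (if a = b then 1 else 0) + if a = none ∧ b = some m then 1 / (q - 1) else 0

lemma sum_evalAt_none (q : ℝ) (x : Option (Fin k) → ℝ) :
    ∑ b, evalAt q none b * x b = x none + 1 / (q - 1) * ∑ i, x (some i) := by
  rw [Fintype.sum_option]
  simp [evalAt, mul_sum]

lemma sum_evalAt_some (q : ℝ) (i : Fin k) (x : Option (Fin k) → ℝ) :
    ∑ b, evalAt q (some i) b * x b = x none + 1 / (q - 1) * ∑ i, x (some i) - x (some i) := by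
  rw [Fintype.sum_option]
  simp [evalAt, mul_sum, sub_mul, sum_sub_distrib]
  ring

lemma intLaw_form_le {q : ℝ} (hq : 2 < q) (x : Option (Fin k) → ℝ) :
    ∑ a, intLaw q a * (∑ b, evalAt q a b * x b) ^ 2 ≤
      ∑ a, intDiag q a * (∑ b, (if a = b then 1 else 0) * x b) ^ 2 := by
  simp only [ite_mul, one_mul, zero_mul, sum_ite_eq, Finset.mem_univ, if_true]
  rw [Fintype.sum_option (fun a => intLaw q a * (∑ b, evalAt q a b * x b) ^ 2),
    Fintype.sum_option (fun a => intDiag q a * x a ^ 2), sum_evalAt_none]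
  simp only [sum_evalAt_some, intLaw, intDiag]
  set S := ∑ i, x (some i) with hS
  set t := x none + 1 / (q - 1) * S with ht
  have h1 : ∑ i : Fin k, 1 / q * (t - x (some i)) ^ 2 =
      k / q * t ^ 2 - 2 / q * t * S + ∑ i : Fin k, 1 / q * x (some i) ^ 2 := by
    have : ∀ i : Fin k, 1 / q * (t - x (some i)) ^ 2 =
        1 / q * t ^ 2 - 2 / q * t * x (some i) + 1 / q * x (some i) ^ 2 := fun i => by ring
    simp only [this, sum_add_distrib, sum_sub_distrib, sum_const, card_univ, Fintype.card_fin,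
      nsmul_eq_mul, ← mul_sum]
    ring
  rw [h1]
  have hq0 : 0 < q := by linarith
  have hq1 : 0 < q - 1 := by linarith
  have hq2 : 0 < q - 2 := by linarith
  have key : (1 + 1 / (q * (q - 2))) * x none ^ 2 - (t ^ 2 - 2 / q * t * S) =
      1 / (q * (q - 2)) * (x none - (q - 2) / (q - 1) * S) ^ 2 := by
    rw [ht]; field_simp; ring
  have : 0 ≤ 1 / (q * (q - 2)) * (x none - (q - 2) / (q - 1) * S) ^ 2 := by positivity
  linarith

lemma sum_primeEval_none (m : Fin k) (q : ℝ) (x : Option (Fin k) → ℝ) :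
    ∑ b, primeEval m q none b * x b = x none + 1 / (q - 1) * x (some m) := by
  rw [Fintype.sum_option]
  simp [primeEval]

lemma sum_primeEval_some (m : Fin k) (q : ℝ) (i : Fin k) (x : Option (Fin k) → ℝ) :
    ∑ b, primeEval m q (some i) b * x b = x (some i) := by
  rw [Fintype.sum_option]
  simp [primeEval]

lemma primeLaw_form_ge (m : Fin k) {q : ℝ} (hq : 1 < q) (hqk : k ≤ q) (x : Option (Fin k) → ℝ) :
    ∑ a, primeDiag m q a * (∑ b, primeEval m q a b * x b) ^ 2 ≤
      ∑ a, primeLaw m q a * (∑ b, evalAt q a b * x b) ^ 2 := by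
  rw [Fintype.sum_option (fun a => primeLaw m q a * (∑ b, evalAt q a b * x b) ^ 2),
    Fintype.sum_option (fun a => primeDiag m q a * (∑ b, primeEval m q a b * x b) ^ 2),
    sum_evalAt_none, sum_primeEval_none]
  simp only [sum_evalAt_some, sum_primeEval_some, primeLaw, primeDiag, ite_mul, zero_mul]
  rw [← add_sum_erase univ (fun i => x (some i)) (mem_univ m)]
  set S := ∑ i ∈ univ.erase m, x (some i) with hS
  set Q := ∑ i ∈ univ.erase m, x (some i) ^ 2 with hQ
  have hif : ∀ f : Fin k → ℝ, ∑ i, (if i = m then 0 else f i) = ∑ i ∈ univ.erase m, f i := fun f => by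
    rw [← add_sum_erase univ _ (mem_univ m), if_pos rfl, zero_add]
    exact Finset.sum_congr rfl fun i hi => if_neg (Finset.ne_of_mem_erase hi)
  rw [hif, hif, ← mul_sum, ← hQ]
  set t := x none + 1 / (q - 1) * (x (some m) + S) with ht
  have hk1 : 1 ≤ k := m.pos
  have hcard : (#(univ.erase m) : ℝ) = k - 1 := by
    rw [card_erase_of_mem (mem_univ m), card_univ, Fintype.card_fin]; push_cast [hk1]; ring
  have h1 : ∑ i ∈ univ.erase m, 1 / (q - 1) * (t - x (some i)) ^ 2 =
      (k - 1) / (q - 1) * t ^ 2 - 2 / (q - 1) * t * S + 1 / (q - 1) * Q := by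
    have : ∀ i : Fin k, 1 / (q - 1) * (t - x (some i)) ^ 2 =
        1 / (q - 1) * t ^ 2 - 2 / (q - 1) * t * x (some i) + 1 / (q - 1) * x (some i) ^ 2 :=
      fun i => by ring
    simp only [this, sum_add_distrib, sum_sub_distrib, sum_const, nsmul_eq_mul, ← mul_sum, hcard]
    rw [← hS, ← hQ]; ring
  rw [h1]
  have hCS : S ^ 2 ≤ (k - 1) * Q := by
    rw [hS, hQ, ← hcard]; exact sq_sum_le_card_mul_sum_sq
  have hQ0 : 0 ≤ Q := Finset.sum_nonneg fun i _ => sq_nonneg _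
  have hq0 : 0 < q := by linarith
  have hq1 : 0 < q - 1 := by linarith
  have key : t ^ 2 - 2 / (q - 1) * t * S =
      (x none + 1 / (q - 1) * x (some m)) ^ 2 - (1 / (q - 1)) ^ 2 * S ^ 2 := by
    rw [ht]; field_simp; ring
  have h2 : 1 / q * (1 - k / q) ≤ 1 / (q - 1) - (1 / (q - 1)) ^ 2 * (k - 1) := by
    have e1 : 1 / q * (1 - k / q) = (q - k) / q ^ 2 := by field_simp
    have e2 : 1 / (q - 1) - (1 / (q - 1)) ^ 2 * (k - 1) = (q - k) / (q - 1) ^ 2 := by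
      field_simp; ring
    rw [e1, e2]
    exact div_le_div_of_nonneg_left (by linarith) (by positivity)
      (pow_le_pow_left₀ hq1.le (by linarith) 2)
  have h3 := mul_le_mul_of_nonneg_right h2 hQ0
  have h4 := mul_le_mul_of_nonneg_left hCS (sq_nonneg (1 / (q - 1)))
  nlinarith

end OneDim

end GapRuns

namespace GapRuns
open Real Filter Topology Finset MeasureTheory

section Config

set_option linter.unusedSectionVars false

variable {ι : Type*} [Fintype ι] [DecidableEq ι] {k : ℕ}

/-- The set of primes to which the configuration `r` assigns the color `i`. -/
def colorSet (r : ι → Option (Fin k)) (i : Fin k) : Finset ι := univ.filter fun p => r p = some i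

lemma mem_colorSet {r : ι → Option (Fin k)} {i : Fin k} {p : ι} : p ∈ colorSet r i ↔ r p = some i := by
  simp [colorSet]

lemma colorSet_injective : Function.Injective (colorSet : (ι → Option (Fin k)) → Fin k → Finset ι) := by
  intro r s h
  funext p
  have key : ∀ i, r p = some i ↔ s p = some i := fun i => by
    rw [← mem_colorSet, ← mem_colorSet, h]
  rcases hr : r p with _ | i
  · rcases hs : s p with _ | j
    · rfl
    · rw [(key j).mpr hs] at hr; exact absurd hr (by simp)
  · rw [(key i).mp hr]

lemma prod_config (F : ι → Option (Fin k) → ℝ) (hF : ∀ p, F p none = 1) (r : ι → Option (Fin k)) :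
    ∏ p, F p (r p) = ∏ i, ∏ p ∈ colorSet r i, F p (some i) := by
  simp only [colorSet, prod_filter]
  rw [Finset.prod_comm]
  refine Finset.prod_congr rfl fun p _ => ?_
  rcases r p with _ | j
  · simp [hF]
  · simp

/-- The logarithmic size of a set of primes. -/
noncomputable def ell (q : ι → ℝ) (A : Finset ι) : ℝ := ∑ p ∈ A, log (q p)

/-- The weight of a set of primes. -/
noncomputable def recip (q : ι → ℝ) (A : Finset ι) : ℝ := ∏ p ∈ A, 1 / q p

/-- The smoothed harmonic sum over squarefree products. -/
noncomputable def gsum (q : ι → ℝ) (G : ℝ → ℝ) : ℝ := ∑ A : Finset ι, recip q A * G (ell q A)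

/-- The sieve coefficients. -/
noncomputable def yval (q : ι → ℝ) (G : ℝ → ℝ) (L : ℝ) (r : ι → Option (Fin k)) : ℝ :=
  if ∑ i, ell q (colorSet r i) ≤ L then ∏ i, G (ell q (colorSet r i)) else 0

lemma yval_nonneg {q : ι → ℝ} {G : ℝ → ℝ} (hG : ∀ s, 0 ≤ G s) (L : ℝ) (r : ι → Option (Fin k)) :
    0 ≤ yval q G L r := by
  unfold yval; split_ifs
  exacts [Finset.prod_nonneg fun i _ => hG _, le_rfl]

lemma yval_le_one {q : ι → ℝ} {G : ℝ → ℝ} (hG : ∀ s, 0 ≤ G s) (hG1 : ∀ s, G s ≤ 1) (L : ℝ)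
    (r : ι → Option (Fin k)) : yval q G L r ≤ 1 := by
  unfold yval; split_ifs
  exacts [Finset.prod_le_one (fun i _ => hG _) fun i _ => hG1 _, zero_le_one]

lemma recip_nonneg {q : ι → ℝ} (hq : ∀ p, 0 < q p) (A : Finset ι) : 0 ≤ recip q A :=
  Finset.prod_nonneg fun p _ => (one_div_pos.mpr (hq p)).le

lemma ell_nonneg {q : ι → ℝ} (hq : ∀ p, 1 < q p) (A : Finset ι) : 0 ≤ ell q A :=
  Finset.sum_nonneg fun p _ => (log_pos (hq p)).le

lemma ell_mono {q : ι → ℝ} (hq : ∀ p, 1 < q p) {A B : Finset ι} (h : A ⊆ B) : ell q A ≤ ell q B :=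
  Finset.sum_le_sum_of_subset_of_nonneg h fun p _ _ => (log_pos (hq p)).le

lemma recip_erase {q : ι → ℝ} {A : Finset ι} {p : ι} (hp : p ∈ A) :
    recip q A = 1 / q p * recip q (A.erase p) := by
  unfold recip; rw [mul_prod_erase A (fun p => 1 / q p) hp]

/-- The proportion of sets containing a given prime. -/
lemma sum_mem_le {q : ι → ℝ} (hq : ∀ p, 1 < q p) {G : ℝ → ℝ} (hG : ∀ s, 0 ≤ G s)
    (hGa : Antitone G) (p : ι) :
    ∑ A : Finset ι, (if p ∈ A then recip q A * G (ell q A) else 0) ≤ 1 / q p * gsum q G := by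
  have hq0 : ∀ p, 0 < q p := fun p => zero_lt_one.trans (hq p)
  rw [← sum_filter]
  calc ∑ A : Finset ι with p ∈ A, recip q A * G (ell q A) ≤
      ∑ A : Finset ι with p ∈ A, 1 / q p * (recip q (A.erase p) * G (ell q (A.erase p))) := by
        refine Finset.sum_le_sum fun A hA => ?_
        rw [recip_erase (mem_filter.mp hA).2, mul_assoc]
        refine mul_le_mul_of_nonneg_left ?_ (one_div_pos.mpr (hq0 p)).le
        exact mul_le_mul_of_nonneg_left (hGa (ell_mono hq (erase_subset _ _))) (recip_nonneg hq0 _)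
    _ = 1 / q p * ∑ A ∈ (univ.filter fun A : Finset ι => p ∈ A).image (fun A : Finset ι => A.erase p),
          recip q A * G (ell q A) := by
        rw [← mul_sum, sum_image]
        intro A hA B hB h
        have hA' : p ∈ A := by simpa using hA
        have hB' : p ∈ B := by simpa using hB
        rw [← insert_erase hA', ← insert_erase hB', show A.erase p = B.erase p from h]
    _ ≤ _ := by
        refine mul_le_mul_of_nonneg_left ?_ (one_div_pos.mpr (hq0 p)).le
        exact Finset.sum_le_sum_of_subset_of_nonneg (subset_univ _)
          fun A _ _ => mul_nonneg (recip_nonneg hq0 A) (hG _)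

lemma prod_indicator (a b : ι → Option (Fin k)) :
    ∏ p, (if a p = b p then (1 : ℝ) else 0) = if a = b then 1 else 0 := by
  rw [Fintype.prod_ite_zero, Finset.prod_const_one]
  simp only [funext_iff]

/-- Upper bound for the mean square of the sieve weight over integers. -/
lemma tensorForm_int_le {q : ι → ℝ} (hq : ∀ p, 4 ≤ q p) (hk : ∀ p, (k : ℝ) ≤ q p)
    (hη : ∑ p, 1 / q p ^ 2 ≤ 1 / 4) {G : ℝ → ℝ} (L : ℝ) :
    tensorForm (fun p => intLaw (k := k) (q p)) (fun p => evalAt (q p)) (yval q G L) ≤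
      2 * gsum q (fun s => G s ^ 2) ^ k := by
  have hq0 : ∀ p, 0 < q p := fun p => by linarith [hq p]
  have hq2 : ∀ p, 0 < q p - 2 := fun p => by linarith [hq p]
  have hlaw : ∀ p (a : Option (Fin k)), 0 ≤ intLaw (q p) a := fun p a => by
    rcases a with _ | i
    · have := div_le_one_of_le₀ (hk p) (hq0 p).le
      simp only [intLaw]; linarith
    · simp only [intLaw]; exact (one_div_pos.mpr (hq0 p)).le
  have hdiag : ∀ p (a : Option (Fin k)), 0 ≤ intDiag (q p) a := fun p a => by
    have := hq0 p
    have := hq2 p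
    rcases a with _ | i <;> simp only [intDiag] <;> positivity
  refine (tensorForm_mono hlaw hdiag
    (fun p x => intLaw_form_le (by linarith [hq p]) x) _).trans ?_
  unfold tensorForm
  simp only [prod_indicator, ite_mul, one_mul, zero_mul, sum_ite_eq, Finset.mem_univ, if_true]
  set F : ι → Option (Fin k) → ℝ := fun p a => match a with
    | none => 1
    | some _ => 1 / q p with hF
  have hF0 : ∀ p a, 0 ≤ F p a := fun p a => by
    have := hq0 p
    rcases a with _ | i <;> simp only [hF] <;> positivity
  have hc0 : ∀ p, 0 ≤ 1 + 1 / (q p * (q p - 2)) := fun p => by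
    have := hq0 p
    have := hq2 p
    positivity
  have hprod : ∏ p, (1 + 1 / (q p * (q p - 2))) ≤ 2 := by
    calc ∏ p, (1 + 1 / (q p * (q p - 2))) ≤ ∏ p, exp (2 * (1 / q p ^ 2)) := by
          refine Finset.prod_le_prod (fun p _ => hc0 p) fun p _ => ?_
          have h0 := hq0 p
          have h2 := hq2 p
          refine le_trans ?_ (add_one_le_exp _)
          rw [add_comm, add_le_add_iff_right, mul_one_div, div_le_div_iff₀ (by positivity)
            (by positivity)]
          nlinarith [hq p]
      _ = exp (2 * ∑ p, 1 / q p ^ 2) := by rw [← exp_sum, mul_sum]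
      _ ≤ exp (1 / 2) := exp_le_exp.mpr (by linarith)
      _ ≤ 2 := by
        have := exp_bound_div_one_sub_of_interval (x := 1 / 2) (by norm_num) (by norm_num)
        linarith [this]
  have h1 : ∀ r : ι → Option (Fin k), (∏ p, intDiag (q p) (r p)) * yval q G L r ^ 2 ≤
      2 * ∏ i, (recip q (colorSet r i) * G (ell q (colorSet r i)) ^ 2) := fun r => by
    have e1 : ∏ p, intDiag (q p) (r p) ≤ 2 * ∏ i, recip q (colorSet r i) := by
      calc ∏ p, intDiag (q p) (r p) ≤ ∏ p, ((1 + 1 / (q p * (q p - 2))) * F p (r p)) := by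
            refine Finset.prod_le_prod (fun p _ => hdiag _ _) fun p _ => ?_
            have h0 := hq0 p
            have h2 := hq2 p
            rcases r p with _ | i
            · simp [intDiag, hF]
            · simp only [intDiag, hF]
              refine le_mul_of_one_le_left (by positivity) ?_
              have : 0 ≤ 1 / (q p * (q p - 2)) := by positivity
              linarith
        _ = (∏ p, (1 + 1 / (q p * (q p - 2)))) * ∏ p, F p (r p) := prod_mul_distrib
        _ ≤ 2 * ∏ p, F p (r p) :=
            mul_le_mul_of_nonneg_right hprod (Finset.prod_nonneg fun p _ => hF0 _ _)
        _ = _ := by rw [prod_config F fun p => rfl]; rfl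
    have e2 : yval q G L r ^ 2 ≤ ∏ i, G (ell q (colorSet r i)) ^ 2 := by
      unfold yval; split_ifs
      · rw [prod_pow]
      · rw [zero_pow two_ne_zero]; exact Finset.prod_nonneg fun i _ => sq_nonneg _
    rw [prod_mul_distrib, ← mul_assoc]
    exact mul_le_mul e1 e2 (sq_nonneg _) (mul_nonneg zero_le_two
      (Finset.prod_nonneg fun i _ => recip_nonneg hq0 _))
  refine (Finset.sum_le_sum fun r _ => h1 r).trans ?_
  rw [← mul_sum]
  refine mul_le_mul_of_nonneg_left ?_ zero_le_two
  calc ∑ r : ι → Option (Fin k), ∏ i, (recip q (colorSet r i) * G (ell q (colorSet r i)) ^ 2) =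
      ∑ t ∈ univ.image (colorSet : (ι → Option (Fin k)) → Fin k → Finset ι),
        ∏ i, (recip q (t i) * G (ell q (t i)) ^ 2) := by
        rw [sum_image fun _ _ _ _ h => colorSet_injective h]
    _ ≤ ∑ t : Fin k → Finset ι, ∏ i, (recip q (t i) * G (ell q (t i)) ^ 2) :=
        Finset.sum_le_sum_of_subset_of_nonneg (subset_univ _) fun t _ _ =>
          Finset.prod_nonneg fun i _ => mul_nonneg (recip_nonneg hq0 _) (sq_nonneg _)
    _ = _ := by
        have := Finset.prod_univ_sum (fun _ : Fin k => (univ : Finset (Finset ι)))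
          (fun _ A => recip q A * G (ell q A) ^ 2)
        rw [Fintype.piFinset_univ, prod_const, card_univ, Fintype.card_fin] at this
        rw [← this]; rfl

/-- Adding a set of primes of color `m`. -/
lemma sum_primeEval_ge {q : ι → ℝ} (hq : ∀ p, 2 ≤ q p) {G : ℝ → ℝ} (hG : ∀ s, 0 ≤ G s)
    (hGa : Antitone G) {L : ℝ} (hGL : ∀ s, G s ≠ 0 → s ≤ L / 2) {m : Fin k}
    {r : ι → Option (Fin k)} (hm : ∀ p, r p ≠ some m) (hr : ∑ i, ell q (colorSet r i) ≤ L / 2) :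
    (∏ i ∈ univ.erase m, G (ell q (colorSet r i))) *
      (gsum q G * (1 - ∑ i, ∑ p ∈ colorSet r i, 1 / q p)) ≤
      ∑ b : ι → Option (Fin k), (∏ p, primeEval m (q p) (r p) (b p)) * yval q G L b := by
  have hq1 : ∀ p, 1 < q p := fun p => by linarith [hq p]
  have hq0 : ∀ p, 0 < q p := fun p => by linarith [hq p]
  let B : Finset ι → ι → Option (Fin k) := fun A p => if p ∈ A then some m else r p
  set D : Finset (Finset ι) := univ.filter fun A => ∀ p ∈ A, r p = none with hD
  have hBinj : Function.Injective B := by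
    intro A A' h
    ext p
    have := congr_fun h p
    simp only [B] at this
    by_cases h1 : p ∈ A <;> by_cases h2 : p ∈ A' <;> simp only [h1, h2, if_true, if_false] at this ⊢
    · exact absurd this.symm (hm p)
    · exact absurd this (hm p)
  have hcolm : ∀ A, colorSet (B A) m = A := fun A => by
    ext p
    rw [mem_colorSet]
    simp only [B]
    split_ifs with h
    · simp [h]
    · simp [h, hm p]
  have hcol : ∀ A ∈ D, ∀ i ≠ m, colorSet (B A) i = colorSet r i := fun A hA i hi => by
    ext p
    rw [mem_colorSet, mem_colorSet]
    simp only [B]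
    split_ifs with h
    · simp [(mem_filter.mp hA).2 p h, Ne.symm hi]
    · rfl
  have hrm : ell q (colorSet r m) = 0 := by
    have : colorSet r m = ∅ := by
      ext p; simp [mem_colorSet, hm p]
    rw [this]; simp [ell]
  have heval : ∀ A ∈ D, recip q A ≤ ∏ p, primeEval m (q p) (r p) (B A p) := fun A hA => by
    have : ∏ p, primeEval m (q p) (r p) (B A p) = ∏ p, if p ∈ A then 1 / (q p - 1) else 1 := by
      refine Finset.prod_congr rfl fun p _ => ?_
      simp only [B]
      split_ifs with h
      · simp [primeEval, (mem_filter.mp hA).2 p h]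
      · simp [primeEval, hm p]
    rw [this, Fintype.prod_ite_mem, recip]
    refine Finset.prod_le_prod (fun p _ => (one_div_pos.mpr (hq0 p)).le) fun p _ => ?_
    exact one_div_le_one_div_of_le (by linarith [hq p]) (by linarith)
  have hy : ∀ A ∈ D, yval q G L (B A) =
      G (ell q A) * ∏ i ∈ univ.erase m, G (ell q (colorSet r i)) := fun A hA => by
    have hprod : ∏ i, G (ell q (colorSet (B A) i)) =
        G (ell q A) * ∏ i ∈ univ.erase m, G (ell q (colorSet r i)) := by
      rw [← mul_prod_erase univ _ (mem_univ m), hcolm]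
      congr 1
      exact Finset.prod_congr rfl fun i hi => by rw [hcol A hA i (Finset.ne_of_mem_erase hi)]
    unfold yval
    split_ifs with h
    · exact hprod
    · by_cases hz : G (ell q A) = 0
      · rw [hz, zero_mul]
      · exfalso
        apply h
        have h1 := hGL _ hz
        have h2 : ∑ i ∈ univ.erase m, ell q (colorSet (B A) i) =
            ∑ i ∈ univ.erase m, ell q (colorSet r i) :=
          Finset.sum_congr rfl fun i hi => by rw [hcol A hA i (Finset.ne_of_mem_erase hi)]
        rw [← add_sum_erase univ _ (mem_univ m), hrm, zero_add] at hr
        rw [← add_sum_erase univ _ (mem_univ m), hcolm, h2]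
        linarith
  have hPE : ∀ p a b, 0 ≤ primeEval m (q p) a b := fun p a b => by
    have : 0 < q p - 1 := by linarith [hq p]
    unfold primeEval
    split_ifs <;> positivity
  set Pr := ∏ i ∈ univ.erase m, G (ell q (colorSet r i)) with hPr
  have hPr0 : 0 ≤ Pr := Finset.prod_nonneg fun i _ => hG _
  calc Pr * (gsum q G * (1 - ∑ i, ∑ p ∈ colorSet r i, 1 / q p)) ≤
      Pr * ∑ A ∈ D, recip q A * G (ell q A) := by
        refine mul_le_mul_of_nonneg_left ?_ hPr0
        have hmem : ∑ p ∈ (univ.filter fun p => r p ≠ none), 1 / q p =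
            ∑ i, ∑ p ∈ colorSet r i, 1 / q p := by
          simp only [colorSet, sum_filter]
          rw [Finset.sum_comm]
          refine Finset.sum_congr rfl fun p _ => ?_
          rcases r p with _ | j <;> simp
        have hsub : gsum q G ≤ ∑ A ∈ D, recip q A * G (ell q A) +
            ∑ p ∈ (univ.filter fun p => r p ≠ none), ∑ A : Finset ι,
              (if p ∈ A then recip q A * G (ell q A) else 0) := by
          rw [Finset.sum_comm, hD, sum_filter, ← sum_add_distrib, gsum]
          refine Finset.sum_le_sum fun A _ => ?_
          have h0 : 0 ≤ recip q A * G (ell q A) := mul_nonneg (recip_nonneg hq0 A) (hG _)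
          have h1 : ∀ p ∈ (univ.filter fun p => r p ≠ none),
              0 ≤ if p ∈ A then recip q A * G (ell q A) else 0 := fun p _ => by
            split_ifs
            exacts [h0, le_rfl]
          split_ifs with h
          · exact le_add_of_nonneg_right (Finset.sum_nonneg h1)
          · push Not at h
            obtain ⟨p, hpA, hp⟩ := h
            rw [zero_add]
            refine le_trans ?_ (Finset.single_le_sum h1 (mem_filter.mpr ⟨mem_univ p, hp⟩))
            rw [if_pos hpA]
        have h2 : ∑ p ∈ (univ.filter fun p => r p ≠ none), ∑ A : Finset ι,
              (if p ∈ A then recip q A * G (ell q A) else 0) ≤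
            (∑ p ∈ (univ.filter fun p => r p ≠ none), 1 / q p) * gsum q G := by
          rw [sum_mul]
          exact Finset.sum_le_sum fun p _ => sum_mem_le hq1 hG hGa p
        rw [hmem] at h2
        linarith
    _ ≤ ∑ A ∈ D, (∏ p, primeEval m (q p) (r p) (B A p)) * yval q G L (B A) := by
        rw [mul_sum]
        refine Finset.sum_le_sum fun A hA => ?_
        rw [hy A hA, show Pr * (recip q A * G (ell q A)) = recip q A * (G (ell q A) * Pr) by ring]
        exact mul_le_mul_of_nonneg_right (heval A hA) (mul_nonneg (hG _) hPr0)
    _ = ∑ b ∈ D.image B, (∏ p, primeEval m (q p) (r p) (b p)) * yval q G L b := by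
        rw [sum_image fun _ _ _ _ h => hBinj h]
    _ ≤ _ := Finset.sum_le_sum_of_subset_of_nonneg (subset_univ _) fun b _ _ =>
        mul_nonneg (Finset.prod_nonneg fun p _ => hPE _ _ _) (yval_nonneg hG L b)

end Config

end GapRuns

namespace GapRuns
open Real Filter Topology Finset MeasureTheory

section Expectation

variable {α : Type*} [Fintype α] {k : ℕ}

lemma sum_prod_mul_apply {p : Fin k → α → ℝ} (h1 : ∀ i, ∑ a, p i a = 1) (i : Fin k) (f : α → ℝ) :
    ∑ t : Fin k → α, (∏ j, p j (t j)) * f (t i) = ∑ a, p i a * f a := by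
  have := Finset.prod_univ_sum (fun _ : Fin k => (univ : Finset α))
    (fun j a => p j a * if j = i then f a else 1)
  rw [Fintype.piFinset_univ] at this
  have e : ∀ t : Fin k → α, (∏ j, p j (t j)) * f (t i) =
      ∏ j, (p j (t j) * if j = i then f (t j) else 1) := fun t => by
    rw [prod_mul_distrib, Finset.prod_ite_eq' univ i (fun j => f (t j)), if_pos (mem_univ i)]
  rw [Finset.sum_congr rfl fun t _ => e t, ← this, Finset.prod_eq_single i]
  · simp
  · intro j _ hj; simp [hj, h1]
  · simp

lemma sum_prod_mul_apply_mul_apply {p : Fin k → α → ℝ} (h1 : ∀ i, ∑ a, p i a = 1) {i j : Fin k}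
    (hij : i ≠ j) (f g : α → ℝ) :
    ∑ t : Fin k → α, (∏ j, p j (t j)) * (f (t i) * g (t j)) =
      (∑ a, p i a * f a) * ∑ a, p j a * g a := by
  have := Finset.prod_univ_sum (fun _ : Fin k => (univ : Finset α))
    (fun l a => p l a * ((if l = i then f a else 1) * if l = j then g a else 1))
  rw [Fintype.piFinset_univ] at this
  have e : ∀ t : Fin k → α, (∏ j, p j (t j)) * (f (t i) * g (t j)) =
      ∏ l, (p l (t l) * ((if l = i then f (t l) else 1) * if l = j then g (t l) else 1)) :=
    fun t => by
      rw [prod_mul_distrib, prod_mul_distrib, Finset.prod_ite_eq' univ i (fun j => f (t j)),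
        Finset.prod_ite_eq' univ j (fun j => g (t j)), if_pos (mem_univ i), if_pos (mem_univ j)]
  rw [Finset.sum_congr rfl fun t _ => e t, ← this,
    Finset.prod_eq_mul i j hij]
  · simp [hij, hij.symm]
  · rintro l _ ⟨h2, h3⟩; simp [h2, h3, h1]
  · simp
  · simp

end Expectation

lemma one_sub_sum_le_prod {ι : Type*} (s : Finset ι) {x : ι → ℝ} (h0 : ∀ i, 0 ≤ x i)
    (h1 : ∀ i, x i ≤ 1) : 1 - ∑ i ∈ s, x i ≤ ∏ i ∈ s, (1 - x i) := by
  classical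
  induction s using Finset.induction_on with
  | empty => simp
  | insert a s ha ih =>
    rw [sum_insert ha, prod_insert ha]
    have h2 : ∏ i ∈ s, (1 - x i) ≤ 1 :=
      Finset.prod_le_one (fun i _ => by linarith [h1 i]) fun i _ => by linarith [h0 i]
    nlinarith [h0 a, h1 a]

section Config

set_option linter.unusedSectionVars false

variable {ι : Type*} [Fintype ι] [DecidableEq ι] {k : ℕ}

/-- The defect of a tuple of sets of primes: it is at most one when some sets meet,
when the sizes are too large, or when the reciprocal sum is too large. -/
noncomputable def quality (q : ι → ℝ) (L : ℝ) (t : Fin k → Finset ι) : ℝ :=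
  1 - (∑ i, ∑ j ∈ univ.erase i, ∑ p, (if p ∈ t i then 1 else 0) * (if p ∈ t j then 1 else 0)) -
    2 / L * ∑ i, ell q (t i) - (k + 2) * ∑ i, ∑ p ∈ t i, 1 / q p

lemma quality_nonpos {q : ι → ℝ} (hq : ∀ p, 1 < q p) {L : ℝ} (hL : 0 < L) {t : Fin k → Finset ι}
    {i j : Fin k} (hij : i ≠ j) {p : ι} (hi : p ∈ t i) (hj : p ∈ t j) : quality q L t ≤ 0 := by
  have h0 : ∀ (i j : Fin k) p,
      (0 : ℝ) ≤ (if p ∈ t i then 1 else 0) * (if p ∈ t j then 1 else 0) := fun i j p => by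
    split_ifs <;> norm_num
  have h1 : (1 : ℝ) ≤
      ∑ i, ∑ j ∈ univ.erase i, ∑ p, (if p ∈ t i then 1 else 0) * (if p ∈ t j then 1 else 0) := by
    refine le_trans ?_ (Finset.single_le_sum (fun i _ => Finset.sum_nonneg fun j _ =>
      Finset.sum_nonneg fun p _ => h0 i j p) (mem_univ i))
    refine le_trans ?_ (Finset.single_le_sum (fun j _ =>
      Finset.sum_nonneg fun p _ => h0 i j p) (mem_erase.mpr ⟨hij.symm, mem_univ j⟩))
    refine le_trans ?_ (Finset.single_le_sum (fun p _ => h0 i j p) (mem_univ p))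
    simp [hi, hj]
  have h2 : 0 ≤ 2 / L * ∑ i, ell q (t i) :=
    mul_nonneg (by positivity) (Finset.sum_nonneg fun i _ => ell_nonneg hq _)
  have h3 : 0 ≤ ((k : ℝ) + 2) * ∑ i, ∑ p ∈ t i, 1 / q p :=
    mul_nonneg (by positivity) (Finset.sum_nonneg fun i _ => Finset.sum_nonneg fun p _ =>
      (one_div_pos.mpr (zero_lt_one.trans (hq p))).le)
  unfold quality
  linarith

lemma exists_colorSet_eq {t : Fin k → Finset ι} (ht : ∀ i j, i ≠ j → ∀ p ∈ t i, p ∉ t j) :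
    ∃ r, colorSet r = t := by
  classical
  refine ⟨fun p => if h : ∃ i, p ∈ t i then some h.choose else none, ?_⟩
  funext i
  ext p
  rw [mem_colorSet]
  constructor
  · intro h
    by_cases h' : ∃ i, p ∈ t i
    · rw [dif_pos h'] at h
      rw [← Option.some.inj h]; exact h'.choose_spec
    · rw [dif_neg h'] at h; exact absurd h (by simp)
  · intro h
    have h' : ∃ i, p ∈ t i := ⟨i, h⟩
    rw [dif_pos h']
    by_contra hne
    exact ht _ _ (fun e => hne (congrArg some e)) p h'.choose_spec h

lemma half_le_sum_quality {q : ι → ℝ} {L : ℝ} (hL : 0 < L)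
    (hη : 16 * (k : ℝ) ^ 2 * ∑ p, 1 / q p ^ 2 ≤ 1) (hk : 0 < k) (hq : ∀ p, 0 < q p)
    {P : Fin k → Finset ι → ℝ} (hP : ∀ i A, 0 ≤ P i A) (hP1 : ∀ i, ∑ A, P i A = 1)
    (hmem : ∀ i p, ∑ A, P i A * (if p ∈ A then 1 else 0) ≤ 1 / q p)
    (hell : ∀ i, ∑ A, P i A * ell q A ≤ L / (8 * k)) :
    1 / 2 ≤ ∑ t : Fin k → Finset ι, (∏ i, P i (t i)) * quality q L t := by
  have hk' : (1 : ℝ) ≤ k := by exact_mod_cast hk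
  set η := ∑ p, 1 / q p ^ 2 with hηd
  have hη0 : 0 ≤ η := Finset.sum_nonneg fun p _ => by positivity
  have h1 : ∑ t : Fin k → Finset ι, (∏ i, P i (t i)) = 1 := by
    have := Finset.prod_univ_sum (fun _ : Fin k => (univ : Finset (Finset ι))) P
    rw [Fintype.piFinset_univ] at this
    rw [← this]; simp [hP1]
  have h2 : ∑ t : Fin k → Finset ι, (∏ i, P i (t i)) *
      (∑ i, ∑ j ∈ univ.erase i, ∑ p, (if p ∈ t i then 1 else 0) * (if p ∈ t j then 1 else 0)) ≤
      k * (k * η) := by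
    simp only [mul_sum]
    rw [Finset.sum_comm]
    have : ∀ i : Fin k, ∑ t : Fin k → Finset ι, ∑ j ∈ univ.erase i, ∑ p, (∏ i, P i (t i)) *
        ((if p ∈ t i then 1 else 0) * (if p ∈ t j then 1 else 0)) ≤ k * η := fun i => by
      rw [Finset.sum_comm]
      have h3 : ∀ j ∈ univ.erase i, ∑ t : Fin k → Finset ι, ∑ p, (∏ i, P i (t i)) *
          ((if p ∈ t i then 1 else 0) * (if p ∈ t j then 1 else 0)) ≤ η := fun j hj => by
        rw [Finset.sum_comm]
        refine Finset.sum_le_sum fun p _ => ?_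
        rw [sum_prod_mul_apply_mul_apply hP1 (Finset.ne_of_mem_erase hj).symm
          (fun A => if p ∈ A then 1 else 0) (fun A => if p ∈ A then 1 else 0)]
        refine (mul_le_mul (hmem i p) (hmem j p) (Finset.sum_nonneg fun A _ =>
          mul_nonneg (hP _ _) (by split_ifs <;> norm_num)) (one_div_pos.mpr (hq p)).le).trans ?_
        rw [← sq, div_pow, one_pow]
      refine (Finset.sum_le_sum h3).trans ?_
      rw [sum_const, nsmul_eq_mul]
      refine mul_le_mul_of_nonneg_right ?_ hη0
      have := card_le_card (erase_subset i univ)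
      rw [card_univ, Fintype.card_fin] at this
      exact_mod_cast this
    refine (Finset.sum_le_sum fun i _ => this i).trans ?_
    simp
  have h3 : ∑ t : Fin k → Finset ι, (∏ i, P i (t i)) * (2 / L * ∑ i, ell q (t i)) ≤ 1 / 4 := by
    have : ∀ t : Fin k → Finset ι, (∏ i, P i (t i)) * (2 / L * ∑ i, ell q (t i)) =
        ∑ i, 2 / L * ((∏ i, P i (t i)) * ell q (t i)) := fun t => by
      rw [← mul_sum, ← mul_sum]; ring
    rw [Finset.sum_congr rfl fun t _ => this t, Finset.sum_comm]
    calc _ ≤ ∑ _i : Fin k, 2 / L * (L / (8 * k)) := Finset.sum_le_sum fun i _ => by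
          rw [← mul_sum, sum_prod_mul_apply hP1 i (ell q)]
          exact mul_le_mul_of_nonneg_left (hell i) (by positivity)
      _ = 1 / 4 := by
          simp only [sum_const, card_univ, Fintype.card_fin, nsmul_eq_mul]
          field_simp; norm_num
  have h4 : ∑ t : Fin k → Finset ι, (∏ i, P i (t i)) * ((k + 2) * ∑ i, ∑ p ∈ t i, 1 / q p) ≤
      (k + 2) * (k * η) := by
    have : ∀ t : Fin k → Finset ι, (∏ i, P i (t i)) * ((k + 2) * ∑ i, ∑ p ∈ t i, 1 / q p) =
        (k + 2) * ∑ i, ∑ p, 1 / q p * ((∏ i, P i (t i)) * if p ∈ t i then 1 else 0) := fun t => by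
      rw [mul_left_comm, mul_sum]
      congr 1
      refine Finset.sum_congr rfl fun i _ => ?_
      rw [← Fintype.sum_ite_mem, mul_sum]
      refine Finset.sum_congr rfl fun p _ => ?_
      split_ifs <;> ring
    rw [Finset.sum_congr rfl fun t _ => this t, ← mul_sum, Finset.sum_comm]
    refine mul_le_mul_of_nonneg_left ?_ (by positivity)
    calc _ ≤ ∑ _i : Fin k, η := Finset.sum_le_sum fun i _ => by
          rw [Finset.sum_comm]
          refine Finset.sum_le_sum fun p _ => ?_
          rw [← mul_sum, sum_prod_mul_apply hP1 i (fun A => if p ∈ A then 1 else 0)]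
          refine (mul_le_mul_of_nonneg_left (hmem i p) (one_div_pos.mpr (hq p)).le).trans ?_
          rw [← sq, div_pow, one_pow]
      _ = k * η := by simp
  have h5 : ∑ t : Fin k → Finset ι, (∏ i, P i (t i)) * quality q L t =
      ∑ t : Fin k → Finset ι, (∏ i, P i (t i)) -
      ∑ t : Fin k → Finset ι, (∏ i, P i (t i)) *
        (∑ i, ∑ j ∈ univ.erase i, ∑ p, (if p ∈ t i then 1 else 0) * (if p ∈ t j then 1 else 0)) -
      ∑ t : Fin k → Finset ι, (∏ i, P i (t i)) * (2 / L * ∑ i, ell q (t i)) -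
      ∑ t : Fin k → Finset ι, (∏ i, P i (t i)) * ((k + 2) * ∑ i, ∑ p ∈ t i, 1 / q p) := by
    rw [← sum_sub_distrib, ← sum_sub_distrib, ← sum_sub_distrib]
    refine Finset.sum_congr rfl fun t _ => ?_
    unfold quality; ring
  rw [h5, h1]
  nlinarith [mul_nonneg (sub_nonneg.mpr hk') hη0]

set_option maxHeartbeats 600000 in
/-- Lower bound for the mean square of the sieve weight over primes. -/
lemma tensorForm_prime_ge {q : ι → ℝ} (hq : ∀ p, 2 ≤ q p) (hkq : ∀ p, (k : ℝ) ≤ q p) {G : ℝ → ℝ}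
    (hG : ∀ s, 0 ≤ G s) (hGa : Antitone G) {L : ℝ} (hL : 0 < L)
    (hGL : ∀ s, G s ≠ 0 → s ≤ L / 2) (m : Fin k) (hA : 0 < gsum q fun s => G s ^ 2)
    (hT : gsum q (fun s => G s ^ 2 * s) ≤ (gsum q fun s => G s ^ 2) * (L / (8 * k)))
    (hη : 16 * (k : ℝ) ^ 2 * ∑ p, 1 / q p ^ 2 ≤ 1) :
    gsum q G ^ 2 * (gsum q fun s => G s ^ 2) ^ (k - 1) / 2 ≤
      tensorForm (fun p => primeLaw m (q p)) (fun p => evalAt (q p)) (yval q G L) := by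
  have hq1 : ∀ p, 1 < q p := fun p => by linarith [hq p]
  have hq0 : ∀ p, 0 < q p := fun p => by linarith [hq p]
  have hk0 : 0 < k := m.pos
  have hk1 : (1 : ℝ) ≤ k := by exact_mod_cast hk0
  have hx0 : ∀ p, 0 ≤ k / q p := fun p => div_nonneg (by positivity) (hq0 p).le
  have hx1 : ∀ p, k / q p ≤ 1 := fun p => div_le_one_of_le₀ (hkq p) (hq0 p).le
  have hdiag : ∀ p (a : Option (Fin k)), 0 ≤ primeDiag m (q p) a := fun p a => by
    rcases a with _ | i
    · simp [primeDiag]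
    · simp only [primeDiag]
      split_ifs
      · exact le_rfl
      · exact mul_nonneg (one_div_pos.mpr (hq0 p)).le (by linarith [hx1 p])
  have hlaw : ∀ p (a : Option (Fin k)), 0 ≤ primeLaw m (q p) a := fun p a => by
    have h1 : 0 < q p - 1 := by linarith [hq p]
    rcases a with _ | i
    · simp only [primeLaw]
      rw [sub_nonneg, div_le_one h1]; linarith [hkq p]
    · simp only [primeLaw]
      split_ifs <;> positivity
  refine le_trans ?_ (tensorForm_mono hdiag hlaw
    (fun p x => primeLaw_form_ge m (hq1 p) (hkq p) x) _)
  set A2 := gsum q fun s => G s ^ 2 with hA2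
  have hG2a : Antitone fun s => G s ^ 2 := fun a b h => pow_le_pow_left₀ (hG b) (hGa h) 2
  set wt : Fin k → Finset ι → ℝ := fun i A =>
    if i = m then (if A = ∅ then 1 else 0) else recip q A * G (ell q A) ^ 2 with hwt
  have hwt0 : ∀ i A, 0 ≤ wt i A := fun i A => by
    have := recip_nonneg hq0 A
    simp only [hwt]; split_ifs <;> positivity
  set Z : Fin k → ℝ := fun i => if i = m then 1 else A2 with hZ
  have hZ0 : ∀ i, 0 < Z i := fun i => by simp only [hZ]; split_ifs <;> positivity
  have hprodZ : ∏ i, Z i = A2 ^ (k - 1) := by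
    rw [← mul_prod_erase univ Z (mem_univ m), show Z m = 1 by simp [hZ], one_mul,
      Finset.prod_congr rfl (g := fun _ => A2) fun i hi => by
        simp [hZ, Finset.ne_of_mem_erase hi], prod_const, card_erase_of_mem (mem_univ m),
      card_univ, Fintype.card_fin]
  set P : Fin k → Finset ι → ℝ := fun i A => wt i A / Z i with hP
  have hhalf : 1 / 2 ≤ ∑ t : Fin k → Finset ι, (∏ i, P i (t i)) * quality q L t := by
    refine half_le_sum_quality hL hη hk0 hq0 (fun i A => div_nonneg (hwt0 i A) (hZ0 i).le)
      (fun i => ?_) (fun i p => ?_) fun i => ?_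
    · simp only [hP]
      rw [← sum_div, div_eq_one_iff_eq (hZ0 i).ne']
      simp only [hwt, hZ]
      split_ifs with h
      · simp
      · rfl
    · have : ∑ A, P i A * (if p ∈ A then 1 else 0) =
          (∑ A, if p ∈ A then wt i A else 0) / Z i := by
        rw [sum_div]
        refine Finset.sum_congr rfl fun A _ => ?_
        simp only [hP]; split_ifs <;> ring
      rw [this, div_le_iff₀ (hZ0 i)]
      simp only [hwt, hZ]
      split_ifs with h
      · refine le_trans (le_of_eq ?_) (mul_nonneg (one_div_pos.mpr (hq0 p)).le zero_le_one)
        refine Finset.sum_eq_zero fun A _ => ?_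
        split_ifs with h1 h2
        · simp [h2] at h1
        · rfl
        · rfl
      · exact sum_mem_le hq1 (fun s => sq_nonneg (G s)) hG2a p
    · have : ∑ A, P i A * ell q A = (∑ A, wt i A * ell q A) / Z i := by
        rw [sum_div]
        refine Finset.sum_congr rfl fun A _ => ?_
        simp only [hP]; ring
      rw [this, div_le_iff₀ (hZ0 i)]
      simp only [hwt, hZ]
      split_ifs with h
      · simp only [ite_mul, one_mul, zero_mul, sum_ite_eq', Finset.mem_univ, if_true, ell,
          sum_empty]
        positivity
      · rw [mul_comm (L / _)]
        refine le_trans (le_of_eq ?_) hT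
        exact Finset.sum_congr rfl fun A _ => by ring
  have hrange : ∑ t : Fin k → Finset ι, (∏ i, P i (t i)) * quality q L t ≤
      ∑ r : ι → Option (Fin k), (∏ i, P i (colorSet r i)) * quality q L (colorSet r) := by
    rw [← sum_image (f := fun t : Fin k → Finset ι => (∏ i, P i (t i)) * quality q L t)
      (g := (colorSet : (ι → Option (Fin k)) → Fin k → Finset ι))
      fun _ _ _ _ h => colorSet_injective h]
    rw [← sum_add_sum_compl (univ.image (colorSet : (ι → Option (Fin k)) → Fin k → Finset ι))]
    refine add_le_of_nonpos_right (Finset.sum_nonpos fun t ht => ?_)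
    refine mul_nonpos_of_nonneg_of_nonpos
      (Finset.prod_nonneg fun i _ => div_nonneg (hwt0 _ _) (hZ0 i).le) ?_
    by_contra hneg
    rw [mem_compl] at ht
    apply ht
    obtain ⟨r, hr⟩ := exists_colorSet_eq (t := t) fun i j hij p hi hj =>
      hneg (quality_nonpos hq1 hL hij hi hj)
    exact mem_image.mpr ⟨r, mem_univ r, hr⟩
  have hterm : ∀ r : ι → Option (Fin k),
      gsum q G ^ 2 * A2 ^ (k - 1) * ((∏ i, P i (colorSet r i)) * quality q L (colorSet r)) ≤
      (∏ p, primeDiag m (q p) (r p)) *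
        (∑ b : ι → Option (Fin k), (∏ p, primeEval m (q p) (r p) (b p)) * yval q G L b) ^ 2 := by
    intro r
    have hR0 : 0 ≤ (∏ p, primeDiag m (q p) (r p)) *
        (∑ b : ι → Option (Fin k), (∏ p, primeEval m (q p) (r p) (b p)) * yval q G L b) ^ 2 :=
      mul_nonneg (Finset.prod_nonneg fun p _ => hdiag _ _) (sq_nonneg _)
    have hPw : A2 ^ (k - 1) * ∏ i, P i (colorSet r i) = ∏ i, wt i (colorSet r i) := by
      simp only [hP]
      rw [prod_div_distrib, hprodZ, mul_div_cancel₀ _ (by positivity)]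
    rw [show gsum q G ^ 2 * A2 ^ (k - 1) * ((∏ i, P i (colorSet r i)) * quality q L (colorSet r)) =
      gsum q G ^ 2 * (A2 ^ (k - 1) * ∏ i, P i (colorSet r i)) * quality q L (colorSet r) by ring,
      hPw]
    have hw0 : 0 ≤ gsum q G ^ 2 * ∏ i, wt i (colorSet r i) :=
      mul_nonneg (sq_nonneg _) (Finset.prod_nonneg fun i _ => hwt0 _ _)
    by_cases hQ : quality q L (colorSet r) ≤ 0
    · exact (mul_nonpos_of_nonneg_of_nonpos hw0 hQ).trans hR0
    push Not at hQ
    by_cases hm : ∃ p, r p = some m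
    · obtain ⟨p, hp⟩ := hm
      have : wt m (colorSet r m) = 0 := by
        simp only [hwt, if_true]
        rw [if_neg (Finset.ne_empty_of_mem (mem_colorSet.mpr hp))]
      rw [Finset.prod_eq_zero (mem_univ m) this, mul_zero, zero_mul]
      exact hR0
    push Not at hm
    set ξ := ∑ i, ∑ p ∈ colorSet r i, 1 / q p with hξ
    have hξ0 : 0 ≤ ξ := Finset.sum_nonneg fun i _ => Finset.sum_nonneg fun p _ =>
      (one_div_pos.mpr (hq0 p)).le
    have hS0 : 0 ≤ ∑ i, ell q (colorSet r i) := Finset.sum_nonneg fun i _ => ell_nonneg hq1 _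
    have hD0 : (0 : ℝ) ≤ ∑ i, ∑ j ∈ univ.erase i, ∑ p, (if p ∈ colorSet r i then 1 else 0) *
        (if p ∈ colorSet r j then 1 else 0) :=
      Finset.sum_nonneg fun i _ => Finset.sum_nonneg fun j _ => Finset.sum_nonneg fun p _ => by
        split_ifs <;> norm_num
    have hQle : quality q L (colorSet r) ≤ 1 - 2 / L * (∑ i, ell q (colorSet r i)) - (k + 2) * ξ := by
      unfold quality; linarith
    have hξ1 : (k + 2) * ξ < 1 := by
      have : 0 ≤ 2 / L * ∑ i, ell q (colorSet r i) := mul_nonneg (by positivity) hS0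
      linarith
    have hSL : ∑ i, ell q (colorSet r i) ≤ L / 2 := by
      have h1 : 2 / L * ∑ i, ell q (colorSet r i) ≤ 1 := by
        have : 0 ≤ (k + 2) * ξ := by positivity
        linarith
      rw [div_mul_eq_mul_div, div_le_one hL] at h1
      linarith
    have hY := sum_primeEval_ge hq hG hGa hGL hm hSL
    rw [← hξ] at hY
    set Y := ∑ b : ι → Option (Fin k), (∏ p, primeEval m (q p) (r p) (b p)) * yval q G L b with hYd
    set Pr := ∏ i ∈ univ.erase m, G (ell q (colorSet r i)) with hPr
    have hPr0 : 0 ≤ Pr := Finset.prod_nonneg fun i _ => hG _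
    have hA10 : 0 ≤ gsum q G := Finset.sum_nonneg fun A _ => mul_nonneg (recip_nonneg hq0 A) (hG _)
    have hcm : colorSet r m = ∅ := by
      ext p; simp [mem_colorSet, hm p]
    set Rr := ∏ i ∈ univ.erase m, recip q (colorSet r i) with hRr
    have hRr0 : 0 ≤ Rr := Finset.prod_nonneg fun i _ => recip_nonneg hq0 _
    have hwprod : ∏ i, wt i (colorSet r i) = Rr * Pr ^ 2 := by
      rw [← mul_prod_erase univ _ (mem_univ m)]
      simp only [hwt, if_true, hcm, one_mul]
      rw [hRr, hPr, ← prod_pow, ← prod_mul_distrib]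
      exact Finset.prod_congr rfl fun i hi => if_neg (Finset.ne_of_mem_erase hi)
    have hdprod : Rr * (1 - k * ξ) ≤ ∏ p, primeDiag m (q p) (r p) := by
      rw [prod_config (fun p a => primeDiag m (q p) a) fun p => rfl,
        ← mul_prod_erase univ _ (mem_univ m), hcm, prod_empty, one_mul]
      have e : ∀ i ∈ univ.erase m, ∏ p ∈ colorSet r i, primeDiag m (q p) (some i) =
          recip q (colorSet r i) * ∏ p ∈ colorSet r i, (1 - k / q p) := fun i hi => by
        rw [recip, ← prod_mul_distrib]
        refine Finset.prod_congr rfl fun p _ => ?_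
        simp only [primeDiag]
        rw [if_neg (Finset.ne_of_mem_erase hi)]
      rw [Finset.prod_congr rfl e, prod_mul_distrib]
      refine mul_le_mul_of_nonneg_left ?_ hRr0
      have e2 : ∏ i ∈ univ.erase m, ∏ p ∈ colorSet r i, (1 - k / q p) =
          ∏ p, (1 - if r p = none then 0 else k / q p) := by
        rw [show ∏ i ∈ univ.erase m, ∏ p ∈ colorSet r i, (1 - k / q p) =
          ∏ i, ∏ p ∈ colorSet r i, (1 - k / q p) by
            rw [← mul_prod_erase univ _ (mem_univ m), hcm, prod_empty, one_mul]]
        rw [show (∏ p, (1 - if r p = none then 0 else k / q p)) = _ from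
          prod_config (fun p a => 1 - if a = none then 0 else k / q p) (fun p => by simp) r]
        simp
      have e3 : k * ξ = ∑ p, if r p = none then 0 else k / q p := by
        rw [hξ]
        simp only [colorSet, sum_filter, mul_sum]
        rw [Finset.sum_comm]
        refine Finset.sum_congr rfl fun p _ => ?_
        rcases r p with _ | j
        · simp
        · simp [div_eq_mul_inv]
      rw [e2, e3]
      refine one_sub_sum_le_prod univ (fun p => ?_) fun p => ?_
      · split_ifs
        exacts [le_rfl, hx0 p]
      · split_ifs
        exacts [zero_le_one, hx1 p]
    have hkξ : 0 ≤ 1 - k * ξ := by linarith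
    have hξ2 : 0 ≤ 1 - ξ := by linarith [le_mul_of_one_le_left hξ0 hk1]
    have hY2 : (Pr * (gsum q G * (1 - ξ))) ^ 2 ≤ Y ^ 2 :=
      pow_le_pow_left₀ (mul_nonneg hPr0 (mul_nonneg hA10 hξ2)) hY 2
    rw [hwprod]
    calc gsum q G ^ 2 * (Rr * Pr ^ 2) * quality q L (colorSet r) ≤
        gsum q G ^ 2 * (Rr * Pr ^ 2) * ((1 - k * ξ) * (1 - ξ) ^ 2) := by
          refine mul_le_mul_of_nonneg_left ?_ (by positivity)
          have : 0 ≤ 2 / L * ∑ i, ell q (colorSet r i) := mul_nonneg (by positivity) hS0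
          have h2 : (1 - k * ξ) * (1 - 2 * ξ) ≤ (1 - k * ξ) * (1 - ξ) ^ 2 :=
            mul_le_mul_of_nonneg_left (by linarith [sq_nonneg ξ, show (1 - ξ) ^ 2 = 1 - 2 * ξ + ξ ^ 2 by ring]) hkξ
          have h3 : (1 - k * ξ) * (1 - 2 * ξ) = 1 - (k + 2) * ξ + 2 * (k * ξ ^ 2) := by ring
          have h4 : 0 ≤ k * ξ ^ 2 := by positivity
          linarith
      _ = (Rr * (1 - k * ξ)) * (Pr * (gsum q G * (1 - ξ))) ^ 2 := by ring
      _ ≤ _ := mul_le_mul hdprod hY2 (sq_nonneg _) (Finset.prod_nonneg fun p _ => hdiag _ _)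
  have hC : 0 ≤ gsum q G ^ 2 * A2 ^ (k - 1) := by positivity
  calc gsum q G ^ 2 * A2 ^ (k - 1) / 2 ≤ gsum q G ^ 2 * A2 ^ (k - 1) *
        ∑ r : ι → Option (Fin k), (∏ i, P i (colorSet r i)) * quality q L (colorSet r) := by
        rw [div_eq_mul_one_div]
        exact mul_le_mul_of_nonneg_left (hhalf.trans hrange) hC
    _ ≤ _ := by
        rw [mul_sum]
        exact Finset.sum_le_sum fun r _ => hterm r

end Config

end GapRuns

namespace GapRuns
open Real Filter Topology Finset MeasureTheory

section CoprimeSums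

lemma sum_Ico_coprime_ge {W : ℕ} (hW : 0 < W) (N : ℕ) :
    (W.totient / W : ℝ) * harmonic N ≤
      ∑ n ∈ Ico 1 (1 + N * W) with W.Coprime n, 1 / (n : ℝ) := by
  have hW' : (0 : ℝ) < W := by exact_mod_cast hW
  simp only [sum_filter]
  induction N with
  | zero => simp
  | succ N ih =>
    rw [← Finset.sum_Ico_consecutive _ (by omega : 1 ≤ 1 + N * W)
      (by nlinarith : 1 + N * W ≤ 1 + (N + 1) * W), harmonic_succ]
    have h1 : (W.totient / W : ℝ) * ((N : ℝ) + 1)⁻¹ ≤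
        ∑ n ∈ Ico (1 + N * W) (1 + (N + 1) * W), if W.Coprime n then 1 / (n : ℝ) else 0 := by
      rw [← sum_filter]
      have hc := Nat.filter_coprime_Ico_eq_totient W (1 + N * W)
      rw [show 1 + N * W + W = 1 + (N + 1) * W by ring] at hc
      calc (W.totient / W : ℝ) * ((N : ℝ) + 1)⁻¹ =
          ∑ n ∈ Ico (1 + N * W) (1 + (N + 1) * W) with W.Coprime n, 1 / (((N : ℝ) + 1) * W) := by
            rw [sum_const, hc, nsmul_eq_mul]; field_simp
        _ ≤ _ := by
            refine Finset.sum_le_sum fun n hn => ?_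
            have hn' := Finset.mem_Ico.mp (mem_filter.mp hn).1
            refine one_div_le_one_div_of_le (by exact_mod_cast (by omega : 0 < n)) ?_
            have : n ≤ (N + 1) * W := by omega
            exact_mod_cast this
    push_cast
    rw [mul_add]
    exact add_le_add ih h1

lemma sum_Ico_coprime_le {W : ℕ} (hW : 0 < W) (N : ℕ) :
    ∑ n ∈ Ico 1 (1 + (N + 1) * W) with W.Coprime n, 1 / (n : ℝ) ≤
      W + (W.totient / W : ℝ) * harmonic N := by
  have hW' : (0 : ℝ) < W := by exact_mod_cast hW
  simp only [sum_filter]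
  induction N with
  | zero =>
    calc _ ≤ ∑ n ∈ Ico 1 (1 + (0 + 1) * W), (1 : ℝ) := by
          refine Finset.sum_le_sum fun n hn => ?_
          have := (Finset.mem_Ico.mp hn).1
          split_ifs
          · rw [div_le_one (by exact_mod_cast this)]; exact_mod_cast this
          · exact zero_le_one
      _ = _ := by simp
  | succ N ih =>
    rw [← Finset.sum_Ico_consecutive _ (by nlinarith : 1 ≤ 1 + (N + 1) * W)
      (by nlinarith : 1 + (N + 1) * W ≤ 1 + (N + 1 + 1) * W), harmonic_succ]
    have h1 : ∑ n ∈ Ico (1 + (N + 1) * W) (1 + (N + 1 + 1) * W),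
        (if W.Coprime n then 1 / (n : ℝ) else 0) ≤ (W.totient / W : ℝ) * ((N : ℝ) + 1)⁻¹ := by
      rw [← sum_filter]
      have hc := Nat.filter_coprime_Ico_eq_totient W (1 + (N + 1) * W)
      rw [show 1 + (N + 1) * W + W = 1 + (N + 1 + 1) * W by ring] at hc
      calc _ ≤ ∑ n ∈ Ico (1 + (N + 1) * W) (1 + (N + 1 + 1) * W) with W.Coprime n,
            1 / (((N : ℝ) + 1) * W) := by
            refine Finset.sum_le_sum fun n hn => ?_
            have hn' := Finset.mem_Ico.mp (mem_filter.mp hn).1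
            refine one_div_le_one_div_of_le (by positivity) ?_
            have : (N + 1) * W ≤ n := by omega
            exact_mod_cast this
        _ = _ := by rw [sum_const, hc, nsmul_eq_mul]; field_simp
    push_cast
    rw [mul_add]
    linarith

/-- The reciprocal sum over integers up to `exp t` coprime to `W`. -/
noncomputable def coprimeSum (W : ℕ) (t : ℝ) : ℝ :=
  ∑ n ∈ Icc 1 ⌊exp t⌋₊ with W.Coprime n, 1 / (n : ℝ)

lemma coprimeSum_ge {W : ℕ} (hW : 0 < W) (t : ℝ) :
    (W.totient / W : ℝ) * (t - log W) ≤ coprimeSum W t := by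
  have hW' : (0 : ℝ) < W := by exact_mod_cast hW
  set N := ⌊exp t / W⌋₊ with hN
  refine le_trans ?_ ((sum_Ico_coprime_ge hW N).trans ?_)
  · refine mul_le_mul_of_nonneg_left ?_ (by positivity)
    refine le_trans ?_ (log_add_one_le_harmonic N)
    rw [show t - log W = log (exp t / W) by rw [log_div (exp_pos _).ne' hW'.ne', log_exp]]
    refine log_le_log (by positivity) ?_
    push_cast
    exact (Nat.lt_floor_add_one _).le
  · refine Finset.sum_le_sum_of_subset_of_nonneg (filter_subset_filter _ fun n hn => ?_)
      fun n _ _ => by positivity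
    have hn' := Finset.mem_Ico.mp hn
    refine Finset.mem_Icc.mpr ⟨hn'.1, Nat.le_floor ?_⟩
    have h1 : (n : ℝ) ≤ N * W := by exact_mod_cast (by omega : n ≤ N * W)
    have h2 : (N : ℝ) ≤ exp t / W := Nat.floor_le (by positivity)
    rw [le_div_iff₀ hW'] at h2
    linarith

lemma coprimeSum_le {W : ℕ} (hW : 0 < W) {t : ℝ} (ht : 0 ≤ t) :
    coprimeSum W t ≤ W + (W.totient / W : ℝ) * (1 + t) := by
  have hW' : (0 : ℝ) < W := by exact_mod_cast hW
  set N := ⌊exp t / W⌋₊ with hN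
  refine le_trans ?_ ((sum_Ico_coprime_le hW N).trans ?_)
  · refine Finset.sum_le_sum_of_subset_of_nonneg (filter_subset_filter _ fun n hn => ?_)
      fun n _ _ => by positivity
    have hn' := Finset.mem_Icc.mp hn
    refine Finset.mem_Ico.mpr ⟨hn'.1, ?_⟩
    have h1 : (n : ℝ) ≤ exp t :=
      (Nat.le_floor_iff (exp_pos t).le).mp hn'.2
    have h2 := Nat.lt_floor_add_one (exp t / W)
    rw [div_lt_iff₀ hW'] at h2
    have : (n : ℝ) < (N + 1) * W := lt_of_le_of_lt h1 h2
    have : n < (N + 1) * W := by exact_mod_cast this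
    omega
  · gcongr
    refine (harmonic_le_one_add_log N).trans ?_
    rcases Nat.eq_zero_or_pos N with h0 | h0
    · rw [h0]; simp [ht]
    · have h2 : (N : ℝ) ≤ exp t / W := Nat.floor_le (by positivity)
      have h3 : exp t / W ≤ exp t := div_le_self (exp_pos t).le (by exact_mod_cast hW)
      have := log_le_log (by exact_mod_cast h0) (h2.trans h3)
      rw [log_exp] at this
      linarith

end CoprimeSums

section SievePrimes

/-- The primes used by the sieve. -/
def sievePrimes (D R : ℕ) : Finset ℕ := (Ioc D R).filter Nat.Prime

variable {D R : ℕ}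

lemma sievePrimes_prime (p : sievePrimes D R) : (p : ℕ).Prime := (mem_filter.mp p.2).2

lemma lt_sievePrimes (p : sievePrimes D R) : D < (p : ℕ) :=
  (Finset.mem_Ioc.mp (mem_filter.mp p.2).1).1

/-- A prime of the sieve as a real number. -/
noncomputable def pval (p : sievePrimes D R) : ℝ := ((p : ℕ) : ℝ)

/-- The product of a set of primes. -/
def prodSet (A : Finset (sievePrimes D R)) : ℕ := ∏ p ∈ A, (p : ℕ)

lemma prodSet_pos (A : Finset (sievePrimes D R)) : 0 < prodSet A :=
  Finset.prod_pos fun p _ => (sievePrimes_prime p).pos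

lemma one_lt_pval (p : sievePrimes D R) : 1 < pval p := by
  unfold pval; exact_mod_cast (sievePrimes_prime p).one_lt

lemma recip_pval (A : Finset (sievePrimes D R)) : recip pval A = 1 / (prodSet A : ℝ) := by
  unfold recip prodSet pval
  rw [prod_div_distrib]; simp

lemma ell_pval (A : Finset (sievePrimes D R)) : ell pval A = log (prodSet A) := by
  unfold ell prodSet pval
  rw [Nat.cast_prod, log_prod fun p _ => by
    exact_mod_cast (sievePrimes_prime p).ne_zero]

lemma prodSet_primeFactors (A : Finset (sievePrimes D R)) :
    (prodSet A).primeFactors = A.image (fun p : sievePrimes D R => (p : ℕ)) := by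
  unfold prodSet
  rw [← Finset.prod_image (f := fun n : ℕ => n) (g := fun p : sievePrimes D R => (p : ℕ))
    fun x _ y _ h => Subtype.ext h]
  refine Nat.primeFactors_prod fun p hp => ?_
  obtain ⟨x, -, rfl⟩ := mem_image.mp hp
  exact sievePrimes_prime x

lemma prodSet_injective : Function.Injective (prodSet : Finset (sievePrimes D R) → ℕ) := by
  intro A B h
  have := congrArg Nat.primeFactors h
  rw [prodSet_primeFactors, prodSet_primeFactors] at this
  exact Finset.image_injective Subtype.val_injective this

lemma coprime_primorial_sievePrimes (p : sievePrimes D R) : (primorial D).Coprime p := by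
  rw [Nat.coprime_comm, (sievePrimes_prime p).coprime_iff_not_dvd,
    (sievePrimes_prime p).dvd_primorial_iff]
  exact (lt_sievePrimes p).not_ge

lemma coprime_primorial_prodSet (A : Finset (sievePrimes D R)) :
    (primorial D).Coprime (prodSet A) :=
  Nat.Coprime.prod_right fun p _ => coprime_primorial_sievePrimes p

lemma exists_prodSet_eq {n : ℕ} (hn : Squarefree n) (hnD : (primorial D).Coprime n) (hnR : n ≤ R) :
    ∃ A : Finset (sievePrimes D R), prodSet A = n := by
  have h0 : n ≠ 0 := hn.ne_zero
  have hsub : n.primeFactors ⊆ sievePrimes D R := fun p hp => by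
    have hpp := Nat.prime_of_mem_primeFactors hp
    have hpn := Nat.dvd_of_mem_primeFactors hp
    refine mem_filter.mpr ⟨Finset.mem_Ioc.mpr ⟨?_, (Nat.le_of_dvd (by omega) hpn).trans hnR⟩, hpp⟩
    by_contra h
    push Not at h
    have := Nat.dvd_gcd (hpp.dvd_primorial_iff.mpr h) hpn
    rw [hnD] at this
    exact hpp.one_lt.ne' (Nat.dvd_one.mp this)
  refine ⟨univ.filter fun p => (p : ℕ) ∈ n.primeFactors, ?_⟩
  unfold prodSet
  rw [prod_filter, Finset.prod_coe_sort (sievePrimes D R)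
    (fun p => if p ∈ n.primeFactors then p else 1), ← prod_filter, filter_mem_eq_inter,
    inter_eq_right.mpr hsub, Nat.prod_primeFactors_of_squarefree hn]

/-- The harmonic sum over squarefree products of sieve primes up to `exp t`. -/
noncomputable def cutSum (D R : ℕ) (t : ℝ) : ℝ :=
  gsum (pval : sievePrimes D R → ℝ) fun s => if s ≤ t then 1 else 0

lemma cutSum_eq (D R : ℕ) (t : ℝ) : cutSum D R t =
    ∑ A : Finset (sievePrimes D R) with prodSet A ≤ ⌊exp t⌋₊, 1 / (prodSet A : ℝ) := by
  unfold cutSum gsum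
  rw [sum_filter]
  refine Finset.sum_congr rfl fun A _ => ?_
  have h0 : (0 : ℝ) < prodSet A := by exact_mod_cast prodSet_pos A
  have : ell pval A ≤ t ↔ prodSet A ≤ ⌊exp t⌋₊ := by
    rw [ell_pval, Nat.le_floor_iff (exp_pos t).le, log_le_iff_le_exp h0]
  rw [recip_pval]
  simp only [this]
  split_ifs <;> simp

lemma cutSum_le (D R : ℕ) (t : ℝ) : cutSum D R t ≤ coprimeSum (primorial D) t := by
  rw [cutSum_eq, coprimeSum, ← sum_image (f := fun n : ℕ => 1 / (n : ℝ))
    fun _ _ _ _ h => prodSet_injective h]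
  refine Finset.sum_le_sum_of_subset_of_nonneg (fun n hn => ?_) fun n _ _ => by positivity
  obtain ⟨A, hA, rfl⟩ := mem_image.mp hn
  exact mem_filter.mpr ⟨Finset.mem_Icc.mpr ⟨prodSet_pos A, (mem_filter.mp hA).2⟩,
    coprime_primorial_prodSet A⟩

lemma coprimeSum_le_two_mul (D R : ℕ) {t : ℝ} (ht : exp t ≤ R) :
    coprimeSum (primorial D) t ≤ 2 * cutSum D R t := by
  set X := ⌊exp t⌋₊ with hX
  have hXR : X ≤ R := Nat.floor_le_of_le ht
  have h2 : ∑ d ∈ Icc 1 X, 1 / (d : ℝ) ^ 2 ≤ 2 := by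
    have := sum_Ioo_inv_sq_le (α := ℝ) 0 (X + 1)
    simp only [Nat.cast_zero, zero_add, div_one] at this
    refine le_trans (le_of_eq ?_) this
    refine Finset.sum_congr ?_ fun d _ => one_div _
    ext d
    rw [Finset.mem_Icc, Finset.mem_Ioo]
    omega
  set T : Finset (Finset (sievePrimes D R)) := univ.filter fun A => prodSet A ≤ X with hT
  have hcut : cutSum D R t = ∑ A ∈ T, 1 / (prodSet A : ℝ) := cutSum_eq D R t
  calc coprimeSum (primorial D) t ≤
      ∑ n ∈ (T ×ˢ Icc 1 X).image (fun z : Finset (sievePrimes D R) × ℕ => z.2 ^ 2 * prodSet z.1),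
        1 / (n : ℝ) := by
        refine Finset.sum_le_sum_of_subset_of_nonneg (fun n hn => ?_) fun n _ _ => by positivity
        obtain ⟨hn1, hn2⟩ := mem_filter.mp hn
        rw [Finset.mem_Icc] at hn1
        obtain ⟨a, b, hab, ha⟩ := Nat.sq_mul_squarefree n
        have hb0 : 0 < b := Nat.pos_of_ne_zero fun h => by
          rw [h, zero_pow two_ne_zero, zero_mul] at hab; omega
        have ha0 : 0 < a := Nat.pos_of_ne_zero ha.ne_zero
        have han : a ≤ n := Nat.le_of_dvd (by omega) (Dvd.intro_left _ hab)
        have hbn : b ≤ n := Nat.le_of_dvd (by omega)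
          ((dvd_pow_self b two_ne_zero).trans (Dvd.intro _ hab))
        obtain ⟨A, hA⟩ := exists_prodSet_eq (D := D) (R := R) ha
          (hn2.coprime_dvd_right (Dvd.intro_left _ hab)) (by omega)
        refine mem_image.mpr ⟨(A, b), Finset.mem_product.mpr
          ⟨mem_filter.mpr ⟨mem_univ _, ?_⟩, Finset.mem_Icc.mpr ⟨hb0, ?_⟩⟩, ?_⟩
        · simp only [hA]; omega
        · simp only; omega
        · simp only [hA, hab]
    _ ≤ ∑ z ∈ T ×ˢ Icc 1 X, 1 / ((z.2 ^ 2 * prodSet z.1 : ℕ) : ℝ) :=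
        Finset.sum_image_le_of_nonneg fun n _ => by positivity
    _ = (∑ d ∈ Icc 1 X, 1 / (d : ℝ) ^ 2) * ∑ A ∈ T, 1 / (prodSet A : ℝ) := by
        rw [sum_product_right, sum_mul]
        refine Finset.sum_congr rfl fun d _ => ?_
        rw [mul_sum]
        refine Finset.sum_congr rfl fun A _ => ?_
        push_cast
        rw [one_div_mul_one_div]
    _ ≤ 2 * cutSum D R t := by
        rw [hcut]
        exact mul_le_mul_of_nonneg_right h2 (Finset.sum_nonneg fun A _ => by positivity)

/-- The density of the integers without prime factors up to `D`. -/
noncomputable def kap (D : ℕ) : ℝ := (primorial D).totient / primorial D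

lemma kap_pos (D : ℕ) : 0 < kap D := by
  have := primorial_pos D
  have h2 := Nat.totient_pos.mpr this
  unfold kap; positivity

lemma exists_cutSum_bounds (D : ℕ) : ∃ t₀ : ℝ, 0 < t₀ ∧ ∀ (R : ℕ) (t : ℝ), t₀ ≤ t → exp t ≤ R →
    kap D * t / 4 ≤ cutSum D R t ∧ cutSum D R t ≤ 2 * kap D * t := by
  have hW := primorial_pos D
  have hk := kap_pos D
  set W := primorial D with hWd
  have hlog : 0 ≤ log W := log_natCast_nonneg W
  refine ⟨1 + 2 * log W + W / kap D, by positivity, fun R t ht hR => ?_⟩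
  have hWk : 0 ≤ W / kap D := by positivity
  have ht0 : 0 ≤ t := by linarith
  constructor
  · have h1 := coprimeSum_ge hW t
    have h2 := coprimeSum_le_two_mul D R hR
    have h3 : kap D * (t / 2) ≤ kap D * (t - log W) :=
      mul_le_mul_of_nonneg_left (by linarith) hk.le
    change kap D * (t - log W) ≤ _ at h1
    linarith
  · have h1 := coprimeSum_le hW ht0
    have h2 := cutSum_le D R t
    change _ ≤ W + kap D * (1 + t) at h1
    have h3 : kap D * (1 + W / kap D) ≤ kap D * t := mul_le_mul_of_nonneg_left (by linarith) hk.le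
    rw [mul_add, mul_div_cancel₀ _ hk.ne'] at h3
    linarith

end SievePrimes

end GapRuns

namespace GapRuns
open Real Filter Topology Finset MeasureTheory

/-- The one-variable profile of the sieve weight. -/
noncomputable def profile (J : ℕ) (τ s : ℝ) : ℝ :=
  ∑ j ∈ range J, (1 / 2 : ℝ) ^ (j + 1) * if s ≤ 2 ^ j * τ then 1 else 0

lemma profile_nonneg (J : ℕ) (τ s : ℝ) : 0 ≤ profile J τ s :=
  Finset.sum_nonneg fun j _ => by split_ifs <;> positivity

lemma profile_succ (J : ℕ) (τ s : ℝ) :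
    profile (J + 1) τ s = 1 / 2 * (if s ≤ τ then 1 else 0) + 1 / 2 * profile J (2 * τ) s := by
  unfold profile
  rw [Finset.sum_range_succ', mul_sum, add_comm]
  congr 1
  · simp
  · refine Finset.sum_congr rfl fun j _ => ?_
    rw [show (2 : ℝ) ^ (j + 1) * τ = 2 ^ j * (2 * τ) by ring]
    ring

lemma profile_le_one (J : ℕ) (τ s : ℝ) : profile J τ s ≤ 1 := by
  induction J generalizing τ with
  | zero => simp [profile]
  | succ J ih =>
    rw [profile_succ]
    have := ih (2 * τ)
    split_ifs <;> linarith

lemma profile_antitone (J : ℕ) (τ : ℝ) : Antitone (profile J τ) := fun a b h =>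
  Finset.sum_le_sum fun j _ => mul_le_mul_of_nonneg_left (by
    split_ifs with h1 h2
    · exact le_rfl
    · exact absurd (h.trans h1) h2
    · exact zero_le_one
    · exact le_rfl) (by positivity)

lemma le_of_profile_ne_zero {J : ℕ} {τ s : ℝ} (hτ : 0 ≤ τ) (h : profile J τ s ≠ 0) :
    s ≤ 2 ^ J * τ := by
  by_contra hs
  push Not at hs
  refine h (Finset.sum_eq_zero fun j hj => ?_)
  rw [if_neg, mul_zero]
  push Not
  refine lt_of_le_of_lt (mul_le_mul_of_nonneg_right ?_ hτ) hs
  exact pow_le_pow_right₀ one_le_two (Finset.mem_range.mp hj).le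

lemma half_le_profile {J : ℕ} (hJ : 0 < J) {τ s : ℝ} (h : s ≤ τ) : 1 / 2 ≤ profile J τ s := by
  obtain ⟨J, rfl⟩ := Nat.exists_eq_succ_of_ne_zero hJ.ne'
  rw [Nat.succ_eq_add_one, profile_succ, if_pos h]
  linarith [profile_nonneg J (2 * τ) s]

lemma profile_sq_le (J : ℕ) (τ s : ℝ) :
    profile J τ s ^ 2 ≤ ∑ j ∈ range J, (1 / 4 : ℝ) ^ j * if s ≤ 2 ^ j * τ then 1 else 0 := by
  induction J generalizing τ with
  | zero => simp [profile]
  | succ J ih =>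
    rw [Finset.sum_range_succ', profile_succ]
    have h1 : ∑ j ∈ range J, (1 / 4 : ℝ) ^ (j + 1) * (if s ≤ 2 ^ (j + 1) * τ then 1 else 0) =
        1 / 4 * ∑ j ∈ range J, (1 / 4 : ℝ) ^ j * if s ≤ 2 ^ j * (2 * τ) then 1 else 0 := by
      rw [mul_sum]
      refine Finset.sum_congr rfl fun j _ => ?_
      rw [show (2 : ℝ) ^ (j + 1) * τ = 2 ^ j * (2 * τ) by ring]
      ring
    rw [h1]
    have h2 := ih (2 * τ)
    have h3 := profile_nonneg J (2 * τ) s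
    have h4 := profile_le_one J (2 * τ) s
    simp only [pow_zero, one_mul]
    split_ifs
    · nlinarith [sq_nonneg (profile J (2 * τ) s)]
    · nlinarith

section Gsum

variable {ι : Type*} [Fintype ι] [DecidableEq ι]

lemma gsum_mono {q : ι → ℝ} (hq : ∀ p, 1 < q p) {F G : ℝ → ℝ} (h : ∀ s, 0 ≤ s → F s ≤ G s) :
    gsum q F ≤ gsum q G :=
  Finset.sum_le_sum fun A _ => mul_le_mul_of_nonneg_left (h _ (ell_nonneg hq A))
    (recip_nonneg (fun p => zero_lt_one.trans (hq p)) A)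

lemma gsum_sum (q : ι → ℝ) (J : ℕ) (c : ℕ → ℝ) (F : ℕ → ℝ → ℝ) :
    gsum q (fun s => ∑ j ∈ range J, c j * F j s) = ∑ j ∈ range J, c j * gsum q (F j) := by
  unfold gsum
  simp only [mul_sum]
  rw [Finset.sum_comm]
  exact Finset.sum_congr rfl fun j _ => Finset.sum_congr rfl fun A _ => by ring

end Gsum

/-- The scale of the profile. -/
noncomputable def scale (J : ℕ) (L : ℝ) : ℝ := L / (256 * (2 ^ J * J))

lemma exists_profile_bounds (D : ℕ) {J : ℕ} (hJ : 0 < J) : ∃ L₀ : ℝ, 0 < L₀ ∧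
    ∀ (R : ℕ) (L : ℝ), L₀ ≤ L → exp L ≤ R →
      J * (kap D * scale J L) / 8 ≤
        gsum (pval : sievePrimes D R → ℝ) (profile J (scale J L)) ∧
      kap D * scale J L / 16 ≤
        gsum (pval : sievePrimes D R → ℝ) (fun s => profile J (scale J L) s ^ 2) ∧
      gsum (pval : sievePrimes D R → ℝ) (fun s => profile J (scale J L) s ^ 2) ≤
        4 * (kap D * scale J L) ∧
      gsum (pval : sievePrimes D R → ℝ) (fun s => profile J (scale J L) s ^ 2 * s) ≤
        gsum (pval : sievePrimes D R → ℝ) (fun s => profile J (scale J L) s ^ 2) *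
          (L / (8 * (2 ^ J : ℕ))) := by
  obtain ⟨t₀, ht₀, H⟩ := exists_cutSum_bounds D
  have hJ' : (1 : ℝ) ≤ J := by exact_mod_cast hJ
  have hκ := kap_pos D
  have h2J : (1 : ℝ) ≤ 2 ^ J := one_le_pow₀ one_le_two
  have hden : (1 : ℝ) ≤ 256 * (2 ^ J * J) := by nlinarith
  refine ⟨t₀ * (256 * (2 ^ J * J)), by positivity, fun R L hL hR => ?_⟩
  set τ := scale J L with hτ
  have hτL : L = τ * (256 * (2 ^ J * J)) := by rw [hτ, scale]; field_simp
  have hτ0 : t₀ ≤ τ := by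
    rw [hτ, scale, le_div_iff₀ (by positivity)]; exact hL
  have hτpos : 0 < τ := ht₀.trans_le hτ0
  set q : sievePrimes D R → ℝ := pval with hq
  have hq1 : ∀ p, 1 < q p := one_lt_pval
  have hcut : ∀ j ∈ range J, kap D * (2 ^ j * τ) / 4 ≤
        gsum q (fun s => if s ≤ 2 ^ j * τ then 1 else 0) ∧
      gsum q (fun s => if s ≤ 2 ^ j * τ then 1 else 0) ≤ 2 * kap D * (2 ^ j * τ) := by
    intro j hj
    have h1 : (1 : ℝ) ≤ 2 ^ j := one_le_pow₀ one_le_two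
    have h2 : (2 : ℝ) ^ j ≤ 2 ^ J := pow_le_pow_right₀ one_le_two (Finset.mem_range.mp hj).le
    refine H R (2 ^ j * τ) ?_ ((exp_le_exp.mpr ?_).trans hR)
    · nlinarith
    · rw [hτL, mul_comm]
      refine mul_le_mul_of_nonneg_left ?_ hτpos.le
      nlinarith
  have hA2 : kap D * τ / 16 ≤ gsum q (fun s => profile J τ s ^ 2) := by
    have h1 := (hcut 0 (Finset.mem_range.mpr hJ)).1
    rw [pow_zero, one_mul] at h1
    have h2 : gsum q (fun s => ∑ j ∈ range 1, (fun _ => 1 / 4 : ℕ → ℝ) j *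
        (fun (_ : ℕ) (s : ℝ) => if s ≤ τ then (1 : ℝ) else 0) j s) ≤
        gsum q (fun s => profile J τ s ^ 2) := by
      refine gsum_mono hq1 fun s _ => ?_
      simp only [sum_range_one]
      split_ifs with h
      · nlinarith [half_le_profile hJ h]
      · rw [mul_zero]; positivity
    rw [gsum_sum] at h2
    simp only [sum_range_one] at h2
    linarith
  refine ⟨?_, hA2, ?_, ?_⟩
  · unfold profile
    rw [gsum_sum q J (fun j => (1 / 2 : ℝ) ^ (j + 1)) (fun j s => if s ≤ 2 ^ j * τ then 1 else 0)]
    calc J * (kap D * τ) / 8 = ∑ j ∈ range J, (1 / 2 : ℝ) ^ (j + 1) * (kap D * (2 ^ j * τ) / 4) := by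
          have : ∀ j ∈ range J, (1 / 2 : ℝ) ^ (j + 1) * (kap D * (2 ^ j * τ) / 4) =
              kap D * τ / 8 := fun j _ => by
            rw [one_div, inv_pow, pow_succ]; field_simp; norm_num
          rw [Finset.sum_congr rfl this]; simp; ring
      _ ≤ _ := Finset.sum_le_sum fun j hj =>
          mul_le_mul_of_nonneg_left (hcut j hj).1 (by positivity)
  · refine (gsum_mono hq1 fun s _ => profile_sq_le J τ s).trans ?_
    rw [gsum_sum q J (fun j => (1 / 4 : ℝ) ^ j) (fun j s => if s ≤ 2 ^ j * τ then 1 else 0)]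
    calc _ ≤ ∑ j ∈ range J, (1 / 4 : ℝ) ^ j * (2 * kap D * (2 ^ j * τ)) :=
          Finset.sum_le_sum fun j hj => mul_le_mul_of_nonneg_left (hcut j hj).2 (by positivity)
      _ = 2 * (kap D * τ) * ∑ j ∈ range J, (1 / 2 : ℝ) ^ j := by
          rw [mul_sum]
          refine Finset.sum_congr rfl fun j _ => ?_
          rw [show (1 / 4 : ℝ) = 1 / 2 * (1 / 2) by norm_num, mul_pow, one_div, inv_pow]
          field_simp
      _ ≤ 2 * (kap D * τ) * 2 := by
          refine mul_le_mul_of_nonneg_left ?_ (by positivity)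
          exact sum_geometric_two_le J
      _ = _ := by ring
  · have h1 : gsum q (fun s => profile J τ s ^ 2 * s) ≤ 2 * (J * (kap D * τ ^ 2)) := by
      refine (gsum_mono (G := fun s => ∑ j ∈ range J, ((1 / 4 : ℝ) ^ j * (2 ^ j * τ)) *
        if s ≤ 2 ^ j * τ then 1 else 0) hq1 fun s hs => ?_).trans ?_
      · refine (mul_le_mul_of_nonneg_right (profile_sq_le J τ s) hs).trans ?_
        rw [sum_mul]
        refine Finset.sum_le_sum fun j _ => ?_
        split_ifs with h
        · simp only [mul_one]
          exact mul_le_mul_of_nonneg_left h (by positivity)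
        · simp
      · rw [gsum_sum q J (fun j => (1 / 4 : ℝ) ^ j * (2 ^ j * τ))
          (fun j s => if s ≤ 2 ^ j * τ then 1 else 0)]
        calc _ ≤ ∑ j ∈ range J, (1 / 4 : ℝ) ^ j * (2 ^ j * τ) * (2 * kap D * (2 ^ j * τ)) :=
              Finset.sum_le_sum fun j hj => mul_le_mul_of_nonneg_left (hcut j hj).2 (by positivity)
          _ = ∑ j ∈ range J, 2 * (kap D * τ ^ 2) := by
              refine Finset.sum_congr rfl fun j _ => ?_
              rw [show (1 / 4 : ℝ) = 1 / 2 * (1 / 2) by norm_num, mul_pow, one_div, inv_pow]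
              field_simp
          _ = _ := by simp; ring
    refine h1.trans (le_trans (le_of_eq ?_) (mul_le_mul_of_nonneg_right hA2 ?_))
    · rw [hτL]; push_cast; field_simp; norm_num
    · rw [hτL]; positivity

end GapRuns

namespace GapRuns
open Real Filter Topology Finset MeasureTheory

section Expand

set_option linter.unusedSectionVars false

variable {ι : Type*} [Fintype ι] [DecidableEq ι] {k : ℕ}

/-- Indicator that the local condition `d` is implied by the local state `a`. -/
def leq (d a : Option (Fin k)) : ℝ := if d = none ∨ d = a then 1 else 0

/-- Expansion of the local factors into indicators of divisibility. -/
noncomputable def coef (q : ℝ) (b d : Option (Fin k)) : ℝ :=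
  match b with
  | none => if d = none then 1 else 0
  | some i => if d = none then 1 / (q - 1) else if d = some i then -1 else 0

lemma evalAt_eq (q : ℝ) (a b : Option (Fin k)) : evalAt q a b = ∑ d, coef q b d * leq d a := by
  rw [Fintype.sum_option]
  rcases b with _ | i
  · simp [evalAt, coef, leq]
  · have : ∀ j : Fin k, coef q (some i) (some j) * leq (some j) a =
        if i = j then -leq (some i) a else 0 := fun j => by
      by_cases h : i = j
      · subst h; simp [coef]
      · simp [coef, h, Ne.symm h]
    simp only [this, Finset.sum_ite_eq, Finset.mem_univ, if_true]
    simp only [evalAt, coef, leq, if_true, true_or, reduceCtorEq, false_or, eq_comm]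
    ring

/-- The sieve weight at a state. -/
noncomputable def sieve (q : ι → ℝ) (y : (ι → Option (Fin k)) → ℝ) (σ : ι → Option (Fin k)) : ℝ :=
  ∑ b : ι → Option (Fin k), (∏ p, evalAt (q p) (σ p) (b p)) * y b

/-- The coefficients of the sieve weight in terms of divisibility conditions. -/
noncomputable def lam (q : ι → ℝ) (y : (ι → Option (Fin k)) → ℝ) (d : ι → Option (Fin k)) : ℝ :=
  ∑ b : ι → Option (Fin k), (∏ p, coef (q p) (b p) (d p)) * y b

lemma prod_sum_config (f : ι → Option (Fin k) → ℝ) :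
    ∏ p, ∑ d, f p d = ∑ d : ι → Option (Fin k), ∏ p, f p (d p) := by
  have := Finset.prod_univ_sum (fun _ : ι => (univ : Finset (Option (Fin k)))) f
  rwa [Fintype.piFinset_univ] at this

lemma sieve_eq (q : ι → ℝ) (y : (ι → Option (Fin k)) → ℝ) (σ : ι → Option (Fin k)) :
    sieve q y σ = ∑ d, lam q y d * ∏ p, leq (d p) (σ p) := by
  unfold sieve lam
  simp only [evalAt_eq, prod_sum_config, prod_mul_distrib, sum_mul]
  rw [Finset.sum_comm]
  exact Finset.sum_congr rfl fun d _ => Finset.sum_congr rfl fun b _ => by ring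

/-- Two systems of local conditions that can hold simultaneously. -/
def Compat (d d' : ι → Option (Fin k)) : Prop := ∀ p, d p = none ∨ d' p = none ∨ d p = d' p

instance (d d' : ι → Option (Fin k)) : Decidable (Compat d d') := by
  unfold Compat; infer_instance

/-- The conjunction of two compatible systems of local conditions. -/
def join (d d' : ι → Option (Fin k)) (p : ι) : Option (Fin k) := if d p = none then d' p else d p

lemma prod_leq_mul_leq (d d' σ : ι → Option (Fin k)) :
    (∏ p, leq (d p) (σ p)) * ∏ p, leq (d' p) (σ p) =
      if Compat d d' then ∏ p, leq (join d d' p) (σ p) else 0 := by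
  rw [← prod_mul_distrib]
  split_ifs with h
  · refine Finset.prod_congr rfl fun p _ => ?_
    unfold join
    by_cases h1 : d p = none
    · rw [if_pos h1]; simp [leq, h1]
    · rw [if_neg h1]
      rcases h p with h2 | h2 | h2
      · exact absurd h2 h1
      · simp [leq, h2]
      · rw [← h2]; unfold leq; split_ifs <;> norm_num
  · unfold Compat at h
    push Not at h
    obtain ⟨p, h1, h2, h3⟩ := h
    refine Finset.prod_eq_zero (mem_univ p) ?_
    unfold leq
    by_cases h4 : d p = σ p
    · rw [if_neg (c := d' p = none ∨ d' p = σ p), mul_zero]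
      rintro (h5 | h5)
      · exact h2 h5
      · exact h3 (h4.trans h5.symm)
    · rw [if_neg (c := d p = none ∨ d p = σ p), zero_mul]
      exact fun h5 => h5.elim h1 h4

lemma sieve_sq (q : ι → ℝ) (y : (ι → Option (Fin k)) → ℝ) (σ : ι → Option (Fin k)) :
    sieve q y σ ^ 2 = ∑ d, ∑ d', lam q y d * lam q y d' *
      if Compat d d' then ∏ p, leq (join d d' p) (σ p) else 0 := by
  rw [sieve_eq, sq, sum_mul_sum]
  refine Finset.sum_congr rfl fun d _ => Finset.sum_congr rfl fun d' _ => ?_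
  rw [← prod_leq_mul_leq]; ring

lemma tensorForm_evalAt (w : ι → Option (Fin k) → ℝ) (q : ι → ℝ) (y : (ι → Option (Fin k)) → ℝ) :
    tensorForm w (fun p => evalAt (q p)) y = ∑ d, ∑ d', lam q y d * lam q y d' *
      if Compat d d' then ∏ p, ∑ a, w p a * leq (join d d' p) a else 0 := by
  change ∑ σ : ι → Option (Fin k), (∏ p, w p (σ p)) * sieve q y σ ^ 2 = _
  simp only [sieve_sq, mul_sum, prod_sum_config, prod_mul_distrib]
  rw [Finset.sum_comm]
  refine Finset.sum_congr rfl fun d _ => ?_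
  rw [Finset.sum_comm]
  refine Finset.sum_congr rfl fun d' _ => ?_
  split_ifs
  · rw [mul_sum]
    exact Finset.sum_congr rfl fun σ _ => by ring
  · simp

lemma leq_nonneg (d a : Option (Fin k)) : 0 ≤ leq d a := by unfold leq; split_ifs <;> norm_num

lemma leq_le_one (d a : Option (Fin k)) : leq d a ≤ 1 := by unfold leq; split_ifs <;> norm_num

lemma summable_mul_prod_leq {f : ℕ → ℝ} (hf : Summable f) (hf0 : ∀ n, 0 ≤ f n)
    (σ : ℕ → ι → Option (Fin k)) (e : ι → Option (Fin k)) :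
    Summable fun n => f n * ∏ p, leq (e p) (σ n p) := by
  refine Summable.of_nonneg_of_le (fun n => mul_nonneg (hf0 n)
    (Finset.prod_nonneg fun p _ => leq_nonneg _ _)) (fun n => ?_) hf
  exact mul_le_of_le_one_right (hf0 n)
    (Finset.prod_le_one (fun p _ => leq_nonneg _ _) fun p _ => leq_le_one _ _)

/-- Comparison of a weighted sum of squares of the sieve weight with its model value. -/
lemma abs_tsum_sieve_sq_sub_le {f : ℕ → ℝ} (hf : Summable f) (hf0 : ∀ n, 0 ≤ f n)
    (σ : ℕ → ι → Option (Fin k)) (w : ι → Option (Fin k) → ℝ) (q : ι → ℝ)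
    (y : (ι → Option (Fin k)) → ℝ) (C : ℝ) {Err : (ι → Option (Fin k)) → ℝ}
    (hErr : ∀ d d', Compat d d' → lam q y d ≠ 0 → lam q y d' ≠ 0 →
      |∑' n, f n * ∏ p, leq (join d d' p) (σ n p) - C * ∏ p, ∑ a, w p a * leq (join d d' p) a| ≤
        Err (join d d')) :
    |∑' n, f n * sieve q y (σ n) ^ 2 - C * tensorForm w (fun p => evalAt (q p)) y| ≤
      ∑ d, ∑ d', |lam q y d| * |lam q y d'| * if Compat d d' then Err (join d d') else 0 := by
  have hs : ∀ d d', Summable fun n => lam q y d * lam q y d' * (f n *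
      if Compat d d' then ∏ p, leq (join d d' p) (σ n p) else 0) := fun d d' => by
    split_ifs
    · exact (summable_mul_prod_leq hf hf0 σ _).mul_left _
    · simpa using summable_zero
  have h1 : ∑' n, f n * sieve q y (σ n) ^ 2 = ∑ d, ∑ d', lam q y d * lam q y d' *
      ∑' n, (f n * if Compat d d' then ∏ p, leq (join d d' p) (σ n p) else 0) := by
    have : ∀ n, f n * sieve q y (σ n) ^ 2 = ∑ d, ∑ d', lam q y d * lam q y d' * (f n *
        if Compat d d' then ∏ p, leq (join d d' p) (σ n p) else 0) := fun n => by
      rw [sieve_sq, mul_sum]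
      refine Finset.sum_congr rfl fun d _ => ?_
      rw [mul_sum]
      exact Finset.sum_congr rfl fun d' _ => by ring
    simp only [this]
    rw [Summable.tsum_finsetSum fun d _ => summable_sum fun d' _ => hs d d']
    refine Finset.sum_congr rfl fun d _ => ?_
    rw [Summable.tsum_finsetSum fun d' _ => hs d d']
    exact Finset.sum_congr rfl fun d' _ => tsum_mul_left
  rw [h1, tensorForm_evalAt, mul_sum, ← sum_sub_distrib]
  refine (Finset.abs_sum_le_sum_abs _ _).trans (Finset.sum_le_sum fun d _ => ?_)
  rw [mul_sum, ← sum_sub_distrib]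
  refine (Finset.abs_sum_le_sum_abs _ _).trans (Finset.sum_le_sum fun d' _ => ?_)
  split_ifs with h
  · rw [mul_left_comm, ← mul_sub, abs_mul, abs_mul]
    by_cases hd : lam q y d = 0
    · simp [hd]
    by_cases hd' : lam q y d' = 0
    · simp [hd']
    exact mul_le_mul_of_nonneg_left (hErr d d' h hd hd') (by positivity)
  · simp

end Expand

end GapRuns

namespace GapRuns
open Real Filter Topology Finset MeasureTheory

section Coef

set_option linter.unusedSectionVars false

variable {ι : Type*} [Fintype ι] [DecidableEq ι] {k : ℕ}

/-- The places where a system of local conditions is not trivial. -/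
def supp (d : ι → Option (Fin k)) : Finset ι := univ.filter fun p => d p ≠ none

lemma mem_supp {d : ι → Option (Fin k)} {p : ι} : p ∈ supp d ↔ d p ≠ none := by simp [supp]

lemma sum_ell_colorSet (q : ι → ℝ) (b : ι → Option (Fin k)) :
    ∑ i, ell q (colorSet b i) = ell q (supp b) := by
  unfold ell colorSet supp
  simp only [sum_filter]
  rw [Finset.sum_comm]
  refine Finset.sum_congr rfl fun p _ => ?_
  rcases h : b p with _ | j
  · simp
  · simp [Finset.sum_ite_eq]

lemma ell_supp_le_of_yval_ne_zero {q : ι → ℝ} {G : ℝ → ℝ} {L : ℝ} {b : ι → Option (Fin k)}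
    (h : yval q G L b ≠ 0) : ell q (supp b) ≤ L := by
  rw [← sum_ell_colorSet]
  by_contra hb
  exact h (by unfold yval; rw [if_neg hb])

/-- The Euler product that controls the coefficients of the sieve weight. -/
noncomputable def euler (k : ℕ) (q : ι → ℝ) : ℝ := ∏ p, (1 + 3 * k / (q p - 1))

lemma sum_abs_coef_left (q : ℝ) (hq : 1 < q) (d : Option (Fin k)) :
    ∑ b, |coef q b d| ≤ 1 + 3 * k / (q - 1) := by
  have hq' : 0 < q - 1 := by linarith
  rcases d with _ | i
  · rw [Fintype.sum_option]
    simp only [coef, if_true, sum_const, card_univ, Fintype.card_fin, nsmul_eq_mul, abs_one]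
    rw [abs_of_pos (by positivity)]
    have : (k : ℝ) * (1 / (q - 1)) ≤ 3 * k / (q - 1) := by
      rw [mul_one_div]
      exact div_le_div_of_nonneg_right (by linarith [(Nat.cast_nonneg k : (0 : ℝ) ≤ k)]) hq'.le
    linarith
  · rw [Fintype.sum_option]
    have : ∀ j : Fin k, |coef q (some j) (some i)| = if i = j then (1 : ℝ) else 0 := fun j => by
      by_cases h : i = j
      · subst h; simp [coef]
      · simp [coef, h]
    simp only [this, Finset.sum_ite_eq, Finset.mem_univ, if_true]
    simp only [coef, reduceCtorEq, if_false, abs_zero, zero_add]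
    have : 0 ≤ 3 * k / (q - 1) := by positivity
    linarith

lemma sum_abs_coef_right (q : ℝ) (hq : 1 < q) (b : Option (Fin k)) :
    ∑ d, |coef q b d| = if b = none then 1 else q / (q - 1) := by
  have hq' : 0 < q - 1 := by linarith
  rw [Fintype.sum_option]
  rcases b with _ | i
  · simp [coef]
  · have : ∀ j : Fin k, |coef q (some i) (some j)| = if j = i then (1 : ℝ) else 0 := fun j => by
      by_cases h : j = i
      · subst h; simp [coef]
      · simp [coef, h]
    simp only [this, Finset.sum_ite_eq', Finset.mem_univ, if_true]
    simp only [coef, if_true, reduceCtorEq, if_false]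
    rw [abs_of_pos (by positivity)]
    field_simp
    ring

variable {q : ι → ℝ} {y : (ι → Option (Fin k)) → ℝ} {L : ℝ}

lemma one_le_euler (hq : ∀ p, 1 < q p) : 1 ≤ euler k q := by
  have h : ∀ p, (1 : ℝ) ≤ 1 + 3 * k / (q p - 1) := fun p => by
    have : 0 < q p - 1 := by linarith [hq p]
    have : 0 ≤ 3 * k / (q p - 1) := by positivity
    linarith
  calc (1 : ℝ) = ∏ _p : ι, (1 : ℝ) := by simp
    _ ≤ _ := Finset.prod_le_prod (fun p _ => zero_le_one) fun p _ => h p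

lemma abs_lam_le (hq : ∀ p, 1 < q p) (hy : ∀ b, |y b| ≤ 1) (d : ι → Option (Fin k)) :
    |lam q y d| ≤ euler k q := by
  calc |lam q y d| ≤ ∑ b : ι → Option (Fin k), ∏ p, |coef (q p) (b p) (d p)| := by
        refine (Finset.abs_sum_le_sum_abs _ _).trans (Finset.sum_le_sum fun b _ => ?_)
        rw [abs_mul, Finset.abs_prod]
        exact mul_le_of_le_one_right (Finset.prod_nonneg fun p _ => abs_nonneg _) (hy b)
    _ = ∏ p, ∑ b, |coef (q p) b (d p)| := by
        rw [← prod_sum_config fun p b => |coef (q p) b (d p)|]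
    _ ≤ _ := Finset.prod_le_prod (fun p _ => Finset.sum_nonneg fun b _ => abs_nonneg _)
        fun p _ => sum_abs_coef_left _ (hq p) _

lemma ell_supp_le_of_lam_ne_zero (hq : ∀ p, 1 < q p)
    (hyL : ∀ b, y b ≠ 0 → ell q (supp b) ≤ L) {d : ι → Option (Fin k)} (hd : lam q y d ≠ 0) :
    ell q (supp d) ≤ L := by
  obtain ⟨b, -, hb⟩ := Finset.exists_ne_zero_of_sum_ne_zero hd
  refine le_trans (ell_mono hq fun p hp => ?_) (hyL b (right_ne_zero_of_mul hb))
  rw [mem_supp] at hp ⊢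
  intro h
  refine Finset.prod_ne_zero_iff.mp (left_ne_zero_of_mul hb) p (mem_univ p) ?_
  simp [coef, h, hp]

lemma exp_ell (hq : ∀ p, 1 < q p) (A : Finset ι) : exp (ell q A) = ∏ p ∈ A, q p := by
  unfold ell
  rw [exp_sum]
  exact Finset.prod_congr rfl fun p _ => exp_log (by linarith [hq p])

lemma sum_abs_lam_le (hq : ∀ p, 1 < q p) (hy : ∀ b, |y b| ≤ 1)
    (hyL : ∀ b, y b ≠ 0 → ell q (supp b) ≤ L) :
    ∑ d, |lam q y d| ≤ exp L * euler k q := by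
  have hq0 : ∀ p, 0 < q p := fun p => by linarith [hq p]
  have hyb : ∀ b, |y b| ≤ exp L * ∏ p, if b p = none then 1 else 1 / q p := fun b => by
    have h2 : ∏ p, (if b p = none then (1 : ℝ) else 1 / q p) = exp (-ell q (supp b)) := by
      rw [exp_neg, exp_ell hq, ← Finset.prod_inv_distrib, supp, prod_filter]
      refine Finset.prod_congr rfl fun p _ => ?_
      by_cases h : b p = none <;> simp [h]
    rw [h2, ← exp_add]
    by_cases hb : y b = 0
    · rw [hb, abs_zero]; exact (exp_pos _).le
    · exact (hy b).trans (one_le_exp (by linarith [hyL b hb]))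
  calc ∑ d, |lam q y d| ≤ ∑ d : ι → Option (Fin k), ∑ b : ι → Option (Fin k),
        (∏ p, |coef (q p) (b p) (d p)|) * |y b| := by
        refine Finset.sum_le_sum fun d _ => (Finset.abs_sum_le_sum_abs _ _).trans
          (Finset.sum_le_sum fun b _ => ?_)
        rw [abs_mul, Finset.abs_prod]
    _ = ∑ b : ι → Option (Fin k), (∏ p, if b p = none then 1 else q p / (q p - 1)) * |y b| := by
        rw [Finset.sum_comm]
        refine Finset.sum_congr rfl fun b _ => ?_
        rw [← sum_mul, ← prod_sum_config fun p d => |coef (q p) (b p) d|]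
        congr 1
        exact Finset.prod_congr rfl fun p _ => sum_abs_coef_right _ (hq p) _
    _ ≤ ∑ b : ι → Option (Fin k), exp L * ∏ p, if b p = none then 1 else 1 / (q p - 1) := by
        refine Finset.sum_le_sum fun b _ => ?_
        refine (mul_le_mul_of_nonneg_left (hyb b) (Finset.prod_nonneg fun p _ => ?_)).trans ?_
        · have : 0 < q p - 1 := by linarith [hq p]
          have := hq0 p
          split_ifs <;> positivity
        · rw [mul_left_comm, ← prod_mul_distrib]
          refine mul_le_mul_of_nonneg_left (le_of_eq ?_) (exp_pos L).le
          refine Finset.prod_congr rfl fun p _ => ?_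
          have := (hq0 p).ne'
          split_ifs
          · norm_num
          · field_simp
    _ = exp L * ∏ p, (1 + k * (1 / (q p - 1))) := by
        rw [← mul_sum,
          ← prod_sum_config fun p (b : Option (Fin k)) => if b = none then (1 : ℝ) else 1 / (q p - 1)]
        congr 1
        refine Finset.prod_congr rfl fun p _ => ?_
        rw [Fintype.sum_option]
        simp
    _ ≤ _ := by
        refine mul_le_mul_of_nonneg_left (Finset.prod_le_prod (fun p _ => ?_) fun p _ => ?_)
          (exp_pos L).le
        · have : 0 < q p - 1 := by linarith [hq p]
          positivity
        · have hq' : 0 < q p - 1 := by linarith [hq p]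
          rw [mul_one_div]
          have := div_le_div_of_nonneg_right
            (by linarith [(Nat.cast_nonneg k : (0 : ℝ) ≤ k)] : (k : ℝ) ≤ 3 * k) hq'.le
          linarith

end Coef

section EulerBound

variable {D R : ℕ}

lemma prod_one_add_rpow_le {δ : ℝ} (hδ : 0 < δ) (hδ1 : δ ≤ 1) :
    ∏ p : sievePrimes D R, (1 + pval p ^ (-(1 + δ))) ≤ 62 / δ := by
  rw [Finset.prod_one_add]
  have h1 : ∀ A : Finset (sievePrimes D R),
      ∏ p ∈ A, pval p ^ (-(1 + δ)) = (prodSet A : ℝ) ^ (-(1 + δ)) := fun A => by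
    unfold prodSet pval
    push_cast
    exact Real.finsetProd_rpow _ _ (fun p _ => by positivity) _
  rw [Finset.powerset_univ]
  simp only [h1]
  rw [← Finset.sum_image (f := fun n : ℕ => (n : ℝ) ^ (-(1 + δ)))
    fun _ _ _ _ h => prodSet_injective h]
  exact ((summable_rpow_one_add hδ).sum_le_tsum _ fun n _ => by positivity).trans
    (tsum_rpow_one_add_le hδ hδ1)

lemma euler_le {k : ℕ} {L : ℝ} (hL : 1 ≤ L) (hR : log R ≤ L) :
    euler k (pval : sievePrimes D R → ℝ) ≤ (62 * L) ^ (18 * k) := by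
  have hL0 : 0 < L := by linarith
  have hp : ∀ p : sievePrimes D R,
      1 + 3 * k / (pval p - 1) ≤ (1 + pval p ^ (-(1 + 1 / L))) ^ (18 * k) := fun p => by
    have h2 : 2 ≤ pval p := by unfold pval; exact_mod_cast (sievePrimes_prime p).two_le
    have hlog : log (pval p) ≤ L := by
      refine le_trans (log_le_log (by linarith) ?_) hR
      unfold pval
      exact_mod_cast (Finset.mem_Ioc.mp (mem_filter.mp p.2).1).2
    have h3 : 1 / pval p ≤ 3 * pval p ^ (-(1 + 1 / L)) := by
      rw [neg_add, rpow_add (by linarith), rpow_neg_one, one_div]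
      have h4 : 1 / 3 ≤ pval p ^ (-(1 / L)) := by
        rw [rpow_def_of_pos (by linarith)]
        have : -1 ≤ log (pval p) * -(1 / L) := by
          rw [mul_neg, mul_one_div, neg_le_neg_iff, div_le_one hL0]; exact hlog
        refine le_trans ?_ (exp_le_exp.mpr this)
        rw [exp_neg, one_div]
        exact inv_anti₀ (exp_pos _) exp_one_lt_three.le
      have h5 : 0 < (pval p)⁻¹ := by positivity
      nlinarith
    refine le_trans ?_ (one_add_mul_le_pow (by
      have : 0 ≤ pval p ^ (-(1 + 1 / L)) := by positivity
      linarith) _)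
    push_cast
    have h6 : 3 * k / (pval p - 1) ≤ 6 * k * (1 / pval p) := by
      rw [mul_one_div, div_le_div_iff₀ (by linarith) (by linarith)]
      nlinarith [(Nat.cast_nonneg k : (0 : ℝ) ≤ k)]
    nlinarith [(Nat.cast_nonneg k : (0 : ℝ) ≤ k)]
  calc euler k (pval : sievePrimes D R → ℝ)
      ≤ ∏ p : sievePrimes D R, (1 + pval p ^ (-(1 + 1 / L))) ^ (18 * k) := by
        refine Finset.prod_le_prod (fun p _ => ?_) fun p _ => hp p
        have : 0 < pval p - 1 := by linarith [one_lt_pval p]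
        positivity
    _ = (∏ p : sievePrimes D R, (1 + pval p ^ (-(1 + 1 / L)))) ^ (18 * k) := prod_pow _ _ _
    _ ≤ _ := by
        refine pow_le_pow_left₀ (Finset.prod_nonneg fun p _ => ?_) ?_ _
        · have : 0 < pval p := by linarith [one_lt_pval p]
          positivity
        · have := prod_one_add_rpow_le (D := D) (R := R) (δ := 1 / L) (by positivity)
            (by rw [div_le_one hL0]; exact hL)
          refine this.trans (le_of_eq ?_)
          field_simp

end EulerBound

end GapRuns

namespace GapRuns
open Real Filter Topology Finset MeasureTheory
open scoped ArithmeticFunction.vonMangoldt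

section Residues

lemma exists_int_crt {α : Type*} [DecidableEq α] (s : Finset α) (f : α → ℤ) (M ν : ℤ)
    (hM : ∀ i ∈ s, IsCoprime M (f i)) (hf : (s : Set α).Pairwise (Function.onFun IsCoprime f))
    (t : α → ℤ) : ∃ a, M ∣ a - ν ∧ ∀ i ∈ s, f i ∣ a - t i := by
  induction s using Finset.induction_on with
  | empty => exact ⟨ν, by simp, by simp⟩
  | insert i s hi ih =>
    obtain ⟨a, ha, has⟩ := ih (fun j hj => hM j (mem_insert_of_mem hj))
      (hf.mono (by simp))
    have hcop : IsCoprime (M * ∏ j ∈ s, f j) (f i) := by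
      refine IsCoprime.mul_left (hM i (mem_insert_self i s)) (IsCoprime.prod_left fun j hj => ?_)
      exact hf (by simp [hj]) (by simp) fun h => hi (h ▸ hj)
    obtain ⟨b, c, hbc⟩ := hcop
    have hkey : f i ∣ a + (t i - a) * (b * (M * ∏ j ∈ s, f j)) - t i :=
      ⟨(a - t i) * c, by linear_combination (t i - a) * hbc⟩
    refine ⟨a + (t i - a) * (b * (M * ∏ j ∈ s, f j)), ?_, fun j hj => ?_⟩
    · rw [add_sub_right_comm]
      exact dvd_add ha ⟨(t i - a) * (b * ∏ j ∈ s, f j), by ring⟩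
    · rcases mem_insert.mp hj with rfl | hj
      · exact hkey
      · rw [add_sub_right_comm]
        obtain ⟨c, hc⟩ := dvd_prod_of_mem f hj
        exact dvd_add (has j hj) ⟨(t i - a) * (b * (M * c)), by rw [hc]; ring⟩

variable {D R k : ℕ}

open Classical in
/-- The index `i` for which `p` divides `x + h i`, if there is one. -/
noncomputable def state (h : Fin k → ℤ) (x : ℤ) (p : sievePrimes D R) : Option (Fin k) :=
  if H : ∃ i, ((p : ℕ) : ℤ) ∣ x + h i then some H.choose else none

/-- The shifts are distinct modulo all the primes of the sieve. -/
def Separated (D R : ℕ) (h : Fin k → ℤ) : Prop :=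
  ∀ (p : sievePrimes D R) (i j : Fin k), ((p : ℕ) : ℤ) ∣ h i - h j → i = j

variable {h : Fin k → ℤ}

lemma state_eq_some (hs : Separated D R h) (x : ℤ) (p : sievePrimes D R) (i : Fin k) :
    state h x p = some i ↔ ((p : ℕ) : ℤ) ∣ x + h i := by
  unfold state
  split_ifs with H
  · have hc := H.choose_spec
    rw [Option.some.injEq]
    refine ⟨fun e => e ▸ hc, fun hd => hs p _ _ ?_⟩
    have := dvd_sub hc hd
    rwa [add_sub_add_left_eq_sub] at this
  · exact ⟨fun e => by simp at e, fun hd => (H ⟨i, hd⟩).elim⟩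

lemma isCoprime_sievePrimes {p p' : sievePrimes D R} (hp : p ≠ p') :
    IsCoprime ((p : ℕ) : ℤ) ((p' : ℕ) : ℤ) := by
  rw [Nat.isCoprime_iff_coprime, Nat.coprime_primes (sievePrimes_prime p) (sievePrimes_prime p')]
  exact fun h => hp (Subtype.ext h)

lemma isCoprime_primorial_sievePrimes (p : sievePrimes D R) :
    IsCoprime (primorial D : ℤ) ((p : ℕ) : ℤ) :=
  Nat.isCoprime_iff_coprime.mpr (coprime_primorial_sievePrimes p)

lemma prod_leq_eq (d a : sievePrimes D R → Option (Fin k)) :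
    ∏ p, leq (d p) (a p) = if ∀ p, d p = none ∨ d p = a p then 1 else 0 := by
  split_ifs with H
  · exact Finset.prod_eq_one fun p _ => if_pos (H p)
  · push Not at H
    obtain ⟨p, h1, h2⟩ := H
    exact Finset.prod_eq_zero (mem_univ p) (if_neg fun h => h.elim h1 h2)

/-- The modulus attached to a system of local conditions. -/
def modulus (e : sievePrimes D R → Option (Fin k)) : ℕ := primorial D * prodSet (supp e)

lemma modulus_pos (e : sievePrimes D R → Option (Fin k)) : 0 < modulus e :=
  Nat.mul_pos (primorial_pos D) (prodSet_pos _)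

instance (e : sievePrimes D R → Option (Fin k)) : NeZero (modulus e) := ⟨(modulus_pos e).ne'⟩

/-- A system of local conditions is a single residue class. -/
lemma exists_residue (hs : Separated D R h) (ν : ℤ) (e : sievePrimes D R → Option (Fin k)) :
    ∃ a : ℤ, (∀ x : ℤ, (if (primorial D : ℤ) ∣ x - ν then (1 : ℝ) else 0) *
        ∏ p, leq (e p) (state h x p) = if (x : ZMod (modulus e)) = (a : ZMod (modulus e)) then 1 else 0) ∧
      ∀ m, IsCoprime (primorial D : ℤ) (ν + h m) →
        (IsUnit ((a + h m : ℤ) : ZMod (modulus e)) ↔ ∀ p, e p ≠ some m) := by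
  obtain ⟨a, haW, has⟩ := exists_int_crt (supp e) (fun p => ((p : ℕ) : ℤ)) (primorial D) ν
    (fun p _ => isCoprime_primorial_sievePrimes p)
    (fun p _ p' _ hp => isCoprime_sievePrimes hp)
    (fun p => - (e p).elim 0 h)
  have hcop : IsCoprime (primorial D : ℤ) (∏ p ∈ supp e, ((p : ℕ) : ℤ)) :=
    IsCoprime.prod_right fun p _ => isCoprime_primorial_sievePrimes p
  have hmod : ((modulus e : ℕ) : ℤ) = primorial D * ∏ p ∈ supp e, ((p : ℕ) : ℤ) := by
    unfold modulus prodSet; push_cast; rfl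
  have hai : ∀ p i, e p = some i → ((p : ℕ) : ℤ) ∣ a + h i := fun p i hi => by
    have := has p (mem_supp.mpr (by simp [hi]))
    simpa [hi] using this
  refine ⟨a, fun x => ?_, fun m hm => ?_⟩
  · rw [prod_leq_eq, ite_zero_mul_ite_zero, mul_one]
    refine if_congr ?_ rfl rfl
    rw [ZMod.intCast_eq_intCast_iff_dvd_sub, hmod]
    constructor
    · rintro ⟨h1, h2⟩
      refine hcop.mul_dvd ?_ (Finset.prod_dvd_of_coprime
        (fun p _ p' _ hp => isCoprime_sievePrimes hp) fun p hp => ?_)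
      · have := dvd_sub haW h1
        rwa [sub_sub_sub_cancel_right] at this
      · rw [mem_supp] at hp
        obtain ⟨i, hi⟩ := Option.ne_none_iff_exists'.mp hp
        have h3 := (state_eq_some hs x p i).mp (((h2 p).resolve_left hp).symm.trans hi)
        have := dvd_sub (hai p i hi) h3
        rwa [add_sub_add_right_eq_sub] at this
    · intro h1
      refine ⟨?_, fun p => ?_⟩
      · have := dvd_sub haW ((dvd_mul_right _ _).trans h1)
        rwa [show a - ν - (a - x) = x - ν by ring] at this
      · rcases hi : e p with _ | i
        · exact Or.inl rfl
        · refine Or.inr ((state_eq_some hs x p i).mpr ?_).symm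
          have h2 : ((p : ℕ) : ℤ) ∣ a - x :=
            ((dvd_prod_of_mem (fun p : sievePrimes D R => ((p : ℕ) : ℤ))
              (mem_supp.mpr (by simp [hi]))).trans (dvd_mul_left _ _)).trans h1
          have := dvd_sub (hai p i hi) h2
          rwa [show a + h i - (a - x) = x + h i by ring] at this
  · rw [ZMod.coe_int_isUnit_iff_isCoprime, hmod, IsCoprime.mul_left_iff, IsCoprime.prod_left_iff]
    have hW : IsCoprime (primorial D : ℤ) (a + h m) := by
      obtain ⟨c, hc⟩ := haW
      rw [show a + h m = ν + h m + primorial D * c by rw [← hc]; ring]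
      exact hm.add_mul_left_right c
    have hpr : ∀ p : sievePrimes D R, Prime ((p : ℕ) : ℤ) := fun p =>
      Nat.prime_iff_prime_int.mp (sievePrimes_prime p)
    refine ⟨fun H p hp => ?_, fun H => ⟨hW, fun p hp => ?_⟩⟩
    · have := H.2 p (mem_supp.mpr (by simp [hp]))
      exact (hpr p).not_isUnit (this.isUnit_of_dvd' dvd_rfl (hai p m hp))
    · rw [(hpr p).coprime_iff_not_dvd]
      intro hd
      rw [mem_supp] at hp
      obtain ⟨i, hi⟩ := Option.ne_none_iff_exists'.mp hp
      have := dvd_sub (hai p i hi) hd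
      rw [add_sub_add_left_eq_sub] at this
      exact H p (by rw [hi, hs p i m this])

lemma totient_prodSet (A : Finset (sievePrimes D R)) :
    ((prodSet A).totient : ℝ) = ∏ p ∈ A, (pval p - 1) := by
  induction A using Finset.induction_on with
  | empty => simp [prodSet]
  | insert p A hp ih =>
    have hc : Nat.Coprime (p : ℕ) (prodSet A) := Nat.Coprime.prod_right fun p' hp' =>
      (Nat.coprime_primes (sievePrimes_prime p) (sievePrimes_prime p')).mpr
        fun h => hp (Subtype.ext h ▸ hp')
    have hmul : prodSet (insert p A) = p * prodSet A := prod_insert hp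
    rw [prod_insert hp, ← ih, hmul, Nat.totient_mul hc, Nat.totient_prime (sievePrimes_prime p)]
    unfold pval
    push_cast [Nat.cast_sub (sievePrimes_prime p).one_le]
    rfl

lemma totient_modulus (e : sievePrimes D R → Option (Fin k)) :
    ((modulus e).totient : ℝ) = (primorial D).totient * ∏ p ∈ supp e, (pval p - 1) := by
  unfold modulus
  rw [Nat.totient_mul (coprime_primorial_prodSet _), Nat.cast_mul, totient_prodSet]

lemma prod_supp_ite (e : sievePrimes D R → Option (Fin k)) (f : sievePrimes D R → ℝ) :
    ∏ p ∈ supp e, f p = ∏ p, if e p = none then 1 else f p := by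
  unfold supp
  rw [prod_filter]
  exact Finset.prod_congr rfl fun p _ => by by_cases h : e p = none <;> simp [h]

lemma prod_sum_intLaw (e : sievePrimes D R → Option (Fin k)) :
    ∏ p, ∑ a, intLaw (k := k) (pval p) a * leq (e p) a = 1 / (prodSet (supp e) : ℝ) := by
  unfold prodSet
  push_cast
  rw [prod_supp_ite e fun p => ((p : ℕ) : ℝ), one_div, ← Finset.prod_inv_distrib]
  refine Finset.prod_congr rfl fun p _ => ?_
  rw [Fintype.sum_option]
  rcases e p with _ | i
  · simp [intLaw, leq]; ring
  · simp [intLaw, leq, pval]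

lemma prod_sum_primeLaw (hk : 0 < k) (m : Fin k) (e : sievePrimes D R → Option (Fin k)) :
    ∏ p, ∑ a, primeLaw m (pval p) a * leq (e p) a =
      if ∀ p, e p ≠ some m then 1 / ∏ p ∈ supp e, (pval p - 1) else 0 := by
  have hsome : ∀ (p : sievePrimes D R) (i : Fin k), ∑ a, primeLaw m (pval p) a * leq (some i) a = primeLaw m (pval p) (some i) :=
    fun p i => by
      rw [Fintype.sum_option]
      simp [leq]
  split_ifs with H
  · rw [prod_supp_ite e fun p => pval p - 1, one_div, ← Finset.prod_inv_distrib]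
    refine Finset.prod_congr rfl fun p _ => ?_
    rcases he : e p with _ | i
    · rw [Fintype.sum_option]
      have : ∀ i, primeLaw m (pval p) (some i) = if i = m then 0 else 1 / (pval p - 1) :=
        fun i => rfl
      simp only [leq, true_or, if_true, mul_one, this, inv_one]
      rw [← Finset.sum_erase_add _ _ (mem_univ m), if_pos rfl, add_zero,
        Finset.sum_congr rfl fun i hi => if_neg (Finset.ne_of_mem_erase hi), sum_const,
        card_erase_of_mem (mem_univ m), card_univ, Fintype.card_fin, nsmul_eq_mul, Nat.cast_sub hk]
      simp only [primeLaw]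
      push_cast
      ring
    · rw [hsome]
      have : i ≠ m := fun h => H p (h ▸ he)
      simp [primeLaw, this]
  · push Not at H
    obtain ⟨p, hp⟩ := H
    refine Finset.prod_eq_zero (mem_univ p) ?_
    rw [hp, hsome]
    simp [primeLaw]

end Residues

end GapRuns

namespace GapRuns
open Real Filter Topology Finset MeasureTheory
open scoped ArithmeticFunction.vonMangoldt

section Level

variable {D R k : ℕ} {h : Fin k → ℤ} {L : ℝ} {y : (sievePrimes D R → Option (Fin k)) → ℝ}

lemma prodSet_supp_join_le (d d' : sievePrimes D R → Option (Fin k)) :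
    prodSet (supp (join d d')) ≤ prodSet (supp d) * prodSet (supp d') := by
  have h1 : ∀ e : sievePrimes D R → Option (Fin k),
      prodSet (supp e) = ∏ p, if e p = none then 1 else (p : ℕ) := fun e => by
    unfold prodSet supp
    rw [prod_filter]
    exact Finset.prod_congr rfl fun p _ => by by_cases h : e p = none <;> simp [h]
  rw [h1, h1, h1, ← prod_mul_distrib]
  refine Finset.prod_le_prod' fun p _ => ?_
  have := (sievePrimes_prime p).one_le
  unfold join
  by_cases h2 : d p = none <;> by_cases h3 : d' p = none <;> simp [h2, h3]
  nlinarith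

lemma modulus_join_le (hyL : ∀ b, y b ≠ 0 → ell pval (supp b) ≤ L)
    {d d' : sievePrimes D R → Option (Fin k)} (hd : lam pval y d ≠ 0) (hd' : lam pval y d' ≠ 0) :
    (modulus (join d d') : ℝ) ≤ primorial D * exp (2 * L) := by
  have h1 : ∀ e : sievePrimes D R → Option (Fin k), lam pval y e ≠ 0 →
      (prodSet (supp e) : ℝ) ≤ exp L := fun e he => by
    have := ell_supp_le_of_lam_ne_zero one_lt_pval hyL he
    rw [ell_pval] at this
    exact (log_le_iff_le_exp (by exact_mod_cast prodSet_pos _)).mp this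
  have h2 : (prodSet (supp (join d d')) : ℝ) ≤ prodSet (supp d) * prodSet (supp d') := by
    exact_mod_cast prodSet_supp_join_le d d'
  unfold modulus
  push_cast
  refine mul_le_mul_of_nonneg_left (h2.trans ?_) (by positivity)
  rw [two_mul, exp_add]
  exact mul_le_mul (h1 d hd) (h1 d' hd') (by positivity) (exp_pos _).le

lemma double_sum_le {B : ℝ} (hB : 0 ≤ B) (hy : ∀ b, |y b| ≤ 1)
    (hyL : ∀ b, y b ≠ 0 → ell pval (supp b) ≤ L) :
    ∑ d, ∑ d', |lam pval y d| * |lam pval y d'| * (if Compat d d' then B else 0) ≤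
      (exp L * euler k (pval : sievePrimes D R → ℝ)) ^ 2 * B := by
  calc _ ≤ ∑ d, ∑ d', |lam pval y d| * |lam pval y d'| * B := by
        refine Finset.sum_le_sum fun d _ => Finset.sum_le_sum fun d' _ => ?_
        refine mul_le_mul_of_nonneg_left ?_ (by positivity)
        split_ifs
        · exact le_rfl
        · exact hB
    _ = (∑ d, |lam pval y d|) ^ 2 * B := by
        rw [sq, sum_mul_sum, sum_mul]
        exact Finset.sum_congr rfl fun d _ => by rw [sum_mul]
    _ ≤ _ := by
        refine mul_le_mul_of_nonneg_right (pow_le_pow_left₀ (Finset.sum_nonneg fun d _ =>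
          abs_nonneg _) (sum_abs_lam_le one_lt_pval hy hyL) 2) hB

lemma abs_int_side_le (u : ℝ) (hs : Separated D R h) (ν : ℤ) (hy : ∀ b, |y b| ≤ 1)
    (hyL : ∀ b, y b ≠ 0 → ell pval (supp b) ≤ L) :
    |∑' n : ℕ, (om u n * if (primorial D : ℤ) ∣ n - ν then 1 else 0) *
        sieve pval y (state h n) ^ 2 - (∑' n, om u n) / primorial D *
        tensorForm (fun p => intLaw (pval p)) (fun p => evalAt (pval p)) y| ≤
      (exp L * euler k (pval : sievePrimes D R → ℝ)) ^ 2 *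
        (primorial D * exp (2 * L) * (48 * exp (-u / 2) * zetaThreeHalves)) := by
  have hz := zetaThreeHalves_nonneg
  obtain ⟨B, hB⟩ : ∃ B, B =
    primorial D * exp (2 * L) * (48 * exp (-u / 2) * zetaThreeHalves) := ⟨_, rfl⟩
  have hB0 : 0 ≤ B := by rw [hB]; positivity
  rw [← hB]
  refine le_trans (abs_tsum_sieve_sq_sub_le
    (f := fun n : ℕ => om u n * if (primorial D : ℤ) ∣ n - ν then 1 else 0)
    (Err := fun _ => B) ?_ ?_ (fun n : ℕ => state h n) _ _ _ _ ?_) (double_sum_le hB0 hy hyL)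
  · refine Summable.of_nonneg_of_le (fun n => ?_) (fun n => ?_) (summable_om u)
    · have := om_nonneg u n
      split_ifs <;> simp [this]
    · have := om_nonneg u n
      split_ifs <;> simp [this]
  · intro n
    have := om_nonneg u n
    split_ifs <;> simp [this]
  · intro d d' _ hd hd'
    set e := join d d'
    obtain ⟨a, ha, -⟩ := exists_residue hs ν e
    have h1 : ∀ n : ℕ, (om u n * if (primorial D : ℤ) ∣ n - ν then 1 else 0) *
        ∏ p, leq (e p) (state h n p) =
        (if (n : ZMod (modulus e)) = (a : ZMod (modulus e)) then 1 else 0) * om u n := fun n => by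
      have := ha n
      rw [Int.cast_natCast] at this
      rw [mul_assoc, this, mul_comm]
    have h2 : (∑' n, om u n) / primorial D *
        ∏ p, ∑ c, intLaw (k := k) (pval p) c * leq (e p) c = (∑' n, om u n) / (modulus e : ℝ) := by
      rw [prod_sum_intLaw, div_mul_div_comm, mul_one]
      unfold modulus; push_cast; rfl
    simp only [h1]
    rw [h2, hB]
    refine (abs_integers_progression_sub_le u (a : ZMod (modulus e))).trans ?_
    exact mul_le_mul_of_nonneg_right (modulus_join_le hyL hd hd') (by positivity)

lemma sum_pair_le (p : sievePrimes D R) (c : Prop) [Decidable c]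
    (hp : 3 * k / (pval p - 1) ≤ 1 / √(pval p)) :
    ∑ a : Option (Fin k), ∑ b : Option (Fin k), (if a = none ∧ b = none then (if c then 0 else 1)
      else if a = none ∨ b = none ∨ a = b then 1 / (pval p - 1) else 0) ≤
      (1 + 3 * k / (pval p - 1)) * if c then 1 / √(pval p) else 1 := by
  have h1 : ∑ a : Option (Fin k), ∑ b : Option (Fin k), (if a = none ∧ b = none then
      (if c then 0 else 1) else if a = none ∨ b = none ∨ a = b then 1 / (pval p - 1) else 0) =
      (if c then 0 else 1) + 3 * k / (pval p - 1) := by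
    simp only [Fintype.sum_option]
    simp
    ring
  rw [h1]
  have h0 : 0 < pval p - 1 := by linarith [one_lt_pval p]
  have h2 : 0 ≤ 3 * k / (pval p - 1) := by positivity
  split_ifs
  · have h3 : 0 ≤ 1 / √(pval p) := by positivity
    nlinarith
  · linarith

lemma dvd_of_dvd_modulus {r : ℕ} {e : sievePrimes D R → Option (Fin k)} (hr : r ∣ modulus e) :
    r ∣ primorial D * prodSet (univ.filter fun p : sievePrimes D R => (p : ℕ) ∣ r) := by
  have h1 : prodSet (supp e) = prodSet ((supp e).filter fun p : sievePrimes D R => (p : ℕ) ∣ r) *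
      prodSet ((supp e).filter fun p : sievePrimes D R => ¬ (p : ℕ) ∣ r) := by
    unfold prodSet
    rw [prod_filter_mul_prod_filter_not]
  have h2 : Nat.Coprime r
      (prodSet ((supp e).filter fun p : sievePrimes D R => ¬ (p : ℕ) ∣ r)) := by
    refine Nat.Coprime.prod_right fun p hp => ?_
    rw [Nat.coprime_comm, (sievePrimes_prime p).coprime_iff_not_dvd]
    exact (mem_filter.mp hp).2
  unfold modulus at hr
  rw [h1, ← mul_assoc] at hr
  refine (h2.dvd_of_dvd_mul_right hr).trans (mul_dvd_mul_left _ ?_)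
  exact Finset.prod_dvd_prod_of_subset _ _ _ (filter_subset_filter _ (subset_univ _))

lemma sum_join_le {r : ℕ} (hr : 0 < r)
    (hp : ∀ p : sievePrimes D R, 3 * k / (pval p - 1) ≤ 1 / √(pval p)) :
    ∑ d : sievePrimes D R → Option (Fin k), ∑ d' : sievePrimes D R → Option (Fin k),
      (if Compat d d' ∧ r ∣ modulus (join d d') then 1 / ((modulus (join d d')).totient : ℝ) else 0) ≤
      euler k (pval : sievePrimes D R → ℝ) * (√(primorial D) / (primorial D).totient) / √r := by
  have hW : 0 < ((primorial D).totient : ℝ) := by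
    exact_mod_cast Nat.totient_pos.mpr (primorial_pos D)
  have hp0 : ∀ p : sievePrimes D R, 0 < pval p - 1 := fun p => by linarith [one_lt_pval p]
  have hE := one_le_euler (k := k) (one_lt_pval : ∀ p : sievePrimes D R, 1 < pval p)
  by_cases hex : ∃ e : sievePrimes D R → Option (Fin k), r ∣ modulus e
  swap
  · push Not at hex
    rw [Finset.sum_eq_zero fun d _ => Finset.sum_eq_zero fun d' _ => if_neg fun h => hex _ h.2]
    positivity
  obtain ⟨e, he⟩ := hex
  set g : sievePrimes D R → Option (Fin k) → Option (Fin k) → ℝ := fun p a b =>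
    if a = none ∧ b = none then (if (p : ℕ) ∣ r then 0 else 1)
      else if a = none ∨ b = none ∨ a = b then 1 / (pval p - 1) else 0 with hg
  have hg0 : ∀ p a b, 0 ≤ g p a b := fun p a b => by
    have := hp0 p
    simp only [hg]
    split_ifs <;> positivity
  have hterm : ∀ d d' : sievePrimes D R → Option (Fin k),
      (if Compat d d' ∧ r ∣ modulus (join d d') then 1 / ((modulus (join d d')).totient : ℝ) else 0) ≤
        1 / ((primorial D).totient : ℝ) * ∏ p, g p (d p) (d' p) := fun d d' => by
    split_ifs with H
    · refine le_of_eq ?_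
      rw [totient_modulus, prod_supp_ite (join d d') fun p => pval p - 1, one_div, mul_inv,
        ← Finset.prod_inv_distrib, one_div]
      congr 1
      refine Finset.prod_congr rfl fun p _ => ?_
      have h1 : join d d' p = none ↔ d p = none ∧ d' p = none := by
        unfold join
        by_cases h2 : d p = none <;> simp [h2]
      simp only [hg]
      by_cases h2 : d p = none ∧ d' p = none
      · rw [if_pos (h1.mpr h2), if_pos h2, if_neg, inv_one]
        intro hpr
        have h3 : (p : ℕ) ∣ primorial D * prodSet (supp (join d d')) := hpr.trans H.2
        rcases (sievePrimes_prime p).dvd_mul.mp h3 with h4 | h4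
        · rw [(sievePrimes_prime p).dvd_primorial_iff] at h4
          exact absurd (lt_sievePrimes p) (by omega)
        · have h5 := Nat.mem_primeFactors.mpr ⟨sievePrimes_prime p, h4, (prodSet_pos _).ne'⟩
          rw [prodSet_primeFactors] at h5
          obtain ⟨p', hp', h6⟩ := mem_image.mp h5
          rw [Subtype.ext h6, mem_supp] at hp'
          exact hp' (h1.mpr h2)
      · rw [if_neg (fun h => h2 (h1.mp h)), if_neg h2, if_pos (H.1 p), one_div]
    · exact mul_nonneg (by positivity) (Finset.prod_nonneg fun p _ => hg0 _ _ _)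
  have hsum : ∑ d : sievePrimes D R → Option (Fin k), ∑ d' : sievePrimes D R → Option (Fin k),
      ∏ p, g p (d p) (d' p) = ∏ p, ∑ a, ∑ b, g p a b := by
    rw [prod_sum_config fun p a => ∑ b, g p a b]
    exact Finset.sum_congr rfl fun d _ => (prod_sum_config fun p b => g p (d p) b).symm
  set N := prodSet (univ.filter fun p : sievePrimes D R => (p : ℕ) ∣ r) with hN
  have hN0 : (0 : ℝ) < N := by exact_mod_cast prodSet_pos _
  have hprod : ∏ p : sievePrimes D R, (if (p : ℕ) ∣ r then 1 / √(pval p) else 1) = 1 / √N := by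
    rw [hN, ← prod_filter]
    unfold prodSet pval
    push_cast
    rw [prod_div_distrib, prod_const_one, Real.sqrt_prod _ fun p _ => by positivity]
  have hrN : (r : ℝ) ≤ primorial D * N := by
    exact_mod_cast Nat.le_of_dvd (Nat.mul_pos (primorial_pos D) (prodSet_pos _))
      (dvd_of_dvd_modulus he)
  have hsq : 1 / √N ≤ √(primorial D) / √r := by
    rw [div_le_div_iff₀ (by positivity) (by positivity), one_mul,
      ← Real.sqrt_mul (Nat.cast_nonneg _)]
    exact Real.sqrt_le_sqrt hrN
  calc _ ≤ ∑ d : sievePrimes D R → Option (Fin k), ∑ d' : sievePrimes D R → Option (Fin k),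
        1 / ((primorial D).totient : ℝ) * ∏ p, g p (d p) (d' p) :=
        Finset.sum_le_sum fun d _ => Finset.sum_le_sum fun d' _ => hterm d d'
    _ = 1 / ((primorial D).totient : ℝ) * ∏ p, ∑ a, ∑ b, g p a b := by
        rw [← hsum, mul_sum]
        exact Finset.sum_congr rfl fun d _ => by rw [mul_sum]
    _ ≤ 1 / ((primorial D).totient : ℝ) * ∏ p : sievePrimes D R,
        ((1 + 3 * k / (pval p - 1)) * if (p : ℕ) ∣ r then 1 / √(pval p) else 1) := by
        refine mul_le_mul_of_nonneg_left (Finset.prod_le_prod (fun p _ => Finset.sum_nonneg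
          fun a _ => Finset.sum_nonneg fun b _ => hg0 p a b) fun p _ => ?_) (by positivity)
        exact sum_pair_le p _ (hp p)
    _ = euler k (pval : sievePrimes D R → ℝ) * (1 / ((primorial D).totient : ℝ)) * (1 / √N) := by
        rw [prod_mul_distrib, hprod]
        unfold euler
        ring
    _ ≤ euler k (pval : sievePrimes D R → ℝ) * (1 / ((primorial D).totient : ℝ)) *
        (√(primorial D) / √r) := mul_le_mul_of_nonneg_left hsq (by positivity)
    _ = _ := by ring

end Level

end GapRuns

namespace GapRuns
open Real Filter Topology Finset MeasureTheory
open scoped ArithmeticFunction.vonMangoldt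

section Level

variable {D R k : ℕ} {h : Fin k → ℤ} {L : ℝ} {y : (sievePrimes D R → Option (Fin k)) → ℝ}

lemma sum_character_le {α : Type*} (S : Finset α) (ψ : α → ℝ) (hψ : ∀ c, 0 ≤ ψ c) (r : α → ℕ)
    (hr : ∀ c ∈ S, 0 < r c)
    (hp : ∀ p : sievePrimes D R, 3 * k / (pval p - 1) ≤ 1 / √(pval p)) :
    ∑ d : sievePrimes D R → Option (Fin k), ∑ d' : sievePrimes D R → Option (Fin k),
      (if Compat d d' then (∑ c ∈ S with r c ∣ modulus (join d d'), ψ c) /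
        ((modulus (join d d')).totient : ℝ) else 0) ≤
      euler k (pval : sievePrimes D R → ℝ) * (√(primorial D) / (primorial D).totient) *
        ∑ c ∈ S, ψ c / √(r c) := by
  have h1 : ∀ d d' : sievePrimes D R → Option (Fin k),
      (if Compat d d' then (∑ c ∈ S with r c ∣ modulus (join d d'), ψ c) /
        ((modulus (join d d')).totient : ℝ) else 0) =
      ∑ c ∈ S, ψ c * if Compat d d' ∧ r c ∣ modulus (join d d') then
        1 / ((modulus (join d d')).totient : ℝ) else 0 := fun d d' => by
    by_cases H : Compat d d'
    · rw [if_pos H, sum_filter, sum_div]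
      refine Finset.sum_congr rfl fun c _ => ?_
      by_cases H' : r c ∣ modulus (join d d')
      · rw [if_pos H', if_pos ⟨H, H'⟩]; ring
      · rw [if_neg H', if_neg fun h => H' h.2]; ring
    · rw [if_neg H]
      exact (Finset.sum_eq_zero fun c _ => by rw [if_neg fun h => H h.1, mul_zero]).symm
  calc _ = ∑ c ∈ S, ψ c * ∑ d : sievePrimes D R → Option (Fin k),
        ∑ d' : sievePrimes D R → Option (Fin k),
        if Compat d d' ∧ r c ∣ modulus (join d d') then
          1 / ((modulus (join d d')).totient : ℝ) else 0 := by
        simp only [h1]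
        simp only [mul_sum]
        refine (Finset.sum_congr rfl fun d _ => Finset.sum_comm).trans ?_
        exact Finset.sum_comm
    _ ≤ ∑ c ∈ S, ψ c * (euler k (pval : sievePrimes D R → ℝ) *
        (√(primorial D) / (primorial D).totient) / √(r c)) :=
        Finset.sum_le_sum fun c hc => mul_le_mul_of_nonneg_left (sum_join_le (hr c hc) hp) (hψ c)
    _ = _ := by
        rw [mul_sum]
        exact Finset.sum_congr rfl fun c _ => by ring

lemma abs_prime_term_le (u : ℝ) (hs : Separated D R h) (ν : ℤ) (m : Fin k)
    (hν : IsCoprime (primorial D : ℤ) (ν + h m)) (e : sievePrimes D R → Option (Fin k)) {Q : ℕ}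
    (hQ : modulus e ≤ Q) :
    |∑' n : ℕ, (Λ n * om u n * if (primorial D : ℤ) ∣ n - h m - ν then 1 else 0) *
        ∏ p, leq (e p) (state h (n - h m) p) - Psi u / (primorial D).totient *
        ∏ p, ∑ a, primeLaw m (pval p) a * leq (e p) a| ≤
      (∑ c ∈ primChars Q with c.1 ∣ modulus e, ‖∑' n, twL c.2 n * (om u n : ℂ)‖) /
        ((modulus e).totient : ℝ) + 24 * modulus e * exp (-u / 2) := by
  have hk : 0 < k := m.pos
  obtain ⟨a, ha, hunit⟩ := exists_residue hs ν e
  have h1 : ∀ n : ℕ, (Λ n * om u n * if (primorial D : ℤ) ∣ n - h m - ν then 1 else 0) *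
      ∏ p, leq (e p) (state h (n - h m) p) =
      (if (n : ZMod (modulus e)) = ((a + h m : ℤ) : ZMod (modulus e)) then 1 else 0) *
        (Λ n * om u n) := fun n => by
    rw [mul_assoc, ha, mul_comm]
    congr 1
    refine if_congr ?_ rfl rfl
    push_cast
    rw [sub_eq_iff_eq_add]
  have h2 : Psi u / (primorial D).totient * ∏ p, ∑ a, primeLaw m (pval p) a * leq (e p) a =
      if IsUnit ((a + h m : ℤ) : ZMod (modulus e)) then Psi u / ((modulus e).totient : ℝ) else 0 := by
    rw [prod_sum_primeLaw hk]
    by_cases H : ∀ p, e p ≠ some m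
    · rw [if_pos H, if_pos ((hunit m hν).mpr H), div_mul_div_comm, mul_one, totient_modulus]
    · rw [if_neg H, if_neg (fun h => H ((hunit m hν).mp h)), mul_zero]
  simp only [h1]
  rw [h2]
  exact abs_progression_sub_le u hQ _

lemma abs_prime_side_le (u : ℝ) (hs : Separated D R h) (ν : ℤ) (m : Fin k)
    (hν : IsCoprime (primorial D : ℤ) (ν + h m)) (hy : ∀ b, |y b| ≤ 1)
    (hyL : ∀ b, y b ≠ 0 → ell pval (supp b) ≤ L)
    (hp : ∀ p : sievePrimes D R, 3 * k / (pval p - 1) ≤ 1 / √(pval p)) {Q : ℕ}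
    (hQ : primorial D * exp (2 * L) ≤ Q) :
    |∑' n : ℕ, (Λ n * om u n * if (primorial D : ℤ) ∣ n - h m - ν then 1 else 0) *
        sieve pval y (state h (n - h m)) ^ 2 - Psi u / (primorial D).totient *
        tensorForm (fun p => primeLaw m (pval p)) (fun p => evalAt (pval p)) y| ≤
      euler k (pval : sievePrimes D R → ℝ) ^ 3 * (√(primorial D) / (primorial D).totient) *
        charMean u Q + (exp L * euler k (pval : sievePrimes D R → ℝ)) ^ 2 *
        (24 * (primorial D * exp (2 * L)) * exp (-u / 2)) := by
  set E := euler k (pval : sievePrimes D R → ℝ) with hE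
  have hE1 : 1 ≤ E := one_le_euler one_lt_pval
  set BV : (sievePrimes D R → Option (Fin k)) → ℝ := fun e =>
    (∑ c ∈ primChars Q with c.1 ∣ modulus e, ‖∑' n, twL c.2 n * (om u n : ℂ)‖) /
        ((modulus e).totient : ℝ) with hBV
  have hBV0 : ∀ e, 0 ≤ BV e := fun e =>
    div_nonneg (Finset.sum_nonneg fun c _ => norm_nonneg _) (Nat.cast_nonneg _)
  obtain ⟨B, hB⟩ : ∃ B, B = 24 * (primorial D * exp (2 * L)) * exp (-u / 2) := ⟨_, rfl⟩
  have hB0 : 0 ≤ B := by rw [hB]; positivity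
  rw [← hB]
  have hfin : ∑ d, ∑ d', |lam pval y d| * |lam pval y d'| *
      (if Compat d d' then BV (join d d') + B else 0) ≤
      E ^ 3 * (√(primorial D) / (primorial D).totient) * charMean u Q + (exp L * E) ^ 2 * B := by
    have h1 : ∑ d, ∑ d', |lam pval y d| * |lam pval y d'| *
        (if Compat d d' then BV (join d d') + B else 0) =
        ∑ d, ∑ d', |lam pval y d| * |lam pval y d'| * (if Compat d d' then BV (join d d') else 0) +
        ∑ d, ∑ d', |lam pval y d| * |lam pval y d'| * (if Compat d d' then B else 0) := by
      rw [← sum_add_distrib]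
      refine Finset.sum_congr rfl fun d _ => ?_
      rw [← sum_add_distrib]
      refine Finset.sum_congr rfl fun d' _ => ?_
      split_ifs <;> ring
    rw [h1]
    refine add_le_add ?_ (double_sum_le hB0 hy hyL)
    calc _ ≤ ∑ d, ∑ d', E ^ 2 * (if Compat d d' then BV (join d d') else 0) := by
          refine Finset.sum_le_sum fun d _ => Finset.sum_le_sum fun d' _ => ?_
          refine mul_le_mul_of_nonneg_right ?_ ?_
          · rw [sq]
            exact mul_le_mul (abs_lam_le one_lt_pval hy d) (abs_lam_le one_lt_pval hy d')
              (abs_nonneg _) (by linarith)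
          · split_ifs
            · exact hBV0 _
            · exact le_rfl
      _ = E ^ 2 * ∑ d, ∑ d', (if Compat d d' then BV (join d d') else 0) := by
          rw [mul_sum]
          exact Finset.sum_congr rfl fun d _ => by rw [mul_sum]
      _ ≤ E ^ 2 * (E * (√(primorial D) / (primorial D).totient) * charMean u Q) := by
          refine mul_le_mul_of_nonneg_left ?_ (by positivity)
          refine sum_character_le (primChars Q) (fun c => ‖∑' n, twL c.2 n * (om u n : ℂ)‖)
            (fun c => norm_nonneg _) (fun c => c.1) (fun c hc => ?_) hp
          have := (mem_primChars.mp hc).1.1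
          omega
      _ = _ := by ring
  refine le_trans (abs_tsum_sieve_sq_sub_le
    (f := fun n : ℕ => Λ n * om u n * if (primorial D : ℤ) ∣ n - h m - ν then 1 else 0)
    (Err := fun e => BV e + B) ?_ ?_ (fun n : ℕ => state h (n - h m)) _ _ _ _ ?_) hfin
  · refine Summable.of_nonneg_of_le (fun n => ?_) (fun n => ?_) (summable_vonMangoldt_mul_om u)
    · have := mul_nonneg (ArithmeticFunction.vonMangoldt_nonneg (n := n)) (om_nonneg u n)
      split_ifs <;> simp [this]
    · have := mul_nonneg (ArithmeticFunction.vonMangoldt_nonneg (n := n)) (om_nonneg u n)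
      split_ifs <;> simp [this]
  · intro n
    have := mul_nonneg (ArithmeticFunction.vonMangoldt_nonneg (n := n)) (om_nonneg u n)
    split_ifs <;> simp [this]
  · intro d d' _ hd hd'
    have hmod := modulus_join_le hyL hd hd'
    refine (abs_prime_term_le u hs ν m hν (join d d') (Q := Q)
      (by exact_mod_cast hmod.trans hQ)).trans (add_le_add le_rfl ?_)
    rw [hB]
    refine mul_le_mul_of_nonneg_right ?_ (exp_pos _).le
    linarith

end Level

end GapRuns

namespace GapRuns
open Real Filter Topology Finset MeasureTheory

section Tuple

/-- Shifts whose successive differences divide each other. -/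
def shift (k : ℕ) : ℕ → ℕ
  | 0 => 0
  | n + 1 => shift k n + (shift k n + k).factorial

lemma shift_strictMono (k : ℕ) : StrictMono (shift k) :=
  strictMono_nat_of_lt_succ fun n => Nat.lt_add_of_pos_right (Nat.factorial_pos _)

lemma dvd_shift_sub {k d b : ℕ} (hd : 0 < d) (hdb : d ≤ shift k b + k) {c : ℕ} (hbc : b ≤ c) :
    d ∣ shift k c - shift k b := by
  induction c, hbc using Nat.le_induction with
  | base => simp
  | succ c hbc ih =>
    have h1 := (shift_strictMono k).monotone hbc
    rw [shift, Nat.sub_add_comm h1]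
    exact dvd_add ih (Nat.dvd_factorial hd (by omega))

lemma shift_sub_dvd {k a b c : ℕ} (hab : a < b) (hbc : b ≤ c) :
    shift k b - shift k a ∣ shift k c - shift k b :=
  dvd_shift_sub (Nat.sub_pos_of_lt (shift_strictMono k hab)) (by omega) hbc

/-- A prime reserved for the integer `b`. -/
noncomputable def killer (k b : ℕ) : ℕ := Nat.nth Nat.Prime (shift k k + b)

lemma killer_prime (k b : ℕ) : (killer k b).Prime := Nat.prime_nth_prime _

lemma killer_injective (k : ℕ) : Function.Injective (killer k) := fun a b hab => by
  have := Nat.nth_injective Nat.infinite_setOfPred_prime hab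
  omega

lemma lt_killer (k b : ℕ) : shift k k + b < killer k b := by
  have := Nat.add_two_le_nth_prime (shift k k + b)
  unfold killer
  omega

lemma exists_local_residue (k : ℕ) {p : ℕ} (hp : p.Prime) :
    ∃ t : ℤ, (∀ i < k, ¬ (p : ℤ) ∣ t + shift k i) ∧
      ∀ b ≤ shift k k, (∀ i < k, shift k i ≠ b) → p = killer k b → (p : ℤ) ∣ t + b := by
  by_cases H : ∃ b ≤ shift k k, (∀ i < k, shift k i ≠ b) ∧ p = killer k b
  · obtain ⟨b, hb, hbi, rfl⟩ := H
    refine ⟨-b, fun i hi hd => ?_, fun b' _ _ h => ?_⟩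
    · have h1 := shift_strictMono k hi
      have h2 := lt_killer k b
      have h3 := Int.eq_zero_of_abs_lt_dvd hd (by rw [abs_lt]; constructor <;> omega)
      exact hbi i hi (by omega)
    · rw [killer_injective k h]; simp
  · push Not at H
    suffices ∃ t : ℤ, ∀ i < k, ¬ (p : ℤ) ∣ t + shift k i by
      obtain ⟨t, ht⟩ := this
      exact ⟨t, ht, fun b hb hbi h => absurd h (H b hb hbi)⟩
    have : Fact p.Prime := ⟨hp⟩
    rcases le_or_gt p k with hpk | hpk
    · refine ⟨1, fun i hi hd => ?_⟩
      have h1 : p ∣ shift k i := by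
        have := dvd_shift_sub (k := k) (b := 0) hp.pos (by omega) (Nat.zero_le i)
        simpa [shift] using this
      have h2 := dvd_sub hd (Int.natCast_dvd_natCast.mpr h1)
      rw [add_sub_cancel_right] at h2
      exact hp.one_lt.ne' (Nat.dvd_one.mp (by exact_mod_cast h2))
    · have hcard : ((range k).image fun i => -(shift k i : ZMod p)).card <
          (univ : Finset (ZMod p)).card := by
        refine lt_of_le_of_lt card_image_le ?_
        rw [card_range, card_univ, ZMod.card]
        exact hpk
      obtain ⟨t, -, ht⟩ := Finset.exists_mem_notMem_of_card_lt_card hcard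
      obtain ⟨s, rfl⟩ := ZMod.intCast_surjective t
      refine ⟨s, fun i hi hd => ht (mem_image.mpr ⟨i, Finset.mem_range.mpr hi, ?_⟩)⟩
      have := (ZMod.intCast_zmod_eq_zero_iff_dvd _ p).mpr hd
      push_cast at this
      exact (eq_neg_of_add_eq_zero_left this).symm

lemma exists_start (k D : ℕ) : ∃ ν : ℤ,
    (∀ i < k, IsCoprime (primorial D : ℤ) (ν + shift k i)) ∧
      ∀ b ≤ shift k k, (∀ i < k, shift k i ≠ b) → killer k b ≤ D → (killer k b : ℤ) ∣ ν + b := by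
  choose! t ht using fun (p : ℕ) (hp : p.Prime) => exists_local_residue k hp
  obtain ⟨ν, -, hν⟩ := exists_int_crt ((range (D + 1)).filter Nat.Prime) (fun p => (p : ℤ)) 1 0
    (fun _ _ => isCoprime_one_left) (fun p hp p' hp' hne => by
      have h1 := (mem_filter.mp hp).2
      have h2 := (mem_filter.mp hp').2
      exact Nat.isCoprime_iff_coprime.mpr ((Nat.coprime_primes h1 h2).mpr hne)) t
  refine ⟨ν, fun i hi => ?_, fun b hb hbi hD => ?_⟩
  · unfold primorial
    push_cast
    refine IsCoprime.prod_left fun p hp => ?_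
    have hpp := (mem_filter.mp hp).2
    rw [(Nat.prime_iff_prime_int.mp hpp).coprime_iff_not_dvd]
    intro hd
    refine (ht p hpp).1 i hi ?_
    have := dvd_sub hd (hν p hp)
    rwa [show ν + (shift k i : ℤ) - (ν - t p) = t p + shift k i by ring] at this
  · have hpp := killer_prime k b
    have h1 := (ht _ hpp).2 b hb hbi rfl
    have h2 := hν (killer k b) (mem_filter.mpr ⟨Finset.mem_range.mpr (by omega), hpp⟩)
    have := dvd_add h2 h1
    rwa [show ν - t (killer k b) + (t (killer k b) + b) = ν + b by ring] at this

lemma exists_run {k D m n : ℕ} {ν : ℤ} (hD : killer k (shift k k) ≤ D)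
    (hν : ∀ b ≤ shift k k, (∀ i < k, shift k i ≠ b) → killer k b ≤ D → (killer k b : ℤ) ∣ ν + b)
    (hn : D < n) (hnν : (primorial D : ℤ) ∣ n - ν)
    (hcard : m < (univ.filter fun i : Fin k => (n + shift k i).Prime).card) :
    ∀ j, 2 ≤ j → j ≤ m →
      primeGap (Nat.count Nat.Prime n) (j - 1) ∣ primeGap (Nat.count Nat.Prime n) j := by
  set r := Nat.count Nat.Prime n with hr
  have hcount : r + m < Nat.count Nat.Prime (n + (shift k k + 1)) := by
    rw [Nat.count_add, ← hr, Nat.count_eq_card_filter_range]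
    refine Nat.add_lt_add_left (hcard.trans_le ?_) _
    refine Finset.card_le_card_of_injOn (fun i : Fin k => shift k i) (fun i hi => ?_)
      fun i _ j _ h => Fin.ext ((shift_strictMono k).injective h)
    have h1 := shift_strictMono k i.2
    have h2 := (mem_filter.mp hi).2
    exact mem_filter.mpr ⟨Finset.mem_range.mpr (by dsimp only; omega), h2⟩
  have hidx : ∀ j ≤ m, ∃ i < k, Nat.nth Nat.Prime (r + j) = n + shift k i := fun j hj => by
    have h1 : Nat.nth Nat.Prime (r + j) < n + (shift k k + 1) :=
      Nat.nth_lt_of_lt_count (by omega)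
    have h2 : n ≤ Nat.nth Nat.Prime (r + j) := by
      by_contra hlt
      push Not at hlt
      have := Nat.count_monotone Nat.Prime (Nat.succ_le_of_lt hlt)
      rw [Nat.succ_eq_add_one, Nat.count_nth_succ_of_infinite Nat.infinite_setOfPred_prime] at this
      omega
    obtain ⟨b, hb⟩ := Nat.exists_eq_add_of_le h2
    by_contra hno
    push Not at hno
    have hbi : ∀ i < k, shift k i ≠ b := fun i hi h => hno i hi (by rw [hb, h])
    have hbk : b ≤ shift k k := by omega
    have hkD : killer k b ≤ D := by
      refine le_trans ?_ hD
      exact (Nat.nth_strictMono Nat.infinite_setOfPred_prime).monotone (by omega)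
    have h3 := hν b hbk hbi hkD
    have h4 : (killer k b : ℤ) ∣ n - ν := dvd_trans
      (Int.natCast_dvd_natCast.mpr ((killer_prime k b).dvd_primorial_iff.mpr hkD)) hnν
    have h5 : killer k b ∣ n + b := by
      have := dvd_add h4 h3
      rw [show (n : ℤ) - ν + (ν + b) = ((n + b : ℕ) : ℤ) by push_cast; ring] at this
      exact Int.natCast_dvd_natCast.mp this
    have h6 : (n + b).Prime := hb ▸ Nat.prime_nth_prime (r + j)
    have h7 := (Nat.prime_dvd_prime_iff_eq (killer_prime k b) h6).mp h5
    omega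
  choose! i hik hi using hidx
  have hmono : ∀ j < m, i j < i (j + 1) := fun j hj => by
    have h1 := (Nat.nth_strictMono Nat.infinite_setOfPred_prime) (show r + j < r + (j + 1) by omega)
    rw [hi j hj.le, hi (j + 1) hj] at h1
    exact (shift_strictMono k).lt_iff_lt.mp (by omega)
  have hgap : ∀ j < m, primeGap r (j + 1) = shift k (i (j + 1)) - shift k (i j) := fun j hj => by
    unfold primeGap nthPrime
    rw [show r + (j + 1) + 1 - 1 = r + (j + 1) by omega, show r + (j + 1) - 1 = r + j by omega,
      hi j hj.le, hi (j + 1) hj]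
    omega
  intro j hj2 hjm
  obtain ⟨j, rfl⟩ := Nat.exists_eq_add_of_le hj2
  rw [show 2 + j - 1 = j + 1 by omega, show 2 + j = (j + 1) + 1 by omega, hgap j (by omega),
    hgap (j + 1) (by omega)]
  exact shift_sub_dvd (hmono j (by omega)) (hmono (j + 1) (by omega)).le

end Tuple

end GapRuns

namespace GapRuns
open Real Filter Topology Finset MeasureTheory
open scoped ArithmeticFunction.vonMangoldt

section Tails

/-- A prime in the range carrying almost all the mass of the weight `om u`. -/
def IsMain (u : ℝ) (n : ℕ) : Prop := exp (u / 2) ≤ n ∧ (n : ℝ) ≤ exp (3 * u / 2) ∧ n.Prime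

open Classical in
/-- The von Mangoldt mass outside the main primes. -/
noncomputable def rest (u : ℝ) (n : ℕ) : ℝ := if IsMain u n then 0 else Λ n * om u n

lemma rest_nonneg (u : ℝ) (n : ℕ) : 0 ≤ rest u n := by
  unfold rest
  split_ifs
  · rfl
  · exact mul_nonneg ArithmeticFunction.vonMangoldt_nonneg (om_nonneg _ _)

lemma rest_le (u : ℝ) (n : ℕ) : rest u n ≤ Λ n * om u n := by
  unfold rest
  split_ifs
  · exact mul_nonneg ArithmeticFunction.vonMangoldt_nonneg (om_nonneg _ _)
  · rfl

lemma summable_rest (u : ℝ) : Summable (rest u) :=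
  (summable_vonMangoldt_mul_om u).of_nonneg_of_le (rest_nonneg u) (rest_le u)

lemma vonMangoldt_mul_om_le_of_large {u : ℝ} {n : ℕ} (hn : exp (3 * u / 2) < n) :
    Λ n * om u n ≤ exp 18 * exp (-(3 * u / 4)) * (n : ℝ) ^ (-(3 / 2) : ℝ) := by
  have hn' : (0 : ℝ) < n := (exp_pos _).trans hn
  have hn0 : 0 < n := by exact_mod_cast hn'
  have hlog : 3 * u / 2 ≤ log n := (le_log_iff_exp_le hn').mpr hn.le
  have h1 : Λ n ≤ exp (log n) := by
    rw [exp_log hn']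
    exact (vonMangoldt_le_log n).trans (log_le_self hn'.le)
  refine (mul_le_mul h1 (om_le 7 u hn0) (om_nonneg _ _) (exp_pos _).le).trans ?_
  rw [rpow_def_of_pos hn', rpow_def_of_pos hn', ← exp_add, ← exp_add, ← exp_add, ← exp_add, ← exp_add]
  apply exp_le_exp.mpr
  linarith

lemma exists_rest_le : ∃ K : ℝ, 0 ≤ K ∧ ∀ u : ℝ, 1 ≤ u →
    ∑' n, rest u n ≤ K * u * exp (-(u / 4)) := by
  classical
  refine ⟨18 + exp 18 * zetaThreeHalves, by have := zetaThreeHalves_nonneg; positivity,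
    fun u hu => ?_⟩
  have hz := zetaThreeHalves_nonneg
  have hpt : ∀ n : ℕ, rest u n ≤
      (if n ∈ (Finset.Ioc 0 ⌊exp (3 * u / 2)⌋₊).filter (fun n => ¬ n.Prime)
        then 2 * exp (-u) * Λ n else 0) +
      (if n ∈ Finset.Ioc 0 ⌊exp (u / 2)⌋₊ then 2 * exp (-u) * Λ n else 0) +
      (if n = 0 then 0 else exp 18 * exp (-(3 * u / 4)) * (n : ℝ) ^ (-(3 / 2) : ℝ)) := by
    intro n
    have hΛ : 0 ≤ Λ n := ArithmeticFunction.vonMangoldt_nonneg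
    have hA : 0 ≤ (if n ∈ (Finset.Ioc 0 ⌊exp (3 * u / 2)⌋₊).filter (fun n => ¬ n.Prime)
        then 2 * exp (-u) * Λ n else 0) := by split_ifs <;> positivity
    have hB : 0 ≤ (if n ∈ Finset.Ioc 0 ⌊exp (u / 2)⌋₊ then 2 * exp (-u) * Λ n else 0) := by
      split_ifs <;> positivity
    have hC : 0 ≤ (if n = 0 then 0 else
        exp 18 * exp (-(3 * u / 4)) * (n : ℝ) ^ (-(3 / 2) : ℝ)) := by split_ifs <;> positivity
    rcases Nat.eq_zero_or_pos n with rfl | hn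
    · have : rest u 0 = 0 := by simp [rest, om_zero]
      rw [this]
      positivity
    have hom : Λ n * om u n ≤ 2 * exp (-u) * Λ n := by
      rw [mul_comm (2 * exp (-u))]
      exact mul_le_mul_of_nonneg_left (om_le_exp_neg u n) hΛ
    by_cases hm : IsMain u n
    · rw [rest, if_pos hm]
      positivity
    by_cases h1 : (n : ℝ) ≤ exp (u / 2)
    · have : (if n ∈ Finset.Ioc 0 ⌊exp (u / 2)⌋₊ then 2 * exp (-u) * Λ n else 0) =
          2 * exp (-u) * Λ n := if_pos (Finset.mem_Ioc.mpr ⟨hn, Nat.le_floor h1⟩)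
      have := rest_le u n
      linarith
    by_cases h2 : (n : ℝ) ≤ exp (3 * u / 2)
    · have hnp : ¬ n.Prime := fun hp => hm ⟨(not_le.mp h1).le, h2, hp⟩
      have : (if n ∈ (Finset.Ioc 0 ⌊exp (3 * u / 2)⌋₊).filter (fun n => ¬ n.Prime)
        then 2 * exp (-u) * Λ n else 0) = 2 * exp (-u) * Λ n :=
        if_pos (Finset.mem_filter.mpr ⟨Finset.mem_Ioc.mpr ⟨hn, Nat.le_floor h2⟩, hnp⟩)
      have := rest_le u n
      linarith
    · have h3 := vonMangoldt_mul_om_le_of_large (not_le.mp h2)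
      have : (if n = 0 then 0 else exp 18 * exp (-(3 * u / 4)) * (n : ℝ) ^ (-(3 / 2) : ℝ)) =
        exp 18 * exp (-(3 * u / 4)) * (n : ℝ) ^ (-(3 / 2) : ℝ) := if_neg hn.ne'
      have := rest_le u n
      linarith
  refine Real.tsum_le_of_sum_range_le (rest_nonneg u) fun N => ?_
  refine (Finset.sum_le_sum fun n _ => hpt n).trans ?_
  rw [Finset.sum_add_distrib, Finset.sum_add_distrib, Finset.sum_ite_mem, Finset.sum_ite_mem]
  have hΛ : ∀ n : ℕ, 0 ≤ 2 * exp (-u) * Λ n := fun n =>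
    mul_nonneg (by positivity) ArithmeticFunction.vonMangoldt_nonneg
  have hA : ∑ n ∈ range N ∩ (Finset.Ioc 0 ⌊exp (3 * u / 2)⌋₊).filter (fun n => ¬ n.Prime),
      2 * exp (-u) * Λ n ≤ 6 * (u * exp (-(u / 4))) := by
    refine (Finset.sum_le_sum_of_subset_of_nonneg Finset.inter_subset_right
      fun n _ _ => hΛ n).trans ?_
    rw [← Finset.mul_sum, ← Chebyshev.psi_sub_theta_eq_sum_not_prime]
    have h := Chebyshev.psi_sub_theta_le (x := exp (3 * u / 2)) (one_le_exp (by linarith))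
    rw [log_exp, ← exp_half] at h
    calc 2 * exp (-u) * _ ≤ 2 * exp (-u) * (2 * exp (3 * u / 2 / 2) * (3 * u / 2)) :=
          mul_le_mul_of_nonneg_left h (by positivity)
      _ = 6 * (u * (exp (-u) * exp (3 * u / 2 / 2))) := by ring
      _ = _ := by
        rw [← exp_add]
        congr 3
        ring
  have hle : exp (-(u / 2)) ≤ u * exp (-(u / 4)) := by
    have : exp (-(u / 2)) ≤ exp (-(u / 4)) := exp_le_exp.mpr (by linarith)
    nlinarith [exp_pos (-(u / 4))]
  have hB : ∑ n ∈ range N ∩ Finset.Ioc 0 ⌊exp (u / 2)⌋₊, 2 * exp (-u) * Λ n ≤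
      12 * (u * exp (-(u / 4))) := by
    refine (Finset.sum_le_sum_of_subset_of_nonneg Finset.inter_subset_right
      fun n _ _ => hΛ n).trans ?_
    rw [← Finset.mul_sum]
    have h := Chebyshev.psi_le_const_mul_self (x := exp (u / 2)) (exp_pos _).le
    have h4 : log 4 ≤ 2 := by
      rw [show (4 : ℝ) = 2 ^ 2 by norm_num, log_pow]
      have := log_two_lt_d9
      push_cast
      linarith
    calc 2 * exp (-u) * Chebyshev.psi (exp (u / 2)) ≤ 2 * exp (-u) * (6 * exp (u / 2)) :=
          mul_le_mul_of_nonneg_left (h.trans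
            (mul_le_mul_of_nonneg_right (by linarith) (exp_pos _).le)) (by positivity)
      _ = 12 * (exp (-u) * exp (u / 2)) := by ring
      _ = 12 * exp (-(u / 2)) := by
        rw [← exp_add]
        congr 2
        ring
      _ ≤ _ := by linarith
  have hC : ∑ n ∈ range N, (if n = 0 then 0 else
      exp 18 * exp (-(3 * u / 4)) * (n : ℝ) ^ (-(3 / 2) : ℝ)) ≤
      exp 18 * zetaThreeHalves * (u * exp (-(u / 4))) := by
    rcases N with _ | N
    · rw [Finset.range_zero, Finset.sum_empty]
      positivity
    rw [Finset.sum_range_succ', if_pos rfl, add_zero]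
    refine (sum_range_le_zeta (D := exp 18 * exp (-(3 * u / 4))) (by positivity)
      (fun l => ?_) N).trans ?_
    · rw [if_neg (Nat.succ_ne_zero l)]
    · have : exp (-(3 * u / 4)) ≤ u * exp (-(u / 4)) :=
        (exp_le_exp.mpr (by linarith)).trans hle
      calc exp 18 * exp (-(3 * u / 4)) * zetaThreeHalves =
          exp 18 * zetaThreeHalves * exp (-(3 * u / 4)) := by ring
        _ ≤ _ := mul_le_mul_of_nonneg_left this (by positivity)
  calc _ ≤ 6 * (u * exp (-(u / 4))) + 12 * (u * exp (-(u / 4))) +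
        exp 18 * zetaThreeHalves * (u * exp (-(u / 4))) := add_le_add (add_le_add hA hB) hC
    _ = _ := by ring

/-- A bounded shift at most doubles the weight in the main range. -/
lemma om_add_le {u : ℝ} (hu : 0 ≤ u) {n h : ℕ} (hn : exp (u / 2) ≤ ((n + h : ℕ) : ℝ))
    (hn2 : ((n + h : ℕ) : ℝ) ≤ exp (3 * u / 2)) (hh : 4 * h * (u + 1) ≤ exp (u / 2)) :
    om u (n + h) ≤ 2 * om u n := by
  push_cast at hn hn2
  have hh' : (0 : ℝ) ≤ h := Nat.cast_nonneg _
  have hn0 : (0 : ℝ) < n := by nlinarith [exp_pos (u / 2)]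
  have hN0 : (0 : ℝ) < n + h := by linarith
  have h4 : 2 * h * (u + 1) ≤ n := by nlinarith
  have hlog : log (n + h) ≤ 3 * u / 2 := (log_le_iff_le_exp hN0).mpr hn2
  have hlog2 : log (n + h) - log n ≤ h / n := by
    rw [← log_div hN0.ne' hn0.ne']
    refine (log_le_sub_one_of_pos (by positivity)).trans (le_of_eq ?_)
    field_simp
    ring
  have hlogle : log n ≤ log (n + h) := log_le_log hn0 (by linarith)
  have hbase : u / 2 ≤ log (n + h) := (le_log_iff_exp_le hN0).mpr hn
  have hsmall : h / n * (u + 1) ≤ (1 / 2 : ℝ) := by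
    rw [div_mul_eq_mul_div, div_le_iff₀ hn0]
    linarith
  have hfrac : (0 : ℝ) ≤ h / n := by positivity
  have h2 : exp (1 / 2 : ℝ) ≤ 2 := by
    have : exp (1 / 2 : ℝ) ^ 2 ≤ 2 ^ 2 := by
      rw [← exp_nat_mul]; norm_num
      linarith [exp_one_lt_d9]
    exact (pow_le_pow_iff_left₀ (exp_pos _).le (by norm_num) two_ne_zero).mp this
  have e1 : om u (n + h) = exp (-log (n + h) - (log (n + h) - u) ^ 2 / 2) := by
    have := gw_eq u hN0
    unfold om
    push_cast
    exact this
  have e2 : om u n = exp (-log n - (log n - u) ^ 2 / 2) := gw_eq u hn0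
  rw [e1, e2]
  calc _ ≤ exp (1 / 2 + (-log n - (log n - u) ^ 2 / 2)) := by
        apply exp_le_exp.mpr
        set a := log (n + h)
        set b := log n
        have : ((b - u) ^ 2 - (a - u) ^ 2) = (a - b) * (2 * u - a - b) := by ring
        have h5 : (a - b) * (2 * u - a - b) ≤ (h / n) * (2 * (u + 1)) := by
          have h6 : 2 * u - a - b ≤ 2 * (u + 1) := by
            have : h / n ≤ (1 / 2 : ℝ) := by nlinarith
            linarith
          exact (mul_le_mul_of_nonneg_left h6 (by linarith)).trans
            (mul_le_mul_of_nonneg_right hlog2 (by linarith))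
        linarith
    _ = exp (1 / 2) * exp (-log n - (log n - u) ^ 2 / 2) := exp_add _ _
    _ ≤ _ := mul_le_mul_of_nonneg_right h2 (exp_pos _).le

end Tails

end GapRuns

namespace GapRuns
open Real Filter Topology Finset MeasureTheory
open scoped ArithmeticFunction.vonMangoldt

section Compare

lemma summable_of_bdd_mul {a g : ℕ → ℝ} {B : ℝ} (ha : Summable a) (ha0 : ∀ n, 0 ≤ a n)
    (hg0 : ∀ n, 0 ≤ g n) (hg : ∀ n, g n ≤ B) : Summable fun n => a n * g n :=
  (ha.mul_right B).of_nonneg_of_le (fun n => mul_nonneg (ha0 n) (hg0 n))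
    fun n => mul_le_mul_of_nonneg_left (hg n) (ha0 n)

/-- The prime sums of a weight are controlled by its integer sum when few shifts are prime. -/
lemma sum_prime_side_le {k m n₀ H : ℕ} {u B : ℝ} (hu : 0 ≤ u) {g : ℤ → ℝ} {a : Fin k → ℕ}
    (hg0 : ∀ x, 0 ≤ g x) (hgB : ∀ x, g x ≤ B) (haH : ∀ i, a i ≤ H)
    (hH : 4 * H * (u + 1) ≤ exp (u / 2)) (hn₀ : (n₀ + H : ℝ) < exp (u / 2))
    (hcount : ∀ n : ℕ, n₀ < n → g n ≠ 0 → (univ.filter fun i => (n + a i).Prime).card ≤ m) :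
    ∑ i, ∑' N : ℕ, Λ N * om u N * g (N - a i) ≤
      k * (B * ∑' N, rest u N) + 3 * u * m * ∑' n : ℕ, om u n * g n := by
  classical
  have hΛ : ∀ n : ℕ, 0 ≤ Λ n := fun n => ArithmeticFunction.vonMangoldt_nonneg
  have hB : 0 ≤ B := (hg0 0).trans (hgB 0)
  have hLs := summable_vonMangoldt_mul_om u
  have hL0 : ∀ n, 0 ≤ Λ n * om u n := fun n => mul_nonneg (hΛ n) (om_nonneg u n)
  have hterm : ∀ i, Summable fun N : ℕ => Λ N * om u N * g (N - a i) := fun i =>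
    summable_of_bdd_mul hLs hL0 (fun _ => hg0 _) fun _ => hgB _
  have hint : Summable fun n : ℕ => om u n * g n :=
    summable_of_bdd_mul (summable_om u) (om_nonneg u) (fun _ => hg0 _) fun _ => hgB _
  let M : Fin k → ℕ → ℝ := fun i N => if IsMain u N then Λ N * om u N * g (N - a i) else 0
  have hM0 : ∀ i N, 0 ≤ M i N := fun i N => by
    dsimp only [M]
    split_ifs
    exacts [mul_nonneg (hL0 N) (hg0 _), le_rfl]
  have hMs : ∀ i, Summable (M i) := fun i => (hterm i).of_nonneg_of_le (hM0 i) fun N => by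
    dsimp only [M]
    split_ifs
    exacts [le_rfl, mul_nonneg (hL0 N) (hg0 _)]
  let V : Fin k → ℕ → ℝ := fun i n =>
    (if n₀ < n ∧ (n + a i).Prime then 1 else 0) * (3 * u * (om u n * g n))
  have h3 : ∀ n : ℕ, 0 ≤ 3 * u * (om u n * g n) := fun n =>
    mul_nonneg (by positivity) (mul_nonneg (om_nonneg u n) (hg0 _))
  have hVs : ∀ i, Summable (V i) := fun i => (hint.mul_left (3 * u)).of_nonneg_of_le
    (fun n => mul_nonneg (by split_ifs <;> simp) (h3 n))
    fun n => mul_le_of_le_one_left (h3 n) (by split_ifs <;> simp)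
  have hsplit : ∀ i, ∑' N : ℕ, Λ N * om u N * g (N - a i) ≤
      B * ∑' N, rest u N + ∑' N, M i N := fun i => by
    rw [← tsum_mul_left, ← ((summable_rest u).mul_left B).tsum_add (hMs i)]
    refine (hterm i).tsum_le_tsum (fun N => ?_) (((summable_rest u).mul_left B).add (hMs i))
    dsimp only [M, rest]
    split_ifs
    · simp
    · rw [add_zero, mul_comm B]
      exact mul_le_mul_of_nonneg_left (hgB _) (hL0 N)
  have hshift : ∀ i, ∑' N, M i N ≤ ∑' n, V i n := fun i => by
    have haH' : (a i : ℝ) ≤ H := by exact_mod_cast haH i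
    have hzero : ∑ N ∈ range (a i), M i N = 0 := Finset.sum_eq_zero fun N hN => by
      have : (N : ℝ) < a i := by exact_mod_cast Finset.mem_range.mp hN
      refine if_neg fun hm => ?_
      have := hm.1
      have : (0 : ℝ) ≤ n₀ := Nat.cast_nonneg _
      linarith
    rw [← (hMs i).sum_add_tsum_nat_add (a i), hzero, zero_add]
    refine ((summable_nat_add_iff (a i)).mpr (hMs i)).tsum_le_tsum (fun n => ?_) (hVs i)
    by_cases hm : IsMain u (n + a i)
    · have hn : n₀ < n := by
        have h1 := hm.1
        push_cast at h1
        have : (n₀ : ℝ) < n := by linarith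
        exact_mod_cast this
      have e1 : M i (n + a i) = Λ (n + a i) * om u (n + a i) * g ((n + a i : ℕ) - a i) :=
        if_pos hm
      have e2 : V i n = 3 * u * (om u n * g n) := by
        dsimp only [V]
        rw [if_pos ⟨hn, hm.2.2⟩, one_mul]
      rw [e1, e2, show ((n + a i : ℕ) : ℤ) - a i = n by push_cast; ring]
      have h1 : Λ (n + a i) ≤ 3 * u / 2 := by
        refine (vonMangoldt_le_log _).trans ((log_le_iff_le_exp ?_).mpr hm.2.1)
        exact_mod_cast hm.2.2.pos
      have h2 : om u (n + a i) ≤ 2 * om u n := om_add_le hu hm.1 hm.2.1 (by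
        refine le_trans ?_ hH
        exact mul_le_mul_of_nonneg_right (by linarith) (by linarith))
      have h4 : Λ (n + a i) * om u (n + a i) ≤ 3 * u / 2 * (2 * om u n) :=
        mul_le_mul h1 h2 (om_nonneg _ _) (by positivity)
      exact (mul_le_mul_of_nonneg_right h4 (hg0 n)).trans (le_of_eq (by ring))
    · have e1 : M i (n + a i) = 0 := if_neg hm
      rw [e1]
      exact mul_nonneg (by split_ifs <;> simp) (h3 n)
  calc ∑ i, ∑' N : ℕ, Λ N * om u N * g (N - a i)
      ≤ ∑ i : Fin k, (B * ∑' N, rest u N + ∑' n, V i n) :=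
        Finset.sum_le_sum fun i _ => (hsplit i).trans (by linarith [hshift i])
    _ = k * (B * ∑' N, rest u N) + ∑' n, ∑ i, V i n := by
        rw [Finset.sum_add_distrib, Finset.sum_const, card_univ, Fintype.card_fin, nsmul_eq_mul,
          Summable.tsum_finsetSum fun i _ => hVs i]
    _ ≤ _ := by
        refine add_le_add le_rfl ?_
        rw [← tsum_mul_left]
        refine (summable_sum fun i _ => hVs i).tsum_le_tsum (fun n => ?_) (hint.mul_left _)
        dsimp only [V]
        rw [← Finset.sum_mul]
        by_cases hc : n₀ < n ∧ g n ≠ 0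
        · have h5 : ∑ i : Fin k, (if n₀ < n ∧ (n + a i).Prime then (1 : ℝ) else 0) ≤ m := by
            rw [Finset.sum_boole]
            refine le_trans ?_ (Nat.cast_le.mpr (hcount n hc.1 hc.2))
            have h6 : (univ.filter fun i : Fin k => n₀ < n ∧ (n + a i).Prime) ⊆
                univ.filter fun i : Fin k => (n + a i).Prime := fun i hi =>
              mem_filter.mpr ⟨mem_univ i, (mem_filter.mp hi).2.2⟩
            exact Nat.cast_le.mpr (Finset.card_le_card h6)
          exact (mul_le_mul_of_nonneg_right h5 (h3 n)).trans (le_of_eq (by ring))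
        · by_cases hn : n₀ < n
          · have : g n = 0 := by
              by_contra h
              exact hc ⟨hn, h⟩
            simp [this]
          · have : ∑ i : Fin k, (if n₀ < n ∧ (n + a i).Prime then (1 : ℝ) else 0) = 0 :=
              Finset.sum_eq_zero fun i _ => if_neg fun h => hn h.1
            rw [this, zero_mul]
            exact mul_nonneg (by positivity) (mul_nonneg (om_nonneg u n) (hg0 _))

end Compare

end GapRuns

namespace GapRuns
open Real Filter Topology Finset MeasureTheory
open scoped ArithmeticFunction.vonMangoldt

section Core

lemma main_term_le {k J : ℕ} {κ s L A₁ A₂ φ W P T : ℝ} (hk : 0 < k) (hJ : 0 < J) (hφ : 0 < φ)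
    (hW : 0 < W) (hκ : κ = φ / W) (hs : s = L / (256 * (k * J))) (hL : 0 < L)
    (hA₁ : J * (κ * s) / 8 ≤ A₁) (hA₂ : 0 < A₂) (hA₂' : A₂ ≤ 4 * (κ * s)) (hP : 1 / 20 ≤ P)
    (hT : A₁ ^ 2 * A₂ ^ (k - 1) / 2 ≤ T) :
    J * L / 2621440 * (A₂ ^ k / W) ≤ k * (P / φ * T) := by
  have hk' : (0 : ℝ) < k := by exact_mod_cast hk
  have hJ' : (0 : ℝ) < J := by exact_mod_cast hJ
  have hs0 : 0 < s := by rw [hs]; positivity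
  have hκ0 : 0 < κ := by rw [hκ]; positivity
  have h1 : (J * (κ * s) / 8) ^ 2 ≤ A₁ ^ 2 := pow_le_pow_left₀ (by positivity) hA₁ 2
  have h2 : (J : ℝ) ^ 2 / 256 * (κ * s) * A₂ ≤ A₁ ^ 2 := by
    refine le_trans ?_ h1
    calc (J : ℝ) ^ 2 / 256 * (κ * s) * A₂ ≤ (J : ℝ) ^ 2 / 256 * (κ * s) * (4 * (κ * s)) :=
          mul_le_mul_of_nonneg_left hA₂' (by positivity)
      _ = _ := by ring
  have hpow : A₂ * A₂ ^ (k - 1) = A₂ ^ k := mul_pow_sub_one hk.ne' A₂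
  have h3 : (J : ℝ) ^ 2 / 512 * (κ * s) * A₂ ^ k ≤ T := by
    refine le_trans ?_ hT
    rw [← hpow]
    calc (J : ℝ) ^ 2 / 512 * (κ * s) * (A₂ * A₂ ^ (k - 1)) =
          (J : ℝ) ^ 2 / 256 * (κ * s) * A₂ * A₂ ^ (k - 1) / 2 := by ring
      _ ≤ _ := by
        have := mul_le_mul_of_nonneg_right h2 (by positivity : 0 ≤ A₂ ^ (k - 1))
        linarith
  calc J * L / 2621440 * (A₂ ^ k / W) =
        k * (1 / 20 / φ * ((J : ℝ) ^ 2 / 512 * (κ * s) * A₂ ^ k)) := by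
        rw [hκ, hs]
        field_simp
        norm_num
    _ ≤ k * (P / φ * T) := by
        refine mul_le_mul_of_nonneg_left ?_ hk'.le
        exact mul_le_mul (div_le_div_of_nonneg_right hP hφ.le) h3 (by positivity)
          (div_nonneg (by linarith) hφ.le)

lemma sieve_sq_le {ι : Type*} [Fintype ι] [DecidableEq ι] {k : ℕ} {q : ι → ℝ} {L : ℝ}
    {y : (ι → Option (Fin k)) → ℝ} (hq : ∀ p, 1 < q p) (hy : ∀ b, |y b| ≤ 1)
    (hyL : ∀ b, y b ≠ 0 → ell q (supp b) ≤ L) (σ : ι → Option (Fin k)) :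
    sieve q y σ ^ 2 ≤ (exp L * euler k q) ^ 2 := by
  rw [← sq_abs]
  refine pow_le_pow_left₀ (abs_nonneg _) ?_ 2
  rw [sieve_eq]
  refine (Finset.abs_sum_le_sum_abs _ _).trans ((Finset.sum_le_sum fun d _ => ?_).trans
    (sum_abs_lam_le hq hy hyL))
  rw [abs_mul, abs_of_nonneg (Finset.prod_nonneg fun p _ => leq_nonneg _ _)]
  exact mul_le_of_le_one_right (abs_nonneg _)
    (Finset.prod_le_one (fun p _ => leq_nonneg _ _) fun p _ => leq_le_one _ _)

/-- The error in the sieve sum over integers. -/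
noncomputable def intError (k D R : ℕ) (u L : ℝ) : ℝ :=
  (exp L * euler k (pval : sievePrimes D R → ℝ)) ^ 2 *
    (primorial D * exp (2 * L) * (48 * exp (-u / 2) * zetaThreeHalves))

/-- The error in the sieve sums over primes. -/
noncomputable def primeError (k D R Q : ℕ) (u L : ℝ) : ℝ :=
  euler k (pval : sievePrimes D R → ℝ) ^ 3 * (√(primorial D) / (primorial D).totient) *
      charMean u Q +
    (exp L * euler k (pval : sievePrimes D R → ℝ)) ^ 2 *
      (24 * (primorial D * exp (2 * L)) * exp (-u / 2))

/-- The upper bound for the mass of the sieve that holds when few shifts are prime. -/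
theorem sieve_mass_le {k m J D R Q n₀ H : ℕ} {u L κs A₁ A₂ : ℝ} {ν : ℤ} {a : Fin k → ℕ}
    {G : ℝ → ℝ} (hk : 0 < k) (hJ : 0 < J) (hu : 11 ≤ u) (hL : 0 < L)
    (hs : Separated D R fun i => (a i : ℤ))
    (hν : ∀ i, IsCoprime (primorial D : ℤ) (ν + a i))
    (hq4 : ∀ p : sievePrimes D R, 4 ≤ pval p) (hkq : ∀ p : sievePrimes D R, (k : ℝ) ≤ pval p)
    (hη : 16 * (k : ℝ) ^ 2 * ∑ p : sievePrimes D R, 1 / pval p ^ 2 ≤ 1)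
    (hp : ∀ p : sievePrimes D R, 3 * k / (pval p - 1) ≤ 1 / √(pval p))
    (hQ : primorial D * exp (2 * L) ≤ Q)
    (hG : ∀ s, 0 ≤ G s) (hG1 : ∀ s, G s ≤ 1) (hGa : Antitone G) (hGL : ∀ s, G s ≠ 0 → s ≤ L / 2)
    (hκs : κs = kap D * (L / (256 * (k * J))))
    (hA₁ : A₁ = gsum (pval : sievePrimes D R → ℝ) G)
    (hA₂ : A₂ = gsum (pval : sievePrimes D R → ℝ) fun s => G s ^ 2) (hA₂0 : 0 < A₂)
    (h₁ : J * κs / 8 ≤ A₁) (h₂ : A₂ ≤ 4 * κs)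
    (hT : gsum (pval : sievePrimes D R → ℝ) (fun s => G s ^ 2 * s) ≤ A₂ * (L / (8 * k)))
    (haH : ∀ i, a i ≤ H) (hH : 4 * H * (u + 1) ≤ exp (u / 2))
    (hn₀ : (n₀ + H : ℝ) < exp (u / 2))
    (hcount : ∀ n : ℕ, n₀ < n → (primorial D : ℤ) ∣ n - ν →
      (univ.filter fun i => (n + a i).Prime).card ≤ m) :
    J * L / 2621440 * (A₂ ^ k / primorial D) ≤
      k * primeError k D R Q u L +
        k * ((exp L * euler k (pval : sievePrimes D R → ℝ)) ^ 2 * ∑' N, rest u N) +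
        3 * u * m * (20 * (A₂ ^ k / primorial D) + intError k D R u L) := by
  have hq1 : ∀ p : sievePrimes D R, 1 < pval p := fun p => by linarith [hq4 p]
  have hW : (0 : ℝ) < primorial D := by exact_mod_cast primorial_pos D
  have hφ : (0 : ℝ) < (primorial D).totient := by
    exact_mod_cast Nat.totient_pos.mpr (primorial_pos D)
  have hk1 : (1 : ℝ) ≤ k := by exact_mod_cast hk
  set y : (sievePrimes D R → Option (Fin k)) → ℝ := yval pval G L with hydef
  have hy : ∀ b, |y b| ≤ 1 := fun b => by
    rw [abs_of_nonneg (yval_nonneg hG L b)]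
    exact yval_le_one hG hG1 L b
  have hyL : ∀ b, y b ≠ 0 → ell pval (supp b) ≤ L := fun b hb => ell_supp_le_of_yval_ne_zero hb
  have hη4 : ∑ p : sievePrimes D R, 1 / pval p ^ 2 ≤ 1 / 4 := by
    have : (0 : ℝ) ≤ ∑ p : sievePrimes D R, 1 / pval p ^ 2 :=
      Finset.sum_nonneg fun p _ => by positivity
    nlinarith
  have hT₁ := tensorForm_int_le hq4 hkq hη4 (G := G) L
  rw [← hA₂, ← hydef] at hT₁
  have hT₂ : ∀ i : Fin k, A₁ ^ 2 * A₂ ^ (k - 1) / 2 ≤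
      tensorForm (fun p : sievePrimes D R => primeLaw i (pval p))
        (fun p => evalAt (pval p)) y := fun i => by
    have := tensorForm_prime_ge (fun p => by linarith [hq4 p]) hkq hG hGa hL hGL i
      (by rw [← hA₂]; exact hA₂0) (by rw [← hA₂]; exact hT) hη
    rwa [← hA₁, ← hA₂] at this
  let g : ℤ → ℝ := fun x => (if (primorial D : ℤ) ∣ x - ν then 1 else 0) *
    sieve pval y (state (fun i => (a i : ℤ)) x) ^ 2
  have hg0 : ∀ x, 0 ≤ g x := fun x => mul_nonneg (by split_ifs <;> simp) (sq_nonneg _)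
  have hgB : ∀ x, g x ≤ (exp L * euler k (pval : sievePrimes D R → ℝ)) ^ 2 := fun x =>
    (mul_le_of_le_one_left (sq_nonneg _) (by split_ifs <;> simp)).trans
      (sieve_sq_le hq1 hy hyL _)
  have hcmp := sum_prime_side_le (by linarith) hg0 hgB haH hH hn₀ fun n hn hne =>
    hcount n hn (by
      by_contra hd
      exact hne (by dsimp only [g]; rw [if_neg hd, zero_mul]))
  have hint : ∑' n : ℕ, om u n * g n ≤ 20 * (A₂ ^ k / primorial D) + intError k D R u L := by
    have h := (abs_le.mp (abs_int_side_le u hs ν hy hyL)).2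
    have e : ∑' n : ℕ, (om u n * if (primorial D : ℤ) ∣ n - ν then 1 else 0) *
        sieve pval y (state (fun i => (a i : ℤ)) n) ^ 2 = ∑' n : ℕ, om u n * g n :=
      tsum_congr fun n => mul_assoc _ _ _
    rw [e] at h
    have h5 : (∑' n, om u n) / primorial D * tensorForm
        (fun p : sievePrimes D R => intLaw (k := k) (pval p)) (fun p => evalAt (pval p)) y ≤
        10 / primorial D * (2 * A₂ ^ k) := by
      have h0 : 0 ≤ (∑' n, om u n) / (primorial D : ℝ) :=
        div_nonneg (tsum_nonneg (om_nonneg u)) hW.le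
      exact (mul_le_mul_of_nonneg_left hT₁ h0).trans (mul_le_mul_of_nonneg_right
        (div_le_div_of_nonneg_right (tsum_om_le (by linarith)) hW.le) (by positivity))
    have e2 : 10 / (primorial D : ℝ) * (2 * A₂ ^ k) = 20 * (A₂ ^ k / primorial D) := by ring
    unfold intError
    linarith
  have hprime : ∀ i : Fin k, J * L / 2621440 * (A₂ ^ k / primorial D) / k -
      primeError k D R Q u L ≤ ∑' N : ℕ, Λ N * om u N * g (N - a i) := fun i => by
    have h := (abs_le.mp (abs_prime_side_le u hs ν i (hν i) hy hyL hp hQ)).1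
    have e : ∑' n : ℕ, (Λ n * om u n * if (primorial D : ℤ) ∣ n - a i - ν then 1 else 0) *
        sieve pval y (state (fun i => (a i : ℤ)) (n - a i)) ^ 2 =
        ∑' N : ℕ, Λ N * om u N * g (N - a i) := tsum_congr fun n => mul_assoc _ _ _
    rw [e] at h
    have h5 := main_term_le hk hJ hφ hW rfl rfl hL (by rw [hκs] at h₁; exact h₁) hA₂0
      (by rw [hκs] at h₂; exact h₂) (Psi_ge hu) (hT₂ i)
    have h6 : J * L / 2621440 * (A₂ ^ k / primorial D) / k ≤
        Psi u / (primorial D).totient * tensorForm (fun p : sievePrimes D R => primeLaw i (pval p))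
        (fun p => evalAt (pval p)) y := by
      rw [div_le_iff₀ (by linarith), mul_comm _ (k : ℝ)]
      exact h5
    unfold primeError
    linarith
  have hsum := Finset.sum_le_sum fun i (_ : i ∈ (univ : Finset (Fin k))) => hprime i
  rw [Finset.sum_const, card_univ, Fintype.card_fin, nsmul_eq_mul, mul_sub,
    mul_div_cancel₀ _ (by linarith : (k : ℝ) ≠ 0)] at hsum
  have h7 := mul_le_mul_of_nonneg_left hint (by positivity : 0 ≤ 3 * u * m)
  linarith

end Core

end GapRuns

namespace GapRuns
open Real Filter Topology Finset MeasureTheory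
open scoped ArithmeticFunction.vonMangoldt

section Cluster

lemma lt_pval {D R : ℕ} (p : sievePrimes D R) : (D : ℝ) + 1 ≤ pval p := by
  have := (Finset.mem_Ioc.mp (mem_filter.mp p.2).1).1
  unfold pval
  exact_mod_cast this

lemma sum_inv_pval_sq_le {D : ℕ} (hD : D ≠ 0) (R : ℕ) :
    ∑ p : sievePrimes D R, 1 / pval p ^ 2 ≤ 1 / (D : ℝ) := by
  have hD' : (0 : ℝ) < D := by exact_mod_cast Nat.pos_of_ne_zero hD
  rcases le_or_gt D R with h | h
  · have h1 : ∑ p : sievePrimes D R, 1 / pval p ^ 2 =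
        ∑ p ∈ sievePrimes D R, ((p : ℝ) ^ 2)⁻¹ := by
      rw [← Finset.sum_coe_sort (sievePrimes D R)]
      exact Finset.sum_congr rfl fun p _ => by rw [one_div]; rfl
    rw [h1]
    refine (Finset.sum_le_sum_of_subset_of_nonneg (Finset.filter_subset _ _)
      fun n _ _ => by positivity).trans ?_
    refine (sum_Ioc_inv_sq_le_sub hD h).trans ?_
    rw [one_div]
    have : (0 : ℝ) ≤ (R : ℝ)⁻¹ := by positivity
    linarith
  · have : IsEmpty (sievePrimes D R) := ⟨fun p => by
      have := Finset.mem_Ioc.mp (mem_filter.mp p.2).1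
      omega⟩
    rw [Finset.univ_eq_empty, Finset.sum_empty]
    positivity

lemma three_mul_div_pval_le {k D R : ℕ} (hD : 36 * (k + 1) ^ 2 ≤ D) (p : sievePrimes D R) :
    3 * k / (pval p - 1) ≤ 1 / √(pval p) := by
  have hp := lt_pval p
  have hD' : 36 * ((k : ℝ) + 1) ^ 2 ≤ D := by exact_mod_cast hD
  have hk : (0 : ℝ) ≤ k := Nat.cast_nonneg k
  have h36 : (36 : ℝ) ≤ pval p := by nlinarith
  have hs : 6 * ((k : ℝ) + 1) ≤ √(pval p) := by
    refine Real.le_sqrt_of_sq_le ?_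
    nlinarith
  have hsq : √(pval p) * √(pval p) = pval p := Real.mul_self_sqrt (by linarith)
  rw [div_le_div_iff₀ (by linarith) (by linarith)]
  nlinarith

lemma separated_shift {k D R : ℕ} (hD : shift k k ≤ D) :
    Separated D R fun i : Fin k => (shift k i : ℤ) := fun p i j hd => by
  have hp := (Finset.mem_Ioc.mp (mem_filter.mp p.2).1).1
  have hi := shift_strictMono k i.2
  have hj := shift_strictMono k j.2
  have h0 := Int.eq_zero_of_abs_lt_dvd hd (by dsimp only; rw [abs_lt]; constructor <;> omega)
  exact Fin.ext ((shift_strictMono k).injective (by dsimp only at h0; omega))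

lemma euler_le_pow {k D : ℕ} {u : ℝ} (hu : 800 ≤ u) :
    euler k (pval : sievePrimes D ⌈exp (u / 400)⌉₊ → ℝ) ≤ u ^ (18 * k) := by
  have h1 : (1 : ℝ) ≤ exp (u / 400) := one_le_exp (by linarith)
  have hR : log (⌈exp (u / 400)⌉₊ : ℝ) ≤ u / 200 := by
    have h2 := (Nat.ceil_lt_add_one (exp_pos (u / 400)).le).le
    have h3 := Nat.le_ceil (exp (u / 400))
    refine (log_le_iff_le_exp (by linarith)).mpr (h2.trans ?_)
    have h4 : exp (u / 400) * exp (u / 400) = exp (u / 200) := by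
      rw [← exp_add]
      congr 1
      ring
    have h5 : (2 : ℝ) ≤ exp (u / 400) := by linarith [add_one_le_exp (u / 400)]
    nlinarith
  refine (euler_le (by linarith) hR).trans (pow_le_pow_left₀ (by positivity) (by linarith) _)

lemma tendsto_pow_mul_exp_neg_eighth (n : ℕ) :
    Tendsto (fun u : ℝ => u ^ n * exp (-(u / 8))) atTop (𝓝 0) := by
  have h := ((tendsto_pow_mul_exp_neg_atTop_nhds_zero n).comp
    (tendsto_id.atTop_div_const (by norm_num : (0 : ℝ) < 8))).const_mul (8 ^ n)
  rw [mul_zero] at h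
  refine h.congr fun u => ?_
  simp only [Function.comp_apply, id_eq, div_pow]
  field_simp

/-- The constant in the error terms. -/
noncomputable def errorConst (k m D : ℕ) (K : ℝ) : ℝ :=
  k * (25 * primorial D) + k * K + 144 * m * primorial D * zetaThreeHalves

lemma error_le {k m D R Q : ℕ} {u K : ℝ} (hu : 1 ≤ u) (hK : 0 ≤ K)
    (hZ : euler k (pval : sievePrimes D R → ℝ) ≤ u ^ (18 * k))
    (hc : charMean u Q * u ^ (54 * k + 1) ≤ 1)
    (hrest : ∑' n, rest u n ≤ K * u * exp (-(u / 4))) :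
    k * primeError k D R Q u (u / 400) +
      k * ((exp (u / 400) * euler k (pval : sievePrimes D R → ℝ)) ^ 2 * ∑' N, rest u N) +
      3 * u * m * intError k D R u (u / 400) ≤
    errorConst k m D K * (1 / u + u ^ (36 * k + 1) * exp (-(u / 8))) := by
  have hZ1 : 1 ≤ euler k (pval : sievePrimes D R → ℝ) := one_le_euler fun p => by
    unfold pval
    exact_mod_cast (sievePrimes_prime p).one_lt
  have hz := zetaThreeHalves_nonneg
  unfold primeError intError errorConst
  obtain ⟨Z, hZdef⟩ : ∃ Z, Z = euler k (pval : sievePrimes D R → ℝ) := ⟨_, rfl⟩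
  rw [← hZdef] at hZ hZ1 ⊢
  have hW : (1 : ℝ) ≤ primorial D := by exact_mod_cast primorial_pos D
  have hφ : (1 : ℝ) ≤ (primorial D).totient := by
    exact_mod_cast Nat.totient_pos.mpr (primorial_pos D)
  obtain ⟨W, hWdef⟩ : ∃ W : ℝ, W = primorial D := ⟨_, rfl⟩
  obtain ⟨φ, hφdef⟩ : ∃ φ : ℝ, φ = (primorial D).totient := ⟨_, rfl⟩
  rw [← hWdef] at hW
  rw [← hφdef] at hφ
  rw [← hWdef, ← hφdef]
  have hu0 : 0 < u := by linarith
  have hZ0 : 0 ≤ Z := by linarith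
  have hZ2 : Z ^ 2 ≤ u ^ (36 * k) := by
    refine (pow_le_pow_left₀ hZ0 hZ 2).trans (le_of_eq ?_)
    rw [← pow_mul]
    congr 1
    ring
  have hZ3 : Z ^ 3 ≤ u ^ (54 * k) := by
    refine (pow_le_pow_left₀ hZ0 hZ 3).trans (le_of_eq ?_)
    rw [← pow_mul]
    congr 1
    ring
  have hc0 := charMean_nonneg u Q
  have t₁ : Z ^ 3 * (√W / φ) * charMean u Q ≤ W * (1 / u) := by
    have h1 : √W / φ ≤ W := (div_le_self (Real.sqrt_nonneg _) hφ).trans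
      ((Real.sqrt_le_iff).mpr ⟨by linarith, by nlinarith⟩)
    have h2 : Z ^ 3 * charMean u Q ≤ 1 / u := by
      rw [le_div_iff₀ hu0]
      refine le_trans ?_ hc
      have := mul_le_mul_of_nonneg_right hZ3 (mul_nonneg hc0 hu0.le)
      calc Z ^ 3 * charMean u Q * u = Z ^ 3 * (charMean u Q * u) := mul_assoc _ _ _
        _ ≤ _ := this
        _ = _ := by ring
    calc Z ^ 3 * (√W / φ) * charMean u Q = √W / φ * (Z ^ 3 * charMean u Q) := by ring
      _ ≤ W * (1 / u) := mul_le_mul h1 h2 (by positivity) (by linarith)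
  have hsq : (exp (u / 400) * Z) ^ 2 = exp (u / 200) * Z ^ 2 := by
    rw [mul_pow, ← exp_nat_mul]
    congr 2
    push_cast
    ring
  have h2L : exp (2 * (u / 400)) = exp (u / 200) := by
    congr 1
    ring
  have hex : exp (u / 200) * exp (u / 200) * exp (-u / 2) ≤ exp (-(u / 8)) := by
    rw [← exp_add, ← exp_add]
    exact exp_le_exp.mpr (by linarith)
  have hmain : Z ^ 2 * (exp (u / 200) * exp (u / 200) * exp (-u / 2)) ≤
      u ^ (36 * k) * exp (-(u / 8)) := mul_le_mul hZ2 hex (by positivity) (by positivity)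
  have hmain' : Z ^ 2 * (exp (u / 200) * exp (-(u / 4))) ≤ u ^ (36 * k) * exp (-(u / 8)) := by
    refine mul_le_mul hZ2 ?_ (by positivity) (by positivity)
    rw [← exp_add]
    exact exp_le_exp.mpr (by linarith)
  obtain ⟨Y, hY⟩ : ∃ Y, Y = u ^ (36 * k) * exp (-(u / 8)) := ⟨_, rfl⟩
  have hY0 : 0 ≤ Y := by rw [hY]; positivity
  have hX : u ^ (36 * k + 1) * exp (-(u / 8)) = u * Y := by rw [hY]; ring
  rw [← hY] at hmain hmain'
  have hYX : Y ≤ u * Y := le_mul_of_one_le_left hY0 hu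
  rw [hX, hsq, h2L]
  have t₂ : exp (u / 200) * Z ^ 2 * (24 * (W * exp (u / 200)) * exp (-u / 2)) ≤
      24 * W * (u * Y) := by
    calc _ = 24 * W * (Z ^ 2 * (exp (u / 200) * exp (u / 200) * exp (-u / 2))) := by ring
      _ ≤ _ := mul_le_mul_of_nonneg_left (hmain.trans hYX) (by positivity)
  have t₃ : exp (u / 200) * Z ^ 2 * ∑' N, rest u N ≤ K * (u * Y) := by
    calc _ ≤ exp (u / 200) * Z ^ 2 * (K * u * exp (-(u / 4))) :=
          mul_le_mul_of_nonneg_left hrest (by positivity)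
      _ = K * (u * (Z ^ 2 * (exp (u / 200) * exp (-(u / 4))))) := by ring
      _ ≤ _ := mul_le_mul_of_nonneg_left (mul_le_mul_of_nonneg_left hmain' hu0.le) hK
  have t₄ : 3 * u * m * (exp (u / 200) * Z ^ 2 *
      (W * exp (u / 200) * (48 * exp (-u / 2) * zetaThreeHalves))) ≤
      144 * m * W * zetaThreeHalves * (u * Y) := by
    calc _ = 144 * m * W * zetaThreeHalves *
          (u * (Z ^ 2 * (exp (u / 200) * exp (u / 200) * exp (-u / 2)))) := by ring
      _ ≤ _ := mul_le_mul_of_nonneg_left (mul_le_mul_of_nonneg_left hmain hu0.le)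
        (by positivity)
  have hk0 : (0 : ℝ) ≤ k := Nat.cast_nonneg k
  have s₁ := mul_le_mul_of_nonneg_left (add_le_add t₁ t₂) hk0
  have s₃ := mul_le_mul_of_nonneg_left t₃ hk0
  have hu1 : 0 ≤ 1 / u := by positivity
  have r₁ : (0 : ℝ) ≤ k * W * (24 * (1 / u) + u * Y) := by positivity
  have r₂ : (0 : ℝ) ≤ (k * K + 144 * m * W * zetaThreeHalves) * (1 / u) := by positivity
  linarith

end Cluster

end GapRuns

namespace GapRuns
open Real Filter Topology Finset MeasureTheory
open scoped ArithmeticFunction.vonMangoldt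

section Cluster

/-- Suitable scales exist for the sieve. -/
lemma exists_scale (k m D J n₀ H : ℕ) (hJ : 0 < J) (K L₀ : ℝ) : ∃ u : ℝ, 800 ≤ u ∧
    L₀ ≤ u / 400 ∧ primorial D * exp (2 * (u / 400)) ≤ (⌊exp (u / 100)⌋₊ : ℝ) ∧
    4 * H * (u + 1) ≤ exp (u / 2) ∧ (n₀ + H : ℝ) < exp (u / 2) ∧
    1 ≤ kap D * scale J (u / 400) / 16 ∧
    primorial D * (errorConst k m D K * (1 / u + u ^ (36 * k + 1) * exp (-(u / 8)))) < 1 ∧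
    charMean u ⌊exp (u / 100)⌋₊ * u ^ (54 * k + 1) ≤ 1 := by
  have hκ := kap_pos D
  have hJ' : (0 : ℝ) < J := by exact_mod_cast hJ
  have herr : Tendsto (fun u : ℝ => primorial D * (errorConst k m D K *
      (1 / u + u ^ (36 * k + 1) * exp (-(u / 8))))) atTop (𝓝 0) := by
    have h := (((tendsto_inv_atTop_zero (𝕜 := ℝ)).add
      (tendsto_pow_mul_exp_neg_eighth (36 * k + 1))).const_mul
        (errorConst k m D K)).const_mul (primorial D : ℝ)
    simpa only [one_div, add_zero, mul_zero] using h
  obtain ⟨u₁, hu₁⟩ := eventually_atTop.mp (herr.eventually_lt_const one_pos)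
  obtain ⟨u, hu, hc⟩ := exists_charMean_le (54 * k + 1)
    (max u₁ (max (max (800 + 400 * L₀) 0) (max (200 * primorial D + 64 * (H + n₀ + 1))
      (800 + 16 * (400 * (256 * (2 ^ J * J))) / kap D))))
  have h1 := (le_max_left _ _).trans hu
  have h2 := (le_max_right _ _).trans hu
  have h3 := (le_max_left _ _).trans h2
  have h4 := (le_max_right _ _).trans h2
  have h5 := (le_max_left _ _).trans h4
  have h6 := (le_max_right _ _).trans h4
  have hpos : (0 : ℝ) ≤ 16 * (400 * (256 * (2 ^ J * J))) / kap D := by positivity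
  have hu800 : 800 ≤ u := by linarith
  have hW : (1 : ℝ) ≤ primorial D := by exact_mod_cast primorial_pos D
  have hH0 : (0 : ℝ) ≤ H := Nat.cast_nonneg H
  have hn0 : (0 : ℝ) ≤ n₀ := Nat.cast_nonneg n₀
  have hquad := quadratic_le_exp_of_nonneg (x := u / 2) (by linarith)
  have hbig : 8 * (H + n₀ + 1 : ℝ) * u ≤ exp (u / 2) := by nlinarith
  refine ⟨u, hu800, ?_, ?_, ?_, ?_, ?_, hu₁ u h1, hc⟩
  · have := (le_max_left (800 + 400 * L₀) 0).trans h3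
    linarith
  · have e1 : exp (2 * (u / 400)) = exp (u / 200) := by congr 1; ring
    have e2 : exp (u / 100) = exp (u / 200) * exp (u / 200) := by
      rw [← exp_add]
      congr 1
      ring
    have h7 : (primorial D : ℝ) + 1 ≤ exp (u / 200) := by
      linarith [add_one_le_exp (u / 200)]
    have h8 := (Nat.sub_one_lt_floor (exp (u / 100))).le
    refine le_trans ?_ h8
    rw [e1, e2]
    nlinarith
  · nlinarith
  · nlinarith
  · unfold scale
    have h7 : 16 * (400 * (256 * (2 ^ J * J))) / kap D ≤ u := by linarith
    rw [div_le_iff₀ hκ] at h7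
    rw [le_div_iff₀ (by norm_num), div_div, mul_div_assoc', le_div_iff₀ (by positivity)]
    linarith

lemma sixteen_mul_sum_le {k D : ℕ} (hD : 36 * (k + 1) ^ 2 ≤ D) (R : ℕ) :
    16 * (k : ℝ) ^ 2 * ∑ p : sievePrimes D R, 1 / pval p ^ 2 ≤ 1 := by
  have hk : (0 : ℝ) ≤ k := Nat.cast_nonneg k
  have hDR : 36 * ((k : ℝ) + 1) ^ 2 ≤ D := by exact_mod_cast hD
  have hD1 : (0 : ℝ) < D := by nlinarith
  have h := sum_inv_pval_sq_le (D := D) (by rintro rfl; simp at hD1) R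
  calc _ ≤ 16 * (k : ℝ) ^ 2 * (1 / D) := mul_le_mul_of_nonneg_left h (by positivity)
    _ ≤ 1 := by
      rw [mul_one_div, div_le_one hD1]
      nlinarith

lemma le_half_of_profile_ne_zero {J : ℕ} {L s : ℝ} (hJ : 0 < J) (hL : 0 < L)
    (hs : profile J (scale J L) s ≠ 0) : s ≤ L / 2 := by
  have hJ1 : (1 : ℝ) ≤ J := by exact_mod_cast hJ
  refine (le_of_profile_ne_zero (by unfold scale; positivity) hs).trans ?_
  have h : 2 ^ J * scale J L = L / (256 * J) := by
    unfold scale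
    field_simp
  rw [h, div_le_div_iff₀ (by positivity) (by norm_num)]
  nlinarith

/-- Translates of an admissible tuple contain many primes, inside a fixed residue class. -/
theorem exists_prime_cluster {m J D : ℕ} {ν : ℤ} (hm : 0 < m) (hJ : 120 * 1048576000 * m ≤ J)
    (hD : 36 * (2 ^ J + 1) ^ 2 ≤ D) (hDs : shift (2 ^ J) (2 ^ J) ≤ D)
    (hν : ∀ i < 2 ^ J, IsCoprime (primorial D : ℤ) (ν + shift (2 ^ J) i)) (n₀ : ℕ) :
    ∃ n : ℕ, n₀ < n ∧ (primorial D : ℤ) ∣ n - ν ∧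
      m < (univ.filter fun i : Fin (2 ^ J) => (n + shift (2 ^ J) i).Prime).card := by
  by_contra hno
  push Not at hno
  have hJ0 : 0 < J := by omega
  obtain ⟨K, hK, hrest⟩ := exists_rest_le
  obtain ⟨L₀, hL₀, hprof⟩ := exists_profile_bounds D hJ0
  obtain ⟨k, hk⟩ : ∃ k, k = 2 ^ J := ⟨_, rfl⟩
  have hkR : (k : ℝ) = 2 ^ J := by rw [hk]; push_cast; rfl
  have hk0 : 0 < k := by rw [hk]; positivity
  rw [← hk] at hD hDs hν hno
  obtain ⟨u, hu, hLu, hQ, hH, hn₀, hA, herr, hc⟩ :=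
    exists_scale k m D J n₀ (shift k k) hJ0 K L₀
  have hL : 0 < u / 400 := by linarith
  obtain ⟨h₁, h₂, h₃, h₄⟩ := hprof ⌈exp (u / 400)⌉₊ (u / 400) hLu (Nat.le_ceil _)
  have hscale : scale J (u / 400) = u / 400 / (256 * (k * J)) := by rw [scale, hkR]
  have hW : (0 : ℝ) < primorial D := by exact_mod_cast primorial_pos D
  have hJR : (120 * 1048576000 * m : ℝ) ≤ J := by exact_mod_cast hJ
  have hm1 : (1 : ℝ) ≤ m := by exact_mod_cast hm
  have hk1 : (1 : ℝ) ≤ k := by exact_mod_cast hk0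
  have hDR : 36 * ((k : ℝ) + 1) ^ 2 ≤ D := by exact_mod_cast hD
  obtain ⟨A, hAdef⟩ : ∃ A, A = gsum (pval : sievePrimes D ⌈exp (u / 400)⌉₊ → ℝ)
    (fun s => profile J (scale J (u / 400)) s ^ 2) := ⟨_, rfl⟩
  rw [← hAdef] at h₂ h₃ h₄
  have hA1 : 1 ≤ A := hA.trans h₂
  have hmass := sieve_mass_le (k := k) (m := m) (Q := ⌊exp (u / 100)⌋₊) (n₀ := n₀)
    (H := shift k k) (ν := ν) (a := fun i : Fin k => shift k i) (u := u) hk0 hJ0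
    (by linarith) hL (separated_shift hDs) (fun i => hν i i.2)
    (fun p => by nlinarith [lt_pval p]) (fun p => by nlinarith [lt_pval p])
    (sixteen_mul_sum_le hD _)
    (three_mul_div_pval_le hD) hQ (profile_nonneg J _) (profile_le_one J _)
    (profile_antitone J _)
    (fun s hs => le_half_of_profile_ne_zero hJ0 hL hs)
    rfl rfl hAdef (by linarith) (by rw [← hscale]; exact h₁) (by rw [← hscale]; exact h₃)
    (by rw [hk]; exact h₄) (fun i => (shift_strictMono k).monotone i.2.le) hH hn₀ hno
  have herrle := error_le (m := m) (by linarith) hK (euler_le_pow (k := k) (D := D) hu) hc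
    (hrest u (by linarith))
  have hAk : 1 / (primorial D : ℝ) ≤ A ^ k / primorial D :=
    div_le_div_of_nonneg_right (one_le_pow₀ hA1) hW.le
  obtain ⟨X, hX⟩ : ∃ X, X = A ^ k / primorial D := ⟨_, rfl⟩
  rw [← hX] at hmass hAk
  have hX0 : 0 < X := lt_of_lt_of_le (by positivity) hAk
  have herr' : errorConst k m D K * (1 / u + u ^ (36 * k + 1) * exp (-(u / 8))) < X := by
    refine lt_of_lt_of_le ?_ hAk
    rw [lt_div_iff₀ hW, mul_comm]
    exact herr
  have hbig : 120 * (u * m * X) ≤ J * (u / 400) / 2621440 * X := by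
    have := mul_le_mul_of_nonneg_right hJR (by positivity : 0 ≤ u * X)
    linarith
  have hone : X ≤ u * m * X := by
    have : 1 ≤ u * m := by nlinarith
    exact le_mul_of_one_le_left hX0.le this
  linarith

end Cluster

end GapRuns

/-- For every `m ≥ 2` there are infinitely many `r` such that the run of
consecutive prime gaps `δ j = primeGap r j` for `1 ≤ j ≤ m` satisfies
`δ (j-1) ∣ δ j` for every `j` with `2 ≤ j ≤ m`. -/
theorem dividing_prime_gap_runs (m : ℕ) (hm : 2 ≤ m) :
    {r : ℕ | ∀ j : ℕ, 2 ≤ j → j ≤ m → primeGap r (j - 1) ∣ primeGap r j}.Infinite := by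
  obtain ⟨J, hJ⟩ : ∃ J, 120 * 1048576000 * m ≤ J := ⟨_, le_rfl⟩
  obtain ⟨k, hk⟩ : ∃ k, k = 2 ^ J := ⟨_, rfl⟩
  obtain ⟨D, hD⟩ : ∃ D, 36 * (k + 1) ^ 2 + GapRuns.shift k k +
    GapRuns.killer k (GapRuns.shift k k) ≤ D := ⟨_, le_rfl⟩
  obtain ⟨ν, hν, hkill⟩ := GapRuns.exists_start k D
  refine Set.infinite_of_forall_exists_gt fun r₀ => ?_
  subst hk
  obtain ⟨n, hn, hdvd, hcard⟩ := GapRuns.exists_prime_cluster (by omega) hJ (by omega) (by omega)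
    hν (D + Nat.nth Nat.Prime r₀)
  refine ⟨Nat.count Nat.Prime n, GapRuns.exists_run (by omega) hkill (by omega) hdvd hcard, ?_⟩
  have := Nat.count_monotone Nat.Prime (show Nat.nth Nat.Prime r₀ + 1 ≤ n by omega)
  rw [Nat.count_nth_succ_of_infinite Nat.infinite_setOfPred_prime] at this
  omega
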